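/- Let G be a 7-contraction-critical graph with no K7^∨-minor. Then G has at least 18 vertices of degree seven. -/

import Mathlib

open SimpleGraph

/-- `K7vee` is the graph obtained from `K 7` by deleting two edges with a common end. -/
def K7vee : SimpleGraph (Fin 7) :=
  (completeGraph (Fin 7)).deleteEdges {s(0, 1), s(0, 2)}

/-- `K6vee` is the graph obtained from `K 6` by deleting two edges with a common end. -/
def K6vee : SimpleGraph (Fin 6) :=
  (completeGraph (Fin 6)).deleteEdges {s(0, 1), s(0, 2)}

/-- The complete multipartite graph with four parts of size two. -/
def K2222 : SimpleGraph (Fin 4 × Fin 2) :=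
  SimpleGraph.comap Prod.fst (completeGraph (Fin 4))

/-- `H` is a minor of `G`: there is a model of `H` in `G`, i.e. a family of pairwise disjoint
nonempty connected branch sets, one for each vertex of `H`, with edges of `G` between branch
sets corresponding to adjacent vertices of `H`. -/
def IsMinor {W V : Type} (H : SimpleGraph W) (G : SimpleGraph V) : Prop :=
  ∃ bag : W → Set V,
    (∀ w, (G.induce (bag w)).Connected) ∧
    (∀ w w', w ≠ w' → Disjoint (bag w) (bag w')) ∧
    (∀ w w', H.Adj w w' → ∃ u ∈ bag w, ∃ v ∈ bag w', G.Adj u v)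

/-- A graph is `k`-connected if it has more than `k` vertices and stays connected after
removing any set of fewer than `k` vertices. -/
def IsKConnected {V : Type} [Fintype V] (k : ℕ) (G : SimpleGraph V) : Prop :=
  k < Fintype.card V ∧ ∀ S : Set V, S.ncard < k → (G.induce (Sᶜ : Set V)).Connected

/-- A separation of `G`: `A ∪ B = V(G)` and no edge joins `A - B` to `B - A`. -/
def IsSeparation {V : Type} (G : SimpleGraph V) (A B : Set V) : Prop :=
  A ∪ B = Set.univ ∧ ∀ ⦃u v : V⦄, G.Adj u v → ¬(u ∈ A \ B ∧ v ∈ B \ A)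

/-- `(G, Z)` is internally `k`-connected: every separation `(A,B)` of `G` with `Z ⊆ A`
and `B - A ≠ ∅` has order at least `k`. -/
def InternallyConnected {V : Type} (G : SimpleGraph V) (Z : Set V) (k : ℕ) : Prop :=
  ∀ A B : Set V, IsSeparation G A B → Z ⊆ A → (B \ A).Nonempty →
    k ≤ (A ∩ B).ncard

/-- A `Z`-rooted `K₄`-model in `G`. -/
def HasRootedK4Model {V : Type} (G : SimpleGraph V) (Z : Set V) : Prop :=
  ∃ B : Fin 4 → Set V,
    (∀ i, (G.induce (B i)).Connected) ∧
    (∀ i j, i ≠ j → Disjoint (B i) (B j)) ∧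
    (∀ i, ∃! z : V, z ∈ Z ∧ z ∈ B i) ∧
    (∀ z ∈ Z, ∃ i, z ∈ B i) ∧
    (∀ i j, i ≠ j → ∃ u ∈ B i, ∃ v ∈ B j, G.Adj u v)

/-- A `Z`-rooted `K*₄,₂`-model in `G`. -/
def HasRootedK42starModel {V : Type} (G : SimpleGraph V) (Z : Set V) : Prop :=
  ∃ (B : Fin 4 → Set V) (C : Fin 2 → Set V),
    (∀ i, (G.induce (B i)).Connected) ∧
    (∀ j, (G.induce (C j)).Connected) ∧
    (∀ i j, i ≠ j → Disjoint (B i) (B j)) ∧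
    (∀ i j, i ≠ j → Disjoint (C i) (C j)) ∧
    (∀ i j, Disjoint (B i) (C j)) ∧
    (∀ i, ∃! z : V, z ∈ Z ∧ z ∈ B i) ∧
    (∀ z ∈ Z, ∃ i, z ∈ B i) ∧
    (∀ i j, ∃ u ∈ B i, ∃ v ∈ C j, G.Adj u v) ∧
    (∃ u ∈ C 0, ∃ v ∈ C 1, G.Adj u v)

/-- An enemy: a `4`-connected graph with `|E(G)| ≥ 4|V(G)| - 8`, with no `K7vee`-minor,
not isomorphic to `K_{2,2,2,2}`. -/
def Enemy {V : Type} [Fintype V] (G : SimpleGraph V) : Prop :=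
  IsKConnected 4 G ∧
    4 * (Fintype.card V : ℤ) - 8 ≤ (G.edgeSet.ncard : ℤ) ∧
    ¬ IsMinor K7vee G ∧
    IsEmpty (G ≃g K2222)

/-- A minor-minimal enemy: an enemy, no minor of which, other than itself, is an enemy. -/
def MinorMinimalEnemy {V : Type} [Fintype V] (G : SimpleGraph V) : Prop :=
  Enemy G ∧ ∀ (W : Type) [Fintype W] (H : SimpleGraph W),
    IsMinor H G → Enemy H → Nonempty (H ≃g G)

/-- The simple graph obtained from `G` by contracting the edge `uv`
(`v` is merged into `u`). -/
def contractEdge {V : Type} (G : SimpleGraph V) (u v : V) :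
    SimpleGraph {x : V // x ≠ v} :=
  SimpleGraph.fromRel (fun x y => G.Adj ↑x ↑y ∨ ((x : V) = u ∧ G.Adj v ↑y))

/-- A graph is `7`-contraction-critical if its chromatic number is `7` and
every minor of it, other than itself, has chromatic number less than `7`. -/
def ContractionCritical7 {V : Type} [Fintype V] (G : SimpleGraph V) : Prop :=
  G.chromaticNumber = 7 ∧
    ∀ (W : Type) [Fintype W] (H : SimpleGraph W),
      IsMinor H G → IsEmpty (H ≃g G) → H.chromaticNumber < 7

section

variable {V W : Type}

/-- `G[S]` is connected, phrased through cuts. -/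
def Cn (G : SimpleGraph V) (S : Set V) : Prop :=
  S.Nonempty ∧ ∀ X ⊆ S, X.Nonempty → (S \ X).Nonempty → ∃ a ∈ X, ∃ b ∈ S \ X, G.Adj a b

/-- Some edge of `G` joins `A` and `B`. -/
def Touch (G : SimpleGraph V) (A B : Set V) : Prop := ∃ a ∈ A, ∃ b ∈ B, G.Adj a b

/-- The neighbourhood of a set, outside the set. -/
def nbr (G : SimpleGraph V) (X : Set V) : Set V := {y | y ∉ X ∧ ∃ x ∈ X, G.Adj x y}

variable {G : SimpleGraph V}

theorem Touch.symm {A B : Set V} (h : Touch G A B) : Touch G B A := by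
  obtain ⟨a, ha, b, hb, h⟩ := h
  exact ⟨b, hb, a, ha, h.symm⟩

theorem touch_comm {A B : Set V} : Touch G A B ↔ Touch G B A := ⟨Touch.symm, Touch.symm⟩

theorem Touch.mono {A B A' B' : Set V} (h : Touch G A B) (hA : A ⊆ A') (hB : B ⊆ B') :
    Touch G A' B' := by
  obtain ⟨a, ha, b, hb, h⟩ := h
  exact ⟨a, hA ha, b, hB hb, h⟩

@[simp] theorem touch_singleton {a b : V} : Touch G {a} {b} ↔ G.Adj a b := by
  simp [Touch]

theorem touch_singleton_left {a : V} {B : Set V} : Touch G {a} B ↔ ∃ b ∈ B, G.Adj a b := by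
  simp [Touch]

theorem touch_union_left {A B C : Set V} : Touch G (A ∪ B) C ↔ Touch G A C ∨ Touch G B C := by
  simp only [Touch, Set.mem_union]
  constructor
  · rintro ⟨a, ha | ha, b, hb, h⟩
    · exact Or.inl ⟨a, ha, b, hb, h⟩
    · exact Or.inr ⟨a, ha, b, hb, h⟩
  · rintro (⟨a, ha, b, hb, h⟩ | ⟨a, ha, b, hb, h⟩)
    · exact ⟨a, Or.inl ha, b, hb, h⟩
    · exact ⟨a, Or.inr ha, b, hb, h⟩

theorem touch_union_right {A B C : Set V} : Touch G C (A ∪ B) ↔ Touch G C A ∨ Touch G C B := by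
  rw [touch_comm, touch_union_left, touch_comm, touch_comm (A := B)]

theorem Cn.mono_graph {G' : SimpleGraph V} {S : Set V} (h : Cn G S) (hG : G ≤ G') : Cn G' S := by
  refine ⟨h.1, fun X hX h1 h2 => ?_⟩
  obtain ⟨a, ha, b, hb, h⟩ := h.2 X hX h1 h2
  exact ⟨a, ha, b, hb, hG h⟩

theorem Cn.singleton (a : V) : Cn G {a} := by
  refine ⟨⟨a, rfl⟩, fun X hX h1 h2 => ?_⟩
  obtain ⟨b, hb, hb'⟩ := h2
  obtain ⟨c, hc⟩ := h1
  have := hX hc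
  simp_all

/-- Unions of connected sets indexed by a connected set are connected. -/
theorem Cn.biUnion {H : SimpleGraph W} {I : Set W} (hI : Cn H I) {B : W → Set V}
    (hB : ∀ i ∈ I, Cn G (B i))
    (hT : ∀ i ∈ I, ∀ j ∈ I, H.Adj i j → Touch G (B i) (B j) ∨ (B i ∩ B j).Nonempty) :
    Cn G (⋃ i ∈ I, B i) := by
  obtain ⟨i0, hi0⟩ := hI.1
  obtain ⟨b0, hb0⟩ := (hB i0 hi0).1
  refine ⟨⟨b0, Set.mem_biUnion hi0 hb0⟩, fun X hX h1 h2 => ?_⟩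
  by_cases hsplit : ∃ i ∈ I, (B i ∩ X).Nonempty ∧ (B i \ X).Nonempty
  · obtain ⟨i, hi, h3, b, hb, hb'⟩ := hsplit
    obtain ⟨a, ha, c, hc, hac⟩ := (hB i hi).2 (B i ∩ X) Set.inter_subset_left h3
      ⟨b, hb, fun h => hb' h.2⟩
    exact ⟨a, ha.2, c, ⟨Set.mem_biUnion hi hc.1, fun h => hc.2 ⟨hc.1, h⟩⟩, hac⟩
  · push Not at hsplit
    have hns : ∀ i ∈ I, (B i ∩ X).Nonempty → B i ⊆ X := by
      intro i hi h b hb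
      by_contra hbX
      have : b ∈ B i \ X := ⟨hb, hbX⟩
      rw [hsplit i hi h] at this
      exact this
    obtain ⟨x, hx⟩ := h1
    obtain ⟨y, hy, hyX⟩ := h2
    obtain ⟨i, hi, hxi⟩ := Set.mem_iUnion₂.1 (hX hx)
    obtain ⟨j, hj, hyj⟩ := Set.mem_iUnion₂.1 hy
    obtain ⟨a, ⟨haI, ha⟩, b, ⟨hbI, hb⟩, hab⟩ := hI.2 {i | i ∈ I ∧ (B i ∩ X).Nonempty}
      (fun i hi => hi.1) ⟨i, hi, x, hxi, hx⟩ ⟨j, hj, fun h => hyX (hns j hj h.2 hyj)⟩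
    have hb' : ∀ y ∈ B b, y ∉ X := fun y hy hyX => hb ⟨hbI, y, hy, hyX⟩
    rcases hT a haI b hbI hab with ⟨u, hu, v, hv, huv⟩ | ⟨u, hu, hv⟩
    · exact ⟨u, hns a haI ha hu, v, ⟨Set.mem_biUnion hbI hv, hb' v hv⟩, huv⟩
    · exact absurd (hns a haI ha hu) (hb' u hv)

/-- A union of connected sets each of which meets or touches a fixed one. -/
theorem Cn.union_star {ι : Type} {A : Set V} (hA : Cn G A) {B : ι → Set V} (hB : ∀ i, Cn G (B i))
    (hT : ∀ i, Touch G A (B i) ∨ (A ∩ B i).Nonempty) : Cn G (A ∪ ⋃ i, B i) := by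
  have hstar : Cn (SimpleGraph.fromRel fun x y : Option ι => x = none) Set.univ := by
    refine ⟨⟨none, trivial⟩, fun X _ h1 h2 => ?_⟩
    obtain ⟨x, hx⟩ := h1
    obtain ⟨y, -, hy⟩ := h2
    by_cases h : none ∈ X
    · exact ⟨none, h, y, ⟨trivial, hy⟩, by
        simp only [SimpleGraph.fromRel_adj]; exact ⟨fun e => hy (e ▸ h), Or.inl trivial⟩⟩
    · exact ⟨x, hx, none, ⟨trivial, h⟩, by
        simp only [SimpleGraph.fromRel_adj]; exact ⟨fun e => h (e ▸ hx), Or.inr trivial⟩⟩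
  have := Cn.biUnion (G := G) hstar (B := fun o : Option ι => o.elim A B)
    (by rintro (_ | i) -; exacts [hA, hB i])
    (by
      rintro (_ | i) - (_ | j) - h
      · simp at h
      · exact hT j
      · rcases hT i with h | h
        · exact Or.inl h.symm
        · exact Or.inr (by rw [Set.inter_comm]; exact h)
      · simp at h)
  convert this using 1
  ext x
  simp only [Set.mem_union, Set.mem_iUnion, Set.mem_univ, Option.exists, Option.elim]
  simp

theorem Cn.union {A B : Set V} (hA : Cn G A) (hB : Cn G B)
    (hT : Touch G A B ∨ (A ∩ B).Nonempty) : Cn G (A ∪ B) := by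
  have := Cn.union_star (ι := Unit) hA (B := fun _ => B) (fun _ => hB) (fun _ => hT)
  convert this using 2
  simp only [Set.iUnion_const]

theorem Cn.union_touch {A B : Set V} (hA : Cn G A) (hB : Cn G B) (hT : Touch G A B) :
    Cn G (A ∪ B) := hA.union hB (Or.inl hT)

theorem Cn.pair {a b : V} (h : G.Adj a b) : Cn G {a, b} :=
  (Cn.singleton a).union_touch (Cn.singleton b) (by simpa using h)

/-- Connected sets in Mathlib's sense. -/
theorem cn_iff {S : Set V} : (G.induce S).Connected ↔ Cn G S := by
  constructor
  · intro h
    refine ⟨Set.nonempty_coe_sort.1 h.nonempty, fun X hX h1 h2 => ?_⟩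
    obtain ⟨x, hx⟩ := h1
    obtain ⟨y, hy, hyX⟩ := h2
    obtain ⟨p⟩ := h.preconnected ⟨x, hX hx⟩ ⟨y, hy⟩
    obtain ⟨d, -, hd1, hd2⟩ := p.exists_boundary_dart {z | (z : V) ∈ X} hx hyX
    exact ⟨d.fst, hd1, d.snd, ⟨d.snd.2, hd2⟩, d.adj⟩
  · intro h
    have := h.1.to_subtype
    refine ⟨fun x y => ?_⟩
    by_contra hxy
    obtain ⟨a, ⟨haS, ha⟩, b, ⟨hbS, hb⟩, hab⟩ := h.2
      {z | ∃ hz : z ∈ S, (G.induce S).Reachable x ⟨z, hz⟩} (fun z hz => hz.1)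
      ⟨x, x.2, SimpleGraph.Reachable.refl _⟩ ⟨y, y.2, fun h => hxy h.2⟩
    exact hb ⟨hbS, ha.trans (SimpleGraph.Adj.reachable (by simpa using hab))⟩

/-- The connected component of `x` in `G[U]`. -/
def comp (G : SimpleGraph V) (U : Set V) (x : V) : Set V :=
  {y | ∃ C ⊆ U, Cn G C ∧ x ∈ C ∧ y ∈ C}

theorem comp_subset {U : Set V} {x : V} : comp G U x ⊆ U := by
  rintro y ⟨C, hC, -, -, hy⟩
  exact hC hy

theorem mem_comp_self {U : Set V} {x : V} (hx : x ∈ U) : x ∈ comp G U x :=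
  ⟨{x}, by simpa using hx, Cn.singleton x, rfl, rfl⟩

theorem Cn.subset_comp {U C : Set V} {x : V} (hC : Cn G C) (hU : C ⊆ U) (hx : x ∈ C) :
    C ⊆ comp G U x := fun _ hy => ⟨C, hU, hC, hx, hy⟩

theorem cn_comp {U : Set V} {x : V} (hx : x ∈ U) : Cn G (comp G U x) := by
  have := Cn.union_star (G := G) (Cn.singleton x)
    (B := fun C : {C : Set V // C ⊆ U ∧ Cn G C ∧ x ∈ C} => C.1) (fun C => C.2.2.1)
    (fun C => Or.inr ⟨x, rfl, C.2.2.2⟩)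
  convert this using 1
  ext y
  constructor
  · rintro ⟨C, h1, h2, h3, h4⟩
    exact Or.inr (Set.mem_iUnion.2 ⟨⟨C, h1, h2, h3⟩, h4⟩)
  · rintro (h | h)
    · rw [Set.mem_singleton_iff.1 h]; exact mem_comp_self hx
    · obtain ⟨C, hC⟩ := Set.mem_iUnion.1 h
      exact ⟨C.1, C.2.1, C.2.2.1, C.2.2.2, hC⟩

theorem comp_closed {U : Set V} {x a b : V} (ha : a ∈ comp G U x) (hb : b ∈ U)
    (hab : G.Adj a b) : b ∈ comp G U x := by
  obtain ⟨C, h1, h2, h3, h4⟩ := ha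
  refine ⟨C ∪ {b}, Set.union_subset h1 (by simpa using hb), h2.union_touch (Cn.singleton b)
    ⟨a, h4, b, rfl, hab⟩, Or.inl h3, Or.inr rfl⟩

theorem nbr_comp_subset {U : Set V} {x : V} : nbr G (comp G U x) ⊆ Uᶜ := by
  rintro y ⟨hy, a, ha, hab⟩ hyU
  exact hy (comp_closed ha hyU hab)

theorem comp_eq_of_mem {U : Set V} {x y : V} (hy : y ∈ comp G U x) :
    comp G U y = comp G U x := by
  have hxU : x ∈ U := by
    obtain ⟨C, h1, -, h3, -⟩ := hy
    exact h1 h3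
  apply Set.Subset.antisymm
  · have h1 := cn_comp (G := G) (comp_subset hy)
    have h2 : Cn G (comp G U y ∪ comp G U x) :=
      h1.union (cn_comp hxU) (Or.inr ⟨y, mem_comp_self (comp_subset hy), hy⟩)
    exact Set.subset_union_left.trans (h2.subset_comp (Set.union_subset comp_subset comp_subset)
      (Or.inr (mem_comp_self hxU)))
  · exact (cn_comp hxU).subset_comp comp_subset hy

theorem touch_of_mem_nbr {X : Set V} {y : V} (h : y ∈ nbr G X) : Touch G X {y} := by
  obtain ⟨-, x, hx, hxy⟩ := h
  exact ⟨x, hx, y, rfl, hxy⟩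

/-! ### Minors -/

theorem isMinor_of_bags {H : SimpleGraph W} (B : W → Set V) (h1 : ∀ w, Cn G (B w))
    (h2 : ∀ w w', w ≠ w' → Disjoint (B w) (B w'))
    (h3 : ∀ w w', H.Adj w w' → Touch G (B w) (B w')) : IsMinor H G :=
  ⟨B, fun w => cn_iff.2 (h1 w), h2, h3⟩

theorem IsMinor.bags {H : SimpleGraph W} (h : IsMinor H G) : ∃ B : W → Set V,
    (∀ w, Cn G (B w)) ∧ (∀ w w', w ≠ w' → Disjoint (B w) (B w')) ∧
    (∀ w w', H.Adj w w' → Touch G (B w) (B w')) := by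
  obtain ⟨B, h1, h2, h3⟩ := h
  exact ⟨B, fun w => cn_iff.1 (h1 w), h2, h3⟩

theorem IsMinor.trans {U : Type} {K : SimpleGraph U} {H : SimpleGraph W}
    (h : IsMinor K H) (h' : IsMinor H G) : IsMinor K G := by
  obtain ⟨A, a1, a2, a3⟩ := h.bags
  obtain ⟨B, b1, b2, b3⟩ := h'.bags
  refine isMinor_of_bags (fun u => ⋃ i ∈ A u, B i) (fun u => ?_) (fun u u' huu => ?_)
    (fun u u' huu => ?_)
  · exact (a1 u).biUnion (fun i _ => b1 i) (fun i _ j _ hij => Or.inl (b3 i j hij))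
  · rw [Set.disjoint_left]
    intro x hx hx'
    obtain ⟨i, hi, hxi⟩ := Set.mem_iUnion₂.1 hx
    obtain ⟨j, hj, hxj⟩ := Set.mem_iUnion₂.1 hx'
    by_cases hij : i = j
    · subst hij
      exact Set.disjoint_left.1 (a2 u u' huu) hi hj
    · exact Set.disjoint_left.1 (b2 i j hij) hxi hxj
  · obtain ⟨i, hi, j, hj, hij⟩ := a3 u u' huu
    exact (b3 i j hij).mono (Set.subset_biUnion_of_mem hi) (Set.subset_biUnion_of_mem hj)

theorem isMinor_of_le {G' : SimpleGraph V} (h : G ≤ G') : IsMinor G G' :=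
  isMinor_of_bags (fun v => {v}) (fun v => Cn.singleton v) (fun v w h => by simpa using h)
    (fun v w hvw => by simpa using h hvw)

theorem isMinor_of_embedding {H : SimpleGraph W} (f : W → V) (hf : Function.Injective f)
    (h : ∀ a b, H.Adj a b → G.Adj (f a) (f b)) : IsMinor H G :=
  isMinor_of_bags (fun v => {f v}) (fun v => Cn.singleton _)
    (fun v w h => by simpa using fun e => h (hf e)) (fun v w hvw => by simpa using h _ _ hvw)

/-! ### Small models -/

/-- A family of disjoint connected sets. -/
def IsModel {ι : Type} (G : SimpleGraph V) (B : ι → Set V) : Prop :=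
  (∀ i, Cn G (B i)) ∧ ∀ i j, i ≠ j → Disjoint (B i) (B j)

theorem IsModel.comp {ι κ : Type} {B : ι → Set V} (h : IsModel G B) {g : κ → ι}
    (hg : Function.Injective g) : IsModel G (fun k => B (g k)) :=
  ⟨fun _ => h.1 _, fun _ _ hij => h.2 _ _ fun e => hij (hg e)⟩

/-- Adjacency recorded by a list of pairs. -/
def ladj {m : ℕ} (L : List (Fin m × Fin m)) (i j : Fin m) : Bool :=
  decide ((i, j) ∈ L) || decide ((j, i) ∈ L)

/-- `f` contracts the graph with edge list `L` onto a supergraph of `K7vee`; every nonempty fibre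
is a star centred at `c k`. -/
def contractsToK7vee {m : ℕ} (L : List (Fin m × Fin m)) (f : Fin m → Fin 8)
    (c : Fin 7 → Fin m) : Bool :=
  decide (∀ k : Fin 7, f (c k) = k.castSucc ∧
    ∀ i, f i = k.castSucc → i = c k ∨ ladj L (c k) i = true) &&
  decide (∀ k l : Fin 7, k < l → (k = 0 ∧ (l = 1 ∨ l = 2)) ∨
    ∃ i j, f i = k.castSucc ∧ f j = l.castSucc ∧ ladj L i j = true)

theorem k7vee_of_model {m : ℕ} {B : Fin m → Set V} (hB : IsModel G B)
    (L : List (Fin m × Fin m)) (hL : ∀ e ∈ L, Touch G (B e.1) (B e.2))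
    (f : Fin m → Fin 8) (c : Fin 7 → Fin m) (h : contractsToK7vee L f c = true) :
    IsMinor K7vee G := by
  simp only [contractsToK7vee, Bool.and_eq_true, decide_eq_true_eq] at h
  obtain ⟨h1, h2⟩ := h
  have hT : ∀ i j, ladj L i j = true → Touch G (B i) (B j) := by
    intro i j hij
    simp only [ladj, Bool.or_eq_true, decide_eq_true_eq] at hij
    rcases hij with hij | hij
    · exact hL _ hij
    · exact (hL _ hij).symm
  have key : ∀ k l : Fin 7, k < l → ¬(k = 0 ∧ (l = 1 ∨ l = 2)) →
      Touch G (⋃ i ∈ {i | f i = k.castSucc}, B i) (⋃ i ∈ {i | f i = l.castSucc}, B i) := by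
    intro k l hkl hn
    rcases h2 k l hkl with h | ⟨i, j, hi, hj, hij⟩
    · exact absurd h hn
    · exact (hT i j hij).mono (Set.subset_biUnion_of_mem (u := B) (by exact hi))
        (Set.subset_biUnion_of_mem (u := B) (by exact hj))
  refine isMinor_of_bags (fun k => ⋃ i ∈ {i | f i = k.castSucc}, B i) (fun k => ?_)
    (fun k l hkl => ?_) (fun k l hkl => ?_)
  · have := Cn.union_star (G := G) (hB.1 (c k)) (B := fun i : {i // f i = k.castSucc} => B i)
      (fun i => hB.1 i) (fun i => by
        rcases (h1 k).2 i i.2 with h | h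
        · right
          rw [h, Set.inter_self]
          exact (hB.1 _).1
        · exact Or.inl (hT _ _ h))
    convert this using 1
    ext x
    simp only [Set.mem_ofPred_eq, Set.mem_iUnion, Set.mem_union, exists_prop, Subtype.exists]
    constructor
    · exact fun h => Or.inr h
    · rintro (h | h)
      · exact ⟨c k, (h1 k).1, h⟩
      · exact h
  · rw [Set.disjoint_left]
    intro x hx hx'
    obtain ⟨i, hi, hxi⟩ := Set.mem_iUnion₂.1 hx
    obtain ⟨j, hj, hxj⟩ := Set.mem_iUnion₂.1 hx'
    by_cases hij : i = j
    · subst hij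
      exact hkl (Fin.castSucc_injective _ (hi.symm.trans hj))
    · exact Set.disjoint_left.1 (hB.2 i j hij) hxi hxj
  · have hkl' : k ≠ l ∧ ¬(k = 0 ∧ (l = 1 ∨ l = 2)) ∧ ¬(l = 0 ∧ (k = 1 ∨ k = 2)) := by
      simp only [K7vee, SimpleGraph.deleteEdges_adj, completeGraph, SimpleGraph.top_adj,
        Set.mem_insert_iff, Set.mem_singleton_iff, Sym2.eq_iff] at hkl
      tauto
    rcases lt_or_gt_of_ne hkl'.1 with h | h
    · exact key k l h hkl'.2.1
    · exact (key l k h hkl'.2.2).symm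

end

section

variable {V : Type} {G : SimpleGraph V}

/-- `S` meets every connected set meeting both `A` and `B`. -/
def Separates (G : SimpleGraph V) (A B S : Set V) : Prop :=
  ∀ C, Cn G C → (C ∩ A).Nonempty → (C ∩ B).Nonempty → (C ∩ S).Nonempty

/-- There are `k` disjoint connected sets meeting both `A` and `B`. -/
def Linked (G : SimpleGraph V) (A B : Set V) (k : ℕ) : Prop :=
  ∃ P : Fin k → Set V, IsModel G P ∧ ∀ i, (P i ∩ A).Nonempty ∧ (P i ∩ B).Nonempty

theorem linked_of_indexed [Finite V] {A B X : Set V} {k : ℕ} (hX : k ≤ X.ncard) (P : V → Set V)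
    (h1 : ∀ x ∈ X, Cn G (P x)) (h2 : ∀ x ∈ X, ∀ y ∈ X, x ≠ y → Disjoint (P x) (P y))
    (h3 : ∀ x ∈ X, (P x ∩ A).Nonempty ∧ (P x ∩ B).Nonempty) : Linked G A B k := by
  obtain ⟨Y, hY, hYk⟩ := Set.exists_subset_card_eq hX
  have := Set.toFinite Y
  obtain ⟨e⟩ : Nonempty (Fin k ≃ Y) := ⟨(Finite.equivFinOfCardEq (by rw [← hYk]; rfl)).symm⟩
  refine ⟨fun i => P (e i), ⟨fun i => h1 _ (hY (e i).2), fun i j hij => ?_⟩,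
    fun i => h3 _ (hY (e i).2)⟩
  exact h2 _ (hY (e i).2) _ (hY (e j).2) fun h => hij (e.injective (Subtype.ext h))

theorem Linked.indexed [Finite V] {A X : Set V} {k : ℕ} (h : Linked G A X k) (hX : X.ncard = k) :
    ∃ P : V → Set V, (∀ x ∈ X, Cn G (P x) ∧ x ∈ P x ∧ (P x ∩ A).Nonempty) ∧
      ∀ x ∈ X, ∀ y ∈ X, x ≠ y → Disjoint (P x) (P y) := by
  obtain ⟨P, hP, hm⟩ := h
  choose f hf using fun i => (hm i).2
  have hinj : Function.Injective fun i => (⟨f i, (hf i).2⟩ : X) := by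
    intro i j hij
    by_contra hne
    have := congrArg Subtype.val hij
    exact Set.disjoint_left.1 (hP.2 i j hne) (hf i).1 (by
      rw [show f i = f j from this]; exact (hf j).1)
  have hbij := (Nat.bijective_iff_injective_and_card _).2 ⟨hinj, by
    rw [Nat.card_fin, ← hX]; rfl⟩
  obtain ⟨g, -, hg⟩ := Function.bijective_iff_has_inverse.1 hbij
  classical
  refine ⟨fun x => if hx : x ∈ X then P (g ⟨x, hx⟩) else ∅, fun x hx => ?_, fun x hx y hy hxy => ?_⟩
  · simp only [hx, dite_true]
    refine ⟨hP.1 _, ?_, (hm _).1⟩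
    have h1 : f (g ⟨x, hx⟩) = x := congrArg Subtype.val (hg ⟨x, hx⟩)
    have h2 := (hf (g ⟨x, hx⟩)).1
    rwa [h1] at h2
  · simp only [hx, hy, dite_true]
    refine hP.2 _ _ fun h => hxy ?_
    have h1 := hg ⟨x, hx⟩
    rw [h, hg] at h1
    exact (congrArg Subtype.val h1).symm

theorem cn_restrict_subset {U C : Set V} {G' : SimpleGraph V}
    (hG' : ∀ a b, G'.Adj a b → b ∈ U) (hC : Cn G' C) (hU : (C ∩ U).Nonempty) : C ⊆ U := by
  by_contra h
  rw [Set.not_subset] at h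
  obtain ⟨c, hc, hcU⟩ := h
  obtain ⟨a, ha, b, hb, hab⟩ := hC.2 (C ∩ U) Set.inter_subset_left hU ⟨c, hc, fun h => hcU h.2⟩
  exact hb.2 ⟨hb.1, hG' a b hab⟩

set_option maxHeartbeats 2000000 in
/-- Menger's theorem. -/
theorem menger [Finite V] (k : ℕ) (A B : Set V) (h : ∀ S, Separates G A B S → k ≤ S.ncard) :
    Linked G A B k := by
  induction hn : G.edgeSet.ncard using Nat.strong_induction_on generalizing G A B with
  | _ n ih =>
  subst hn
  by_cases hE : ∃ x y, G.Adj x y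
  swap
  · push Not at hE
    refine linked_of_indexed (X := A ∩ B) (h _ ?_) (fun x => {x}) (fun x _ => Cn.singleton x)
      (fun x _ y _ hxy => by simpa using hxy) (fun x hx => ⟨⟨x, rfl, hx.1⟩, ⟨x, rfl, hx.2⟩⟩)
    rintro C hC ⟨a, haC, haA⟩ ⟨b, hbC, hbB⟩
    by_cases hab : a = b
    · exact ⟨a, haC, haA, hab ▸ hbB⟩
    · obtain ⟨c, -, d, -, hcd⟩ := hC.2 {a} (by simpa using haC) ⟨a, rfl⟩
        ⟨b, hbC, fun h => hab h.symm⟩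
      exact absurd hcd (hE c d)
  obtain ⟨x, y, hxy⟩ := hE
  set G0 : SimpleGraph V := G.deleteEdges {s(x, y)} with hG0
  have hlt : ∀ {G' : SimpleGraph V}, G' ≤ G0 → G'.edgeSet.ncard < G.edgeSet.ncard := by
    intro G' hle
    refine Set.ncard_lt_ncard ?_ (Set.toFinite _)
    rw [SimpleGraph.edgeSet_ssubset_edgeSet]
    refine lt_of_le_of_lt hle (lt_of_le_of_ne (SimpleGraph.deleteEdges_le _) fun he => ?_)
    have : G0.Adj x y := by rw [he]; exact hxy
    simp [hG0, SimpleGraph.deleteEdges_adj] at this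
  by_cases hsep : ∀ S, Separates G0 A B S → k ≤ S.ncard
  · obtain ⟨P, hP, hm⟩ := ih _ (hlt le_rfl) A B hsep rfl
    exact ⟨P, ⟨fun i => (hP.1 i).mono_graph (SimpleGraph.deleteEdges_le _), hP.2⟩, hm⟩
  push Not at hsep
  obtain ⟨S, hS, hSk⟩ := hsep
  -- the parts of `G0 - S` reachable from `A` and from `B`
  let L : Set V → Set V := fun A => {z | ∃ C ⊆ Sᶜ, Cn G0 C ∧ z ∈ C ∧ (C ∩ A).Nonempty}
  have hLS : ∀ A z, z ∈ L A → z ∉ S := fun A z ⟨C, h1, _, h3, _⟩ => h1 h3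
  have hAL : ∀ A, ∀ a ∈ A, a ∉ S → a ∈ L A := fun A a ha haS =>
    ⟨{a}, by simpa using haS, Cn.singleton a, rfl, a, rfl, ha⟩
  have hLcl : ∀ A a b, a ∈ L A → b ∉ S → G0.Adj a b → b ∈ L A := by
    rintro A a b ⟨C, h1, h2, h3, h4⟩ hb hab
    exact ⟨C ∪ {b}, Set.union_subset h1 (by simpa using hb),
      h2.union_touch (Cn.singleton b) ⟨a, h3, b, rfl, hab⟩, Or.inr rfl,
      h4.mono (Set.inter_subset_inter_left _ Set.subset_union_left)⟩
  have hdis : ∀ z, z ∈ L A → z ∉ L B := by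
    rintro z ⟨C, h1, h2, h3, h4⟩ ⟨D, d1, d2, d3, d4⟩
    obtain ⟨w, hw, hwS⟩ := hS (C ∪ D) (h2.union d2 (Or.inr ⟨z, h3, d3⟩))
      (h4.mono (Set.inter_subset_inter_left _ Set.subset_union_left))
      (d4.mono (Set.inter_subset_inter_left _ Set.subset_union_right))
    exact (Set.union_subset h1 d1 hw) hwS
  have hG0adj : ∀ a b, G0.Adj a b ↔ G.Adj a b ∧ ¬(a = x ∧ b = y) ∧ ¬(a = y ∧ b = x) := by
    intro a b
    simp only [hG0, SimpleGraph.deleteEdges_adj, Set.mem_singleton_iff, Sym2.eq_iff]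
    tauto
  -- the main step, for either orientation of the edge
  have main : ∀ x y, (∀ a b, G0.Adj a b ↔ G.Adj a b ∧ ¬(a = x ∧ b = y) ∧ ¬(a = y ∧ b = x)) →
      G.Adj x y → x ∈ L A → y ∈ L B → Linked G A B k := by
    intro x y hG0adj hxy hx hy
    have hside : ∀ A B x y, (∀ a b, G0.Adj a b ↔ G.Adj a b ∧ ¬(a = x ∧ b = y) ∧ ¬(a = y ∧ b = x)) →
        x ∈ L A → y ∈ L B → (∀ z, z ∈ L A → z ∉ L B) →
        (∀ S, Separates G A B S → k ≤ S.ncard) →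
        Linked (G0 ⊓ SimpleGraph.fromRel fun a b => a ∈ L A ∪ S ∧ b ∈ L A ∪ S) A (S ∪ {x}) k := by
      intro A B x y hG0adj hx hy hdis h
      refine ih _ (hlt inf_le_left) A (S ∪ {x}) (fun T hT => h T ?_) rfl
      rintro C hC ⟨a, haC, haA⟩ ⟨b, hbC, hbB⟩
      by_contra hCT
      rw [Set.not_nonempty_iff_eq_empty] at hCT
      have hsub : ∀ D, D ⊆ C → Cn
          (G0 ⊓ SimpleGraph.fromRel fun a b => a ∈ L A ∪ S ∧ b ∈ L A ∪ S) D →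
          (D ∩ A).Nonempty → (D ∩ (S ∪ {x})).Nonempty → False := by
        intro D hD h1 h2 h3
        obtain ⟨t, ht, htT⟩ := hT D h1 h2 h3
        have : t ∈ C ∩ T := ⟨hD ht, htT⟩
        rw [hCT] at this
        exact this
      have haS : a ∉ S := fun haS => hsub {a} (by simpa using haC) (Cn.singleton a) ⟨a, rfl, haA⟩
        ⟨a, rfl, Or.inl haS⟩
      have haL : a ∈ L A := hAL A a haA haS
      have hbL : b ∉ L A := fun hb => hdis b hb (hAL B b hbB (hLS _ _ hb))
      set K := comp (G0 ⊓ SimpleGraph.fromRel fun a b => a ∈ L A ∪ S ∧ b ∈ L A ∪ S) (C ∩ L A) a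
        with hK
      have haK : a ∈ K := mem_comp_self ⟨haC, haL⟩
      have hKL : K ⊆ C ∩ L A := comp_subset
      obtain ⟨u, hu, v, hv, huv⟩ := hC.2 K (fun z hz => (hKL hz).1) ⟨a, haK⟩
        ⟨b, hbC, fun h => hbL (hKL h).2⟩
      have hKc : Cn _ K := cn_comp (G :=
          (G0 ⊓ SimpleGraph.fromRel fun a b => a ∈ L A ∪ S ∧ b ∈ L A ∪ S))
        ⟨haC, haL⟩
      have huL := (hKL hu).2
      by_cases hux : u = x
      · exact hsub K (fun z hz => (hKL hz).1) hKc ⟨a, haK, haA⟩ ⟨u, hu, Or.inr hux⟩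
      have hG0uv : G0.Adj u v := (hG0adj u v).2 ⟨huv, fun h => hux h.1, fun h =>
        hdis u huL (h.1 ▸ hy)⟩
      by_cases hvS : v ∈ S
      · refine hsub (K ∪ {v}) ?_ (hKc.union_touch (Cn.singleton v) ⟨u, hu, v, rfl, hG0uv, ?_⟩)
          ⟨a, Or.inl haK, haA⟩ ⟨v, Or.inr rfl, Or.inl hvS⟩
        · exact Set.union_subset (fun z hz => (hKL hz).1) (by simpa using hv.1)
        · rw [SimpleGraph.fromRel_adj]
          exact ⟨huv.ne, Or.inl ⟨Or.inl huL, Or.inr hvS⟩⟩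
      · have hvL := hLcl A u v huL hvS hG0uv
        refine hv.2 (comp_closed hu ⟨hv.1, hvL⟩ ⟨hG0uv, ?_⟩)
        rw [SimpleGraph.fromRel_adj]
        exact ⟨huv.ne, Or.inl ⟨Or.inl huL, Or.inl hvL⟩⟩
    have hxS := hLS _ _ hx
    have hyS := hLS _ _ hy
    have hcx : (S ∪ {x}).ncard = k := by
      refine le_antisymm ?_ ?_
      · rw [Set.union_singleton, Set.ncard_insert_of_notMem hxS]; omega
      · refine h _ ?_
        rintro C hC hCA hCB
        by_contra hCT
        rw [Set.not_nonempty_iff_eq_empty] at hCT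
        have hn : ∀ z ∈ C, z ∉ S ∪ {x} := fun z hz hz' => by
          have : z ∈ C ∩ (S ∪ {x}) := ⟨hz, hz'⟩
          rw [hCT] at this
          exact this
        have hC0 : Cn G0 C := by
          refine ⟨hC.1, fun X hX h1 h2 => ?_⟩
          obtain ⟨a, ha, b, hb, hab⟩ := hC.2 X hX h1 h2
          refine ⟨a, ha, b, hb, (hG0adj a b).2 ⟨hab, fun h => hn a (hX ha) (Or.inr h.1),
            fun h => hn b hb.1 (Or.inr h.2)⟩⟩
        obtain ⟨z, hz, hzS⟩ := hS C hC0 hCA hCB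
        exact hn z hz (Or.inl hzS)
    have hcy : (S ∪ {y}).ncard = k := by
      rw [Set.union_singleton, Set.ncard_insert_of_notMem hyS]
      rw [Set.union_singleton, Set.ncard_insert_of_notMem hxS] at hcx
      exact hcx
    obtain ⟨P, hP1, hP2⟩ := (hside A B x y hG0adj hx hy hdis h).indexed hcx
    obtain ⟨Q, hQ1, hQ2⟩ := (hside B A y x (fun a b => by rw [hG0adj]; tauto) hy hx
      (fun z hz hz' => hdis z hz' hz) (fun T hT => h T fun C h1 h2 h3 => hT C h1 h3 h2)).indexed hcy
    have hPL : ∀ z ∈ S ∪ {x}, P z ⊆ L A ∪ S := fun z hz =>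
      cn_restrict_subset (fun a b hab => by
        have := hab.2; rw [SimpleGraph.fromRel_adj] at this; exact this.2.elim (fun h => h.2) (fun h => h.1)) (hP1 z hz).1
        ⟨z, (hP1 z hz).2.1, hz.elim Or.inr fun h => Or.inl (by rw [Set.mem_singleton_iff.1 h]; exact hx)⟩
    have hQL : ∀ z ∈ S ∪ {y}, Q z ⊆ L B ∪ S := fun z hz =>
      cn_restrict_subset (fun a b hab => by
        have := hab.2; rw [SimpleGraph.fromRel_adj] at this; exact this.2.elim (fun h => h.2) (fun h => h.1)) (hQ1 z hz).1
        ⟨z, (hQ1 z hz).2.1, hz.elim Or.inr fun h => Or.inl (by rw [Set.mem_singleton_iff.1 h]; exact hy)⟩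
    have hPQ : ∀ z ∈ S ∪ {x}, ∀ w ∈ S ∪ {y}, (z ∈ S → z ≠ w) → (w ∈ S → z ≠ w) →
        Disjoint (P z) (Q w) := by
      intro z hz w hw hzw hwz
      rw [Set.disjoint_left]
      intro t ht ht'
      have htS : t ∈ S := by
        rcases hPL z hz ht with h1 | h1
        · rcases hQL w hw ht' with h2 | h2
          · exact absurd h2 (hdis t h1)
          · exact h2
        · exact h1
      have e1 : t = z := by
        by_contra hne
        exact Set.disjoint_left.1 (hP2 t (Or.inl htS) z hz hne) (hP1 t (Or.inl htS)).2.1 ht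
      have e2 : t = w := by
        by_contra hne
        exact Set.disjoint_left.1 (hQ2 t (Or.inl htS) w hw hne) (hQ1 t (Or.inl htS)).2.1 ht'
      exact hzw (e1 ▸ htS) (e1.symm.trans e2)
    classical
    let σ : V → V := fun z => if z = x then y else z
    have hσ : ∀ z ∈ S ∪ {x}, σ z ∈ S ∪ {y} := by
      intro z hz
      by_cases h : z = x
      · simp [σ, h]
      · simp only [σ, h, if_false]
        exact hz.elim Or.inl fun h' => absurd h' h
    have hσinj : ∀ z ∈ S ∪ {x}, ∀ w ∈ S ∪ {x}, z ≠ w → σ z ≠ σ w := by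
      intro z hz w hw hzw
      have hyx : y ∉ S := hyS
      by_cases h : z = x <;> by_cases h' : w = x <;> simp only [σ, h, h', if_true, if_false]
      · exact absurd (h.trans h'.symm) hzw
      · rintro rfl; exact hw.elim hyS h'
      · intro e; exact hz.elim (fun h'' => hyS (e ▸ h'')) h
      · exact hzw
    have hxy' : x ≠ y := hxy.ne
    have hcross : ∀ z ∈ S ∪ {x}, ∀ w ∈ S ∪ {x}, z ≠ w → Disjoint (P z) (Q (σ w)) := by
      intro z hz w hw hzw
      refine hPQ z hz _ (hσ w hw) (fun hzS e => ?_) (fun hwS e => ?_)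
      · by_cases h' : w = x
        · simp only [σ, h', if_true] at e; exact hyS (e ▸ hzS)
        · simp only [σ, h', if_false] at e; exact hzw e
      · by_cases h' : w = x
        · simp only [σ, h', if_true] at hwS; exact hyS hwS
        · simp only [σ, h', if_false] at e; exact hzw e
    refine linked_of_indexed (X := S ∪ {x}) hcx.ge (fun z => P z ∪ Q (σ z)) (fun z hz => ?_)
      (fun z hz w hw hzw => ?_) (fun z hz => ⟨?_, ?_⟩)
    · refine ((hP1 z hz).1.mono_graph ?_).union ((hQ1 _ (hσ z hz)).1.mono_graph ?_) ?_
      · exact inf_le_left.trans (SimpleGraph.deleteEdges_le _)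
      · exact inf_le_left.trans (SimpleGraph.deleteEdges_le _)
      · by_cases h' : z = x
        · left
          refine ⟨z, (hP1 z hz).2.1, y, ?_, h' ▸ hxy⟩
          have := (hQ1 _ (hσ z hz)).2.1
          simp only [σ, h', if_true] at this ⊢
          exact this
        · right
          refine ⟨z, (hP1 z hz).2.1, ?_⟩
          have := (hQ1 _ (hσ z hz)).2.1
          simp only [σ, h', if_false] at this ⊢
          exact this
    · rw [Set.disjoint_union_left, Set.disjoint_union_right, Set.disjoint_union_right]
      exact ⟨⟨hP2 z hz w hw hzw, hcross z hz w hw hzw⟩,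
        ⟨(hcross w hw z hz hzw.symm).symm, hQ2 _ (hσ z hz) _ (hσ w hw) (hσinj z hz w hw hzw)⟩⟩
    · exact (hP1 z hz).2.2.mono (Set.inter_subset_inter_left _ Set.subset_union_left)
    · exact (hQ1 _ (hσ z hz)).2.2.mono (Set.inter_subset_inter_left _ Set.subset_union_right)
  -- `S` does not separate in `G`, hence the edge joins the two parts
  have hnS : ¬ Separates G A B S := fun hh => by have := h S hh; omega
  simp only [Separates, not_forall] at hnS
  obtain ⟨C, hC, ⟨a, haC, haA⟩, ⟨b, hbC, hbB⟩, hCS⟩ := hnS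
  have hCn : ∀ z ∈ C, z ∉ S := fun z hz hzS => hCS ⟨z, hz, hzS⟩
  obtain ⟨u, hu, v, hv, huv⟩ := hC.2 (C ∩ L A) Set.inter_subset_left
    ⟨a, haC, hAL A a haA (hCn a haC)⟩
    ⟨b, hbC, fun h => hdis b h.2 (hAL B b hbB (hCn b hbC))⟩
  obtain ⟨u', hu', v', hv', huv'⟩ := hC.2 (C ∩ L B) Set.inter_subset_left
    ⟨b, hbC, hAL B b hbB (hCn b hbC)⟩
    ⟨a, haC, fun h => hdis a (hAL A a haA (hCn a haC)) h.2⟩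
  have e1 : (u = x ∧ v = y) ∨ (u = y ∧ v = x) := by
    by_contra hne
    rw [not_or] at hne
    exact hv.2 ⟨hv.1, hLcl A u v hu.2 (hCn v hv.1) ((hG0adj u v).2 ⟨huv, hne.1, hne.2⟩)⟩
  have e2 : (u' = x ∧ v' = y) ∨ (u' = y ∧ v' = x) := by
    by_contra hne
    rw [not_or] at hne
    exact hv'.2 ⟨hv'.1, hLcl B u' v' hu'.2 (hCn v' hv'.1) ((hG0adj u' v').2 ⟨huv', hne.1, hne.2⟩)⟩
  have hx1 := hu.2
  have hx2 := hu'.2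
  rcases e1 with ⟨h1, -⟩ | ⟨h1, -⟩ <;> rcases e2 with ⟨h2, -⟩ | ⟨h2, -⟩ <;>
    rw [h1] at hx1 <;> rw [h2] at hx2
  · exact absurd hx2 (hdis _ hx1)
  · exact main x y hG0adj hxy hx1 hx2
  · exact main y x (fun a b => by rw [hG0adj]; tauto) hxy.symm hx1 hx2
  · exact absurd hx2 (hdis _ hx1)

end

section

variable {V W : Type} {G : SimpleGraph V}

/-! ### Seven bags with few missing pairs -/

theorem exists_two_cover {ι : Type} [Fintype ι] [DecidableEq ι] (hι : 7 ≤ Fintype.card ι)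
    (z a b : ι) : ∃ a' b', z ≠ a' ∧ z ≠ b' ∧ a' ≠ b' ∧ ∀ j, j ≠ z → j = a ∨ j = b →
      j = a' ∨ j = b' := by
  have fresh : ∀ s : Finset ι, s.card ≤ 3 → ∃ x, x ∉ s := by
    intro s hs
    by_contra! h
    have : s = Finset.univ := Finset.eq_univ_iff_forall.2 h
    rw [this, Finset.card_univ] at hs
    omega
  have h3 : ∀ x y w : ι, Finset.card {x, y, w} ≤ 3 := fun x y w => Finset.card_le_three
  by_cases ha : a = z
  · by_cases hb : b = z
    · obtain ⟨x, hx⟩ := fresh {z, z, z} (h3 _ _ _)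
      obtain ⟨y, hy⟩ := fresh {z, x, x} (h3 _ _ _)
      simp only [Finset.mem_insert, Finset.mem_singleton, not_or] at hx hy
      exact ⟨x, y, Ne.symm hx.1, Ne.symm hy.1, Ne.symm hy.2.1, by grind⟩
    · obtain ⟨x, hx⟩ := fresh {z, b, b} (h3 _ _ _)
      simp only [Finset.mem_insert, Finset.mem_singleton, not_or] at hx
      exact ⟨b, x, Ne.symm hb, Ne.symm hx.1, Ne.symm hx.2.1, by grind⟩
  · by_cases hb : b = z ∨ b = a
    · obtain ⟨x, hx⟩ := fresh {z, a, a} (h3 _ _ _)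
      simp only [Finset.mem_insert, Finset.mem_singleton, not_or] at hx
      exact ⟨a, x, Ne.symm ha, Ne.symm hx.1, Ne.symm hx.2.1, by grind⟩
    · push Not at hb
      exact ⟨a, b, Ne.symm ha, Ne.symm hb.1, Ne.symm hb.2, fun j _ h => h⟩

/-- Seven bags pairwise touching except possibly for two pairs with a common member `z`. -/
theorem k7vee_of_cover {ι : Type} [Fintype ι] (hι : Fintype.card ι = 7)
    {B : ι → Set V} (hB : IsModel G B) (z a b : ι)
    (h : ∀ i j, i ≠ j → j ≠ z → Touch G (B i) (B j) ∨ (i = z ∧ (j = a ∨ j = b))) :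
    IsMinor K7vee G := by
  classical
  obtain ⟨a', b', h1, h2, h3, h4⟩ := exists_two_cover hι.ge z a b
  have hinj : Function.Injective ![z, a', b'] := by
    intro i j hij
    fin_cases i <;> fin_cases j <;> simp_all
  let f : Fin 7 → ι := fun i => if i = 0 then z else if i = 1 then a' else b'
  obtain ⟨g, hg⟩ := Finset.exists_equiv_extend_of_card_eq (α := Fin 7) (β := ι)
    (t := Finset.univ) (by simp [hι]) (s := {0, 1, 2}) (f := f) (by simp) (by
      intro i hi j hj hij
      simp only [Finset.coe_insert, Finset.coe_singleton, Set.mem_insert_iff,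
        Set.mem_singleton_iff] at hi hj
      rcases hi with rfl | rfl | rfl <;> rcases hj with rfl | rfl | rfl <;> simp_all [f])
  have g0 : (g 0 : ι) = z := by rw [hg 0 (by simp)]; simp [f]
  have g1 : (g 1 : ι) = a' := by rw [hg 1 (by simp)]; simp [f]
  have g2 : (g 2 : ι) = b' := by rw [hg 2 (by simp)]; simp [f]
  have hinj : ∀ i j, i ≠ j → (g i : ι) ≠ g j := fun i j hij e =>
    hij (g.injective (Subtype.ext e))
  refine isMinor_of_bags (fun i => B (g i)) (fun i => hB.1 _) (fun i j hij => hB.2 _ _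
      (hinj i j hij))
    fun i j hij => ?_
  have hij' : i ≠ j ∧ ¬(i = 0 ∧ (j = 1 ∨ j = 2)) ∧ ¬(j = 0 ∧ (i = 1 ∨ i = 2)) := by
    simp only [K7vee, SimpleGraph.deleteEdges_adj, completeGraph, SimpleGraph.top_adj,
      Set.mem_insert_iff, Set.mem_singleton_iff, Sym2.eq_iff] at hij
    tauto
  have back : ∀ i j, i ≠ j → ¬(i = 0 ∧ (j = 1 ∨ j = 2)) → (g j : ι) ≠ z →
      Touch G (B (g i)) (B (g j)) := by
    intro i j hij hn hz
    rcases h (g i) (g j) (hinj i j hij) hz with h' | ⟨h', h''⟩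
    · exact h'
    · exfalso
      have hi : i = 0 := by
        by_contra hne
        exact hinj i 0 hne (h'.trans g0.symm)
      apply hn
      refine ⟨hi, ?_⟩
      rcases h4 _ hz h'' with h5 | h5
      · left
        by_contra hne
        exact hinj j 1 hne (h5.trans g1.symm)
      · right
        by_contra hne
        exact hinj j 2 hne (h5.trans g2.symm)
  by_cases hz : (g j : ι) = z
  · have hzi : (g i : ι) ≠ z := fun e => hinj i j hij'.1 (e.trans hz.symm)
    exact (back j i (Ne.symm hij'.1) hij'.2.2 hzi).symm
  · exact back i j hij'.1 hij'.2.1 hz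

/-! ### Four-connectivity -/

/-- Every nonempty set of vertices with a non-neighbour outside has at least four neighbours. -/
def FourConn (G : SimpleGraph V) : Prop :=
  ∀ X : Set V, X.Nonempty → X ∪ nbr G X ≠ Set.univ → 4 ≤ (nbr G X).ncard

theorem FourConn.four_le [Finite V] (h : FourConn G) {X S : Set V} (hX : X.Nonempty)
    (hS : nbr G X ⊆ S) {y : V} (hy : y ∉ X) (hyS : y ∉ S) : 4 ≤ (nbr G X).ncard :=
  h X hX fun e => by
    rcases (e ▸ Set.mem_univ y : y ∈ X ∪ nbr G X) with h | h
    · exact hy h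
    · exact hyS (hS h)

theorem nbr_comp_subset' {U : Set V} {x : V} : nbr G (comp G Uᶜ x) ⊆ U := by
  simpa using nbr_comp_subset (G := G) (U := Uᶜ) (x := x)

theorem FourConn.comp [Finite V] (h : FourConn G) {U : Set V} {x y : V} (hx : x ∉ U)
    (hy : y ∈ U) (hyn : ∀ z ∉ U, ¬ G.Adj z y) : 4 ≤ (nbr G (comp G Uᶜ x)).ncard := by
  refine h _ ⟨x, mem_comp_self hx⟩ fun e => ?_
  rcases (e ▸ Set.mem_univ y : y ∈ _ ∪ nbr G _) with h | ⟨-, z, hz, hzy⟩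
  · exact comp_subset h hy
  · exact hyn z (comp_subset hz) hzy

/-! ### Counting -/

/-- The ordered adjacent pairs. -/
def arcs (G : SimpleGraph V) : Set (V × V) := {p | G.Adj p.1 p.2}

/-- Twice the number of edges missing to the bound `4n - 9`. -/
noncomputable def defect (G : SimpleGraph V) : ℤ := 8 * Nat.card V - 18 - (arcs G).ncard

theorem ncard_arcs [Fintype V] [DecidableRel G.Adj] :
    (arcs G).ncard = ∑ v, G.degree v := by
  classical
  rw [← Nat.card_coe_set_eq, Nat.card_congr (β := Σ v, G.neighborSet v)
    { toFun := fun p => ⟨p.1.1, p.1.2, p.2⟩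
      invFun := fun p => ⟨(p.1, p.2.1), p.2.2⟩
      left_inv := fun p => rfl
      right_inv := fun p => rfl }, Nat.card_eq_fintype_card, Fintype.card_sigma]
  simp only [SimpleGraph.card_neighborSet_eq_degree]

theorem even_ncard_arcs [Finite V] : Even (arcs G).ncard := by
  classical
  have := Fintype.ofFinite V
  rw [ncard_arcs, SimpleGraph.sum_degrees_eq_twice_card_edges]
  simp

theorem ncard_arcs_le [Finite V] : (arcs G).ncard ≤ Nat.card V * (Nat.card V - 1) := by
  classical
  have := Fintype.ofFinite V
  rw [ncard_arcs, Nat.card_eq_fintype_card]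
  have : ∀ v ∈ Finset.univ, G.degree v ≤ Fintype.card V - 1 := fun v _ => by
    have := G.degree_lt_card_verts v
    omega
  simpa using Finset.sum_le_card_nsmul _ _ _ this

theorem even_defect [Finite V] : Even (defect G) := by
  have := even_ncard_arcs (G := G)
  unfold defect
  have h2 : Even ((arcs G).ncard : ℤ) := by exact_mod_cast this
  refine Even.sub (Even.sub ?_ ?_) h2
  · exact ⟨4 * Nat.card V, by ring⟩
  · exact ⟨9, by ring⟩

theorem seven_le_card [Finite V] (h3 : 3 ≤ Nat.card V) (hd : defect G < 0) : 7 ≤ Nat.card V := by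
  have := ncard_arcs_le (G := G)
  unfold defect at hd
  by_contra! h
  interval_cases Nat.card V <;> omega

theorem sum_degree_defect [Fintype V] [DecidableRel G.Adj] :
    ∑ v, (8 - (G.degree v : ℤ)) = 18 + defect G := by
  unfold defect
  rw [ncard_arcs, Nat.card_eq_fintype_card]
  simp
  ring

theorem ncard_arcs_deleteEdge [Finite V] {u v : V} (h : G.Adj u v) :
    (arcs (G.deleteEdges {s(u, v)})).ncard + 2 = (arcs G).ncard := by
  have : arcs G = arcs (G.deleteEdges {s(u, v)}) ∪ {(u, v), (v, u)} := by
    ext ⟨x, y⟩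
    simp only [arcs, deleteEdges_adj, Set.mem_ofPred_eq, Set.mem_union, Set.mem_insert_iff,
      Set.mem_singleton_iff, Prod.mk.injEq, Sym2.eq_iff]
    constructor
    · tauto
    · rintro (h | ⟨rfl, rfl⟩ | ⟨rfl, rfl⟩)
      exacts [h.1, h, h.symm]
  rw [this, Set.ncard_union_eq, Set.ncard_pair]
  · simp [h.ne]
  · rw [Set.disjoint_left]
    rintro ⟨x, y⟩ h1 h2
    simp only [arcs, deleteEdges_adj, Set.mem_ofPred_eq, Set.mem_insert_iff,
      Set.mem_singleton_iff, Prod.mk.injEq, Sym2.eq_iff] at h1 h2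
    tauto

/-- The number of common neighbours. -/
noncomputable def cnbr (G : SimpleGraph V) (u v : V) : ℕ := (G.commonNeighbors u v).ncard

theorem contractEdge_adj {u v : V} {x y : {x : V // x ≠ v}} : (contractEdge G u v).Adj x y ↔
    x ≠ y ∧ (G.Adj x y ∨ ((x : V) = u ∧ G.Adj v y) ∨ ((y : V) = u ∧ G.Adj v x)) := by
  simp only [contractEdge, fromRel_adj, G.adj_comm y x]
  tauto

theorem card_contract [Finite V] (v : V) : Nat.card {x : V // x ≠ v} + 1 = Nat.card V := by
  classical
  have := Fintype.ofFinite V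
  rw [Nat.card_eq_fintype_card, Nat.card_eq_fintype_card]
  have : 0 < Fintype.card V := Fintype.card_pos_iff.2 ⟨v⟩
  simp
  omega

theorem ncard_arcs_contract [Finite V] {u v : V} (h : G.Adj u v) :
    (arcs G).ncard ≤ (arcs (contractEdge G u v)).ncard + 2 + 2 * cnbr G u v := by
  classical
  set T := insert u (G.commonNeighbors u v) with hT
  let bad : Set (V × V) := (fun x => (v, x)) '' T ∪ (fun x => (x, v)) '' T
  have hbad : bad.ncard ≤ 2 + 2 * cnbr G u v := by
    have h1 := Set.ncard_union_le ((fun x => (v, x)) '' T) ((fun x => (x, v)) '' T)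
    have h2 := Set.ncard_image_le (f := fun x => (v, x)) (Set.toFinite T)
    have h3 := Set.ncard_image_le (f := fun x => (x, v)) (Set.toFinite T)
    have h4 : T.ncard ≤ cnbr G u v + 1 := Set.ncard_insert_le _ _
    have h5 : bad.ncard ≤ _ := h1
    omega
  let π : V → V := fun x => if x = v then u else x
  have hπn : ∀ x, π x ≠ v := by
    intro x
    simp only [π]
    split_ifs with hx
    exacts [h.ne, hx]
  have hmem : ∀ x y, (x, y) ∈ bad ↔ (x = v ∧ (y = u ∨ G.Adj u y ∧ G.Adj v y)) ∨
      (y = v ∧ (x = u ∨ G.Adj u x ∧ G.Adj v x)) := by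
    intro x y
    simp only [bad, hT, Set.mem_union, Set.mem_image, Prod.mk.injEq, Set.mem_insert_iff,
      mem_commonNeighbors]
    constructor
    · rintro (⟨z, h1, rfl, rfl⟩ | ⟨z, h1, rfl, rfl⟩)
      exacts [Or.inl ⟨rfl, h1⟩, Or.inr ⟨rfl, h1⟩]
    · rintro (⟨rfl, h1⟩ | ⟨rfl, h1⟩)
      exacts [Or.inl ⟨y, h1, rfl, rfl⟩, Or.inr ⟨x, h1, rfl, rfl⟩]
  have key : (arcs G \ bad).ncard ≤ (arcs (contractEdge G u v)).ncard := by
    refine Set.ncard_le_ncard_of_injOn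
      (fun p => ((⟨π p.1, hπn _⟩, ⟨π p.2, hπn _⟩) : {x // x ≠ v} × {x // x ≠ v})) ?_ ?_
      (Set.toFinite _)
    · rintro ⟨x, y⟩ ⟨hxy, hb⟩
      simp only [arcs, Set.mem_ofPred_eq] at hxy
      simp only [arcs, Set.mem_ofPred_eq, contractEdge_adj, ne_eq, Subtype.mk.injEq]
      rw [hmem] at hb
      have := hxy.ne
      simp only [π]
      split_ifs with h1 h2 h2
      · exact absurd (h1.trans h2.symm) this
      · subst h1
        exact ⟨fun e => hb (Or.inl ⟨rfl, Or.inl e.symm⟩), Or.inr (Or.inl ⟨rfl, hxy⟩)⟩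
      · subst h2
        exact ⟨fun e => hb (Or.inr ⟨rfl, Or.inl e⟩), Or.inr (Or.inr ⟨rfl, hxy.symm⟩)⟩
      · exact ⟨this, Or.inl hxy⟩
    · rintro ⟨x, y⟩ ⟨hxy, hb⟩ ⟨x', y'⟩ ⟨hxy', hb'⟩ he
      simp only [arcs, Set.mem_ofPred_eq] at hxy hxy'
      rw [hmem] at hb hb'
      simp only [Prod.mk.injEq, Subtype.mk.injEq] at he ⊢
      obtain ⟨e1, e2⟩ := he
      have n1 := hxy.symm
      have n2 := hxy'.symm
      have n3 := hxy.ne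
      have n4 := hxy'.ne
      simp only [π] at e1 e2
      split_ifs at e1 e2 <;> grind
  have := Set.ncard_le_ncard_sdiff_add_ncard (arcs G) bad (Set.toFinite _)
  omega

theorem defect_contract [Finite V] {u v : V} (h : G.Adj u v) :
    defect (contractEdge G u v) ≤ defect G - 6 + 2 * cnbr G u v := by
  have h1 := ncard_arcs_contract h
  have h2 := card_contract v
  unfold defect
  omega

theorem isMinor_contract {u v : V} (h : G.Adj u v) : IsMinor (contractEdge G u v) G := by
  classical
  refine isMinor_of_bags (fun x => {(x : V)} ∪ (if (x : V) = u then {v} else ∅)) (fun x => ?_)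
    (fun x y hxy => ?_) (fun x y hxy => ?_)
  · split_ifs with hx
    · exact (Cn.singleton _).union_touch (Cn.singleton _) (by rw [hx]; simpa using h)
    · simpa using Cn.singleton (G := G) (x : V)
  · have hne : (x : V) ≠ y := fun e => hxy (Subtype.ext e)
    rw [Set.disjoint_left]
    have h1 := x.2
    have h2 := y.2
    split_ifs <;> simp only [Set.mem_union, Set.mem_singleton_iff, Set.mem_empty_iff_false] <;> grind
  · rw [contractEdge_adj] at hxy
    rcases hxy.2 with h' | ⟨hx, h'⟩ | ⟨hy, h'⟩
    · exact ⟨x, Or.inl rfl, y, Or.inl rfl, h'⟩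
    · exact ⟨v, Or.inr (by simp [hx]), y, Or.inl rfl, h'⟩
    · exact ⟨x, Or.inl rfl, v, Or.inr (by simp [hy]), h'.symm⟩

end

section

/-- Boolean quantification over `Bool`. -/
def allB (f : Bool → Bool) : Bool := f false && f true

theorem allB_iff {f : Bool → Bool} : allB f = true ↔ ∀ b, f b = true := by
  simp [allB]

/-- at most `k` of the entries are true -/
def atMost : ℕ → List Bool → Bool
  | _, [] => true
  | k, false :: l => atMost k l
  | 0, true :: _ => false
  | k + 1, true :: l => atMost k l

inductive S7 | s0 | s1 | s2 | s3 | s4 | s5 | s6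

def sel (i : S7) (a0 a1 a2 a3 a4 a5 a6 : Bool) : Bool :=
  S7.casesOn (motive := fun _ => Bool) i a0 a1 a2 a3 a4 a5 a6

def mat (b01 b02 b03 b04 b05 b06 b12 b13 b14 b15 b16 b23 b24 b25 b26 b34 b35 b36 b45 b46 b56 : Bool)
    (i j : S7) : Bool := sel i
      (sel j false b01 b02 b03 b04 b05 b06)
      (sel j b01 false b12 b13 b14 b15 b16)
      (sel j b02 b12 false b23 b24 b25 b26)
      (sel j b03 b13 b23 false b34 b35 b36)
      (sel j b04 b14 b24 b34 false b45 b46)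
      (sel j b05 b15 b25 b35 b45 false b56)
      (sel j b06 b16 b26 b36 b46 b56 false)

def indepB (K : S7 → S7 → Bool) : List (S7) → Bool
  | [] => true
  | a :: l => l.all (fun b => !K a b) && indepB K l

/-- One vertex of `l` covers all pairs of `l` in `K`. -/
def coverB (K : S7 → S7 → Bool) : List (S7) → List (S7) → Bool
  | _, [] => false
  | p, a :: l => indepB K (p ++ l) || coverB K (a :: p) l

open S7 in
def pairs7 : List (S7 × S7 × List (S7)) :=
  [(s0, s1, [s2, s3, s4, s5, s6]), (s0, s2, [s1, s3, s4, s5, s6]), (s0, s3, [s1, s2, s4, s5, s6]),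
    (s0, s4, [s1, s2, s3, s5, s6]), (s0, s5, [s1, s2, s3, s4, s6]), (s0, s6, [s1, s2, s3, s4, s5]),
    (s1, s2, [s0, s3, s4, s5, s6]), (s1, s3, [s0, s2, s4, s5, s6]), (s1, s4, [s0, s2, s3, s5, s6]),
    (s1, s5, [s0, s2, s3, s4, s6]), (s1, s6, [s0, s2, s3, s4, s5]), (s2, s3, [s0, s1, s4, s5, s6]),
    (s2, s4, [s0, s1, s3, s5, s6]), (s2, s5, [s0, s1, s3, s4, s6]), (s2, s6, [s0, s1, s3, s4, s5]),
    (s3, s4, [s0, s1, s2, s5, s6]), (s3, s5, [s0, s1, s2, s4, s6]), (s3, s6, [s0, s1, s2, s4, s5]),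
    (s4, s5, [s0, s1, s2, s3, s6]), (s4, s6, [s0, s1, s2, s3, s5]), (s5, s6, [s0, s1, s2, s3, s4])]

def goodK (K : S7 → S7 → Bool) : Bool :=
  pairs7.any fun t => !K t.1 t.2.1 && t.2.2.all
      (fun z => !(K t.1 z && K t.2.1 z)) && coverB K [] t.2.2

/-- An isolated edge together with a five-cycle, up to the parts that are never used. -/
def badJ (J : S7 → S7 → Bool) : Bool :=
  open S7 in
  atMost 0 [J s0 s2, J s0 s3, J s0 s4, J s0 s5, J s0 s6] &&
  atMost 2 [!J s4 s2, !J s4 s3, !J s4 s5, !J s4 s6] &&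
  atMost 1 [!J s2 s4, !J s2 s5, !J s2 s6] && atMost 1 [!J s3 s4, !J s3 s5, !J s3 s6] &&
  (J s4 s2 || J s4 s3) && (J s5 s2 || J s5 s3) && (J s6 s2 || J s6 s3)

def enumJ : Bool :=
  allB fun b02 => allB fun b03 => allB fun b04 => allB fun b05 => allB fun b06 =>
  !atMost 1 [b02, b03, b04, b05, b06] ||
  allB fun b12 => allB fun b13 => allB fun b14 => allB fun b15 => allB fun b16 =>
  !atMost 1 [b12, b13, b14, b15, b16] ||
  allB fun b23 => allB fun b24 => allB fun b25 => allB fun b26 =>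
  !atMost 2 [b02, b12, b23, b24, b25, b26] ||
  allB fun b34 => allB fun b35 => allB fun b36 =>
  !atMost 2 [b03, b13, b23, b34, b35, b36] ||
  allB fun b45 => allB fun b46 =>
  !atMost 2 [b04, b14, b24, b34, b45, b46] ||
  allB fun b56 =>
  !atMost 2 [b05, b15, b25, b35, b45, b56] ||
  !atMost 2 [b06, b16, b26, b36, b46, b56] ||
  goodK (mat false false false b04 b05 b06 b12 b13 b14 b15 b16 b23 b24 b25 b26 b34 b35 b36 b45 b46 b56) ||
  goodK (mat true false b03 b04 b05 b06 false b13 b14 b15 b16 false b24 b25 b26 b34 b35 b36 b45 b46 b56) ||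
  goodK (mat false b02 b03 b04 b05 b06 false false b14 b15 b16 b23 b24 b25 b26 b34 b35 b36 b45 b46 b56) ||
  badJ (mat true b02 b03 b04 b05 b06 b12 b13 b14 b15 b16 b23 b24 b25 b26 b34 b35 b36 b45 b46 b56)

theorem enumJ_true : enumJ = true := by decide +kernel

end

section

variable {V : Type} {G : SimpleGraph V}

/-- The seven symbols as numbers. -/
def S7.equivFin : S7 ≃ Fin 7 where
  toFun i := S7.casesOn i 0 1 2 3 4 5 6
  invFun := ![S7.s0, S7.s1, S7.s2, S7.s3, S7.s4, S7.s5, S7.s6]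
  left_inv := by rintro (_ | _) <;> rfl
  right_inv := by intro i; fin_cases i <;> rfl

instance : DecidableEq S7 := S7.equivFin.decidableEq

instance : Fintype S7 := Fintype.ofEquiv _ S7.equivFin.symm

theorem S7.card : Fintype.card S7 = 7 := by
  rw [Fintype.card_congr S7.equivFin, Fintype.card_fin]

theorem indepB_sound {K : S7 → S7 → Bool} (hs : ∀ i j, K i j = K j i) :
    ∀ l : List S7, indepB K l = true → ∀ i ∈ l, ∀ j ∈ l, i ≠ j → K i j = false
  | [], _ => by simp
  | a :: l, h => by
    simp only [indepB, Bool.and_eq_true, List.all_eq_true, Bool.not_eq_true'] at h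
    have ih := indepB_sound hs l h.2
    intro i hi j hj hij
    rw [List.mem_cons] at hi hj
    rcases hi with rfl | hi <;> rcases hj with rfl | hj
    · exact absurd rfl hij
    · exact h.1 j hj
    · rw [hs]; exact h.1 i hi
    · exact ih i hi j hj hij

theorem coverB_sound {K : S7 → S7 → Bool} (hs : ∀ i j, K i j = K j i) :
    ∀ p l : List S7, coverB K p l = true → ∃ z, ∀ i ∈ p ++ l, ∀ j ∈ p ++ l, i ≠ j → i ≠ z →
      j ≠ z → K i j = false
  | p, [], h => by simp [coverB] at h
  | p, a :: l, h => by
    simp only [coverB, Bool.or_eq_true] at h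
    rcases h with h | h
    · refine ⟨a, fun i hi j hj hij hia hja => indepB_sound hs _ h i ?_ j ?_ hij⟩
      · simp only [List.mem_append, List.mem_cons] at hi ⊢
        tauto
      · simp only [List.mem_append, List.mem_cons] at hj ⊢
        tauto
    · obtain ⟨z, hz⟩ := coverB_sound hs (a :: p) l h
      refine ⟨z, fun i hi j hj => hz i ?_ j ?_⟩
      · simp only [List.mem_append, List.mem_cons] at hi ⊢
        tauto
      · simp only [List.mem_append, List.mem_cons] at hj ⊢
        tauto

theorem pairs7_spec : ∀ t ∈ pairs7, t.1 ≠ t.2.1 ∧ ∀ z, z ∈ t.2.2 ↔ z ≠ t.1 ∧ z ≠ t.2.1 := by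
  decide +kernel

/-- Contracting an edge of a seven-vertex graph below a dominating bag. -/
theorem k7vee_of_goodK {N : S7 → Set V} {P : Set V} (hN : IsModel G N) (hP : Cn G P)
    (hd : ∀ i, Disjoint P (N i)) (hT : ∀ i, Touch G P (N i)) {K : S7 → S7 → Bool}
    (hs : ∀ i j, K i j = K j i) (hK : ∀ i j, i ≠ j → K i j = false → Touch G (N i) (N j))
    (hdeg : ∀ i, ∃ a b, ∀ j, K i j = true → j = a ∨ j = b) (h : goodK K = true) :
    IsMinor K7vee G := by
  simp only [goodK, List.any_eq_true, Bool.and_eq_true, List.all_eq_true, Bool.not_eq_true'] at h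
  obtain ⟨⟨x, y, r⟩, ht, ⟨hxy, hr⟩, hc⟩ := h
  obtain ⟨hne, hmem⟩ := pairs7_spec _ ht
  simp only at hxy hr hc hne hmem
  obtain ⟨z, hz⟩ := coverB_sound hs _ _ hc
  rw [List.nil_append] at hz
  obtain ⟨a, b, hab⟩ := hdeg z
  let B : Option {i : S7 // i ≠ y} → Set V := fun o => o.elim P fun i =>
    if (i : S7) = x then N x ∪ N y else N i
  have Bx : ∀ i : {i : S7 // i ≠ y}, N i ⊆ B (some i) := by
    intro i
    simp only [B, Option.elim]
    split_ifs with h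
    · rw [h]; exact Set.subset_union_left
    · exact Set.Subset.rfl
  have By : ∀ i : {i : S7 // i ≠ y}, (i : S7) = x → N y ⊆ B (some i) := by
    intro i hi
    simp only [B, Option.elim, if_pos hi]
    exact Set.subset_union_right
  have hB : IsModel G B := by
    refine ⟨?_, ?_⟩
    · rintro (_ | i)
      · exact hP
      · simp only [B, Option.elim]
        split_ifs
        · exact (hN.1 x).union_touch (hN.1 y) (hK x y hne hxy)
        · exact hN.1 i
    · have h1 : ∀ i, Disjoint P (B (some i)) := by
        intro i
        simp only [B, Option.elim]
        split_ifs
        · exact Set.disjoint_union_right.2 ⟨hd x, hd y⟩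
        · exact hd i
      rintro (_ | i) (_ | j) hij
      · exact absurd rfl hij
      · exact h1 j
      · exact (h1 i).symm
      · have hij' : (i : S7) ≠ j := fun e => hij (by rw [Subtype.ext e])
        simp only [B, Option.elim]
        split_ifs with h1 h2 h2
        · exact absurd (h1.trans h2.symm) hij'
        · exact Set.disjoint_union_left.2 ⟨hN.2 _ _ (Ne.symm h2), hN.2 _ _ (Ne.symm j.2)⟩
        · exact Set.disjoint_union_right.2 ⟨hN.2 _ _ h1, hN.2 _ _ i.2⟩
        · exact hN.2 _ _ hij'
  have hcard : Fintype.card (Option {i : S7 // i ≠ y}) = 7 := by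
    simp [S7.card]
  have hxT : ∀ i : {i : S7 // i ≠ y}, (i : S7) ≠ x → Touch G (B (some ⟨x, hne⟩)) (N i) := by
    intro i hi
    have := hr i ((hmem i).2 ⟨hi, i.2⟩)
    rw [Bool.and_eq_false_iff] at this
    rcases this with h | h
    · exact (hK x i (Ne.symm hi) h).mono (Bx ⟨x, hne⟩) Set.Subset.rfl
    · exact (hK y i (Ne.symm i.2) h).mono (By ⟨x, hne⟩ rfl) Set.Subset.rfl
  have hpair : ∀ i j : {i : S7 // i ≠ y}, (i : S7) ≠ j → (j : S7) ≠ z →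
      Touch G (B (some i)) (B (some j)) ∨ ((i : S7) = z ∧ ((j : S7) = a ∨ (j : S7) = b)) := by
    intro i j hij hjz
    by_cases hi : (i : S7) = x
    · have : i = ⟨x, hne⟩ := Subtype.ext hi
      subst this
      exact Or.inl ((hxT j fun e => hij (hi.trans e.symm)).mono Set.Subset.rfl (Bx j))
    by_cases hj : (j : S7) = x
    · have : j = ⟨x, hne⟩ := Subtype.ext hj
      subst this
      exact Or.inl ((hxT i hi).mono Set.Subset.rfl (Bx i)).symm
    by_cases hk : K i j = true
    · right
      have hiz : (i : S7) = z := by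
        by_contra hiz
        rw [hz i ((hmem i).2 ⟨hi, i.2⟩) j ((hmem j).2 ⟨hj, j.2⟩) hij hiz hjz] at hk
        exact Bool.noConfusion hk
      exact ⟨hiz, hab _ (hiz ▸ hk)⟩
    · exact Or.inl ((hK i j hij (by simpa using hk)).mono (Bx i) (Bx j))
  have hPT : ∀ i, Touch G P (B (some i)) := fun i => (hT i).mono Set.Subset.rfl (Bx i)
  by_cases hzy : z = y
  · refine k7vee_of_cover hcard hB none none none ?_
    rintro (_ | i) (_ | j) hij hj
    · exact absurd rfl hij
    · exact Or.inl (hPT j)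
    · exact Or.inl (hPT i).symm
    · have hij' : (i : S7) ≠ j := fun e => hij (by rw [Subtype.ext e])
      rcases hpair i j hij' (hzy ▸ j.2) with h | h
      · exact Or.inl h
      · exact absurd (h.1.trans hzy) i.2
  · let w : S7 → Option {i : S7 // i ≠ y} := fun i => if hi : i = y then none else some ⟨i, hi⟩
    have hw : ∀ i : {i : S7 // i ≠ y}, some i = w i := fun i => by simp [w, i.2]
    refine k7vee_of_cover hcard hB (some ⟨z, hzy⟩) (w a) (w b) ?_
    rintro (_ | i) (_ | j) hij hj
    · exact absurd rfl hij
    · exact Or.inl (hPT j)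
    · exact Or.inl (hPT i).symm
    · have hij' : (i : S7) ≠ j := fun e => hij (by rw [Subtype.ext e])
      rcases hpair i j hij' (fun e => hj (by rw [Option.some_inj]; exact Subtype.ext e)) with h | h
      · exact Or.inl h
      · refine Or.inr ⟨by rw [Option.some_inj]; exact Subtype.ext h.1, ?_⟩
        rw [hw j]
        rcases h.2 with h | h
        · exact Or.inl (by rw [h])
        · exact Or.inr (by rw [h])

theorem atMost_map {f : S7 → Bool} : ∀ (k : ℕ) (l s : List S7), l.Nodup → s.length ≤ k →
    (∀ j ∈ l, f j = true → j ∈ s) → atMost k (l.map f) = true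
  | _, [], _, _, _, _ => by simp [atMost]
  | k, a :: l, s, hl, hs, h => by
    rw [List.nodup_cons] at hl
    rw [List.map_cons]
    by_cases ha : f a = true
    · have has := h a (by simp) ha
      obtain _ | k := k
      · rw [List.eq_nil_of_length_eq_zero (Nat.le_zero.1 hs)] at has
        simp at has
      · rw [ha]
        simp only [atMost]
        refine atMost_map k l (s.erase a) hl.2 ?_ fun j hj hf => ?_
        · rw [List.length_erase_of_mem has]; omega
        · refine (List.mem_erase_of_ne fun e => hl.1 (by rw [← e]; exact hj)).2 (h j (by simp [hj]) hf)
    · rw [Bool.not_eq_true] at ha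
      rw [ha]
      simp only [atMost]
      exact atMost_map k l s hl.2 hs fun j hj => h j (by simp [hj])

theorem enumJ_spec {J : S7 → S7 → Bool} (hs : ∀ i j, J i j = J j i) (hi : ∀ i, J i i = false)
    (hdeg : ∀ i, ∃ a b, ∀ j, J i j = true → j = a ∨ j = b) (h01 : J S7.s0 S7.s1 = true) :
    badJ J = true ∨ ∃ s K, (∀ i j, K i j = K j i) ∧ (∀ i j, K i j = true → J i j = true) ∧
      s ∈ [S7.s0, S7.s1, S7.s2, S7.s3] ∧
      (∀ i j, K i j = false → J i j = false ∨ (i = s ∧ j ∈ [S7.s0, S7.s1, S7.s2, S7.s3]) ∨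
        (j = s ∧ i ∈ [S7.s0, S7.s1, S7.s2, S7.s3])) ∧ goodK K = true := by
  have two : ∀ i (l : List S7), l.Nodup → atMost 2 (l.map (J i)) = true := by
    intro i l hl
    obtain ⟨a, b, hab⟩ := hdeg i
    exact atMost_map 2 l [a, b] hl (by simp) fun j _ hj => by simpa using hab j hj
  have one : ∀ i i' (l : List S7), l.Nodup → i' ∉ l → J i i' = true →
      atMost 1 (l.map (J i)) = true := by
    intro i i' l hl hi' h
    have := two i (i' :: l) (List.nodup_cons.2 ⟨hi', hl⟩)
    rw [List.map_cons, h] at this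
    exact this
  have h := enumJ_true
  simp only [enumJ, allB_iff, Bool.or_eq_true, Bool.not_eq_true'] at h
  have h := h (J S7.s0 S7.s2) (J S7.s0 S7.s3) (J S7.s0 S7.s4) (J S7.s0 S7.s5) (J S7.s0 S7.s6)
  rw [show atMost 1 [J S7.s0 S7.s2, J S7.s0 S7.s3, J S7.s0 S7.s4, J S7.s0 S7.s5,
      J S7.s0 S7.s6] = true from
    one S7.s0 S7.s1 [S7.s2, S7.s3, S7.s4, S7.s5, S7.s6] (by decide) (by decide) h01] at h
  replace h := (h.resolve_left Bool.noConfusion) (J S7.s1 S7.s2) (J S7.s1 S7.s3) (J S7.s1 S7.s4)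
      (J S7.s1 S7.s5) (J S7.s1 S7.s6)
  rw [show atMost 1 [J S7.s1 S7.s2, J S7.s1 S7.s3, J S7.s1 S7.s4, J S7.s1 S7.s5,
      J S7.s1 S7.s6] = true from
    one S7.s1 S7.s0 [S7.s2, S7.s3, S7.s4, S7.s5, S7.s6] (by decide) (by decide) (hs _ _ ▸ h01)] at h
  replace h := (h.resolve_left Bool.noConfusion) (J S7.s2 S7.s3) (J S7.s2 S7.s4) (J S7.s2 S7.s5)
      (J S7.s2 S7.s6)
  rw [show atMost 2 [J S7.s0 S7.s2, J S7.s1 S7.s2, J S7.s2 S7.s3, J S7.s2 S7.s4, J S7.s2 S7.s5,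
      J S7.s2 S7.s6] = true by
    rw [hs S7.s0 S7.s2, hs S7.s1 S7.s2]
    exact two S7.s2 [S7.s0, S7.s1, S7.s3, S7.s4, S7.s5, S7.s6] (by decide)] at h
  replace h := (h.resolve_left Bool.noConfusion) (J S7.s3 S7.s4) (J S7.s3 S7.s5) (J S7.s3 S7.s6)
  rw [show atMost 2 [J S7.s0 S7.s3, J S7.s1 S7.s3, J S7.s2 S7.s3, J S7.s3 S7.s4, J S7.s3 S7.s5,
      J S7.s3 S7.s6] = true by
    rw [hs S7.s0 S7.s3, hs S7.s1 S7.s3, hs S7.s2 S7.s3]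
    exact two S7.s3 [S7.s0, S7.s1, S7.s2, S7.s4, S7.s5, S7.s6] (by decide)] at h
  replace h := (h.resolve_left Bool.noConfusion) (J S7.s4 S7.s5) (J S7.s4 S7.s6)
  rw [show atMost 2 [J S7.s0 S7.s4, J S7.s1 S7.s4, J S7.s2 S7.s4, J S7.s3 S7.s4, J S7.s4 S7.s5,
      J S7.s4 S7.s6] = true by
    rw [hs S7.s0 S7.s4, hs S7.s1 S7.s4, hs S7.s2 S7.s4, hs S7.s3 S7.s4]
    exact two S7.s4 [S7.s0, S7.s1, S7.s2, S7.s3, S7.s5, S7.s6] (by decide)] at h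
  replace h := (h.resolve_left Bool.noConfusion) (J S7.s5 S7.s6)
  rw [show atMost 2 [J S7.s0 S7.s5, J S7.s1 S7.s5, J S7.s2 S7.s5, J S7.s3 S7.s5, J S7.s4 S7.s5,
      J S7.s5 S7.s6] = true by
    rw [hs S7.s0 S7.s5, hs S7.s1 S7.s5, hs S7.s2 S7.s5, hs S7.s3 S7.s5, hs S7.s4 S7.s5]
    exact two S7.s5 [S7.s0, S7.s1, S7.s2, S7.s3, S7.s4, S7.s6] (by decide)] at h
  replace h := h
  rw [show atMost 2 [J S7.s0 S7.s6, J S7.s1 S7.s6, J S7.s2 S7.s6, J S7.s3 S7.s6, J S7.s4 S7.s6,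
      J S7.s5 S7.s6] = true by
    rw [hs S7.s0 S7.s6, hs S7.s1 S7.s6, hs S7.s2 S7.s6, hs S7.s3 S7.s6, hs S7.s4 S7.s6,
        hs S7.s5 S7.s6]
    exact two S7.s6 [S7.s0, S7.s1, S7.s2, S7.s3, S7.s4, S7.s5] (by decide)] at h
  simp only [Bool.true_eq_false, false_or] at h
  have hJ : ∀ s ∈ [S7.s0, S7.s1, S7.s2, S7.s3], ∀ K : S7 → S7 → Bool, goodK K = true →
      (∀ i j, K i j = true ∧ J i j = true ∧ K j i = true ∨ K i j = false ∧ K j i = false ∧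
        (J i j = false ∨ (i = s ∧ j ∈ [S7.s0, S7.s1, S7.s2, S7.s3]) ∨
          (j = s ∧ i ∈ [S7.s0, S7.s1, S7.s2, S7.s3]))) →
      ∃ s K, (∀ i j, K i j = K j i) ∧ (∀ i j, K i j = true → J i j = true) ∧
      s ∈ [S7.s0, S7.s1, S7.s2, S7.s3] ∧
      (∀ i j, K i j = false → J i j = false ∨ (i = s ∧ j ∈ [S7.s0, S7.s1, S7.s2, S7.s3]) ∨
        (j = s ∧ i ∈ [S7.s0, S7.s1, S7.s2, S7.s3])) ∧ goodK K = true := by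
    intro s hs K hK h
    refine ⟨s, K, fun i j => ?_, fun i j hij => ?_, hs, fun i j hij => ?_, hK⟩
    · rcases h i j with h | h
      · rw [h.1, h.2.2]
      · rw [h.1, h.2.1]
    · rcases h i j with h | h
      · exact h.2.1
      · rw [h.1] at hij; exact Bool.noConfusion hij
    · rcases h i j with h | h
      · rw [h.1] at hij; exact Bool.noConfusion hij
      · exact h.2.2
  have lt : ∀ i j (R : Prop), J i j = true ∧ J i j = true ∧ J i j = true ∨
      J i j = false ∧ J i j = false ∧ (J i j = false ∨ R) := by
    intro i j R
    cases J i j <;> simp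
  have gt : ∀ i j (R : Prop), J j i = true ∧ J i j = true ∧ J j i = true ∨
      J j i = false ∧ J j i = false ∧ (J i j = false ∨ R) := by
    intro i j R
    rw [hs j i]
    exact lt i j R
  rcases h with ((h | h) | h) | h
  · refine Or.inr (hJ S7.s0 (by decide) _ h ?_)
    rintro (_ | _) (_ | _) <;> 
      first
      | exact Or.inl ⟨rfl, h01, rfl⟩
      | exact Or.inl ⟨rfl, (hs _ _).trans h01, rfl⟩
      | exact lt _ _ _
      | exact gt _ _ _
      | exact Or.inr ⟨rfl, rfl, Or.inl (hi _)⟩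
      | exact Or.inr ⟨rfl, rfl, Or.inr (Or.inl ⟨rfl, by decide⟩)⟩
      | exact Or.inr ⟨rfl, rfl, Or.inr (Or.inr ⟨rfl, by decide⟩)⟩
  · refine Or.inr (hJ S7.s2 (by decide) _ h ?_)
    rintro (_ | _) (_ | _) <;> 
      first
      | exact Or.inl ⟨rfl, h01, rfl⟩
      | exact Or.inl ⟨rfl, (hs _ _).trans h01, rfl⟩
      | exact lt _ _ _
      | exact gt _ _ _
      | exact Or.inr ⟨rfl, rfl, Or.inl (hi _)⟩
      | exact Or.inr ⟨rfl, rfl, Or.inr (Or.inl ⟨rfl, by decide⟩)⟩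
      | exact Or.inr ⟨rfl, rfl, Or.inr (Or.inr ⟨rfl, by decide⟩)⟩
  · refine Or.inr (hJ S7.s1 (by decide) _ h ?_)
    rintro (_ | _) (_ | _) <;> 
      first
      | exact Or.inl ⟨rfl, h01, rfl⟩
      | exact Or.inl ⟨rfl, (hs _ _).trans h01, rfl⟩
      | exact lt _ _ _
      | exact gt _ _ _
      | exact Or.inr ⟨rfl, rfl, Or.inl (hi _)⟩
      | exact Or.inr ⟨rfl, rfl, Or.inr (Or.inl ⟨rfl, by decide⟩)⟩
      | exact Or.inr ⟨rfl, rfl, Or.inr (Or.inr ⟨rfl, by decide⟩)⟩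
  · left
    rw [← h]
    congr 1
    funext i j
    rcases i with _ | _ <;> rcases j with _ | _ <;> simp only [mat, sel, hi, h01] <;> 
      first | rfl | exact hs _ _ | (rw [hs]; exact h01)

end

section

variable {V : Type} {G : SimpleGraph V}

theorem exists_perm_of_injOn {ι : Type} [Fintype ι] [DecidableEq ι] (s : Finset ι) (f : ι → ι)
    (hf : Set.InjOn f s) : ∃ σ : Equiv.Perm ι, ∀ i ∈ s, σ i = f i := by
  obtain ⟨g, hg⟩ := Finset.exists_equiv_extend_of_card_eq (α := ι) (β := ι)
    (t := Finset.univ) (by simp) (s := s) (f := f) (by simp) hf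
  exact ⟨g.trans (Equiv.subtypeUnivEquiv (by simp)), fun i hi => hg i hi⟩

theorem S7.exists_perm {a b c d : S7} (hab : a ≠ b) (hac : a ≠ c) (had : a ≠ d) (hbc : b ≠ c)
    (hbd : b ≠ d) (hcd : c ≠ d) : ∃ σ : Equiv.Perm S7, σ S7.s0 = a ∧ σ S7.s1 = b ∧ σ S7.s2 = c ∧
      σ S7.s3 = d := by
  obtain ⟨σ, hσ⟩ := exists_perm_of_injOn {S7.s0, S7.s1, S7.s2, S7.s3}
    (fun i => S7.casesOn (motive := fun _ => S7) i a b c d a a a) (by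
      intro i hi j hj hij
      simp only [Finset.coe_insert, Finset.coe_singleton, Set.mem_insert_iff,
        Set.mem_singleton_iff] at hi hj
      rcases hi with rfl | rfl | rfl | rfl <;> rcases hj with rfl | rfl | rfl | rfl <;>
        simp_all)
  exact ⟨σ, hσ S7.s0 (by decide), hσ S7.s1 (by decide), hσ S7.s2 (by decide),
    hσ S7.s3 (by decide)⟩

/-- Seven bags `N` and a bag `P` touching all of them; `J` contains the missing pairs and has
maximum degree two. -/
structure Wheel (G : SimpleGraph V) (N : S7 → Set V) (P : Set V) (J : S7 → S7 → Bool) : Prop where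
  model : IsModel G N
  hub : Cn G P
  disj : ∀ i, Disjoint P (N i)
  spoke : ∀ i, Touch G P (N i)
  symm : ∀ i j, J i j = J j i
  irrefl : ∀ i, J i i = false
  touch : ∀ i j, i ≠ j → J i j = false → Touch G (N i) (N j)
  deg : ∀ i, ∃ a b, ∀ j, J i j = true → j = a ∨ j = b

variable {N : S7 → Set V} {P X : Set V} {J : S7 → S7 → Bool}

theorem Wheel.perm (h : Wheel G N P J) (σ : Equiv.Perm S7) :
    Wheel G (fun i => N (σ i)) P (fun i j => J (σ i) (σ j)) where
  model := h.model.comp σ.injective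
  hub := h.hub
  disj i := h.disj _
  spoke i := h.spoke _
  symm i j := h.symm _ _
  irrefl i := h.irrefl _
  touch i j hij := h.touch _ _ fun e => hij (σ.injective e)
  deg i := by
    obtain ⟨a, b, hab⟩ := h.deg (σ i)
    refine ⟨σ.symm a, σ.symm b, fun j hj => ?_⟩
    rcases hab _ hj with e | e
    · exact Or.inl (by rw [← e, σ.symm_apply_apply])
    · exact Or.inr (by rw [← e, σ.symm_apply_apply])

/-- Enlarging a bag by a set touching it. -/
theorem Wheel.merge (h : Wheel G N P J) (hX : Cn G X) (hXN : ∀ i, Disjoint X (N i))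
    (hXP : Disjoint P X) {s : S7} (hs : Touch G X (N s)) {K : S7 → S7 → Bool}
    (hKs : ∀ i j, K i j = K j i) (hKJ : ∀ i j, K i j = true → J i j = true)
    (hK : ∀ i j, K i j = false → J i j = false ∨ (i = s ∧ Touch G X (N j)) ∨
      (j = s ∧ Touch G X (N i))) :
    Wheel G (Function.update N s (N s ∪ X)) P K := by
  have hsub : ∀ i, N i ⊆ Function.update N s (N s ∪ X) i := by
    intro i
    by_cases hi : i = s
    · subst hi; rw [Function.update_self]; exact Set.subset_union_left
    · rw [Function.update_of_ne hi]
  have hXs : X ⊆ Function.update N s (N s ∪ X) s := by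
    rw [Function.update_self]; exact Set.subset_union_right
  refine ⟨⟨fun i => ?_, fun i j hij => ?_⟩, h.hub, fun i => ?_, fun i => ?_, hKs, fun i => ?_,
    fun i j hij hk => ?_, fun i => ?_⟩
  · by_cases hi : i = s
    · subst hi; rw [Function.update_self]; exact (h.model.1 i).union_touch hX hs.symm
    · rw [Function.update_of_ne hi]; exact h.model.1 i
  · by_cases hi : i = s
    · subst hi
      rw [Function.update_self, Function.update_of_ne (Ne.symm hij)]
      exact Set.disjoint_union_left.2 ⟨h.model.2 _ _ hij, hXN j⟩
    · rw [Function.update_of_ne hi]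
      by_cases hj : j = s
      · subst hj
        rw [Function.update_self]
        exact Set.disjoint_union_right.2 ⟨h.model.2 _ _ hij, (hXN i).symm⟩
      · rw [Function.update_of_ne hj]
        exact h.model.2 _ _ hij
  · by_cases hi : i = s
    · subst hi; rw [Function.update_self]; exact Set.disjoint_union_right.2 ⟨h.disj i, hXP⟩
    · rw [Function.update_of_ne hi]; exact h.disj i
  · exact (h.spoke i).mono Set.Subset.rfl (hsub i)
  · by_contra hk
    have := hKJ i i (by simpa using hk)
    rw [h.irrefl] at this
    exact Bool.noConfusion this
  · rcases hK i j hk with hj | ⟨rfl, hj⟩ | ⟨rfl, hj⟩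
    · exact (h.touch i j hij hj).mono (hsub i) (hsub j)
    · exact hj.mono hXs (hsub j)
    · exact (hj.mono hXs (hsub i)).symm
  · obtain ⟨a, b, hab⟩ := h.deg i
    exact ⟨a, b, fun j hj => hab j (hKJ i j hj)⟩

theorem Wheel.edge (h : Wheel G N P J) (hX : Cn G X) (hXN : ∀ i, Disjoint X (N i))
    (hXP : Disjoint P X) (hT : ∀ i ∈ [S7.s0, S7.s1, S7.s2, S7.s3], Touch G X (N i))
    (h01 : J S7.s0 S7.s1 = true) : IsMinor K7vee G ∨ badJ J = true := by
  rcases enumJ_spec h.symm h.irrefl h.deg h01 with hb | ⟨s, K, h1, h2, h3, h4, h5⟩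
  · exact Or.inr hb
  · left
    have := h.merge hX hXN hXP (hT s h3) h1 h2 fun i j hij => by
      rcases h4 i j hij with h | h | h
      · exact Or.inl h
      · exact Or.inr (Or.inl ⟨h.1, hT _ h.2⟩)
      · exact Or.inr (Or.inr ⟨h.1, hT _ h.2⟩)
    exact k7vee_of_goodK this.model this.hub this.disj this.spoke h1 this.touch this.deg h5

/-- The exceptional configuration, for some labelling. -/
def BadAt (J : S7 → S7 → Bool) (σ : Equiv.Perm S7) : Prop :=
  J (σ S7.s0) (σ S7.s1) = true ∧ badJ (fun i j => J (σ i) (σ j)) = true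

theorem Wheel.pair (h : Wheel G N P J) (hX : Cn G X) (hXN : ∀ i, Disjoint X (N i))
    (hXP : Disjoint P X) {a b c d : S7} (hac : a ≠ c) (had : a ≠ d) (hbc : b ≠ c)
    (hbd : b ≠ d) (hcd : c ≠ d) (ha : Touch G X (N a)) (hb : Touch G X (N b))
    (hc : Touch G X (N c)) (hd : Touch G X (N d)) (hab : J a b = true) :
    IsMinor K7vee G ∨ ∃ σ : Equiv.Perm S7, (σ S7.s0 = a ∧ σ S7.s1 = b ∧ σ S7.s2 = c ∧
      σ S7.s3 = d) ∧ BadAt J σ := by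
  have hne : a ≠ b := fun e => by
    rw [e, h.irrefl] at hab
    exact Bool.noConfusion hab
  obtain ⟨σ, h0, h1, h2, h3⟩ := S7.exists_perm hne hac had hbc hbd hcd
  have h01 : J (σ S7.s0) (σ S7.s1) = true := by rw [h0, h1]; exact hab
  rcases (h.perm σ).edge hX (fun i => hXN _) hXP (by
    intro i hi
    simp only [List.mem_cons, List.not_mem_nil, or_false] at hi
    rcases hi with rfl | rfl | rfl | rfl
    exacts [h0 ▸ ha, h1 ▸ hb, h2 ▸ hc, h3 ▸ hd]) h01 with hm | hm
  · exact Or.inl hm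
  · exact Or.inr ⟨σ, ⟨h0, h1, h2, h3⟩, h01, hm⟩

theorem Wheel.indep (h : Wheel G N P J) (hX : Cn G X) (hXN : ∀ i, Disjoint X (N i))
    (hXP : Disjoint P X) (hT : ∀ i ∈ [S7.s0, S7.s1, S7.s2, S7.s3], Touch G X (N i))
    (hJ : ∀ i ∈ [S7.s0, S7.s1, S7.s2, S7.s3], ∀ j ∈ [S7.s0, S7.s1, S7.s2, S7.s3], J i j = false) :
    IsMinor K7vee G := by
  have finish : ∀ Y : Set V, Cn G Y → Disjoint P Y → Disjoint X Y →
      (∀ i ∈ [S7.s0, S7.s1, S7.s2, S7.s3], Disjoint (N i) Y) → Touch G P Y →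
      (∀ i ∈ [S7.s0, S7.s1, S7.s2, S7.s3], Touch G (N i) Y) → IsMinor K7vee G := by
    intro Y hY hPY hXY hNY hPYt hNYt
    have m := h.model
    have d := h.disj
    have t := h.touch
    simp only [List.mem_cons, List.not_mem_nil, or_false, forall_eq_or_imp,
        forall_eq] at hT hJ hNY hNYt
    obtain ⟨t0, t1, t2, t3⟩ := hT
    obtain ⟨y0, y1, y2, y3⟩ := hNYt
    obtain ⟨e0, e1, e2, e3⟩ := hNY
    have hB : IsModel G (![X, P, Y, N S7.s0, N S7.s1, N S7.s2, N S7.s3] : Fin 7 → Set V) := by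
      refine ⟨?_, ?_⟩
      · simp only [Fin.forall_fin_succ]
        refine ⟨hX, h.hub, hY, m.1 _, m.1 _, m.1 _, m.1 _, fun i => i.elim0⟩
      · have := hXN S7.s0
        have := hXN S7.s1
        have := hXN S7.s2
        have := hXN S7.s3
        have := d S7.s0
        have := d S7.s1
        have := d S7.s2
        have := d S7.s3
        have m01 := m.2 S7.s0 S7.s1 (by decide)
        have m02 := m.2 S7.s0 S7.s2 (by decide)
        have m03 := m.2 S7.s0 S7.s3 (by decide)
        have m12 := m.2 S7.s1 S7.s2 (by decide)
        have m13 := m.2 S7.s1 S7.s3 (by decide)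
        have m23 := m.2 S7.s2 S7.s3 (by decide)
        intro i j hij
        fin_cases i <;> fin_cases j <;> first | exact absurd rfl hij | assumption | (apply Disjoint.symm; assumption)
    have m01 := t S7.s0 S7.s1 (by decide) (by tauto)
    have m02 := t S7.s0 S7.s2 (by decide) (by tauto)
    have m03 := t S7.s0 S7.s3 (by decide) (by tauto)
    have m12 := t S7.s1 S7.s2 (by decide) (by tauto)
    have m13 := t S7.s1 S7.s3 (by decide) (by tauto)
    have m23 := t S7.s2 S7.s3 (by decide) (by tauto)
    have s0 := h.spoke S7.s0
    have s1 := h.spoke S7.s1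
    have s2 := h.spoke S7.s2
    have s3 := h.spoke S7.s3
    refine k7vee_of_cover (by simp) hB 0 1 2 ?_
    intro i j hij hj
    fin_cases i <;> fin_cases j <;>
      first
      | exact absurd rfl hij
      | exact absurd rfl hj
      | (left; assumption)
      | (left; apply Touch.symm; assumption)
      | (right; exact ⟨rfl, by decide⟩)
  by_cases hq : ∃ q q' q'', q ∉ [S7.s0, S7.s1, S7.s2, S7.s3] ∧ q' ∉ [S7.s0, S7.s1, S7.s2, S7.s3] ∧
      q'' ∉ [S7.s0, S7.s1, S7.s2, S7.s3] ∧ q' ≠ q'' ∧ J q q' = true ∧ J q q'' = true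
  · obtain ⟨q, q', q'', hq, hq', hq'', hne, h1, h2⟩ := hq
    obtain ⟨a, b, hab⟩ := h.deg q
    refine finish (N q) (h.model.1 q) (h.disj q) (hXN q) (fun i hi => ?_) (h.spoke q) fun i hi => ?_
    · exact h.model.2 _ _ fun e => hq (e ▸ hi)
    · have hiq : i ≠ q := fun e => hq (e ▸ hi)
      refine h.touch _ _ hiq ?_
      by_contra hk
      have hk : J q i = true := by rw [h.symm]; simpa using hk
      have n1 : i ≠ q' := fun e => hq' (e ▸ hi)
      have n2 : i ≠ q'' := fun e => hq'' (e ▸ hi)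
      have := hab _ h1
      have := hab _ h2
      have := hab _ hk
      grind
  · push Not at hq
    have hmem : ∀ q, q ∉ [S7.s0, S7.s1, S7.s2, S7.s3] ↔ q = S7.s4 ∨ q = S7.s5 ∨ q = S7.s6 := by
      decide
    have key : ∀ x y z, [x, y, z].Nodup → (∀ q, q ∉ [S7.s0, S7.s1, S7.s2, S7.s3] ↔
        q = x ∨ q = y ∨ q = z) → J x y = false → J x z = false → IsMinor K7vee G := by
      intro x y z hn hxyz h1 h2
      have hx := (hxyz x).2 (by simp)
      have hy := (hxyz y).2 (by simp)
      have hz := (hxyz z).2 (by simp)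
      simp only [List.nodup_cons, List.mem_cons, List.not_mem_nil, or_false, not_or,
        not_false_eq_true, List.nodup_nil, and_true] at hn
      have cn : Cn G (N x ∪ N y ∪ N z) :=
        ((h.model.1 x).union_touch (h.model.1 y) (h.touch _ _ hn.1.1 h1)).union_touch (h.model.1 z)
          ((h.touch _ _ hn.1.2 h2).mono Set.subset_union_left Set.Subset.rfl)
      refine finish (N x ∪ N y ∪ N z) cn ?_ ?_ (fun i hi => ?_) ?_ fun i hi => ?_
      · simp only [Set.disjoint_union_right]
        exact ⟨⟨h.disj x, h.disj y⟩, h.disj z⟩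
      · simp only [Set.disjoint_union_right]
        exact ⟨⟨hXN x, hXN y⟩, hXN z⟩
      · simp only [Set.disjoint_union_right]
        exact ⟨⟨h.model.2 _ _ fun e => hx (e ▸ hi), h.model.2 _ _ fun e => hy (e ▸ hi)⟩,
          h.model.2 _ _ fun e => hz (e ▸ hi)⟩
      · exact (h.spoke x).mono Set.Subset.rfl fun _ h => Or.inl (Or.inl h)
      · obtain ⟨a, b, hab⟩ := h.deg i
        by_cases ix : J i x = true
        · by_cases iy : J i y = true
          · have iz : J i z = false := by
              by_contra iz
              have iz : J i z = true := by simpa using iz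
              have := hab _ ix
              have := hab _ iy
              have := hab _ iz
              grind
            exact (h.touch _ _ (fun e : i = z => hz (e ▸ hi)) iz).mono Set.Subset.rfl
              fun _ h => Or.inr h
          · exact (h.touch _ _ (fun e : i = y => hy (e ▸ hi))
                (by simpa using iy)).mono Set.Subset.rfl
              fun _ h => Or.inl (Or.inr h)
        · exact (h.touch _ _ (fun e : i = x => hx (e ▸ hi)) (by simpa using ix)).mono Set.Subset.rfl
            fun _ h => Or.inl (Or.inl h)
    have q4 := hq S7.s4 S7.s5 S7.s6 (by decide) (by decide) (by decide) (by decide)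
    have q5 := hq S7.s5 S7.s4 S7.s6 (by decide) (by decide) (by decide) (by decide)
    have q6 := hq S7.s6 S7.s4 S7.s5 (by decide) (by decide) (by decide) (by decide)
    rw [h.symm S7.s5 S7.s4] at q5
    rw [h.symm S7.s6 S7.s4, h.symm S7.s6 S7.s5] at q6
    by_cases h45 : J S7.s4 S7.s5 = true
    · exact key S7.s6 S7.s4 S7.s5 (by decide) (by decide)
        (by rw [h.symm]; simpa using q4 h45) (by rw [h.symm]; simpa using q5 h45)
    · by_cases h46 : J S7.s4 S7.s6 = true
      · exact key S7.s5 S7.s4 S7.s6 (by decide) (by decide)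
          (by rw [h.symm]; simpa using h45) (by simpa using q6 h46)
      · exact key S7.s4 S7.s5 S7.s6 (by decide) (by decide) (by simpa using h45)
          (by simpa using h46)

theorem Wheel.main (h : Wheel G N P J) (hX : Cn G X) (hXN : ∀ i, Disjoint X (N i))
    (hXP : Disjoint P X) (hT : 4 ≤ {i | Touch G X (N i)}.ncard) :
    IsMinor K7vee G ∨ ∃ σ : Equiv.Perm S7, Touch G X (N (σ S7.s0)) ∧ Touch G X (N (σ S7.s1)) ∧
      Touch G X (N (σ S7.s2)) ∧ Touch G X (N (σ S7.s3)) ∧ BadAt J σ := by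
  obtain ⟨T, hTs, hT4⟩ := Set.exists_subset_card_eq hT
  obtain ⟨e⟩ : Nonempty (Fin 4 ≃ T) := ⟨(Finite.equivFinOfCardEq (by rw [← hT4]; rfl)).symm⟩
  have ht : ∀ i, Touch G X (N (e i)) := fun i => hTs (e i).2
  have hinj : ∀ i j, i ≠ j → (e i : S7) ≠ e j := fun i j hij he =>
    hij (e.injective (Subtype.ext he))
  by_cases hJ : ∃ i j, J (e i) (e j) = true
  · obtain ⟨i, j, hij⟩ := hJ
    have hne : i ≠ j := fun e => by
      rw [e, h.irrefl] at hij
      exact Bool.noConfusion hij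
    obtain ⟨k, l, h1, h2, h3, h4, h5⟩ : ∃ k l : Fin 4, i ≠ k ∧ i ≠ l ∧ j ≠ k ∧ j ≠ l ∧ k ≠ l := by
      clear hij
      revert i j
      decide
    rcases h.pair hX hXN hXP (hinj _ _ h1) (hinj _ _ h2) (hinj _ _ h3) (hinj _ _ h4)
      (hinj _ _ h5) (ht i) (ht j) (ht k) (ht l) hij with hm | ⟨σ, ⟨e0, e1, e2, e3⟩, hσ⟩
    · exact Or.inl hm
    · exact Or.inr ⟨σ, e0 ▸ ht _, e1 ▸ ht _, e2 ▸ ht _, e3 ▸ ht _, hσ⟩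
  · left
    push Not at hJ
    obtain ⟨σ, h0, h1, h2, h3⟩ := S7.exists_perm (hinj 0 1 (by decide)) (hinj 0 2 (by decide))
      (hinj 0 3 (by decide)) (hinj 1 2 (by decide)) (hinj 1 3 (by decide)) (hinj 2 3 (by decide))
    have hσ : ∀ i ∈ [S7.s0, S7.s1, S7.s2, S7.s3], ∃ k, σ i = e k := by
      intro i hi
      simp only [List.mem_cons, List.not_mem_nil, or_false] at hi
      rcases hi with rfl | rfl | rfl | rfl
      exacts [⟨_, h0⟩, ⟨_, h1⟩, ⟨_, h2⟩, ⟨_, h3⟩]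
    refine (h.perm σ).indep hX (fun i => hXN _) hXP (fun i hi => ?_) (fun i hi j hj => ?_)
    · obtain ⟨k, hk⟩ := hσ i hi
      rw [hk]; exact ht k
    · obtain ⟨k, hk⟩ := hσ i hi
      obtain ⟨l, hl⟩ := hσ j hj
      rw [hk, hl]; simpa using hJ k l

end

section

variable {V : Type} {G : SimpleGraph V} {N : S7 → Set V} {P X : Set V} {J : S7 → S7 → Bool}

theorem exists_true_of_badJ (hb : badJ J = true) (h01 : J S7.s0 S7.s1 = true)
    (hs : ∀ i j, J i j = J j i) (i : S7) : ∃ j, J i j = true := by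
  simp only [badJ, Bool.and_eq_true, Bool.or_eq_true] at hb
  obtain ⟨⟨⟨⟨⟨⟨h0, h4⟩, h2⟩, h3⟩, h42⟩, h52⟩, h62⟩ := hb
  cases i
  · exact ⟨_, h01⟩
  · exact ⟨_, by rw [hs]; exact h01⟩
  · by_contra hn
    push Not at hn
    simp [hn, atMost] at h2
  · by_contra hn
    push Not at hn
    simp [hn, atMost] at h3
  · rcases h42 with h | h <;> exact ⟨_, h⟩
  · rcases h52 with h | h <;> exact ⟨_, h⟩
  · rcases h62 with h | h <;> exact ⟨_, h⟩

theorem badJ_s0 (hb : badJ J = true) {j : S7} (h0 : j ≠ S7.s0) (h1 : j ≠ S7.s1) :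
    J S7.s0 j = false := by
  simp only [badJ, Bool.and_eq_true] at hb
  have h := hb.1.1.1.1.1.1
  have key : ∀ a b c d e : Bool, atMost 0 [a, b, c, d, e] = true →
      a = false ∧ b = false ∧ c = false ∧ d = false ∧ e = false := by decide
  have := key _ _ _ _ _ h
  cases j <;> tauto

theorem badJ_s2 (hb : badJ J = true) : ¬ (J S7.s2 S7.s4 = false ∧ J S7.s2 S7.s5 = false) := by
  simp only [badJ, Bool.and_eq_true] at hb
  have h := hb.1.1.1.1.2
  intro hn
  simp_all [atMost]

theorem badJ_s4 (hb : badJ J = true) : ∃ a b, a ≠ b ∧ J S7.s4 a = true ∧ J S7.s4 b = true := by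
  simp only [badJ, Bool.and_eq_true] at hb
  have h := hb.1.1.1.1.1.2
  by_contra hn
  push Not at hn
  have h1 := hn S7.s2 S7.s3 (by decide)
  have h2 := hn S7.s2 S7.s5 (by decide)
  have h3 := hn S7.s2 S7.s6 (by decide)
  have h4 := hn S7.s3 S7.s5 (by decide)
  have h5 := hn S7.s3 S7.s6 (by decide)
  have h6 := hn S7.s5 S7.s6 (by decide)
  cases e2 : J S7.s4 S7.s2 <;> cases e3 : J S7.s4 S7.s3 <;> cases e5 : J S7.s4 S7.s5 <;>
    cases e6 : J S7.s4 S7.s6 <;> simp_all [atMost]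

theorem Wheel.outer (h : Wheel G N P J) (hX : Cn G X) (hXN : ∀ i, Disjoint X (N i))
    (hXP : Disjoint P X) {σ : Equiv.Perm S7} (h0 : Touch G X (N (σ S7.s0)))
    (h1 : Touch G X (N (σ S7.s1))) (h2 : Touch G X (N (σ S7.s2))) (h3 : Touch G X (N (σ S7.s3)))
    (h4 : Touch G X (N (σ S7.s4))) (hb : BadAt J σ) : IsMinor K7vee G := by
  have hne : ∀ {a b : S7}, a ≠ b → σ a ≠ σ b := fun hab e => hab (σ.injective e)
  have key : ∀ e, e = S7.s2 ∨ e = S7.s3 → Touch G X (N (σ e)) → J (σ S7.s4) (σ e) = true →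
      IsMinor K7vee G := by
    intro e he hte hJ
    have e0 : e ≠ S7.s0 := by rcases he with rfl | rfl <;> decide
    have e1 : e ≠ S7.s1 := by rcases he with rfl | rfl <;> decide
    rcases h.pair hX hXN hXP (hne (show S7.s4 ≠ S7.s0 by decide))
      (hne (show S7.s4 ≠ S7.s1 by decide)) (hne e0) (hne e1)
      (hne (show S7.s0 ≠ S7.s1 by decide)) h4 hte h0 h1 hJ with hm | ⟨τ, ⟨-, -, t2, t3⟩, -, hτ⟩
    · exact hm
    · exfalso
      have hf : ∀ k, k ≠ S7.s2 → k ≠ S7.s3 → J (τ S7.s2) (τ k) = false := by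
        intro k k2 k3
        rw [t2, ← σ.apply_symm_apply (τ k)]
        refine badJ_s0 hb.2 (fun e => k2 ?_) (fun e => k3 ?_)
        · apply τ.injective; rw [t2, ← e, σ.apply_symm_apply]
        · apply τ.injective; rw [t3, ← e, σ.apply_symm_apply]
      exact badJ_s2 hτ ⟨hf _ (by decide) (by decide), hf _ (by decide) (by decide)⟩
  have hb' := hb.2
  simp only [badJ, Bool.and_eq_true, Bool.or_eq_true] at hb'
  rcases hb'.1.1.2 with h | h
  · exact key _ (Or.inl rfl) h2 h
  · exact key _ (Or.inr rfl) h3 h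

theorem Wheel.finish (h : Wheel G N P J) (𝒳 : Set (Set V)) (hne : 𝒳.Nonempty)
    (hC : ∀ X ∈ 𝒳, Cn G X) (hN : ∀ X ∈ 𝒳, ∀ i, Disjoint X (N i)) (hP : ∀ X ∈ 𝒳, Disjoint P X)
    (hd : ∀ X ∈ 𝒳, ∀ Y ∈ 𝒳, X ≠ Y → Disjoint X Y)
    (h4 : ∀ X ∈ 𝒳, 4 ≤ {i | Touch G X (N i)}.ncard)
    (h2 : ∀ i, (∃ a b, a ≠ b ∧ J i a = true ∧ J i b = true) → ∃ X ∈ 𝒳, Touch G X (N i)) :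
    IsMinor K7vee G := by
  obtain ⟨X, hX⟩ := hne
  rcases h.main (hC X hX) (hN X hX) (hP X hX) (h4 X hX) with hm | ⟨σ, x0, x1, x2, x3, hb⟩
  · exact hm
  obtain ⟨a, b, hab, ha, hb4⟩ := badJ_s4 hb.2
  obtain ⟨Y, hY, hYt⟩ := h2 (σ S7.s4) ⟨σ a, σ b, fun e => hab (σ.injective e), ha, hb4⟩
  by_cases hXY : X = Y
  · subst hXY
    exact h.outer (hC X hX) (hN X hX) (hP X hX) x0 x1 x2 x3 hYt hb
  set p := σ S7.s0
  set q := σ S7.s1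
  let K : S7 → S7 → Bool := fun i j => J i j && !decide (i = p ∧ j = q ∨ i = q ∧ j = p)
  have hK0 : ∀ j, K p j = false := by
    intro j
    by_contra hk
    simp only [K, Bool.and_eq_true, Bool.not_eq_true', decide_eq_false_iff_not, not_or, not_and,
      Bool.not_eq_false, true_and] at hk
    have hjq := hk.2.1
    have hjp : j ≠ p := by
      rintro rfl
      have := h.irrefl p
      simp_all
    have := badJ_s0 hb.2 (j := σ.symm j) (fun e => hjp (by simp [p, ← e]))
      (fun e => hjq (by simp [q, ← e]))
    simp only [Equiv.apply_symm_apply] at this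
    rw [this] at hk
    exact Bool.noConfusion hk.1
  have hKs : ∀ i j, K i j = K j i := by
    intro i j
    simp only [K, h.symm i j]
    congr 2
    rw [decide_eq_decide]
    tauto
  have hM := h.merge (hC X hX) (hN X hX) (hP X hX) x0 (K := K) hKs (fun i j hij => by
      simp only [K, Bool.and_eq_true] at hij; exact hij.1) (fun i j hij => by
      simp only [K, Bool.and_eq_false_iff, Bool.not_eq_false', decide_eq_true_eq] at hij
      rcases hij with hij | ⟨e, e'⟩ | ⟨e, e'⟩
      · exact Or.inl hij
      · exact Or.inr (Or.inl ⟨e, by rw [e']; exact x1⟩)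
      · exact Or.inr (Or.inr ⟨e', by rw [e]; exact x1⟩))
  have hsub : ∀ i, N i ⊆ Function.update N p (N p ∪ X) i := by
    intro i
    by_cases hi : i = p
    · rw [hi, Function.update_self]; exact Set.subset_union_left
    · rw [Function.update_of_ne hi]
  have hYN : ∀ i, Disjoint Y (Function.update N p (N p ∪ X) i) := fun i => by
    by_cases hi : i = p
    · rw [hi, Function.update_self]
      exact Set.disjoint_union_right.2 ⟨hN Y hY p, (hd X hX Y hY hXY).symm⟩
    · rw [Function.update_of_ne hi]; exact hN Y hY i
  rcases hM.main (hC Y hY) hYN (hP Y hY) ((h4 Y hY).trans (Set.ncard_le_ncard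
    (fun i hi => hi.mono Set.Subset.rfl (hsub i)) (Set.toFinite _))) with hm | ⟨τ, -, -, -, -, hτ⟩
  · exact hm
  · exfalso
    obtain ⟨j, hj⟩ := exists_true_of_badJ hτ.2 hτ.1 (fun i j => hKs _ _) (τ.symm p)
    simp only [Equiv.apply_symm_apply] at hj
    rw [hK0] at hj
    exact Bool.noConfusion hj

end

section

variable {V : Type} {G : SimpleGraph V}

theorem IsModel.cons {m : ℕ} {B : Fin m → Set V} (hB : IsModel G B) {X : Set V} (hX : Cn G X)
    (hd : ∀ i, Disjoint X (B i)) : IsModel G (Fin.cons X B : Fin (m + 1) → Set V) := by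
  refine ⟨fun i => ?_, fun i j hij => ?_⟩
  · cases i using Fin.cases with
    | zero => exact hX
    | succ i => exact hB.1 i
  · cases i using Fin.cases with
    | zero =>
      cases j using Fin.cases with
      | zero => exact absurd rfl hij
      | succ j => exact hd j
    | succ i =>
      cases j using Fin.cases with
      | zero => exact (hd i).symm
      | succ j => exact hB.2 i j fun e => hij (by rw [e])

theorem isModel_singleton {ι : Type} {f : ι → V} (hf : Function.Injective f) :
    IsModel G (fun i => ({f i} : Set V)) :=
  ⟨fun i => Cn.singleton _, fun i j hij => by simpa using fun e => hij (hf e)⟩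

/-- Vertices of `N(v)` not adjacent to `x`. -/
def nadj (G : SimpleGraph V) (v x : V) : Set V := {y | G.Adj v y ∧ y ≠ x ∧ ¬ G.Adj x y}

theorem ncard_nadj [Finite V] {v x : V} (h : G.Adj v x) :
    (nadj G v x).ncard + cnbr G v x + 1 = (G.neighborSet v).ncard := by
  have h1 : G.neighborSet v = insert x (nadj G v x ∪ G.commonNeighbors v x) := by
    ext y
    simp only [mem_neighborSet, nadj, Set.mem_insert_iff, Set.mem_union, Set.mem_ofPred_eq,
      mem_commonNeighbors]
    constructor
    · intro hy
      by_cases e : y = x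
      · exact Or.inl e
      · by_cases hxy : G.Adj x y <;> tauto
    · rintro (rfl | h | h)
      exacts [h, h.1, h.1]
  have h2 : x ∉ nadj G v x ∪ G.commonNeighbors v x := by
    simp [nadj, mem_commonNeighbors]
  have h3 : Disjoint (nadj G v x) (G.commonNeighbors v x) := by
    rw [Set.disjoint_left]
    rintro y ⟨-, -, h⟩ hy
    exact h (G.mem_commonNeighbors.1 hy).2
  rw [h1, Set.ncard_insert_of_notMem h2, Set.ncard_union_eq h3]
  rfl

/-- A vertex with a non-neighbour has a component of the remainder attached to at least four of
its neighbours. -/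
theorem FourConn.exists_comp [Finite V] (h : FourConn G) {v x : V} (hx : x ≠ v)
    (hvx : ¬ G.Adj v x) : ∃ X, Cn G X ∧ x ∈ X ∧ Disjoint X (insert v (G.neighborSet v)) ∧
      nbr G X ⊆ G.neighborSet v ∧ 4 ≤ (nbr G X).ncard ∧
      X = _root_.comp G (insert v (G.neighborSet v))ᶜ x := by
  set U := insert v (G.neighborSet v) with hU
  have hxU : x ∉ U := by simp [hU, hx, hvx]
  have hyn : ∀ z ∉ U, ¬ G.Adj z v := fun z hz hzv => hz (by simp [hU, hzv.symm])
  have hsub : nbr G (_root_.comp G Uᶜ x) ⊆ U := nbr_comp_subset'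
  refine ⟨_root_.comp G Uᶜ x, cn_comp hxU, mem_comp_self hxU, ?_, fun y hy => ?_,
    h.comp hxU (y := v) (by simp [hU]) hyn, rfl⟩
  · rw [Set.disjoint_left]
    exact fun y hy => comp_subset hy
  · rcases hsub hy with rfl | h
    · obtain ⟨-, z, hz, hzy⟩ := hy
      exact absurd hzy (hyn z (comp_subset hz))
    · exact h

/-- Six pairwise adjacent vertices and a connected set touching at least four of them. -/
theorem k7vee_of_clique [Finite V] {A X : Set V} (hA : A.ncard = 6)
    (hadj : ∀ x ∈ A, ∀ y ∈ A, x ≠ y → G.Adj x y) (hX : Cn G X) (hd : Disjoint X A)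
    (h4 : 4 ≤ (nbr G X ∩ A).ncard) : IsMinor K7vee G := by
  classical
  have : Fintype A := Fintype.ofFinite A
  have hcard : Fintype.card A = 6 := by
    rw [← hA, ← Nat.card_coe_set_eq, Nat.card_eq_fintype_card]
  have h2 : (A \ nbr G X).ncard ≤ 2 := by
    have := Set.ncard_inter_add_ncard_sdiff_eq_ncard A (nbr G X)
    rw [Set.inter_comm] at this
    omega
  obtain ⟨a, b, hab⟩ : ∃ a b, A \ nbr G X ⊆ {a, b} := by
    have hne : A.Nonempty := by
      rw [← Set.ncard_pos]; omega
    obtain ⟨z, -⟩ := hne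
    rcases (by omega : (A \ nbr G X).ncard = 0 ∨ (A \ nbr G X).ncard = 1 ∨
      (A \ nbr G X).ncard = 2) with h | h | h
    · exact ⟨z, z, by simp [(Set.ncard_eq_zero).1 h]⟩
    · obtain ⟨a, ha⟩ := Set.ncard_eq_one.1 h
      exact ⟨a, a, by simp [ha]⟩
    · obtain ⟨a, b, -, ha⟩ := Set.ncard_eq_two.1 h
      exact ⟨a, b, ha.subset⟩
  let B : Option A → Set V := fun i => i.elim X fun a => {(a : V)}
  have hB : IsModel G B := by
    refine ⟨fun i => ?_, fun i j hij => ?_⟩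
    · cases i
      exacts [hX, Cn.singleton _]
    · cases i <;> cases j
      · exact absurd rfl hij
      · exact Set.disjoint_singleton_right.2 fun h => hd.le_bot ⟨h, Subtype.coe_prop _⟩
      · exact Set.disjoint_singleton_left.2 fun h => hd.le_bot ⟨h, Subtype.coe_prop _⟩
      · simp only [B, Option.elim, Set.disjoint_singleton]
        exact fun e => hij (by rw [Subtype.ext e])
  have get : ∀ a, ∃ a' : Option A, ∀ x : A, (x : V) = a → some x = a' := by
    intro a
    by_cases ha : a ∈ A
    · exact ⟨some ⟨a, ha⟩, fun x hx => by rw [← Subtype.ext (a1 := x) (a2 := ⟨a, ha⟩) hx]⟩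
    · exact ⟨none, fun x hx => absurd (hx ▸ x.2) ha⟩
  obtain ⟨a', ha'⟩ := get a
  obtain ⟨b', hb'⟩ := get b
  refine k7vee_of_cover (ι := Option A) (by simp [hcard]) hB none a' b' ?_
  intro i j hij hj
  cases j with
  | none => exact absurd rfl hj
  | some y =>
    cases i with
    | some x =>
      left
      simpa [B] using hadj x x.2 y y.2 fun e => hij (by rw [Subtype.ext e])
    | none =>
      by_cases hy : (y : V) ∈ nbr G X
      · exact Or.inl (touch_of_mem_nbr hy)
      · right
        refine ⟨rfl, ?_⟩
        rcases hab ⟨y.2, hy⟩ with h | h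
        · exact Or.inl (ha' y h)
        · exact Or.inr (hb' y h)

theorem k7vee_of_degree_five [Finite V] (hF : FourConn G) (hn : 7 ≤ Nat.card V) {v : V}
    (hv : (G.neighborSet v).ncard = 5) (ht : ∀ x, G.Adj v x → 4 ≤ cnbr G v x) :
    IsMinor K7vee G := by
  have hvn : v ∉ G.neighborSet v := by simp
  have hA : (insert v (G.neighborSet v)).ncard = 6 := by
    rw [Set.ncard_insert_of_notMem hvn, hv]
  obtain ⟨x, hx⟩ : ∃ x, x ∉ insert v (G.neighborSet v) := by
    by_contra! h
    have := Set.ncard_univ V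
    rw [← Set.eq_univ_of_forall h] at this
    omega
  obtain ⟨X, hX, -, hd, hs, h4, -⟩ := hF.exists_comp (v := v) (x := x) (fun e => hx (by simp [e]))
    fun e => hx (by simp [e])
  have hadj : ∀ x y, G.Adj v x → G.Adj v y → x ≠ y → G.Adj x y := by
    intro x y hx hy hxy
    by_contra hn
    have h1 := ncard_nadj hx
    have h2 := ht x hx
    have : (nadj G v x).ncard = 0 := by omega
    rw [Set.ncard_eq_zero] at this
    exact (this ▸ (⟨hy, hxy.symm, hn⟩ : y ∈ nadj G v x) : y ∈ (∅ : Set V))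
  refine k7vee_of_clique hA ?_ hX hd ?_
  · rintro x (rfl | hx) y (rfl | hy) hxy
    · exact absurd rfl hxy
    · exact hy
    · exact G.adj_symm hx
    · exact hadj x y hx hy hxy
  · refine h4.trans (Set.ncard_le_ncard (fun y hy => ⟨hy, Or.inr (hs hy)⟩))

end

section

variable {V : Type} {G : SimpleGraph V}

theorem k7vee_of_ncard_arcs [Finite V] (hn : Nat.card V = 7) (ha : 39 ≤ (arcs G).ncard) :
    IsMinor K7vee G := by
  classical
  have := Fintype.ofFinite V
  have hB : IsModel G (fun x : V => ({x} : Set V)) := isModel_singleton (f := id) fun _ _ h => h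
  have hc : Fintype.card V = 7 := by rw [← hn, Nat.card_eq_fintype_card]
  by_cases hK : ∃ p q, p ≠ q ∧ ¬ G.Adj p q
  · obtain ⟨p, q, hpq, hna⟩ := hK
    refine k7vee_of_cover hc hB p q q ?_
    intro i j hij hj
    by_contra hcon
    simp only [touch_singleton_left, Set.mem_singleton_iff, exists_eq_left, not_or, not_and] at hcon
    have hsub : ({(p, q), (q, p), (i, j), (j, i)} : Set (V × V)) ∪ (fun x => (x, x)) '' Set.univ ⊆
        (arcs G)ᶜ := by
      rintro ⟨x, y⟩ (h | ⟨z, -, h⟩)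
      · simp only [Set.mem_insert_iff, Prod.mk.injEq, Set.mem_singleton_iff] at h
        simp only [arcs, Set.mem_compl_iff, Set.mem_ofPred_eq]
        rcases h with ⟨rfl, rfl⟩ | ⟨rfl, rfl⟩ | ⟨rfl, rfl⟩ | ⟨rfl, rfl⟩
        exacts [hna, fun h => hna h.symm, hcon.1, fun h => hcon.1 h.symm]
      · simp only [Prod.mk.injEq] at h
        obtain ⟨rfl, rfl⟩ := h
        simp [arcs]
    have h4 : ({(p, q), (q, p), (i, j), (j, i)} : Set (V × V)).ncard = 4 := by
      rw [Set.ncard_eq_toFinset_card']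
      have : ({(p, q), (q, p), (i, j), (j, i)} : Set (V × V)).toFinset =
        {(p, q), (q, p), (i, j), (j, i)} := by ext; simp
      rw [this, Finset.card_insert_of_notMem, Finset.card_insert_of_notMem,
        Finset.card_insert_of_notMem, Finset.card_singleton] <;>
      simp only [Finset.mem_insert, Finset.mem_singleton, Prod.mk.injEq] <;> grind
    have h7 : ((fun x : V => (x, x)) '' Set.univ).ncard = 7 := by
      rw [Set.ncard_image_of_injective _ (fun x y h => (Prod.mk.inj h).1), Set.ncard_univ, hn]
    have hd : Disjoint ({(p, q), (q, p), (i, j), (j, i)} : Set (V × V))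
        ((fun x => (x, x)) '' Set.univ) := by
      rw [Set.disjoint_left]
      rintro ⟨x, y⟩ h ⟨z, -, h'⟩
      simp only [Set.mem_insert_iff, Prod.mk.injEq, Set.mem_singleton_iff] at h h'
      grind
    have h11 := Set.ncard_le_ncard hsub
    rw [Set.ncard_union_eq hd, h4, h7] at h11
    have := Set.ncard_add_ncard_compl (arcs G)
    rw [Nat.card_prod, hn] at this
    omega
  · push Not at hK
    have hne : Nonempty V := ⟨(Finite.equivFinOfCardEq hn).symm 0⟩
    obtain ⟨p⟩ := hne
    refine k7vee_of_cover hc hB p p p ?_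
    intro i j hij hj
    left
    simpa using hK i j hij

theorem injective_cons {m : ℕ} {f : Fin m → V} (hf : Function.Injective f) {a : V}
    (ha : ∀ i, a ≠ f i) : Function.Injective (Fin.cons a f : Fin (m + 1) → V) := by
  rw [Fin.cons_injective_iff]
  exact ⟨fun ⟨i, hi⟩ => ha i hi.symm, hf⟩

/-- Two missing pairs in the neighbourhood of a vertex of degree six. -/
theorem k7vee_of_two_pairs {v a b c d e z : V} {X : Set V} (hnd : [v, a, b, c, d, e, z].Nodup)
    (hX : Cn G X) (hd : ∀ x ∈ [v, a, b, c, d, e, z], x ∉ X)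
    (hv : ∀ x ∈ [a, b, c, d, e, z], G.Adj v x)
    (hab : ∀ x ∈ [a, b], ∀ y ∈ [c, d, e, z], G.Adj x y)
    (hcd : ∀ x ∈ [c, d], ∀ y ∈ [e, z], G.Adj x y) (hez : G.Adj e z)
    (hT : (Touch G X {a} ∧ Touch G X {b}) ∨ (Touch G X {c} ∧ Touch G X {d}) ∨
      ∀ x ∈ [a, c, e, z], Touch G X {x}) : IsMinor K7vee G := by
  let o : Fin 7 → V := ![v, a, b, c, d, e, z]
  have ho : Function.Injective o := by
    have := List.nodup_iff_injective_get.1 hnd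
    intro i j hij
    refine this ?_
    fin_cases i <;> fin_cases j <;> first | rfl | exact hij
  have hB : IsModel G (Fin.cons X (fun i => {o i}) : Fin 8 → Set V) := by
    refine (isModel_singleton ho).cons hX fun i => ?_
    rw [Set.disjoint_singleton_right]
    fin_cases i <;> exact hd _ (by simp [o])
  let L : List (Fin 8 × Fin 8) := [(1, 2), (1, 3), (1, 4), (1, 5), (1, 6), (1, 7), (2, 4), (2, 5),
    (2, 6), (2, 7), (3, 4), (3, 5), (3, 6), (3, 7), (4, 6), (4, 7), (5, 6), (5, 7), (6, 7)]
  have hL : ∀ p ∈ L, Touch G ((Fin.cons X (fun i => {o i}) : Fin 8 → Set V) p.1)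
      ((Fin.cons X (fun i => {o i}) : Fin 8 → Set V) p.2) := by
    simp only [List.mem_cons, List.not_mem_nil, or_false, forall_eq_or_imp, forall_eq] at hv hab hcd
    simp only [L, List.forall_mem_cons, List.not_mem_nil, false_imp_iff, implies_true, and_true]
    refine ⟨?_, ?_, ?_, ?_, ?_, ?_, ?_, ?_, ?_, ?_, ?_, ?_, ?_, ?_, ?_, ?_, ?_, ?_, ?_⟩ <;>
      refine ⟨_, rfl, _, rfl, ?_⟩
    · exact hv.1
    · exact hv.2.1
    · exact hv.2.2.1
    · exact hv.2.2.2.1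
    · exact hv.2.2.2.2.1
    · exact hv.2.2.2.2.2
    · exact hab.1.1
    · exact hab.1.2.1
    · exact hab.1.2.2.1
    · exact hab.1.2.2.2
    · exact hab.2.1
    · exact hab.2.2.1
    · exact hab.2.2.2.1
    · exact hab.2.2.2.2
    · exact hcd.1.1
    · exact hcd.1.2
    · exact hcd.2.1
    · exact hcd.2.2
    · exact hez
  rcases hT with ⟨h1, h2⟩ | ⟨h1, h2⟩ | h
  · refine k7vee_of_model hB ((0, 2) :: (0, 3) :: L) ?_ ![2, 4, 2, 3, 0, 1, 5, 6]
      ![4, 5, 2, 3, 1, 6, 7] (by decide)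
    rw [List.forall_mem_cons, List.forall_mem_cons]
    exact ⟨h1, h2, hL⟩
  · refine k7vee_of_model hB ((0, 4) :: (0, 5) :: L) ?_ ![2, 4, 0, 1, 2, 3, 5, 6]
      ![2, 3, 4, 5, 1, 6, 7] (by decide)
    rw [List.forall_mem_cons, List.forall_mem_cons]
    exact ⟨h1, h2, hL⟩
  · refine k7vee_of_model hB ((0, 2) :: (0, 4) :: (0, 6) :: (0, 7) :: L) ?_
      ![0, 1, 3, 2, 4, 2, 5, 6] ![0, 1, 3, 2, 4, 6, 7] (by decide)
    simp only [List.forall_mem_cons]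
    exact ⟨h a (by simp), h c (by simp), h e (by simp), h z (by simp), hL⟩

end

section

variable {V : Type} {G : SimpleGraph V}

theorem exists_antipode [Finite V] (hF : FourConn G) (hD : defect G < 0)
    (hK : ¬ IsMinor K7vee G) {v : V} (hv : (G.neighborSet v).ncard = 6)
    (ht : ∀ x, G.Adj v x → 4 ≤ cnbr G v x) {z : V} (hz : G.Adj v z) :
    ∃ x, nadj G v z = {x} := by
  classical
  by_contra hcon
  have h1 : ∀ x, G.Adj v x → (nadj G v x).ncard ≤ 1 := fun x hx => by
    have := ncard_nadj hx
    have := ht x hx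
    omega
  have huniq : ∀ x y y', G.Adj v x → y ∈ nadj G v x → y' ∈ nadj G v x → y = y' :=
    fun x y y' hx hy hy' => (Set.ncard_le_one).1 (h1 x hx) y hy y' hy'
  have hsym : ∀ x y, G.Adj v x → y ∈ nadj G v x → x ∈ nadj G v y :=
    fun x y hx hy => ⟨hx, hy.2.1.symm, fun h => hy.2.2 h.symm⟩
  have hz0 : nadj G v z = ∅ := by
    rw [← Set.ncard_eq_zero]
    by_contra h
    exact hcon (Set.ncard_eq_one.1 (by have := h1 z hz; omega))
  have hadj : ∀ x y, G.Adj v x → G.Adj v y → x ≠ y → y ∉ nadj G v x → G.Adj x y := by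
    intro x y hx hy hxy hn
    by_contra h
    exact hn ⟨hy, hxy.symm, h⟩
  have hzadj : ∀ y, G.Adj v y → y ≠ z → G.Adj z y := fun y hy hyz =>
    hadj z y hz hy hyz.symm (by simp [hz0])
  have hvn : v ∉ G.neighborSet v := by simp
  -- at least two missing pairs
  by_cases hone : ∃ a b, G.Adj v a ∧ ∀ x y, G.Adj v x → G.Adj v y → x ≠ y → ¬ G.Adj x y →
      (x = a ∧ y = b) ∨ (x = b ∧ y = a)
  · obtain ⟨a, b, ha, hab⟩ := hone
    apply hK
    have hA : (insert v (G.neighborSet v)).ncard = 7 := by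
      rw [Set.ncard_insert_of_notMem hvn, hv]
    have : Fintype (insert v (G.neighborSet v) : Set V) := Fintype.ofFinite _
    have hc : Fintype.card (insert v (G.neighborSet v) : Set V) = 7 := by
      rw [← Nat.card_eq_fintype_card, Nat.card_coe_set_eq, hA]
    by_cases hb : G.Adj v b
    · refine k7vee_of_cover hc (isModel_singleton Subtype.val_injective) ⟨a, Or.inr ha⟩
        ⟨b, Or.inr hb⟩ ⟨b, Or.inr hb⟩ ?_
      rintro ⟨x, rfl | hx⟩ ⟨y, rfl | hy⟩ hxy hya
      · exact absurd rfl hxy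
      · exact Or.inl (by simpa using hy)
      · exact Or.inl (by simpa using G.adj_symm hx)
      · have hxy : x ≠ y := fun e => hxy (Subtype.ext e)
        by_cases h : G.Adj x y
        · exact Or.inl (by simpa using h)
        · right
          rcases hab x y hx hy hxy h with h | h
          · exact ⟨Subtype.ext h.1, Or.inl (Subtype.ext h.2)⟩
          · exact absurd (Subtype.ext h.2) hya
    · refine k7vee_of_cover hc (isModel_singleton Subtype.val_injective) ⟨a, Or.inr ha⟩
        ⟨a, Or.inr ha⟩ ⟨a, Or.inr ha⟩ ?_
      rintro ⟨x, rfl | hx⟩ ⟨y, rfl | hy⟩ hxy hya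
      · exact absurd rfl hxy
      · exact Or.inl (by simpa using hy)
      · exact Or.inl (by simpa using G.adj_symm hx)
      · have hxy : x ≠ y := fun e => hxy (Subtype.ext e)
        by_cases h : G.Adj x y
        · exact Or.inl (by simpa using h)
        · rcases hab x y hx hy hxy h with h | h
          · exact absurd (h.2 ▸ hy) hb
          · exact absurd (h.1 ▸ hx) hb
  push Not at hone
  obtain ⟨a, b, ha, hb, hab, hnab, -⟩ := hone z z hz
  obtain ⟨c, d, hc, hd, hcd, hncd, hne1, hne2⟩ := hone a b ha
  have mab : b ∈ nadj G v a := ⟨hb, hab.symm, hnab⟩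
  have mba := hsym _ _ ha mab
  have mcd : d ∈ nadj G v c := ⟨hd, hcd.symm, hncd⟩
  have mdc := hsym _ _ hc mcd
  have hac : a ≠ c := by rintro rfl; exact hne1 rfl (huniq _ _ _ ha mcd mab)
  have had : a ≠ d := by rintro rfl; exact hne2 (huniq _ _ _ ha mdc mab) rfl
  have hbc : b ≠ c := by rintro rfl; exact hne2 rfl (huniq _ _ _ hb mcd mba)
  have hbd : b ≠ d := by rintro rfl; exact hne1 (huniq _ _ _ hb mdc mba) rfl
  have hzn : ∀ x y, x ∈ nadj G v y → G.Adj v y → z ≠ x := by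
    rintro x y hxy hy rfl
    exact (hz0 ▸ hsym _ _ hy hxy : _ ∈ (∅ : Set V))
  have hza := hzn _ _ mba hb
  have hzb := hzn _ _ mab ha
  have hzc := hzn _ _ mdc hd
  have hzd := hzn _ _ mcd hc
  have h5 : ({a, b, c, d, z} : Finset V).card = 5 := by
    rw [Finset.card_insert_of_notMem, Finset.card_insert_of_notMem, Finset.card_insert_of_notMem,
      Finset.card_insert_of_notMem, Finset.card_singleton] <;> simp <;> grind
  obtain ⟨e, he, hes⟩ : ∃ e, G.Adj v e ∧ e ∉ ({a, b, c, d, z} : Finset V) := by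
    by_contra! h
    have := Set.ncard_le_ncard (s := G.neighborSet v) (t := ({a, b, c, d, z} : Finset V))
      (fun x hx => h x hx)
    rw [Set.ncard_coe_finset, h5] at this
    omega
  simp only [Finset.mem_insert, Finset.mem_singleton, not_or] at hes
  have hN : ∀ x, G.Adj v x → x ∈ ({e, a, b, c, d, z} : Finset V) := by
    have h6 : ({e, a, b, c, d, z} : Finset V).card = 6 := by
      rw [Finset.card_insert_of_notMem (by simpa using hes), h5]
    have hsub : (({e, a, b, c, d, z} : Finset V) : Set V) ⊆ G.neighborSet v := by
      intro x hx
      simp only [Finset.coe_insert, Finset.coe_singleton, Set.mem_insert_iff,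
        Set.mem_singleton_iff] at hx
      rcases hx with rfl | rfl | rfl | rfl | rfl | rfl <;> assumption
    have := Set.eq_of_subset_of_ncard_le hsub (by rw [Set.ncard_coe_finset, h6, hv])
    intro x hx
    exact Finset.mem_coe.1 (this ▸ hx)
  have nad : ∀ x y x', G.Adj v x → G.Adj v y → x' ∈ nadj G v x → x ≠ y → x' ≠ y → G.Adj x y := by
    intro x y x' hx hy hx' hxy hn
    exact hadj _ _ hx hy hxy fun h => hn (huniq _ _ _ hx hx' h)
  -- an outer component
  by_cases hout : ∃ x, x ≠ v ∧ ¬ G.Adj v x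
  · obtain ⟨x, hxv, hvx⟩ := hout
    obtain ⟨X, hX, -, hXd, hXs, h4, -⟩ := hF.exists_comp hxv hvx
    have hdis : ∀ y ∈ insert v (G.neighborSet v), y ∉ X := fun y hy hyX => hXd.le_bot ⟨hyX, hy⟩
    have key : ∀ a b c d, G.Adj v a → G.Adj v b → G.Adj v c → G.Adj v d → a ≠ b → a ≠ c → a ≠ d →
        b ≠ c → b ≠ d → c ≠ d → z ≠ a → z ≠ b → z ≠ c → z ≠ d → e ≠ a → e ≠ b → e ≠ c → e ≠ d →
        b ∈ nadj G v a → a ∈ nadj G v b → c ∈ nadj G v d → d ∈ nadj G v c →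
        ((Touch G X {a} ∧ Touch G X {b}) ∨ (Touch G X {c} ∧ Touch G X {d}) ∨
          ∀ x ∈ [a, c, e, z], Touch G X {x}) → IsMinor K7vee G := by
      intro a b c d ha hb hc hd hab hac had hbc hbd hcd hza hzb hzc hzd hea heb hec hed mab mba mdc
        mcd hT
      refine k7vee_of_two_pairs (v := v) (a := a) (b := b) (c := c) (d := d) (e := e) (z := z)
        ?_ hX ?_ ?_ ?_ ?_ ?_ hT
      · simp only [List.nodup_cons, List.mem_cons, List.not_mem_nil, or_false, not_or,
          not_false_eq_true, List.nodup_nil, and_true]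
        have := ha.ne; have := hb.ne; have := hc.ne; have := hd.ne; have := he.ne; have := hz.ne
        have := hes.2.2.2.2
        grind
      · simp only [List.mem_cons, List.not_mem_nil, or_false]
        rintro y (rfl | rfl | rfl | rfl | rfl | rfl | rfl) <;> apply hdis <;> simp [*]
      · simp only [List.mem_cons, List.not_mem_nil, or_false]
        rintro y (rfl | rfl | rfl | rfl | rfl | rfl) <;> assumption
      · simp only [List.mem_cons, List.not_mem_nil, or_false, forall_eq_or_imp, forall_eq]
        exact ⟨⟨nad _ _ _ ha hc mab hac hbc, nad _ _ _ ha hd mab had hbd,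
          nad _ _ _ ha he mab hea.symm heb.symm, nad _ _ _ ha hz mab hza.symm hzb.symm⟩,
          nad _ _ _ hb hc mba hbc hac, nad _ _ _ hb hd mba hbd had,
          nad _ _ _ hb he mba heb.symm hea.symm, nad _ _ _ hb hz mba hzb.symm hza.symm⟩
      · simp only [List.mem_cons, List.not_mem_nil, or_false, forall_eq_or_imp, forall_eq]
        exact ⟨⟨nad _ _ _ hc he mcd hec.symm hed.symm, nad _ _ _ hc hz mcd hzc.symm hzd.symm⟩,
          nad _ _ _ hd he mdc hed.symm hec.symm, nad _ _ _ hd hz mdc hzd.symm hzc.symm⟩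
      · exact (hzadj e he hes.2.2.2.2).symm
    have tch : ∀ y, y ∈ nbr G X → Touch G X {y} := fun y hy => touch_of_mem_nbr hy
    have rest : ∀ p q, (p = a ∨ p = b) → (q = c ∨ q = d) → p ∉ nbr G X → q ∉ nbr G X →
        ∀ x, G.Adj v x → x ≠ p → x ≠ q → Touch G X {x} := by
      intro p q hp hq hpT hqT x hx hxp hxq
      by_contra hxt
      have hxT : x ∉ nbr G X := fun h => hxt (tch _ h)
      have hpv : G.Adj v p := by rcases hp with rfl | rfl <;> assumption
      have hqv : G.Adj v q := by rcases hq with rfl | rfl <;> assumption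
      have hpq : p ≠ q := by grind
      have hd : Disjoint (nbr G X) {x, p, q} := by
        rw [Set.disjoint_left]
        rintro y hy (rfl | rfl | rfl)
        exacts [hxT hy, hpT hy, hqT hy]
      have h3 : ({x, p, q} : Set V).ncard = 3 := by
        rw [Set.ncard_eq_three]
        exact ⟨x, p, q, hxp, hxq, hpq, rfl⟩
      have := Set.ncard_le_ncard (s := nbr G X ∪ {x, p, q}) (t := G.neighborSet v) (by
        rintro y (hy | rfl | rfl | rfl)
        exacts [hXs hy, hx, hpv, hqv])
      rw [Set.ncard_union_eq hd] at this
      omega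
    have k1 := key a b c d ha hb hc hd hab hac had hbc hbd hcd hza hzb hzc hzd hes.1 hes.2.1
      hes.2.2.1 hes.2.2.2.1 mab mba mdc mcd
    by_cases c1 : Touch G X {a} ∧ Touch G X {b}
    · exact hK (k1 (Or.inl c1))
    by_cases c2 : Touch G X {c} ∧ Touch G X {d}
    · exact hK (k1 (Or.inr (Or.inl c2)))
    have hp : a ∉ nbr G X ∨ b ∉ nbr G X := by
      by_contra! h; exact c1 ⟨tch _ h.1, tch _ h.2⟩
    have hq : c ∉ nbr G X ∨ d ∉ nbr G X := by
      by_contra! h; exact c2 ⟨tch _ h.1, tch _ h.2⟩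
    obtain ⟨e1, e2, e3, e4, e5⟩ := hes
    rcases hp with hp | hp <;> rcases hq with hq | hq
    · have r := rest a c (Or.inl rfl) (Or.inl rfl) hp hq
      exact hK (key b a d c hb ha hd hc hab.symm hbd hbc had hac hcd.symm hzb hza hzd hzc e2 e1 e4
        e3 mba mab mcd mdc (Or.inr (Or.inr (by
          simp only [List.mem_cons, List.not_mem_nil, or_false, forall_eq_or_imp, forall_eq]
          exact ⟨r _ hb hab.symm hbc, r _ hd had.symm hcd.symm, r _ he e1 e3, r _ hz hza hzc⟩))))
    · have r := rest a d (Or.inl rfl) (Or.inr rfl) hp hq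
      exact hK (key b a c d hb ha hc hd hab.symm hbc hbd hac had hcd hzb hza hzc hzd e2 e1 e3
        e4 mba mab mdc mcd (Or.inr (Or.inr (by
          simp only [List.mem_cons, List.not_mem_nil, or_false, forall_eq_or_imp, forall_eq]
          exact ⟨r _ hb hab.symm hbd, r _ hc hac.symm hcd, r _ he e1 e4, r _ hz hza hzd⟩))))
    · have r := rest b c (Or.inr rfl) (Or.inl rfl) hp hq
      exact hK (key a b d c ha hb hd hc hab had hac hbd hbc hcd.symm hza hzb hzd hzc e1 e2 e4
        e3 mab mba mcd mdc (Or.inr (Or.inr (by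
          simp only [List.mem_cons, List.not_mem_nil, or_false, forall_eq_or_imp, forall_eq]
          exact ⟨r _ ha hab hac, r _ hd hbd.symm hcd.symm, r _ he e2 e3, r _ hz hzb hzc⟩))))
    · have r := rest b d (Or.inr rfl) (Or.inr rfl) hp hq
      exact hK (k1 (Or.inr (Or.inr (by
          simp only [List.mem_cons, List.not_mem_nil, or_false, forall_eq_or_imp, forall_eq]
          exact ⟨r _ ha hab had, r _ hc hbc.symm hcd, r _ he e2 e4, r _ hz hzb hzd⟩))))
  · push Not at hout
    have hu : (insert v (G.neighborSet v)) = Set.univ := by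
      ext x
      simp only [Set.mem_insert_iff, mem_neighborSet, Set.mem_univ, iff_true]
      by_cases hx : x = v
      · exact Or.inl hx
      · exact Or.inr (hout x hx)
    have hn : Nat.card V = 7 := by
      rw [← Set.ncard_univ, ← hu, Set.ncard_insert_of_notMem hvn, hv]
    refine hK (k7vee_of_ncard_arcs hn ?_)
    unfold defect at hD
    omega

end

section

variable {V : Type} {G : SimpleGraph V}

theorem k7vee_of_degree_seven [Finite V] (hF : FourConn G) {v : V}
    (hv : (G.neighborSet v).ncard = 7) (hout : ∃ x, x ≠ v ∧ ¬ G.Adj v x)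
    (ht : ∀ x, G.Adj v x → 4 ≤ cnbr G v x) (h6 : ∀ x, 6 ≤ (G.neighborSet x).ncard) :
    IsMinor K7vee G := by
  classical
  obtain ⟨e⟩ : Nonempty (S7 ≃ G.neighborSet v) := by
    have : Nat.card (G.neighborSet v) = Nat.card S7 := by
      rw [Nat.card_coe_set_eq, hv, Nat.card_eq_fintype_card, S7.card]
    exact ⟨((Finite.equivFinOfCardEq this).trans (Finite.equivFinOfCardEq rfl).symm).symm⟩
  have hinj : ∀ {i j}, i ≠ j → (e i : V) ≠ e j := fun hij h => hij (e.injective (Subtype.ext h))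
  have hadj : ∀ i, G.Adj v (e i) := fun i => (e i).2
  have hsurj : ∀ x, G.Adj v x → ∃ i, (e i : V) = x := fun x hx => ⟨e.symm ⟨x, hx⟩, by simp⟩
  let N : S7 → Set V := fun i => {(e i : V)}
  let J : S7 → S7 → Bool := fun i j => decide (i ≠ j ∧ ¬ G.Adj (e i) (e j))
  have hW : Wheel G N {v} J := by
    refine ⟨isModel_singleton fun i j h => e.injective (Subtype.ext h), Cn.singleton _, fun i => ?_,
      fun i => ?_, fun i j => ?_, fun i => ?_, fun i j hij h => ?_, fun i => ?_⟩
    · simpa [N] using (hadj i).ne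
    · simpa [N] using hadj i
    · simp only [J, G.adj_comm (e j), ne_comm (a := j)]
    · simp [J]
    · simp only [J, decide_eq_false_iff_not, not_and, not_not] at h
      simpa [N] using h hij
    · have h1 := ncard_nadj (hadj i)
      have h2 := ht _ (hadj i)
      have h3 : (nadj G v (e i)).ncard ≤ 2 := by omega
      obtain ⟨a, b, hab⟩ : ∃ a b, ∀ j, (e j : V) ∈ nadj G v (e i) → j = a ∨ j = b := by
        by_contra! hc
        obtain ⟨j, hj, -⟩ := hc i i
        obtain ⟨k, hk, hkj, -⟩ := hc j j
        obtain ⟨l, hl, hlj, hlk⟩ := hc j k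
        have : ({(e j : V), (e k : V), (e l : V)} : Set V).ncard = 3 :=
          Set.ncard_eq_three.2 ⟨_, _, _, hinj hkj.symm, hinj hlj.symm, hinj hlk.symm, rfl⟩
        have := Set.ncard_le_ncard (s := {(e j : V), (e k : V), (e l : V)})
          (t := nadj G v (e i)) (by rintro y (rfl | rfl | rfl) <;> assumption)
        omega
      refine ⟨a, b, fun j hj => hab j ?_⟩
      simp only [J, decide_eq_true_eq] at hj
      exact ⟨hadj j, hinj hj.1.symm, hj.2⟩
  set U := insert v (G.neighborSet v) with hU
  obtain ⟨x0, hx0, hvx0⟩ := hout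
  have hx0U : x0 ∉ U := by simp [hU, hx0, hvx0]
  have hsub : ∀ x ∉ U, _root_.comp G Uᶜ x ⊆ Uᶜ := fun x _ => comp_subset
  refine hW.finish {X | ∃ x ∉ U, X = _root_.comp G Uᶜ x} ⟨_, x0, hx0U, rfl⟩ ?_ ?_ ?_ ?_ ?_ ?_
  · rintro _ ⟨x, hx, rfl⟩
    exact cn_comp hx
  · rintro _ ⟨x, hx, rfl⟩ i
    exact Set.disjoint_singleton_right.2 fun h => hsub x hx h (Or.inr (hadj i))
  · rintro _ ⟨x, hx, rfl⟩
    exact Set.disjoint_singleton_left.2 fun h => hsub x hx h (Or.inl rfl)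
  · rintro _ ⟨x, hx, rfl⟩ _ ⟨y, hy, rfl⟩ hxy
    rw [Set.disjoint_left]
    intro z hz hz'
    exact hxy ((comp_eq_of_mem hz).symm.trans (comp_eq_of_mem hz'))
  · rintro _ ⟨x, hx, rfl⟩
    obtain ⟨X, -, -, -, hs, h4, rfl⟩ := hF.exists_comp (v := v) (x := x)
      (fun e => hx (by simp [hU, e])) fun e => hx (by simp [hU, e])
    refine h4.trans ?_
    have : nbr G (_root_.comp G Uᶜ x) ⊆
        (fun i => (e i : V)) '' {i | Touch G (_root_.comp G Uᶜ x) (N i)} := by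
      intro y hy
      obtain ⟨i, rfl⟩ := hsurj y (hs hy)
      exact ⟨i, touch_of_mem_nbr hy, rfl⟩
    exact (Set.ncard_le_ncard this).trans (Set.ncard_image_le)
  · rintro i ⟨a, b, hab, ha, hb⟩
    simp only [J, decide_eq_true_eq] at ha hb
    by_cases h : ∃ y ∉ U, G.Adj (e i) y
    · obtain ⟨y, hy, hiy⟩ := h
      exact ⟨_, ⟨y, hy, rfl⟩, y, mem_comp_self hy, e i, rfl, hiy.symm⟩
    · push Not at h
      exfalso
      have hs : G.neighborSet (e i) ∪ {(e i : V), (e a : V), (e b : V)} ⊆ U := by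
        rintro y (hy | rfl | rfl | rfl)
        · by_contra hyU; exact h y hyU hy
        · exact Or.inr (hadj _)
        · exact Or.inr (hadj _)
        · exact Or.inr (hadj _)
      have h1 := Set.ncard_le_ncard hs
      rw [Set.ncard_union_eq, Set.ncard_eq_three.2 ⟨_, _, _, hinj ha.1, hinj hb.1, hinj hab, rfl⟩,
        Set.ncard_insert_of_notMem (by simp), hv] at h1
      · have := h6 (e i)
        omega
      · rw [Set.disjoint_left]
        rintro y hy (rfl | rfl | rfl)
        · exact G.loopless.irrefl _ hy
        · exact ha.2 hy
        · exact hb.2 hy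

end

section

variable {V : Type} {G : SimpleGraph V}

/-- The antipode in the octahedron on `Fin 6`. -/
def opp6 : Fin 6 → Fin 6 := ![1, 0, 3, 2, 5, 4]

theorem exists_octahedron [Finite V] {v : V} (hv : (G.neighborSet v).ncard = 6)
    (ha : ∀ x, G.Adj v x → ∃ y, nadj G v x = {y}) {z : V} (hz : G.Adj v z) :
    ∃ o : Fin 6 → V, Function.Injective o ∧ (∀ x, G.Adj v x ↔ ∃ i, o i = x) ∧
      (∀ i j, G.Adj (o i) (o j) ↔ i ≠ j ∧ j ≠ opp6 i) ∧ o 5 = z := by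
  classical
  have huniq : ∀ x y y', G.Adj v x → y ∈ nadj G v x → y' ∈ nadj G v x → y = y' := by
    intro x y y' hx hy hy'
    obtain ⟨a, h⟩ := ha x hx
    rw [h] at hy hy'
    exact hy.trans hy'.symm
  have hsym : ∀ x y, G.Adj v x → y ∈ nadj G v x → x ∈ nadj G v y :=
    fun x y hx hy => ⟨hx, hy.2.1.symm, fun h => hy.2.2 h.symm⟩
  have hex : ∀ x, G.Adj v x → ∃ y, y ∈ nadj G v x := fun x hx => by
    obtain ⟨y, hy⟩ := ha x hx
    exact ⟨y, by rw [hy]; rfl⟩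
  have fresh : ∀ s : Finset V, s.card < 6 → ∃ x, G.Adj v x ∧ x ∉ s := by
    intro s hs
    by_contra! h
    have := Set.ncard_le_ncard (s := G.neighborSet v) (t := (s : Set V)) (fun x hx => h x hx)
    rw [Set.ncard_coe_finset] at this
    omega
  obtain ⟨z', hz'⟩ := hex z hz
  obtain ⟨y, hy, hys⟩ := fresh {z, z'} (by have := Finset.card_le_two (a := z) (b := z'); omega)
  obtain ⟨y', hy'⟩ := hex y hy
  obtain ⟨x, hx, hxs⟩ := fresh {z, z', y, y'} (by
    have := Finset.card_le_four (a := z) (b := z') (c := y) (d := y'); omega)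
  obtain ⟨x', hx'⟩ := hex x hx
  simp only [Finset.mem_insert, Finset.mem_singleton, not_or] at hys hxs
  let o : Fin 6 → V := ![x, x', y, y', z', z]
  have hpair : ∀ i, o (opp6 i) ∈ nadj G v (o i) := by
    intro i
    fin_cases i
    exacts [hx', hsym _ _ hx hx', hy', hsym _ _ hy hy', hsym _ _ hz hz', hz']
  have hov : ∀ i, G.Adj v (o i) := by
    intro i
    have := (hpair (opp6 i)).1
    fin_cases i <;> exact this
  have hinj : Function.Injective o := by
    have n1 : z ≠ z' := hz'.2.1.symm
    have n2 : y ≠ y' := hy'.2.1.symm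
    have n3 : x ≠ x' := hx'.2.1.symm
    have u1 : ∀ i j, o i = o j → o (opp6 i) = o (opp6 j) := fun i j h =>
      huniq (o i) _ _ (hov i) (hpair i) (by rw [h]; exact hpair j)
    have a1 : y' ≠ z := fun e => hys.2 (u1 3 5 e)
    have a2 : y' ≠ z' := fun e => hys.1 (u1 3 4 e)
    have b1 : x' ≠ z := fun e => hxs.2.1 (u1 1 5 e)
    have b2 : x' ≠ z' := fun e => hxs.1 (u1 1 4 e)
    have b3 : x' ≠ y := fun e => hxs.2.2.2 (u1 1 2 e)
    have b4 : x' ≠ y' := fun e => hxs.2.2.1 (u1 1 3 e)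
    obtain ⟨c1, c2⟩ := hys
    obtain ⟨d1, d2, d3, d4⟩ := hxs
    have : [x, x', y, y', z', z].Nodup := by
      simp only [List.nodup_cons, List.mem_cons, List.not_mem_nil, or_false, not_or,
        not_false_eq_true, List.nodup_nil, and_true]
      exact ⟨⟨n3, d3, d4, d2, d1⟩, ⟨b3, b4, b2, b1⟩, ⟨n2, c2, c1⟩, ⟨a2, a1⟩, n1.symm⟩
    have := List.nodup_iff_injective_get.1 this
    intro i j hij
    refine this ?_
    fin_cases i <;> fin_cases j <;> first | rfl | exact hij
  have hrange : Set.range o = G.neighborSet v := by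
    refine Set.eq_of_subset_of_ncard_le ?_ ?_
    · rintro _ ⟨i, rfl⟩
      exact hov i
    · rw [← Set.image_univ, Set.ncard_image_of_injective _ hinj, Set.ncard_univ, hv]
      simp
  refine ⟨o, hinj, fun x => ?_, fun i j => ?_, rfl⟩
  · exact (Set.ext_iff.1 hrange x).symm
  · constructor
    · intro h
      exact ⟨fun e => h.ne (by rw [e]), fun e => (hpair i).2.2 (e ▸ h)⟩
    · rintro ⟨h1, h2⟩
      by_contra h
      have : o j ∈ nadj G v (o i) := ⟨hov j, fun e => h1 (hinj e).symm, h⟩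
      exact h2 (hinj (huniq _ _ _ (hov i) this (hpair i)))

theorem k2222_of_labelling (g : Fin 8 → V) (hg : Function.Bijective g)
    (h : ∀ i j, G.Adj (g i) (g j) ↔ i.val / 2 ≠ j.val / 2) : Nonempty (G ≃g K2222) := by
  let e : Fin 4 × Fin 2 ≃ V := (finProdFinEquiv (m := 4) (n := 2)).trans (Equiv.ofBijective g hg)
  refine ⟨RelIso.symm ⟨e, fun {a b} => ?_⟩⟩
  change G.Adj (g (finProdFinEquiv (m := 4) (n := 2) a)) (g (finProdFinEquiv (m := 4) (n := 2) b))
    ↔ a.1 ≠ b.1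
  rw [h]
  revert a b
  decide

theorem k7vee_of_twins_pair {v w : V} {o : Fin 6 → V} {X : Set V} (ho : Function.Injective o)
    (hvo : ∀ i, G.Adj v (o i)) (hwo : ∀ i, G.Adj w (o i)) (hvw : v ≠ w)
    (hoo : ∀ i j, i ≠ j → j ≠ opp6 i → G.Adj (o i) (o j)) (hX : Cn G X) (hvX : v ∉ X)
    (hwX : w ∉ X) (hoX : ∀ i, o i ∉ X) (h4 : Touch G X {o 4}) (h5 : Touch G X {o 5}) :
    IsMinor K7vee G := by
  have i1 : Function.Injective (Fin.cons w o : Fin 7 → V) := injective_cons ho fun i => (hwo i).ne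
  have i2 : Function.Injective (Fin.cons v (Fin.cons w o) : Fin 8 → V) := by
    refine injective_cons i1 fun i => ?_
    cases i using Fin.cases with
    | zero => exact hvw
    | succ i => exact (hvo i).ne
  have hB : IsModel G (Fin.cons X (fun i => {(Fin.cons v (Fin.cons w o) : Fin 8 → V) i}) :
      Fin 9 → Set V) := by
    refine (isModel_singleton i2).cons hX fun i => ?_
    rw [Set.disjoint_singleton_right]
    cases i using Fin.cases with
    | zero => exact hvX
    | succ i =>
      cases i using Fin.cases with
      | zero => exact hwX
      | succ i => exact hoX i
  refine k7vee_of_model hB [(0, 7), (0, 8), (1, 3), (1, 4), (1, 5), (1, 6), (1, 7), (1, 8), (2, 3),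
    (2, 4), (2, 5), (2, 6), (2, 7), (2, 8), (3, 5), (3, 6), (3, 7), (3, 8), (4, 5), (4, 6), (4, 7),
    (4, 8), (5, 7), (5, 8), (6, 7), (6, 8)] ?_ ![2, 4, 3, 0, 1, 3, 5, 2, 6] ![3, 4, 7, 5, 1, 6, 8]
    (by decide)
  simp only [List.forall_mem_cons, List.not_mem_nil, false_imp_iff, implies_true, and_true]
  refine ⟨h4, h5, ?_, ?_, ?_, ?_, ?_, ?_, ?_, ?_, ?_, ?_, ?_, ?_, ?_, ?_, ?_, ?_, ?_, ?_, ?_, ?_,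
    ?_, ?_, ?_, ?_⟩ <;> refine ⟨_, rfl, _, rfl, ?_⟩
  · exact hvo 0
  · exact hvo 1
  · exact hvo 2
  · exact hvo 3
  · exact hvo 4
  · exact hvo 5
  · exact hwo 0
  · exact hwo 1
  · exact hwo 2
  · exact hwo 3
  · exact hwo 4
  · exact hwo 5
  · exact hoo 0 2 (by decide) (by decide)
  · exact hoo 0 3 (by decide) (by decide)
  · exact hoo 0 4 (by decide) (by decide)
  · exact hoo 0 5 (by decide) (by decide)
  · exact hoo 1 2 (by decide) (by decide)
  · exact hoo 1 3 (by decide) (by decide)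
  · exact hoo 1 4 (by decide) (by decide)
  · exact hoo 1 5 (by decide) (by decide)
  · exact hoo 2 4 (by decide) (by decide)
  · exact hoo 2 5 (by decide) (by decide)
  · exact hoo 3 4 (by decide) (by decide)
  · exact hoo 3 5 (by decide) (by decide)

theorem k7vee_of_five_common {v w x : V} {o : Fin 6 → V} (ho : Function.Injective o)
    (hvo : ∀ i, G.Adj v (o i)) (hwo : ∀ i, i ≠ 5 → G.Adj w (o i)) (hvw : v ≠ w) (hwo5 : w ≠ o 5)
    (hoo : ∀ i j, i ≠ j → j ≠ opp6 i → G.Adj (o i) (o j)) (hxv : x ≠ v) (hxw : x ≠ w)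
    (hxo : ∀ i, x ≠ o i) (hx : ∀ i : Fin 6, i.val < 4 → G.Adj x (o i)) : IsMinor K7vee G := by
  have i0 : Function.Injective (Fin.cons x o : Fin 7 → V) := injective_cons ho hxo
  have i1 : Function.Injective (Fin.cons w (Fin.cons x o) : Fin 8 → V) := by
    refine injective_cons i0 fun i => ?_
    cases i using Fin.cases with
    | zero => exact hxw.symm
    | succ i =>
      by_cases hi : i = 5
      · rw [hi]; exact hwo5
      · exact (hwo i hi).ne
  have i2 : Function.Injective (Fin.cons v (Fin.cons w (Fin.cons x o)) : Fin 9 → V) := by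
    refine injective_cons i1 fun i => ?_
    cases i using Fin.cases with
    | zero => exact hvw
    | succ i =>
      cases i using Fin.cases with
      | zero => exact hxv.symm
      | succ i => exact (hvo i).ne
  refine k7vee_of_model (isModel_singleton i2) [(0, 3), (0, 4), (0, 5), (0, 6), (0, 7), (0, 8),
    (1, 3), (1, 4), (2, 5), (2, 6), (3, 5), (3, 6), (3, 7), (3, 8), (4, 5), (4, 6), (4, 7), (4, 8),
    (5, 7), (5, 8), (6, 7), (6, 8)] ?_ ![2, 3, 4, 3, 5, 4, 6, 0, 1] ![7, 8, 0, 3, 5, 4, 6]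
    (by decide)
  simp only [List.forall_mem_cons, List.not_mem_nil, false_imp_iff, implies_true, and_true]
  refine ⟨?_, ?_, ?_, ?_, ?_, ?_, ?_, ?_, ?_, ?_, ?_, ?_, ?_, ?_, ?_, ?_, ?_, ?_, ?_, ?_, ?_, ?_⟩ <;>
    refine ⟨_, rfl, _, rfl, ?_⟩
  · exact hvo 0
  · exact hvo 1
  · exact hvo 2
  · exact hvo 3
  · exact hvo 4
  · exact hvo 5
  · exact hwo 0 (by decide)
  · exact hwo 1 (by decide)
  · exact hx 2 (by decide)
  · exact hx 3 (by decide)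
  · exact hoo 0 2 (by decide) (by decide)
  · exact hoo 0 3 (by decide) (by decide)
  · exact hoo 0 4 (by decide) (by decide)
  · exact hoo 0 5 (by decide) (by decide)
  · exact hoo 1 2 (by decide) (by decide)
  · exact hoo 1 3 (by decide) (by decide)
  · exact hoo 1 4 (by decide) (by decide)
  · exact hoo 1 5 (by decide) (by decide)
  · exact hoo 2 4 (by decide) (by decide)
  · exact hoo 2 5 (by decide) (by decide)
  · exact hoo 3 4 (by decide) (by decide)
  · exact hoo 3 5 (by decide) (by decide)

end

section

variable {V : Type} {G : SimpleGraph V}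

theorem Cn.exists_trim {P A B : Set V} (hP : Cn G P) (hA : (P ∩ A).Nonempty)
    (hB : (P ∩ B).Nonempty) : ∃ Q ⊆ P, Cn G Q ∧ (∃ a, Q ∩ A = {a}) ∧ (Q ∩ B).Nonempty := by
  obtain ⟨y, hyP, hyB⟩ := hB
  obtain ⟨x, hxP, hxA⟩ := hA
  by_cases hyA : y ∈ A
  · exact ⟨{y}, by simpa using hyP, Cn.singleton y, ⟨y, by simpa using hyA⟩, y, rfl, hyB⟩
  have hy : y ∈ P \ A := ⟨hyP, hyA⟩
  have hCP : _root_.comp G (P \ A) y ⊆ P \ A := comp_subset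
  obtain ⟨a, ha, b, hb, hab⟩ := hP.2 (_root_.comp G (P \ A) y) (hCP.trans Set.sdiff_subset)
    ⟨y, mem_comp_self hy⟩ ⟨x, hxP, fun h => (hCP h).2 hxA⟩
  have hbA : b ∈ A := by
    by_contra h
    exact hb.2 (comp_closed ha ⟨hb.1, h⟩ hab)
  refine ⟨_root_.comp G (P \ A) y ∪ {b}, Set.union_subset (hCP.trans Set.sdiff_subset)
    (by simpa using hb.1), (cn_comp hy).union_touch (Cn.singleton b) ⟨a, ha, b, rfl, hab⟩,
    ⟨b, ?_⟩, y, Or.inl (mem_comp_self hy), hyB⟩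
  ext z
  simp only [Set.mem_inter_iff, Set.mem_union, Set.mem_singleton_iff]
  constructor
  · rintro ⟨h | h, hz⟩
    · exact absurd hz (hCP h).2
    · exact h
  · rintro rfl
    exact ⟨Or.inr rfl, hbA⟩

theorem Cn.exists_trim_both {P A B : Set V} (hP : Cn G P) (hA : (P ∩ A).Nonempty)
    (hB : (P ∩ B).Nonempty) :
    ∃ Q ⊆ P, Cn G Q ∧ (∃ a, Q ∩ A = {a}) ∧ ∃ b, Q ∩ B = {b} := by
  obtain ⟨Q, hQP, hQ, ⟨a, ha⟩, hQB⟩ := hP.exists_trim hA hB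
  obtain ⟨R, hRQ, hR, hb, c, hcR, hcA⟩ := hQ.exists_trim hQB (ha ▸ Set.singleton_nonempty a)
  refine ⟨R, hRQ.trans hQP, hR, ⟨a, ?_⟩, hb⟩
  have h : R ∩ A ⊆ {a} := fun z hz => ha ▸ (⟨hRQ hz.1, hz.2⟩ : z ∈ Q ∩ A)
  refine h.antisymm ?_
  have : c = a := h ⟨hcR, hcA⟩
  rintro z rfl
  exact ⟨this ▸ hcR, this ▸ hcA⟩

/-- A shortest linkage meets each end once and covers all common terminals. -/
theorem Linked.tight [Finite V] {A B : Set V} {k : ℕ} (h : Linked G A B k)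
    (hc : (A ∩ B).ncard ≤ k) : ∃ P : Fin k → Set V, IsModel G P ∧
      (∀ i, ∃ a, P i ∩ A = {a}) ∧ (∀ i, ∃ b, P i ∩ B = {b}) ∧ A ∩ B ⊆ ⋃ i, P i := by
  classical
  obtain ⟨P, ⟨hP, hAB⟩, hmin⟩ := (measure fun P : Fin k → Set V => ∑ i, (P i).ncard).wf.has_min
    {P | IsModel G P ∧ ∀ i, (P i ∩ A).Nonempty ∧ (P i ∩ B).Nonempty} h
  have key : ∀ i Q, Cn G Q → (Q ∩ A).Nonempty → (Q ∩ B).Nonempty →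
      (∀ j, j ≠ i → Disjoint Q (P j)) → (P i).ncard ≤ Q.ncard := by
    intro i Q hQ hA hB hd
    have := hmin (Function.update P i Q) ⟨⟨fun j => ?_, fun j l hjl => ?_⟩, fun j => ?_⟩
    · have h2 : ∑ j, (Function.update P i Q j).ncard
          = Q.ncard + ∑ j ∈ Finset.univ \ {i}, (P j).ncard := by
        have h3 := Finset.sum_update_of_mem (Finset.mem_univ i) (fun j => (P j).ncard) Q.ncard
        rw [← h3]
        refine Finset.sum_congr rfl fun j _ => ?_
        by_cases hj : j = i
        · subst hj; simp
        · simp [Function.update_of_ne hj]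
      have h4 : ∑ j, (P j).ncard = (P i).ncard + ∑ j ∈ Finset.univ \ {i}, (P j).ncard :=
        (Finset.add_sum_erase _ (fun j => (P j).ncard) (Finset.mem_univ i)).symm.trans
          (by rw [Finset.sdiff_singleton_eq_erase])
      change ¬ (∑ j, (Function.update P i Q j).ncard < ∑ j, (P j).ncard) at this
      omega
    · by_cases hj : j = i
      · subst hj; simpa using hQ
      · simpa [Function.update_of_ne hj] using hP.1 j
    · by_cases hj : j = i
      · subst hj
        simpa [Function.update_of_ne hjl.symm] using hd l hjl.symm
      · by_cases hl : l = i
        · subst hl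
          simpa [Function.update_of_ne hj] using (hd j hj).symm
        · simpa [Function.update_of_ne hj, Function.update_of_ne hl] using hP.2 j l hjl
    · by_cases hj : j = i
      · subst hj; simpa using ⟨hA, hB⟩
      · simpa [Function.update_of_ne hj] using hAB j
  have htrim : ∀ i, (∃ a, P i ∩ A = {a}) ∧ ∃ b, P i ∩ B = {b} := by
    intro i
    obtain ⟨Q, hQP, hQ, ha, hb⟩ := (hP.1 i).exists_trim_both (hAB i).1 (hAB i).2
    have h1 := key i Q hQ (by obtain ⟨a, ha⟩ := ha; simp [ha])
      (by obtain ⟨a, ha⟩ := hb; simp [ha]) fun j hj => (hP.2 i j hj.symm).mono_left hQP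
    rw [← Set.eq_of_subset_of_ncard_le hQP h1]
    exact ⟨ha, hb⟩
  refine ⟨P, hP, fun i => (htrim i).1, fun i => (htrim i).2, fun z hz => ?_⟩
  by_contra hzP
  simp only [Set.mem_iUnion, not_exists] at hzP
  have h1 : ∀ i, ∃ p ∈ A ∩ B, P i = {p} := by
    intro i
    have h2 := key i {z} (Cn.singleton z) ⟨z, rfl, hz.1⟩ ⟨z, rfl, hz.2⟩
      fun j _ => Set.disjoint_singleton_left.2 (hzP j)
    rw [Set.ncard_singleton] at h2
    have h3 := (hP.1 i).1.ncard_pos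
    obtain ⟨p, hp⟩ := Set.ncard_eq_one.1 (le_antisymm h2 h3)
    obtain ⟨⟨x, hx1, hx2⟩, y, hy1, hy2⟩ := hAB i
    rw [hp] at hx1 hy1
    obtain rfl : x = p := hx1
    obtain rfl : y = x := hy1
    exact ⟨y, ⟨hx2, hy2⟩, hp⟩
  choose p hp hPp using h1
  have hinj : Function.Injective p := by
    intro i j hij
    by_contra hne
    have := hP.2 i j hne
    rw [hPp, hPp, hij] at this
    simp at this
  have hzr : z ∉ Set.range p := by
    rintro ⟨i, rfl⟩
    exact hzP i (by rw [hPp]; rfl)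
  have h2 : (insert z (Set.range p)).ncard = k + 1 := by
    rw [Set.ncard_insert_of_notMem hzr, ← Set.image_univ, Set.ncard_image_of_injective _ hinj,
      Set.ncard_univ, Nat.card_eq_fintype_card, Fintype.card_fin]
  have h3 : insert z (Set.range p) ⊆ A ∩ B := by
    rintro x (rfl | ⟨i, rfl⟩)
    exacts [hz, hp i]
  have := Set.ncard_le_ncard h3
  omega

theorem octahedron_hub : ∀ a b c d : Fin 6, a ≠ b → a ≠ c → a ≠ d → b ≠ c → b ≠ d → c ≠ d →
    ∃ x y : Fin 6, (∀ k : Fin 4, x ≠ ![a, b, c, d] k ∧ y ≠ ![a, b, c, d] k) ∧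
      (x = y ∨ (x ≠ y ∧ y ≠ opp6 x)) ∧ ∀ k : Fin 4, ![a, b, c, d] k ≠ opp6 x ∨
        ![a, b, c, d] k ≠ opp6 y := by
  decide +kernel

/-- Attaching `x` to the `s`-th and `y` to the `t`-th of four vertices of an octahedron makes them
pairwise adjacent. -/
def joinsUp (p : Fin 4 → Fin 6) (x y : Fin 6) (s t : Fin 4) : Bool :=
  decide (p s ≠ opp6 x) && decide (p t ≠ opp6 y) && decide (∀ i j : Fin 4, i ≠ j →
    p j ≠ opp6 (p i) ∨ (i = s ∧ p j ≠ opp6 x) ∨ (j = s ∧ p i ≠ opp6 x) ∨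
      (i = t ∧ p j ≠ opp6 y) ∨ (j = t ∧ p i ≠ opp6 y))

theorem octahedron_join : ∀ a b c d : Fin 6, a ≠ b → a ≠ c → a ≠ d → b ≠ c → b ≠ d → c ≠ d →
    ∃ x y : Fin 6, x ≠ y ∧ (∀ k : Fin 4, x ≠ ![a, b, c, d] k ∧ y ≠ ![a, b, c, d] k) ∧
      ∃ s t : Fin 4, joinsUp ![a, b, c, d] x y s t = true := by
  decide +kernel

end

section

variable {V : Type} {G : SimpleGraph V}

/-- `G` with all edges at `v` and `w` removed. -/
def isolate (G : SimpleGraph V) (v w : V) : SimpleGraph V where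
  Adj a b := G.Adj a b ∧ a ≠ v ∧ a ≠ w ∧ b ≠ v ∧ b ≠ w
  symm := ⟨fun _ _ h => ⟨h.1.symm, h.2.2.2.1, h.2.2.2.2, h.2.1, h.2.2.1⟩⟩
  loopless := ⟨fun _ h => h.1.ne rfl⟩

theorem isolate_le {v w : V} : isolate G v w ≤ G := fun _ _ h => h.1

theorem Cn.isolate {v w : V} {S : Set V} (h : Cn G S) (hv : v ∉ S) (hw : w ∉ S) :
    Cn (isolate G v w) S := by
  refine ⟨h.1, fun X hX h1 h2 => ?_⟩
  obtain ⟨a, ha, b, hb, hab⟩ := h.2 X hX h1 h2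
  exact ⟨a, ha, b, hb, hab, fun e => hv (e ▸ hX ha), fun e => hw (e ▸ hX ha),
    fun e => hv (e ▸ hb.1), fun e => hw (e ▸ hb.1)⟩

theorem Cn.eq_singleton {S : Set V} {v : V} (h : Cn G S) (hv : v ∈ S) (hn : ∀ y, ¬ G.Adj v y) :
    S = {v} := by
  by_contra hne
  obtain ⟨a, ha, b, -, hab⟩ := h.2 {v} (by simpa using hv) ⟨v, rfl⟩ (by
    by_contra h0
    rw [Set.not_nonempty_iff_eq_empty, Set.sdiff_eq_empty] at h0
    exact hne (h0.antisymm (by simpa using hv)))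
  rw [Set.mem_singleton_iff.1 ha] at hab
  exact hn b hab

theorem FourConn.linked [Finite V] (hF : FourConn G) {v w : V} (hvw : v ≠ w)
    (hnvw : ¬ G.Adj v w) : Linked (isolate G v w) (G.neighborSet v) (G.neighborSet w) 4 := by
  refine menger 4 _ _ fun S hS => ?_
  set U : Set V := (S ∪ {w}) \ {v} with hU
  have hvU : v ∈ Uᶜ := by simp [hU]
  set X := _root_.comp G Uᶜ v with hX
  have hXn : Cn G X := cn_comp hvU
  have hvX : v ∈ X := mem_comp_self hvU
  have hsub : nbr G X ⊆ U := nbr_comp_subset'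
  have hXU : X ⊆ Uᶜ := comp_subset
  have hwX : w ∉ X := fun h => hXU h (by simp [hU, hvw.symm])
  by_cases hw : w ∈ nbr G X
  · exfalso
    obtain ⟨-, x, hx, hxw⟩ := hw
    have hxv : x ≠ v := by rintro rfl; exact hnvw hxw
    have hxD : x ∈ X \ {v} := ⟨hx, hxv⟩
    have hD : _root_.comp G (X \ {v}) x ⊆ X \ {v} := comp_subset
    obtain ⟨a, ha, b, hb, hab⟩ := hXn.2 (_root_.comp G (X \ {v}) x) (hD.trans Set.sdiff_subset)
      ⟨x, mem_comp_self hxD⟩ ⟨v, hvX, fun h => (hD h).2 rfl⟩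
    have hbv : b = v := by
      by_contra h
      exact hb.2 (comp_closed ha ⟨hb.1, h⟩ hab)
    subst hbv
    obtain ⟨z, hz, hzS⟩ := hS (_root_.comp G (X \ {b}) x)
      ((cn_comp hxD).isolate (fun h => (hD h).2 rfl) fun h => hwX (hD h).1)
      ⟨a, ha, hab.symm⟩ ⟨x, mem_comp_self hxD, hxw.symm⟩
    exact hXU (hD hz).1 ⟨Or.inl hzS, (hD hz).2⟩
  · have h1 : nbr G X ⊆ S \ {w} := by
      intro y hy
      have hyw : y ≠ w := by rintro rfl; exact hw hy
      rcases (hsub hy).1 with h | h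
      · exact ⟨h, hyw⟩
      · exact absurd h hyw
    have h2 := hF.four_le ⟨v, hvX⟩ h1 hwX (by simp)
    exact h2.trans (Set.ncard_le_ncard (h1.trans Set.sdiff_subset))

theorem FourConn.tight_linkage [Finite V] (hF : FourConn G) {v w : V} (hvw : v ≠ w)
    (hnvw : ¬ G.Adj v w) (hc : (G.neighborSet v ∩ G.neighborSet w).ncard ≤ 4) :
    ∃ P : Fin 4 → Set V, IsModel G P ∧ (∀ i, v ∉ P i) ∧ (∀ i, w ∉ P i) ∧
      (∀ i, ∃ a, P i ∩ G.neighborSet v = {a}) ∧ (∀ i, ∃ b, P i ∩ G.neighborSet w = {b}) ∧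
      G.neighborSet v ∩ G.neighborSet w ⊆ ⋃ i, P i := by
  obtain ⟨P, hP, ha, hb, hcov⟩ := (hF.linked hvw hnvw).tight hc
  refine ⟨P, ⟨fun i => (hP.1 i).mono_graph isolate_le, hP.2⟩, fun i hi => ?_, fun i hi => ?_,
    ha, hb, hcov⟩
  · have := (hP.1 i).eq_singleton hi fun y h => h.2.1 rfl
    obtain ⟨a, h⟩ := ha i
    have h2 : a ∈ P i ∩ G.neighborSet v := h ▸ rfl
    rw [this] at h2
    obtain ⟨rfl, h3⟩ := h2
    exact h3.ne rfl
  · have := (hP.1 i).eq_singleton hi fun y h => h.2.2.1 rfl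
    obtain ⟨a, h⟩ := hb i
    have h2 : a ∈ P i ∩ G.neighborSet w := h ▸ rfl
    rw [this] at h2
    obtain ⟨rfl, h3⟩ := h2
    exact h3.ne rfl

theorem k7vee_of_octahedral_linkage {v w : V} {o o' : Fin 6 → V} (hvw : v ≠ w)
    (hv : ∀ x, G.Adj v x ↔ ∃ i, o i = x) (hw : ∀ x, G.Adj w x ↔ ∃ i, o' i = x)
    (ho : Function.Injective o) (ho' : Function.Injective o')
    (hnvw : ¬ G.Adj v w) (hoo : ∀ i j, i ≠ j → j ≠ opp6 i → G.Adj (o i) (o j))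
    (hoo' : ∀ i j, i ≠ j → j ≠ opp6 i → G.Adj (o' i) (o' j)) {P : Fin 4 → Set V}
    (hP : IsModel G P) (hvP : ∀ i, v ∉ P i) (hwP : ∀ i, w ∉ P i)
    (ha : ∀ i, ∃ a, P i ∩ G.neighborSet v = {a}) (hb : ∀ i, ∃ b, P i ∩ G.neighborSet w = {b})
    (hcov : G.neighborSet v ∩ G.neighborSet w ⊆ ⋃ i, P i) : IsMinor K7vee G := by
  have hvo : ∀ i, G.Adj v (o i) := fun i => (hv _).2 ⟨i, rfl⟩
  have hwo : ∀ i, G.Adj w (o' i) := fun i => (hw _).2 ⟨i, rfl⟩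
  have label : ∀ (v : V) (o : Fin 6 → V), (∀ x, G.Adj v x ↔ ∃ i, o i = x) →
      (∀ i, ∃ a, P i ∩ G.neighborSet v = {a}) → Function.Injective o →
      ∃ p : Fin 4 → Fin 6, Function.Injective p ∧ (∀ i, o (p i) ∈ P i) ∧
        (∀ i j, o j ∈ P i → j = p i) := by
    intro v o hv ha ho
    choose a ha using ha
    have h1 : ∀ i, a i ∈ P i ∩ G.neighborSet v := fun i => by rw [ha]; rfl
    have h2 : ∀ i, ∃ j, o j = a i := fun i => (hv _).1 (h1 i).2
    choose p hp using h2
    refine ⟨p, fun i j hij => ?_, fun i => hp i ▸ (h1 i).1, fun i j hj => ho ?_⟩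
    · by_contra hne
      refine Set.disjoint_left.1 (hP.2 i j hne) (h1 i).1 ?_
      rw [← hp i, hij, hp j]
      exact (h1 j).1
    · have h3 : o j ∈ P i ∩ G.neighborSet v := ⟨hj, (hv _).2 ⟨j, rfl⟩⟩
      rw [ha] at h3
      rw [hp i]
      exact h3
  obtain ⟨p, hpi, hp, hp'⟩ := label v o hv ha ho
  obtain ⟨q, hqi, hq, hq'⟩ := label w o' hw hb ho'
  have vec : ∀ p : Fin 4 → Fin 6, ![p 0, p 1, p 2, p 3] = p := by
    intro p; ext i; fin_cases i <;> rfl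
  have n01 : (0 : Fin 4) ≠ 1 := by decide
  have n02 : (0 : Fin 4) ≠ 2 := by decide
  have n03 : (0 : Fin 4) ≠ 3 := by decide
  have n12 : (1 : Fin 4) ≠ 2 := by decide
  have n13 : (1 : Fin 4) ≠ 3 := by decide
  have n23 : (2 : Fin 4) ≠ 3 := by decide
  obtain ⟨x, y, hxy, hxy', hhub⟩ := octahedron_hub (p 0) (p 1) (p 2) (p 3) (hpi.ne n01)
    (hpi.ne n02) (hpi.ne n03) (hpi.ne n12) (hpi.ne n13) (hpi.ne n23)
  obtain ⟨x', y', hne', hxyq, s, t, hj⟩ := octahedron_join (q 0) (q 1) (q 2) (q 3) (hqi.ne n01)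
    (hqi.ne n02) (hqi.ne n03) (hqi.ne n12) (hqi.ne n13) (hqi.ne n23)
  rw [vec] at hxy hhub hxyq hj
  simp only [joinsUp, Bool.and_eq_true, decide_eq_true_eq] at hj
  obtain ⟨⟨hs, ht⟩, hj⟩ := hj
  have oP : ∀ i z, (∀ k, z ≠ p k) → o z ∉ P i := fun i z h hz => h i (hp' i z hz)
  have oP' : ∀ i z, (∀ k, z ≠ q k) → o' z ∉ P i := fun i z h hz => h i (hq' i z hz)
  have oo' : ∀ z z', (∀ k, z ≠ p k) → o z ≠ o' z' := by
    intro z z' h e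
    obtain ⟨i, hi⟩ := Set.mem_iUnion.1 (hcov ⟨hvo z, e ▸ hwo z'⟩)
    exact oP i z h hi
  have hxp : ∀ k, x ≠ p k := fun k => (hxy k).1
  have hyp : ∀ k, y ≠ p k := fun k => (hxy k).2
  have hxq : ∀ k, x' ≠ q k := fun k => (hxyq k).1
  have hyq : ∀ k, y' ≠ q k := fun k => (hxyq k).2
  have hY : Cn G {o x, o y} := by
    rcases hxy' with rfl | ⟨h1, h2⟩
    · simpa using Cn.singleton (o x)
    · exact Cn.pair (hoo _ _ h1 h2)
  set E : Fin 4 → Set V := fun i => {z | (i = s ∧ z = o' x') ∨ (i = t ∧ z = o' y')} with hE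
  set Q : Fin 4 → Set V := fun i => P i ∪ E i with hQ
  have hQn : ∀ i, Cn G (Q i) := by
    intro i
    refine ⟨(hP.1 i).1.mono Set.subset_union_left, ?_⟩
    have key : ∀ z ∈ E i, G.Adj z (o' (q i)) := by
      rintro z (⟨rfl, rfl⟩ | ⟨rfl, rfl⟩)
      · exact hoo' _ _ (hxq _) hs
      · exact hoo' _ _ (hyq _) ht
    have h := Cn.union_star (hP.1 i) (B := fun z : E i => {z.1}) (fun z => Cn.singleton _)
      fun z => Or.inl ⟨o' (q i), hq i, z.1, rfl, (key z z.2).symm⟩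
    have h2 : Q i = P i ∪ ⋃ z : E i, {z.1} := by simp [hQ]
    rw [h2]
    exact h.2
  have hEP : ∀ i j z, z ∈ E i → z ∉ P j := by
    rintro i j z (⟨-, rfl⟩ | ⟨-, rfl⟩)
    exacts [oP' j _ hxq, oP' j _ hyq]
  have hQd : ∀ i j, i ≠ j → Disjoint (Q i) (Q j) := by
    intro i j hij
    rw [Set.disjoint_left]
    rintro z (hz | hz) (hz' | hz')
    · exact Set.disjoint_left.1 (hP.2 i j hij) hz hz'
    · exact hEP j i z hz' hz
    · exact hEP i j z hz hz'
    · rcases hz with ⟨rfl, rfl⟩ | ⟨rfl, rfl⟩ <;> rcases hz' with ⟨h1, h2⟩ | ⟨h1, h2⟩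
      · exact hij h1.symm
      · exact hne' (ho' h2)
      · exact hne' (ho' h2.symm)
      · exact hij h1.symm
  have hvE : ∀ i, v ∉ E i := by
    rintro i (⟨-, rfl⟩ | ⟨-, rfl⟩)
    exacts [hnvw (hwo _).symm, hnvw (hwo _).symm]
  have hwE : ∀ i, w ∉ E i := by
    rintro i (⟨-, h⟩ | ⟨-, h⟩)
    · have := hwo x'
      rw [← h] at this
      exact this.ne rfl
    · have := hwo y'
      rw [← h] at this
      exact this.ne rfl
  have hYQ : ∀ i, Disjoint {o x, o y} (Q i) := by
    intro i
    rw [Set.disjoint_left]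
    rintro z (rfl | rfl) (hz | ⟨-, hz⟩ | ⟨-, hz⟩)
    · exact oP i _ hxp hz
    · exact oo' _ _ hxp hz
    · exact oo' _ _ hxp hz
    · exact oP i _ hyp hz
    · exact oo' _ _ hyp hz
    · exact oo' _ _ hyp hz
  have m1 : IsModel G (Fin.cons {o x, o y} Q) := IsModel.cons ⟨hQn, hQd⟩ hY hYQ
  have m2 : IsModel G (Fin.cons {v} (Fin.cons {o x, o y} Q)) := by
    refine IsModel.cons m1 (Cn.singleton v) fun i => ?_
    rw [Set.disjoint_singleton_left]
    cases i using Fin.cases with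
    | zero =>
      rintro (h | h)
      exacts [(hvo x).ne h, (hvo y).ne h]
    | succ i =>
      rintro (h | h)
      exacts [hvP i h, hvE i h]
  have m3 : IsModel G (Fin.cons {w} (Fin.cons {v} (Fin.cons {o x, o y} Q))) := by
    refine IsModel.cons m2 (Cn.singleton w) fun i => ?_
    rw [Set.disjoint_singleton_left]
    cases i using Fin.cases with
    | zero => exact fun h => hvw (Set.mem_singleton_iff.1 h).symm
    | succ i =>
      cases i using Fin.cases with
      | zero =>
        rintro (h | h)
        exacts [hnvw (h ▸ hvo x), hnvw (h ▸ hvo y)]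
      | succ i =>
        rintro (h | h)
        exacts [hwP i h, hwE i h]
  have tvQ : ∀ i, Touch G {v} (Q i) := fun i =>
    ⟨v, rfl, o (p i), Or.inl (hp i), hvo _⟩
  have twQ : ∀ i, Touch G {w} (Q i) := fun i =>
    ⟨w, rfl, o' (q i), Or.inl (hq i), hwo _⟩
  have tvY : Touch G {v} {o x, o y} := ⟨v, rfl, o x, Or.inl rfl, hvo _⟩
  have tYQ : ∀ i, Touch G {o x, o y} (Q i) := by
    intro i
    rcases hhub i with h | h
    · exact ⟨o x, Or.inl rfl, o (p i), Or.inl (hp i), hoo _ _ (hxp i) h⟩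
    · exact ⟨o y, Or.inr rfl, o (p i), Or.inl (hp i), hoo _ _ (hyp i) h⟩
  have tQQ : ∀ i j, i ≠ j → Touch G (Q i) (Q j) := by
    intro i j hij
    rcases hj i j hij with h | ⟨rfl, h⟩ | ⟨rfl, h⟩ | ⟨rfl, h⟩ | ⟨rfl, h⟩
    · exact ⟨o' (q i), Or.inl (hq i), o' (q j), Or.inl (hq j), hoo' _ _ (hqi.ne hij) h⟩
    · exact ⟨o' x', Or.inr (Or.inl ⟨rfl, rfl⟩), o' (q j), Or.inl (hq j), hoo' _ _ (hxq j) h⟩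
    · exact ⟨o' (q i), Or.inl (hq i), o' x', Or.inr (Or.inl ⟨rfl, rfl⟩),
        (hoo' _ _ (hxq i) h).symm⟩
    · exact ⟨o' y', Or.inr (Or.inr ⟨rfl, rfl⟩), o' (q j), Or.inl (hq j), hoo' _ _ (hyq j) h⟩
    · exact ⟨o' (q i), Or.inl (hq i), o' y', Or.inr (Or.inr ⟨rfl, rfl⟩),
        (hoo' _ _ (hyq i) h).symm⟩
  refine k7vee_of_cover (by simp) m3 0 1 2 fun i j hij hj0 => ?_
  cases j using Fin.cases with
  | zero => exact absurd rfl hj0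
  | succ j =>
  cases i using Fin.cases with
  | zero =>
    cases j using Fin.cases with
    | zero => exact Or.inr ⟨rfl, Or.inl rfl⟩
    | succ j =>
      cases j using Fin.cases with
      | zero => exact Or.inr ⟨rfl, Or.inr rfl⟩
      | succ j => exact Or.inl (twQ j)
  | succ i =>
    left
    cases i using Fin.cases with
    | zero =>
      cases j using Fin.cases with
      | zero => exact absurd rfl hij
      | succ j =>
        cases j using Fin.cases with
        | zero => exact tvY
        | succ j => exact tvQ j
    | succ i =>
      cases i using Fin.cases with
      | zero =>
        cases j using Fin.cases with
        | zero => exact tvY.symm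
        | succ j =>
          cases j using Fin.cases with
          | zero => exact absurd rfl hij
          | succ j => exact tYQ j
      | succ i =>
        cases j using Fin.cases with
        | zero => exact (tvQ i).symm
        | succ j =>
          cases j using Fin.cases with
          | zero => exact (tYQ i).symm
          | succ j => exact tQQ i j fun e => hij (by rw [e])

end

section

variable {V : Type} {G : SimpleGraph V}

theorem FourConn.deleteEdge [Finite V] (hF : FourConn G) {u v : V} (h4 : 4 ≤ cnbr G u v) :
    FourConn (G.deleteEdges {s(u, v)}) := by
  have adj : ∀ x y, G.Adj x y → ¬ (x = u ∧ y = v) → ¬ (x = v ∧ y = u) →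
      (G.deleteEdges {s(u, v)}).Adj x y := by
    intro x y h h1 h2
    simp only [deleteEdges_adj, Set.mem_singleton_iff, Sym2.eq_iff]
    tauto
  have le : ∀ X, nbr (G.deleteEdges {s(u, v)}) X ⊆ nbr G X := by
    rintro X y ⟨hy, x, hx, hxy⟩
    exact ⟨hy, x, hx, (deleteEdges_le _) hxy⟩
  have key : ∀ a b, s(a, b) = s(u, v) → ∀ X : Set V, a ∈ X → b ∉ X →
      b ∉ nbr (G.deleteEdges {s(u, v)}) X → 4 ≤ (nbr (G.deleteEdges {s(u, v)}) X).ncard := by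
    intro a b hab X ha hb hbn
    have hs : G.commonNeighbors a b = G.commonNeighbors u v := by
      rw [Sym2.eq_iff] at hab
      rcases hab with ⟨rfl, rfl⟩ | ⟨rfl, rfl⟩
      · rfl
      · exact commonNeighbors_symm _ _ _
    have hne : ∀ x y, G.Adj x y → (x ≠ a ∧ x ≠ b ∨ y ≠ a ∧ y ≠ b) →
        (G.deleteEdges {s(u, v)}).Adj x y := by
      intro x y hxy hne
      simp only [deleteEdges_adj, Set.mem_singleton_iff, ← hab, Sym2.eq_iff]
      refine ⟨hxy, ?_⟩
      rintro (⟨rfl, rfl⟩ | ⟨rfl, rfl⟩) <;> simp at hne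
    refine (h4.trans_eq (by unfold cnbr; rw [← hs])).trans (Set.ncard_le_ncard fun c hc => ?_)
    obtain ⟨h1, h2⟩ := hc
    have hca : c ≠ a := fun e => h1.ne e.symm
    have hcb : c ≠ b := fun e => h2.ne e.symm
    refine ⟨fun hcX => hbn ⟨hb, c, hcX, hne _ _ h2.symm (Or.inl ⟨hca, hcb⟩)⟩, a, ha,
      hne _ _ h1 (Or.inr ⟨hca, hcb⟩)⟩
  intro X hX hXu
  by_cases h1 : u ∈ X ∧ v ∉ X ∧ v ∉ nbr (G.deleteEdges {s(u, v)}) X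
  · exact key u v rfl X h1.1 h1.2.1 h1.2.2
  by_cases h2 : v ∈ X ∧ u ∉ X ∧ u ∉ nbr (G.deleteEdges {s(u, v)}) X
  · exact key v u Sym2.eq_swap X h2.1 h2.2.1 h2.2.2
  have : nbr (G.deleteEdges {s(u, v)}) X = nbr G X := by
    refine (le X).antisymm ?_
    rintro y ⟨hy, x, hx, hxy⟩
    by_cases e1 : x = u ∧ y = v
    · obtain ⟨rfl, rfl⟩ := e1
      by_contra h
      exact h1 ⟨hx, hy, h⟩
    by_cases e2 : x = v ∧ y = u
    · obtain ⟨rfl, rfl⟩ := e2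
      by_contra h
      exact h2 ⟨hx, hy, h⟩
    exact ⟨hy, x, hx, adj x y hxy e1 e2⟩
  rw [this] at hXu ⊢
  exact hF X hX hXu

/-- The edges of `K2222` on `Fin 8`, with the additional edge `01`. -/
def edgesK2222plus : List (Fin 8 × Fin 8) :=
  (List.finRange 8).flatMap fun i => (List.finRange 8).filterMap fun j =>
    if i.val / 2 ≠ j.val / 2 ∨ (i = 0 ∧ j = 1) then some (i, j) else none

theorem k7vee_of_k2222_add_edge {G' : SimpleGraph V} (hle : G' ≤ G) (e : G' ≃g K2222) {u v : V}
    (hG' : ¬ G'.Adj u v) (huv : G.Adj u v) : IsMinor K7vee G := by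
  have hK : ∀ a b : Fin 4 × Fin 2, K2222.Adj a b ↔ a.1 ≠ b.1 := fun a b => by simp [K2222]
  have h1 : (e u).1 = (e v).1 := by
    by_contra h
    exact hG' (e.map_adj_iff.1 ((hK _ _).2 h))
  let s := Equiv.swap 0 (e u).1
  let g : Fin 8 → V := fun i => e.symm (s (finProdFinEquiv (m := 4) (n := 2) |>.symm i).1,
    (finProdFinEquiv (m := 4) (n := 2) |>.symm i).2)
  have hg : Function.Injective g := by
    intro i j hij
    have h2 := e.symm.injective hij
    rw [Prod.mk.injEq] at h2
    exact (finProdFinEquiv (m := 4) (n := 2)).symm.injective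
      (Prod.ext (s.injective h2.1) h2.2)
  refine k7vee_of_model (isModel_singleton hg) edgesK2222plus (fun p hp => ?_)
    ![2, 3, 4, 5, 4, 6, 0, 1] ![6, 7, 0, 1, 2, 3, 5] (by decide +kernel)
  have hp' : p.1.val / 2 ≠ p.2.val / 2 ∨ (p.1 = 0 ∧ p.2 = 1) := by
    revert hp
    revert p
    decide +kernel
  rw [touch_singleton]
  rcases hp' with h | ⟨h2, h3⟩
  · refine hle (e.symm.map_adj_iff.2 ((hK _ _).2 fun h2 => h ?_))
    have h3 := s.injective h2
    simpa [finProdFinEquiv, Fin.ext_iff, Fin.divNat] using h3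
  · rw [h2, h3]
    have hs : s 0 = (e u).1 := Equiv.swap_apply_left _ _
    have hg0 : g 0 = e.symm ((e u).1, 0) := by rw [← hs]; rfl
    have hg1 : g 1 = e.symm ((e u).1, 1) := by rw [← hs]; rfl
    have hne : (e u).2 ≠ (e v).2 := fun h => huv.ne (e.injective (Prod.ext h1 h))
    have hu : u = e.symm ((e u).1, (e u).2) := (e.symm_apply_apply u).symm
    have hv : v = e.symm ((e u).1, (e v).2) := by rw [h1]; exact (e.symm_apply_apply v).symm
    rw [hg0, hg1]
    rcases (by omega : (e u).2 = 0 ∧ (e v).2 = 1 ∨ (e u).2 = 1 ∧ (e v).2 = 0) with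
      ⟨h5, h6⟩ | ⟨h5, h6⟩
    · rw [h5] at hu; rw [h6] at hv; rw [← hu, ← hv]; exact huv
    · rw [h5] at hu; rw [h6] at hv; rw [← hu, ← hv]; exact huv.symm

end

section

variable {V : Type} {G : SimpleGraph V}

theorem exists_antipodal_pair : ∀ J : Finset (Fin 6), 4 ≤ J.card → ∃ i ∈ J, opp6 i ∈ J := by
  decide +kernel

theorem opp6_ne : ∀ i, opp6 i ≠ i := by decide

/-- Two nonadjacent vertices of degree six with octahedral neighbourhoods. -/
theorem k2222_of_two_octahedral [Finite V] (hF : FourConn G) (hK : ¬ IsMinor K7vee G) {v w : V}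
    (hvw : w ≠ v) (hnvw : ¬ G.Adj v w) (hv : (G.neighborSet v).ncard = 6)
    (hw : (G.neighborSet w).ncard = 6) (hva : ∀ x, G.Adj v x → ∃ y, nadj G v x = {y})
    (hwa : ∀ x, G.Adj w x → ∃ y, nadj G w x = {y}) : Nonempty (G ≃g K2222) := by
  classical
  have hne : ∀ {v x : V}, G.Adj v x → v ≠ x := fun h => h.ne
  obtain ⟨z0, hz0⟩ : (G.neighborSet v).Nonempty := by rw [← Set.ncard_pos]; omega
  obtain ⟨z1, hz1⟩ : (G.neighborSet w).Nonempty := by rw [← Set.ncard_pos]; omega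
  rcases le_or_gt (G.neighborSet v ∩ G.neighborSet w).ncard 4 with hc | hc
  · exfalso
    obtain ⟨P, hP, hvP, hwP, ha, hb, hcov⟩ := hF.tight_linkage hvw.symm hnvw hc
    obtain ⟨o, ho, hvo, hoo, -⟩ := exists_octahedron hv hva hz0
    obtain ⟨o', ho', hwo, hoo', -⟩ := exists_octahedron hw hwa hz1
    exact hK (k7vee_of_octahedral_linkage hvw.symm hvo hwo ho ho' hnvw
      (fun i j h1 h2 => (hoo i j).2 ⟨h1, h2⟩) (fun i j h1 h2 => (hoo' i j).2 ⟨h1, h2⟩)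
      hP hvP hwP ha hb hcov)
  have e1 := Set.ncard_inter_add_ncard_sdiff_eq_ncard (G.neighborSet v) (G.neighborSet w)
  have e2 := Set.ncard_inter_add_ncard_sdiff_eq_ncard (G.neighborSet w) (G.neighborSet v)
  rw [Set.inter_comm] at e2
  by_cases h0 : (G.neighborSet v \ G.neighborSet w).ncard = 0
  · have hN : G.neighborSet v = G.neighborSet w := by
      refine Set.eq_of_subset_of_ncard_le ?_ (by omega)
      rw [← Set.sdiff_eq_empty]
      exact (Set.ncard_eq_zero).1 h0
    have hN' : ∀ x, G.Adj v x ↔ G.Adj w x := fun x => by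
      rw [← mem_neighborSet, hN, mem_neighborSet]
    obtain ⟨o, ho, hvo, hoo, -⟩ := exists_octahedron hv hva hz0
    by_cases hall : ∀ x, x = v ∨ x = w ∨ G.Adj v x
    · have i1 : Function.Injective (Fin.cons w o : Fin 7 → V) :=
        injective_cons ho fun i => hne ((hN' _).1 ((hvo _).2 ⟨i, rfl⟩))
      have i2 : Function.Injective (Fin.cons v (Fin.cons w o) : Fin 8 → V) := by
        refine injective_cons i1 fun i => ?_
        cases i using Fin.cases with
        | zero => exact hvw.symm
        | succ i => exact hne ((hvo _).2 ⟨i, rfl⟩)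
      refine k2222_of_labelling (Fin.cons v (Fin.cons w o) : Fin 8 → V) ⟨i2, fun x => ?_⟩ ?_
      · rcases hall x with rfl | rfl | h
        · exact ⟨0, rfl⟩
        · exact ⟨1, rfl⟩
        · obtain ⟨i, rfl⟩ := (hvo x).1 h
          exact ⟨i.succ.succ, rfl⟩
      · have hvo' : ∀ i, G.Adj v (o i) := fun i => (hvo _).2 ⟨i, rfl⟩
        have hwo' : ∀ i, G.Adj w (o i) := fun i => (hN' _).1 (hvo' i)
        have num : ∀ i j : Fin 6, (i ≠ j ∧ j ≠ opp6 i) ↔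
            i.succ.succ.val / 2 ≠ j.succ.succ.val / 2 := by decide
        intro i j
        cases i using Fin.cases with
        | zero =>
          cases j using Fin.cases with
          | zero => simp
          | succ j =>
            cases j using Fin.cases with
            | zero => simpa using hnvw
            | succ j => simpa [hvo' j] using by omega
        | succ i =>
          cases i using Fin.cases with
          | zero =>
            cases j using Fin.cases with
            | zero => simpa using fun h : G.Adj w v => hnvw h.symm
            | succ j =>
              cases j using Fin.cases with
              | zero => simp
              | succ j => simpa [hwo' j] using by omega
          | succ i =>
            cases j using Fin.cases with
            | zero => simp [(hvo' i).symm]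
            | succ j =>
              cases j using Fin.cases with
              | zero => simp [(hwo' i).symm]
              | succ j =>
                simp only [Fin.cons_succ]
                rw [hoo, num]
    · exfalso
      push Not at hall
      obtain ⟨x, hxv, hxw, hx⟩ := hall
      set U : Set V := {v, w} ∪ G.neighborSet v with hU
      have hxU : x ∉ U := by simp [hU, hxv, hxw, hx]
      have hvn : ∀ z ∉ U, ¬ G.Adj z v := fun z hz h => hz (Or.inr h.symm)
      have hwn : ∀ z ∉ U, ¬ G.Adj z w := fun z hz h => hz (Or.inr ((hN' _).2 h.symm))
      have h4 := hF.comp hxU (y := v) (by simp [hU]) hvn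
      set X := _root_.comp G Uᶜ x with hX
      have hXU : X ⊆ Uᶜ := comp_subset
      have hsub : nbr G X ⊆ G.neighborSet v := by
        intro y hy
        obtain ⟨-, a, ha, hay⟩ := id hy
        rcases nbr_comp_subset' hy with (rfl | rfl) | h
        · exact absurd hay (hvn a (hXU ha))
        · exact absurd hay (hwn a (hXU ha))
        · exact h
      have hJ : 4 ≤ (Finset.univ.filter fun i => o i ∈ nbr G X).card := by
        refine h4.trans ?_
        rw [← Set.ncard_coe_finset]
        have : nbr G X ⊆ o '' ((Finset.univ.filter fun i => o i ∈ nbr G X : Finset (Fin 6)) :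
            Set (Fin 6)) := by
          intro y hy
          obtain ⟨i, rfl⟩ := (hvo y).1 (hsub hy)
          exact ⟨i, by simpa using hy, rfl⟩
        exact (Set.ncard_le_ncard this).trans (Set.ncard_image_le (Set.toFinite _))
      obtain ⟨i, hi, hi'⟩ := exists_antipodal_pair _ hJ
      simp only [Finset.mem_filter, Finset.mem_univ, true_and] at hi hi'
      obtain ⟨p, hp, hvp, hpp, hp5⟩ := exists_octahedron hv hva ((hvo _).2 ⟨i, rfl⟩)
      have h4' : p 4 = o (opp6 i) := by
        obtain ⟨y, hy⟩ := hva (o i) ((hvo _).2 ⟨i, rfl⟩)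
        have m1 : p 4 ∈ nadj G v (o i) :=
          ⟨(hvp _).2 ⟨4, rfl⟩, fun e => absurd (hp (e.trans hp5.symm)) (by decide), fun h => by
            rw [← hp5, hpp] at h
            exact h.2 (by decide)⟩
        have m2 : o (opp6 i) ∈ nadj G v (o i) :=
          ⟨(hvo _).2 ⟨_, rfl⟩, fun e => opp6_ne i (ho e), fun h => ((hoo _ _).1 h).2 rfl⟩
        rw [hy] at m1 m2
        exact (Set.mem_singleton_iff.1 m1).trans (Set.mem_singleton_iff.1 m2).symm
      have hpU : ∀ j, p j ∉ X := fun j h => hXU h (Or.inr ((hvp _).2 ⟨j, rfl⟩))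
      exact hK (k7vee_of_twins_pair hp (fun j => (hvp _).2 ⟨j, rfl⟩)
        (fun j => (hN' _).1 ((hvp _).2 ⟨j, rfl⟩)) hvw.symm
        (fun a b h1 h2 => (hpp a b).2 ⟨h1, h2⟩) (cn_comp hxU)
        (fun h => hXU h (by simp [hU])) (fun h => hXU h (by simp [hU])) hpU
        (by rw [h4']; exact touch_of_mem_nbr hi') (by rw [hp5]; exact touch_of_mem_nbr hi))
  · exfalso
    obtain ⟨z, hz⟩ := Set.ncard_eq_one.1 (by omega : (G.neighborSet v \ G.neighborSet w).ncard = 1)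
    obtain ⟨x, hx⟩ := Set.ncard_eq_one.1 (by omega : (G.neighborSet w \ G.neighborSet v).ncard = 1)
    have hzm : z ∈ G.neighborSet v \ G.neighborSet w := by rw [hz]; rfl
    have hxm : x ∈ G.neighborSet w \ G.neighborSet v := by rw [hx]; rfl
    obtain ⟨o, ho, hvo, hoo, ho5⟩ := exists_octahedron hv hva hzm.1
    have hvo' : ∀ i, G.Adj v (o i) := fun i => (hvo _).2 ⟨i, rfl⟩
    have hwo' : ∀ i, i ≠ 5 → G.Adj w (o i) := by
      intro i hi
      by_contra h
      have : o i ∈ G.neighborSet v \ G.neighborSet w := ⟨hvo' i, h⟩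
      rw [hz, Set.mem_singleton_iff, ← ho5] at this
      exact hi (ho this)
    have hxo : ∀ i, x ≠ o i := fun i e => hxm.2 (by rw [e]; exact hvo' i)
    refine hK (k7vee_of_five_common (x := x) ho hvo' hwo' hvw.symm
      (fun e => hnvw (by rw [e]; exact hvo' 5)) (fun i j h1 h2 => (hoo i j).2 ⟨h1, h2⟩)
      (fun e => hnvw (by have := hxm.1; rw [e] at this; exact this.symm))
      (fun e => (show G.Adj w x from hxm.1).ne e.symm) hxo fun i hi => ?_)
    by_contra h
    have hi5 : i ≠ 5 := by rintro rfl; simp at hi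
    have hi5' : opp6 i ≠ 5 :=
      (by decide : ∀ i : Fin 6, i.val < 4 → opp6 i ≠ 5) i hi
    obtain ⟨y, hy⟩ := hwa (o i) (hwo' i hi5)
    have m1 : x ∈ nadj G w (o i) := ⟨hxm.1, hxo i, fun h' => h h'.symm⟩
    have m2 : o (opp6 i) ∈ nadj G w (o i) :=
      ⟨hwo' _ hi5', fun e => opp6_ne i (ho e), fun h => ((hoo _ _).1 h).2 rfl⟩
    rw [hy] at m1 m2
    exact hxo _ ((Set.mem_singleton_iff.1 m1).trans (Set.mem_singleton_iff.1 m2).symm)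

/-- A dense 4-connected graph none of whose edges can be contracted densely. -/
theorem k2222_of_tight [Finite V] (h3 : 3 ≤ Nat.card V) (hF : FourConn G)
    (hK : ¬ IsMinor K7vee G) (hD : defect G < 0)
    (ht : ∀ u v, G.Adj u v → 0 ≤ defect G - 6 + 2 * cnbr G u v)
    (ih : ∀ G' : SimpleGraph V, (arcs G').ncard < (arcs G).ncard → FourConn G' →
      ¬ IsMinor K7vee G' → defect G' < 0 → Nonempty (G' ≃g K2222)) : Nonempty (G ≃g K2222) := by
  classical
  have := Fintype.ofFinite V
  have heven := even_defect (G := G)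
  have h7 := seven_le_card h3 hD
  have t4 : ∀ u v, G.Adj u v → 4 ≤ cnbr G u v := fun u v h => by
    have := ht u v h
    omega
  by_cases hD2 : defect G = -2
  swap
  · exfalso
    obtain ⟨⟨u, v⟩, huv⟩ : (arcs G).Nonempty := by
      rw [← Set.ncard_pos]
      unfold defect at hD
      omega
    have huv : G.Adj u v := huv
    have hcard := ncard_arcs_deleteEdge huv
    obtain ⟨k, hk⟩ := heven
    obtain ⟨e⟩ := ih (G.deleteEdges {s(u, v)}) (by omega) (hF.deleteEdge (t4 u v huv))
      (fun h => hK (h.trans (isMinor_of_le (deleteEdges_le _)))) (by unfold defect at *; omega)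
    exact hK (k7vee_of_k2222_add_edge (deleteEdges_le _) e (by simp) huv)
  have hdeg : ∀ x, (G.neighborSet x).ncard = G.degree x := fun x => by
    rw [← Nat.card_coe_set_eq, Nat.card_eq_fintype_card, card_neighborSet_eq_degree]
  have h5 : ∀ x, 5 ≤ (G.neighborSet x).ncard := by
    intro x
    have hx : 0 < (G.neighborSet x).ncard := by
      by_contra h0
      have h0' : (G.neighborSet x) = ∅ := by
        rw [← Set.ncard_eq_zero]; omega
      have hn : nbr G {x} = ∅ := by
        rw [Set.eq_empty_iff_forall_notMem]
        rintro y ⟨-, a, rfl, hay⟩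
        exact (h0' ▸ hay : y ∈ (∅ : Set V))
      have := hF {x} ⟨x, rfl⟩ (by
        rw [hn, Set.union_empty]
        intro e
        have := congrArg Set.ncard e
        rw [Set.ncard_singleton, Set.ncard_univ] at this
        omega)
      rw [hn] at this
      simp at this
    obtain ⟨y, hy⟩ := (Set.ncard_pos).1 hx
    have := ncard_nadj hy
    have := t4 x y hy
    omega
  have h6 : ∀ x, 6 ≤ (G.neighborSet x).ncard := by
    intro x
    by_contra h
    exact hK (k7vee_of_degree_five hF h7 (by have := h5 x; omega) (t4 x))
  have hsum := sum_degree_defect (G := G)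
  have h7' : ∀ x, (G.neighborSet x).ncard ≠ 7 := by
    intro x hx
    by_cases hout : ∃ y, y ≠ x ∧ ¬ G.Adj x y
    · exact hK (k7vee_of_degree_seven hF hx hout (t4 x) h6)
    · push Not at hout
      have hcard : Fintype.card V = 8 := by
        rw [← Nat.card_eq_fintype_card, ← Set.ncard_univ]
        have : (Set.univ : Set V) = insert x (G.neighborSet x) := by
          ext y
          simp only [Set.mem_univ, Set.mem_insert_iff, mem_neighborSet, true_iff]
          by_cases hy : y = x
          · exact Or.inl hy
          · exact Or.inr (hout y hy)
        rw [this, Set.ncard_insert_of_notMem (by simp), hx]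
      have hlt : ∑ v, (8 - (G.degree v : ℤ)) < ∑ v : V, (2 : ℤ) := by
        refine Finset.sum_lt_sum (fun v _ => ?_) ⟨x, Finset.mem_univ _, ?_⟩
        · have := h6 v; rw [hdeg] at this; omega
        · rw [hdeg] at hx; omega
      rw [hsum, hD2] at hlt
      simp [hcard] at hlt
  have hlow : 8 ≤ {x | (G.neighborSet x).ncard = 6}.ncard := by
    have hle : ∑ v, (8 - (G.degree v : ℤ))
        ≤ ∑ v : V, if (G.neighborSet v).ncard = 6 then (2 : ℤ) else 0 := by
      refine Finset.sum_le_sum fun v _ => ?_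
      have h1 := h6 v
      have h2 := h7' v
      rw [hdeg] at h1 h2 ⊢
      split_ifs <;> omega
    rw [hsum, hD2, ← Finset.sum_filter, Finset.sum_const, nsmul_eq_mul] at hle
    have : {x | (G.neighborSet x).ncard = 6}
        = ((Finset.univ.filter fun x => (G.neighborSet x).ncard = 6 : Finset V) : Set V) := by
      ext; simp
    rw [this, Set.ncard_coe_finset]
    omega
  obtain ⟨v, hv⟩ : {x | (G.neighborSet x).ncard = 6}.Nonempty := by
    rw [← Set.ncard_pos]; omega
  have hv : (G.neighborSet v).ncard = 6 := hv
  obtain ⟨w, hw, hwv⟩ : ∃ w ∈ {x | (G.neighborSet x).ncard = 6},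
      w ∉ insert v (G.neighborSet v) := by
    refine Set.exists_mem_notMem_of_ncard_lt_ncard ?_
    rw [Set.ncard_insert_of_notMem (by simp), hv]
    omega
  simp only [Set.mem_insert_iff, mem_neighborSet, not_or] at hwv
  exact k2222_of_two_octahedral hF hK hwv.1 hwv.2 hv hw
    (fun x hx => exists_antipode hF hD hK hv (t4 v) hx)
    (fun x hx => exists_antipode hF hD hK hw (t4 w) hx)

end

section Torso

variable {V : Type} {G : SimpleGraph V}

/-- The torso of `A`: two vertices of `A` are adjacent if they are adjacent in `G` or attached to
a common connected set avoiding `A`. -/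
def torso (G : SimpleGraph V) (A : Set V) : SimpleGraph V where
  Adj a b := a ≠ b ∧ a ∈ A ∧ b ∈ A ∧
    (G.Adj a b ∨ ∃ C ⊆ Aᶜ, Cn G C ∧ Touch G C {a} ∧ Touch G C {b})
  symm := ⟨by
    rintro a b ⟨h1, h2, h3, h4⟩
    refine ⟨h1.symm, h3, h2, h4.imp (·.symm) ?_⟩
    rintro ⟨C, c1, c2, c3, c4⟩
    exact ⟨C, c1, c2, c4, c3⟩⟩
  loopless := ⟨fun a h => h.1 rfl⟩

theorem torso_mono {A A' : Set V} (h : A' ⊆ A) {a b : V} (hab : (torso G A).Adj a b) (ha : a ∈ A')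
    (hb : b ∈ A') : (torso G A').Adj a b := by
  refine ⟨hab.1, ha, hb, hab.2.2.2.imp id ?_⟩
  rintro ⟨C, c1, c2⟩
  exact ⟨C, c1.trans (Set.compl_subset_compl.2 h), c2⟩

/-- Every connected set avoiding `A` is attached to at most three vertices of `A`. -/
def ThinOutside (G : SimpleGraph V) (A : Set V) : Prop :=
  ∀ C ⊆ Aᶜ, Cn G C → {a ∈ A | Touch G C {a}}.ncard ≤ 3

/-- Vertex cuts have at least three vertices, and those with three contain `p`. -/
def AlmostFourConn (G : SimpleGraph V) (p : V) : Prop :=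
  ∀ X : Set V, X.Nonempty → X ∪ nbr G X ≠ Set.univ →
    4 ≤ (nbr G X).ncard ∨ ((nbr G X).ncard = 3 ∧ p ∈ nbr G X)

/-- Twice the number of edges missing to the bound `4n - 9` in the torso of `A`. -/
noncomputable def torsoDefect (G : SimpleGraph V) (A : Set V) : ℤ :=
  8 * A.ncard - 18 - (arcs (torso G A)).ncard

theorem exists_of_torso_cut [Finite V] {p : V} (hG : AlmostFourConn G p) {X S Y : Set V}
    (hX : X.Nonempty) (hY : Y.Nonempty) (hXY : Disjoint X Y) (hXS : Disjoint X S)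
    (hYS : Disjoint Y S)
    (hno : ∀ x ∈ X, ∀ y ∈ Y, ¬ (torso G (X ∪ S ∪ Y)).Adj x y) (hS : S.ncard ≤ 3) :
    S.ncard = 3 ∧ p ∈ S ∧ ∃ D ⊆ (S ∪ Y)ᶜ, Cn G D ∧ ∀ s ∈ S, Touch G D {s} := by
  set A := X ∪ S ∪ Y with hA
  have hXA : X ⊆ A := fun x hx => Or.inl (Or.inl hx)
  have hYA : Y ⊆ A := fun x hx => Or.inr hx
  have hSA : S ⊆ A := fun x hx => Or.inl (Or.inr hx)
  set X' : Set V := X ∪ {z | z ∉ A ∧ ∃ x ∈ X, Touch G (comp G Aᶜ z) {x}} with hX'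
  have hX'Y : ∀ y ∈ X', y ∉ Y ∧ y ∉ S := by
    rintro y (hy | ⟨hy, -⟩)
    · exact ⟨fun h => hXY.le_bot ⟨hy, h⟩, fun h => hXS.le_bot ⟨hy, h⟩⟩
    · exact ⟨fun h => hy (hYA h), fun h => hy (hSA h)⟩
  have hkey : nbr G X' ⊆ S := by
    rintro n ⟨hn, w, hw, hwn⟩
    by_contra hnS
    by_cases hnA : n ∈ A
    · have hnX : n ∉ X := fun h => hn (Or.inl h)
      have hnY : n ∈ Y := by
        rcases hnA with (h | h) | h
        · exact absurd h hnX
        · exact absurd h hnS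
        · exact h
      rcases hw with hw | ⟨hw, x, hx, hxw⟩
      · exact hno w hw n hnY ⟨hwn.ne, hXA hw, hnA, Or.inl hwn⟩
      · exact hno x hx n hnY ⟨fun e => hXY.le_bot ⟨hx, e ▸ hnY⟩, hXA hx, hnA, Or.inr
          ⟨_, comp_subset, cn_comp hw, hxw, w, mem_comp_self hw, n, rfl, hwn⟩⟩
    · rcases hw with hw | ⟨hw, x, hx, hxw⟩
      · exact hn (Or.inr ⟨hnA, w, hw, n, mem_comp_self hnA, w, rfl, hwn.symm⟩)
      · refine hn (Or.inr ⟨hnA, x, hx, ?_⟩)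
        rwa [comp_eq_of_mem (comp_closed (mem_comp_self hw) hnA hwn)]
  obtain ⟨x, hx⟩ := hX
  obtain ⟨y, hy⟩ := hY
  set D := _root_.comp G X' x
  have hxX' : x ∈ X' := Or.inl hx
  have hDS : nbr G D ⊆ S := by
    rintro n ⟨hn, w, hw, hwn⟩
    by_cases hnX : n ∈ X'
    · exact absurd (comp_closed hw hnX hwn) hn
    · exact hkey ⟨hnX, w, comp_subset hw, hwn⟩
  have hDc : ∀ z ∈ D, z ∉ Y ∧ z ∉ S := fun z hz => hX'Y z (comp_subset hz)
  have hle := Set.ncard_le_ncard hDS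
  rcases hG D ⟨x, mem_comp_self hxX'⟩ (fun e => by
    rcases (e ▸ Set.mem_univ y : y ∈ D ∪ nbr G D) with h | h
    · exact (hDc y h).1 hy
    · exact hYS.le_bot ⟨hy, hDS h⟩) with h | ⟨h, hp⟩
  · omega
  · have heq : nbr G D = S := Set.eq_of_subset_of_ncard_le hDS (by omega)
    refine ⟨by rw [← heq, h], hDS hp, D, fun z hz => ?_, cn_comp hxX', fun s hs => ?_⟩
    · rintro (h | h)
      · exact (hDc z hz).2 h
      · exact (hDc z hz).1 h
    · rw [← heq] at hs
      exact touch_of_mem_nbr hs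

theorem ThinOutside.of_cut [Finite V] {X S Y : Set V} (hthin : ThinOutside G (X ∪ S ∪ Y))
    (hXY : Disjoint X Y)
    (hno : ∀ x ∈ X, ∀ y ∈ Y, ¬ (torso G (X ∪ S ∪ Y)).Adj x y) (hS : S.ncard ≤ 3) :
    ThinOutside G (X ∪ S) := by
  intro C hC hcn
  set A := X ∪ S ∪ Y with hA
  by_cases hCY : (C ∩ Y).Nonempty
  · refine (Set.ncard_le_ncard ?_).trans hS
    rintro a ⟨ha, c, hc, a', ha', hca⟩
    obtain rfl : a' = a := ha'
    rcases ha with ha | ha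
    swap
    · exact ha
    exfalso
    have hcXS := hC hc
    by_cases hcY : c ∈ Y
    · exact hno a' ha c hcY ⟨fun e => hXY.le_bot ⟨ha, e ▸ hcY⟩, Or.inl (Or.inl ha), Or.inr hcY,
        Or.inl hca.symm⟩
    · obtain ⟨y, hyC, hyY⟩ := hCY
      have hcU : c ∈ C \ Y := ⟨hc, hcY⟩
      obtain ⟨e, he, f, hf, hef⟩ := hcn.2 (_root_.comp G (C \ Y) c)
        (comp_subset.trans Set.sdiff_subset) ⟨c, mem_comp_self hcU⟩
        ⟨y, hyC, fun h => (comp_subset h).2 hyY⟩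
      have hfY : f ∈ Y := by
        by_contra hfY
        exact hf.2 (comp_closed he ⟨hf.1, hfY⟩ hef)
      refine hno a' ha f hfY ⟨fun e => hXY.le_bot ⟨ha, e ▸ hfY⟩, Or.inl (Or.inl ha), Or.inr hfY,
        Or.inr ⟨_, fun z hz => ?_, cn_comp hcU, ⟨c, mem_comp_self hcU, a', rfl, hca⟩,
          e, he, f, rfl, hef⟩⟩
      rintro (h | h)
      · exact hC (comp_subset hz).1 h
      · exact (comp_subset hz).2 h
  · refine le_trans (Set.ncard_le_ncard ?_) (hthin C (fun z hz => ?_) hcn)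
    · rintro a ⟨ha, h⟩
      exact ⟨Or.inl ha, h⟩
    · rintro (h | h)
      · exact hC hz h
      · exact hCY ⟨z, hz, h⟩

theorem torsoDefect_cut [Finite V] {X S Y : Set V} (hXY : Disjoint X Y) (hXS : Disjoint X S)
    (hYS : Disjoint Y S)
    (hno : ∀ x ∈ X, ∀ y ∈ Y, ¬ (torso G (X ∪ S ∪ Y)).Adj x y) (hS : S.ncard = 3)
    (h1 : ∃ D ⊆ (S ∪ Y)ᶜ, Cn G D ∧ ∀ s ∈ S, Touch G D {s})
    (h2 : ∃ D ⊆ (S ∪ X)ᶜ, Cn G D ∧ ∀ s ∈ S, Touch G D {s}) :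
    torsoDefect G (X ∪ S) + torsoDefect G (Y ∪ S) ≤ torsoDefect G (X ∪ S ∪ Y) := by
  have hclique : ∀ Z : Set V, (∃ D ⊆ (S ∪ Z)ᶜ, Cn G D ∧ ∀ s ∈ S, Touch G D {s}) →
      S.offDiag ⊆ arcs (torso G (Z ∪ S)) := by
    rintro Z ⟨D, d1, d2, d3⟩ ⟨a, b⟩ ⟨ha, hb, hab⟩
    exact ⟨hab, Or.inr ha, Or.inr hb, Or.inr ⟨D, by rwa [Set.union_comm], d2, d3 a ha, d3 b hb⟩⟩
  have hsub : arcs (torso G (X ∪ S ∪ Y)) ⊆ arcs (torso G (X ∪ S)) ∪ arcs (torso G (Y ∪ S)) := by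
    rintro ⟨a, b⟩ hab
    have hab' : (torso G (X ∪ S ∪ Y)).Adj a b := hab
    have s1 : X ∪ S ⊆ X ∪ S ∪ Y := Set.subset_union_left
    have s2 : Y ∪ S ⊆ X ∪ S ∪ Y := by
      rintro z (h | h)
      exacts [Or.inr h, Or.inl (Or.inr h)]
    have m1 : a ∈ X ∪ S → b ∈ X ∪ S →
        (a, b) ∈ arcs (torso G (X ∪ S)) ∪ arcs (torso G (Y ∪ S)) := fun h h' => Or.inl
            (torso_mono s1 hab' h h')
    have m2 : a ∈ Y ∪ S → b ∈ Y ∪ S →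
        (a, b) ∈ arcs (torso G (X ∪ S)) ∪ arcs (torso G (Y ∪ S)) := fun h h' => Or.inr
            (torso_mono s2 hab' h h')
    obtain ⟨-, ha, hb, -⟩ := hab'
    rcases ha with (ha | ha) | ha <;> rcases hb with (hb | hb) | hb
    · exact m1 (Or.inl ha) (Or.inl hb)
    · exact m1 (Or.inl ha) (Or.inr hb)
    · exact absurd hab (hno a ha b hb)
    · exact m1 (Or.inr ha) (Or.inl hb)
    · exact m1 (Or.inr ha) (Or.inr hb)
    · exact m2 (Or.inr ha) (Or.inl hb)
    · exact absurd (SimpleGraph.Adj.symm hab) (hno b hb a ha)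
    · exact m2 (Or.inl ha) (Or.inr hb)
    · exact m2 (Or.inl ha) (Or.inl hb)
  have hcard : S.offDiag.ncard = 6 := by
    obtain ⟨a, b, c, hab, hac, hbc, rfl⟩ := Set.ncard_eq_three.1 hS
    classical
    have : ({a, b, c} : Set V).offDiag = (({a, b, c} : Finset V).offDiag : Set (V × V)) := by
      rw [Finset.coe_offDiag]; simp
    rw [this, Set.ncard_coe_finset, Finset.offDiag_card]
    have : ({a, b, c} : Finset V).card = 3 := Finset.card_eq_three.2 ⟨a, b, c, hab, hac, hbc, rfl⟩
    rw [this]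
  have e1 := Set.ncard_le_ncard hsub
  have e2 := Set.ncard_le_ncard (Set.subset_inter (hclique X h2) (hclique Y h1))
  have e3 := Set.ncard_union_add_ncard_inter (arcs (torso G (X ∪ S))) (arcs (torso G (Y ∪ S)))
  have c1 := Set.ncard_union_eq hXS
  have c2 := Set.ncard_union_eq hYS
  have c3 : (X ∪ S ∪ Y).ncard = (X ∪ S).ncard + Y.ncard :=
    Set.ncard_union_eq (Set.disjoint_union_left.2 ⟨hXY, hYS.symm⟩)
  unfold torsoDefect
  omega

theorem exists_minimal_torso [Finite V] {p : V} (hG : AlmostFourConn G p) (h3 : 3 ≤ Nat.card V)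
    (hD : defect G < 0) : ∃ A : Set V, p ∈ A ∧ 3 ≤ A.ncard ∧ ThinOutside G A ∧
      torsoDefect G A < 0 ∧ FourConn ((torso G A).induce A) := by
  let P : Set V → Prop := fun A => p ∈ A ∧ 3 ≤ A.ncard ∧ ThinOutside G A ∧ torsoDefect G A < 0
  have hP : ∃ n, ∃ A, P A ∧ A.ncard = n := by
    refine ⟨_, Set.univ, ⟨trivial, by rwa [Set.ncard_univ], fun C hC hcn => ?_, ?_⟩, rfl⟩
    · obtain ⟨x, hx⟩ := hcn.1
      exact absurd trivial (hC hx)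
    · have : torso G Set.univ = G := by
        ext a b
        refine ⟨fun h => h.2.2.2.resolve_right ?_, fun h => ⟨h.ne, trivial, trivial, Or.inl h⟩⟩
        rintro ⟨C, hC, hcn, -⟩
        obtain ⟨x, hx⟩ := hcn.1
        exact absurd trivial (hC hx)
      rwa [torsoDefect, this, Set.ncard_univ]
  classical
  obtain ⟨A, ⟨hp, hA3, hthin, hdef⟩, hAn⟩ := Nat.find_spec hP
  have hmin : ∀ A', P A' → A.ncard ≤ A'.ncard := fun A' h => by
    rw [hAn]; exact Nat.find_min' hP ⟨A', h, rfl⟩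
  refine ⟨A, hp, hA3, hthin, hdef, ?_⟩
  by_contra hF
  simp only [FourConn, not_forall, not_le, exists_prop] at hF
  obtain ⟨X0, ⟨x0, hx0⟩, huniv, hlt⟩ := hF
  obtain ⟨y0, hy0⟩ := (Set.ne_univ_iff_exists_notMem _).1 huniv
  set X : Set V := Subtype.val '' X0
  set S : Set V := Subtype.val '' nbr ((torso G A).induce A) X0
  set Y : Set V := A \ (X ∪ S) with hY
  have hXA : X ⊆ A := by rintro _ ⟨x, -, rfl⟩; exact x.2
  have hSA : S ⊆ A := by rintro _ ⟨x, -, rfl⟩; exact x.2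
  have hXSY : X ∪ S ∪ Y = A := Set.union_sdiff_cancel (Set.union_subset hXA hSA)
  have hXY : Disjoint X Y := Set.disjoint_left.2 fun z hz hz' => hz'.2 (Or.inl hz)
  have hYS : Disjoint Y S := Set.disjoint_left.2 fun z hz hz' => hz.2 (Or.inr hz')
  have hXS : Disjoint X S := by
    rw [Set.disjoint_left]
    rintro _ ⟨x, hx, rfl⟩ ⟨x', hx', e⟩
    rw [Subtype.ext e] at hx'
    exact hx'.1 hx
  have hXne : X.Nonempty := ⟨_, x0, hx0, rfl⟩
  have hYne : Y.Nonempty := by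
    refine ⟨y0, y0.2, ?_⟩
    rintro (⟨y, hy, e⟩ | ⟨y, hy, e⟩) <;> rw [Subtype.ext e] at hy
    exacts [hy0 (Or.inl hy), hy0 (Or.inr hy)]
  have hno : ∀ x ∈ X, ∀ y ∈ Y, ¬ (torso G (X ∪ S ∪ Y)).Adj x y := by
    rw [hXSY]
    rintro _ ⟨x, hx, rfl⟩ y ⟨hyA, hy⟩ hxy
    refine hy (Or.inr ⟨⟨y, hyA⟩, ⟨fun h => hy (Or.inl ⟨_, h, rfl⟩), x, hx, hxy⟩, rfl⟩)
  have hS : S.ncard ≤ 3 := by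
    have : S.ncard = (nbr ((torso G A).induce A) X0).ncard :=
      Set.ncard_image_of_injective _ Subtype.val_injective
    omega
  have hXSY' : Y ∪ S ∪ X = A := by rw [← hXSY]; ac_rfl
  have hno' : ∀ x ∈ Y, ∀ y ∈ X, ¬ (torso G (Y ∪ S ∪ X)).Adj x y := by
    rw [hXSY', ← hXSY]
    exact fun x hx y hy h => hno y hy x hx h.symm
  obtain ⟨hS3, hpS, h1⟩ := exists_of_torso_cut hG hXne hYne hXY hXS hYS hno hS
  obtain ⟨-, -, h2⟩ := exists_of_torso_cut hG hYne hXne hXY.symm hYS hXS hno' hS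
  have hsum := torsoDefect_cut hXY hXS hYS hno hS3 h1 h2
  have t1 := ThinOutside.of_cut (by rwa [hXSY]) hXY hno hS
  have t2 := ThinOutside.of_cut (by rwa [hXSY']) hXY.symm hno' hS
  rw [hXSY] at hsum
  have c1 := Set.ncard_union_eq hXS
  have c2 := Set.ncard_union_eq hYS
  have c3 : A.ncard = (X ∪ S).ncard + Y.ncard := by
    rw [← Set.ncard_union_eq (Set.disjoint_union_left.2 ⟨hXY, hYS.symm⟩), hXSY]
  have hXpos := (Set.ncard_pos).2 hXne
  have hYpos := (Set.ncard_pos).2 hYne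
  by_cases hd : torsoDefect G (X ∪ S) < 0
  · have := hmin (X ∪ S) ⟨Or.inr hpS, by omega, t1, hd⟩
    omega
  · have := hmin (Y ∪ S) ⟨Or.inr hpS, by omega, t2, by omega⟩
    omega

end Torso

section RootedTriangle

variable {V : Type} {G : SimpleGraph V}

theorem Cn.sdiff_comp {D : Set V} (hD : Cn G D) {b c : V} (hb : b ∈ D) :
    Cn G (D \ comp G (D \ {b}) c) := by
  set P := _root_.comp G (D \ {b}) c with hP
  have hbQ : b ∈ D \ P := ⟨hb, fun h => (comp_subset h).2 rfl⟩
  have : D \ P = _root_.comp G (D \ P) b := by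
    refine Set.Subset.antisymm (fun z hz => ?_) comp_subset
    by_contra hzb
    obtain ⟨e, he, f, hf, hef⟩ := hD.2 (_root_.comp G (D \ P) z)
      (comp_subset.trans Set.sdiff_subset) ⟨z, mem_comp_self hz⟩
      ⟨b, hb, fun h => hzb (by rw [comp_eq_of_mem h]; exact mem_comp_self hz)⟩
    have heQ := comp_subset he
    by_cases hfP : f ∈ P
    · refine heQ.2 (comp_closed hfP ⟨heQ.1, ?_⟩ hef.symm)
      rintro rfl
      exact hzb (by rw [comp_eq_of_mem he]; exact mem_comp_self hz)
    · exact hf.2 (comp_closed he ⟨hf.1, hfP⟩ hef)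
  rw [this]
  exact cn_comp hbQ

/-- Bags attached to three roots making them pairwise adjacent. -/
def RootedTriangle (G : SimpleGraph V) (C T : Set V) : Prop :=
  ∃ part : V → Set V, (∀ a, part a ⊆ C) ∧ (∀ a b, a ≠ b → Disjoint (part a) (part b)) ∧
    (∀ a, Cn G ({a} ∪ part a)) ∧
    ∀ a ∈ T, ∀ b ∈ T, a ≠ b → Touch G ({a} ∪ part a) ({b} ∪ part b)

open Classical in
theorem rootedTriangle_of_three {C P Q R : Set V} {a b c : V} (hab : a ≠ b) (hac : a ≠ c)
    (hbc : b ≠ c) (hP : P ⊆ C) (hQ : Q ⊆ C) (hR : R ⊆ C) (hPQ : Disjoint P Q) (hPR : Disjoint P R)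
    (hQR : Disjoint Q R) (ha : Cn G ({a} ∪ P)) (hb : Cn G ({b} ∪ Q)) (hc : Cn G ({c} ∪ R))
    (tab : Touch G ({a} ∪ P) ({b} ∪ Q)) (tac : Touch G ({a} ∪ P) ({c} ∪ R))
    (tbc : Touch G ({b} ∪ Q) ({c} ∪ R)) : RootedTriangle G C {a, b, c} := by
  refine ⟨fun x => if x = a then P else if x = b then Q else if x = c then R else ∅,
    fun x => ?_, fun x y hxy => ?_, fun x => ?_, ?_⟩
  · dsimp only
    split_ifs <;> simp [*]
  · dsimp only
    split_ifs <;> simp_all [disjoint_comm]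
  · dsimp only
    split_ifs with h1 h2 h3
    · rwa [h1]
    · rwa [h2]
    · rwa [h3]
    · simpa using Cn.singleton x
  · rintro x (rfl | rfl | rfl) y (rfl | rfl | rfl) hxy
    all_goals first
      | exact absurd rfl hxy
      | simp only [if_true, if_neg hab, if_neg hac, if_neg hbc, if_neg hab.symm, if_neg hac.symm,
          if_neg hbc.symm]
        first
          | assumption
          | (apply Touch.symm; assumption)

theorem Cn.insert {P : Set V} (hP : Cn G P) {a : V} (h : Touch G P {a}) : Cn G ({a} ∪ P) :=
  (Cn.singleton a).union_touch hP h.symm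

theorem rootedTriangle_of_edge {C : Set V} (hC : Cn G C) {a b c : V} (hab : a ≠ b) (hac : a ≠ c)
    (hbc : b ≠ c) (ha : Touch G C {a}) (hb : Touch G C {b}) (hc : Touch G C {c})
    (h : G.Adj a b) : RootedTriangle G C {a, b, c} := by
  refine rootedTriangle_of_three (P := ∅) (Q := ∅) (R := C) hab hac hbc (by simp) (by simp)
    (by simp) (by simp) (by simp) (by simp) (by simpa using Cn.singleton a)
    (by simpa using Cn.singleton b) (hC.insert hc) (by simpa using h) ?_ ?_
  · exact ha.symm.mono (by simp) (by simp)
  · exact hb.symm.mono (by simp) (by simp)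

/-- Vertices of `T` attached to `Y`. -/
def att (G : SimpleGraph V) (T Y : Set V) : Set V := {t ∈ T | Touch G Y {t}}

theorem att_union {T Y Z : Set V} : att G T (Y ∪ Z) = att G T Y ∪ att G T Z := by
  ext t
  simp only [att, touch_union_left, Set.mem_ofPred_eq, Set.mem_union]
  tauto

theorem rootedTriangle_of_two [Finite V] {C P Q T : Set V} (hP : Cn G P) (hQ : Cn G Q)
    (hPC : P ⊆ C) (hQC : Q ⊆ C)
    (hPQ : Disjoint P Q) (ht : Touch G P Q) (hT : T.ncard = 3)
    (hall : att G T (P ∪ Q) = T) (h1 : 2 ≤ (att G T P).ncard) (h2 : 2 ≤ (att G T Q).ncard) :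
    RootedTriangle G C T := by
  rw [att_union] at hall
  have e := Set.ncard_union_add_ncard_inter (att G T P) (att G T Q)
  rw [hall, hT] at e
  have hqne : (att G T P ∩ att G T Q).Nonempty := by
    rw [← Set.ncard_pos]; omega
  obtain ⟨q, hqP, hqQ⟩ := hqne
  have hs : ∃ s ∈ att G T P, ∃ r ∈ att G T Q, s ≠ q ∧ r ≠ q ∧ s ≠ r := by
    obtain ⟨s, hs, hsq⟩ := Set.exists_ne_of_one_lt_ncard (by omega : 1 < (att G T P).ncard) q
    by_cases h : ∃ r ∈ att G T Q, r ≠ q ∧ s ≠ r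
    · obtain ⟨r, hr, h⟩ := h
      exact ⟨s, hs, r, hr, hsq, h⟩
    push Not at h
    have hsub : att G T Q ⊆ {q, s} := fun r hr => by
      by_cases hrq : r = q
      · exact Or.inl hrq
      · exact Or.inr (h r hr hrq).symm
    obtain ⟨z, hz, hz'⟩ : ∃ z ∈ T, z ∉ ({q, s} : Set V) := by
      by_contra! hc
      have := Set.ncard_le_ncard (show T ⊆ ({q, s} : Set V) from hc)
      have := Set.ncard_insert_le q ({s} : Set V)
      rw [Set.ncard_singleton] at this
      omega
    rw [← hall] at hz
    have hzP : z ∈ att G T P := hz.resolve_right fun h => hz' (hsub h)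
    have hsQ : s ∈ att G T Q := by
      obtain ⟨r, hr, hrq⟩ := Set.exists_ne_of_one_lt_ncard (by omega : 1 < (att G T Q).ncard) q
      rwa [h r hr hrq]
    exact ⟨z, hzP, s, hsQ, fun e => hz' (Or.inl e), hsq, fun e => hz' (Or.inr e)⟩
  obtain ⟨s, hs, r, hr, hsq, hrq, hsr⟩ := hs
  have hTe : T = {q, s, r} := by
    refine (Set.eq_of_subset_of_ncard_le ?_ ?_).symm
    · rintro x (rfl | rfl | rfl)
      exacts [hqP.1, hs.1, hr.1]
    · rw [hT, Set.ncard_eq_three.2 ⟨q, s, r, hsq.symm, hrq.symm, hsr, rfl⟩]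
  rw [hTe]
  refine rootedTriangle_of_three (P := ∅) (Q := P) (R := Q) hsq.symm hrq.symm hsr (by simp) hPC hQC
    (by simp) (by simp) hPQ (by simpa using Cn.singleton q) (hP.insert hs.2) (hQ.insert hr.2)
    ?_ ?_ ?_
  · exact hqP.2.symm.mono (by simp) (by simp)
  · exact hqQ.2.symm.mono (by simp) (by simp)
  · exact ht.mono (by simp) (by simp)

theorem Cn.touch_sdiff {C P : Set V} (hC : Cn G C) (hP : P ⊆ C) (h1 : P.Nonempty)
    (h2 : (C \ P).Nonempty) : Touch G P (C \ P) := hC.2 P hP h1 h2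

theorem AlmostFourConn.three_le {p : V} (hG : AlmostFourConn G p) {X : Set V} (hX : X.Nonempty)
    (h : X ∪ nbr G X ≠ Set.univ) : 3 ≤ (nbr G X).ncard := by
  rcases hG X hX h with h | h <;> omega

theorem exists_rootedTriangle [Finite V] {p : V} (hG : AlmostFourConn G p) {C : Set V}
    (hC : Cn G C) (hT : (nbr G C).ncard = 3) (hC2 : 2 ≤ C.ncard)
    (huniv : C ∪ nbr G C ≠ Set.univ) : RootedTriangle G C (nbr G C) := by
  set T := nbr G C with hTdef
  let F : Set (Set V) := {Y | Y ⊆ C ∧ (Y = ∅ ∨ Cn G Y) ∧ Cn G (C \ Y) ∧ (att G T Y).ncard ≤ 1}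
  have hF0 : ∅ ∈ F := by
    refine ⟨by simp, Or.inl rfl, by simpa using hC, ?_⟩
    have : att G T ∅ = ∅ := by ext; simp [att, Touch]
    simp [this]
  obtain ⟨Y, ⟨hYC, hYcn, hD, hY1⟩, hmax⟩ := Set.exists_max_image F Set.ncard (Set.toFinite _)
    ⟨_, hF0⟩
  set D := C \ Y with hDdef
  have hmax' : ∀ Z ⊆ C, Cn G Z → Cn G (C \ Z) → Y.ncard < Z.ncard → 2 ≤ (att G T Z).ncard := by
    intro Z h1 h2 h3 h4
    by_contra h
    have := hmax Z ⟨h1, Or.inr h2, h3, by omega⟩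
    omega
  have hTC : Disjoint T C := Set.disjoint_left.2 fun t ht => ht.1
  obtain ⟨b', hb', b, hb, hbb, hYb', hYb⟩ : ∃ b' ∈ D, ∃ b ∈ D, b' ≠ b ∧
      (Y.Nonempty → Touch G Y {b'}) ∧ (Y.Nonempty → Touch G Y {b}) := by
    by_cases hYe : Y.Nonempty
    · have h3 : 3 ≤ (nbr G Y).ncard := by
        refine hG.three_le hYe fun e => huniv ?_
        rw [Set.eq_univ_iff_forall] at e ⊢
        intro z
        rcases e z with h | ⟨-, y, hy, hyz⟩
        · exact Or.inl (hYC h)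
        · by_cases hz : z ∈ C
          · exact Or.inl hz
          · exact Or.inr ⟨hz, y, hYC hy, hyz⟩
      have hsub : nbr G Y ⊆ att G T Y ∪ (nbr G Y ∩ D) := by
        intro z hz
        by_cases hzC : z ∈ C
        · exact Or.inr ⟨hz, hzC, hz.1⟩
        · obtain ⟨-, y, hy, hyz⟩ := hz
          exact Or.inl ⟨⟨hzC, y, hYC hy, hyz⟩, y, hy, z, rfl, hyz⟩
      have h4 := (Set.ncard_le_ncard hsub).trans (Set.ncard_union_le _ _)
      obtain ⟨b', hb', b, hb, hne⟩ := (Set.one_lt_ncard (hs := Set.toFinite _)).1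
        (by omega : 1 < (nbr G Y ∩ D).ncard)
      exact ⟨b', hb'.2, b, hb.2, hne, fun _ => touch_of_mem_nbr hb'.1,
        fun _ => touch_of_mem_nbr hb.1⟩
    · have : Y = ∅ := Set.not_nonempty_iff_eq_empty.1 hYe
      obtain ⟨b', hb', b, hb, hne⟩ := (Set.one_lt_ncard (hs := Set.toFinite _)).1
        (by omega : 1 < C.ncard)
      refine ⟨b', by simpa [hDdef, this] using hb', b, by simpa [hDdef, this] using hb, hne,
        fun h => absurd h hYe, fun h => absurd h hYe⟩
  set P := _root_.comp G (D \ {b'}) b with hPdef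
  have hbP : b ∈ P := mem_comp_self ⟨hb, hbb.symm⟩
  have hP : Cn G P := cn_comp ⟨hb, hbb.symm⟩
  have hPD : P ⊆ D := comp_subset.trans Set.sdiff_subset
  set Q := D \ P with hQdef
  have hQ : Cn G Q := hD.sdiff_comp hb'
  have hb'Q : b' ∈ Q := ⟨hb', fun h => (comp_subset h).2 rfl⟩
  have hDC : D ⊆ C := Set.sdiff_subset
  have hPQ : Touch G P Q := hD.touch_sdiff hPD hP.1 hQ.1
  have hPQd : Disjoint P Q := Set.disjoint_sdiff_right
  have hYP : Disjoint Y P := Set.disjoint_left.2 fun z hz hz' => (hPD hz').2 hz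
  have hYQ : Disjoint Y Q := Set.disjoint_left.2 fun z hz hz' => hz'.1.2 hz
  have hU : Y ∪ P ∪ Q = C := by
    rw [Set.union_assoc, hQdef, Set.union_sdiff_cancel hPD, hDdef, Set.union_sdiff_cancel hYC]
  have cYP : Cn G (Y ∪ P) := by
    rcases hYcn with h | h
    · simpa [h] using hP
    · exact h.union_touch hP ((hYb h.1).mono subset_rfl (by simpa using hbP))
  have cYQ : Cn G (Y ∪ Q) := by
    rcases hYcn with h | h
    · simpa [h] using hQ
    · exact h.union_touch hQ ((hYb' h.1).mono subset_rfl (by simpa using hb'Q))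
  have sYP : C \ (Y ∪ P) = Q := by rw [hQdef, hDdef, Set.sdiff_sdiff]
  have sYQ : C \ (Y ∪ Q) = P := by
    rw [← hU]
    ext z
    simp only [Set.mem_sdiff, Set.mem_union]
    have h1 : z ∈ P → z ∉ Q := fun h => Set.disjoint_left.1 hPQd h
    have h2 : z ∈ Y → z ∉ P := fun h => Set.disjoint_left.1 hYP h
    tauto
  have hall : att G T C = T := by
    refine Set.Subset.antisymm (fun t ht => ht.1) fun t ht => ⟨ht, ?_⟩
    exact touch_of_mem_nbr ht
  have nP := (Set.ncard_pos).2 hP.1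
  have nQ := (Set.ncard_pos).2 hQ.1
  have a1 : 2 ≤ (att G T (Y ∪ P)).ncard := hmax' _ (Set.union_subset hYC (hPD.trans hDC)) cYP
    (by rwa [sYP]) (by rw [Set.ncard_union_eq hYP]; omega)
  have a2 : 2 ≤ (att G T (Y ∪ Q)).ncard := hmax' _
    (Set.union_subset hYC (Set.sdiff_subset.trans hDC)) cYQ
    (by rwa [sYQ]) (by rw [Set.ncard_union_eq hYQ]; omega)
  by_cases q2 : 2 ≤ (att G T Q).ncard
  · exact rootedTriangle_of_two cYP hQ (Set.union_subset hYC (hPD.trans hDC))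
      (Set.sdiff_subset.trans hDC) (Set.disjoint_union_left.2 ⟨hYQ, hPQd⟩)
      (hPQ.mono Set.subset_union_right subset_rfl) hT (by rw [hU, hall]) a1 q2
  by_cases p2 : 2 ≤ (att G T P).ncard
  · exact rootedTriangle_of_two cYQ hP (Set.union_subset hYC (Set.sdiff_subset.trans hDC))
      (hPD.trans hDC) (Set.disjoint_union_left.2 ⟨hYP, hPQd.symm⟩)
      (hPQ.symm.mono Set.subset_union_right subset_rfl) hT
      (by rw [show Y ∪ Q ∪ P = C by rw [← hU]; ac_rfl, hall]) a2 p2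
  rw [← hU, att_union, att_union] at hall
  rw [att_union] at a1 a2
  have u1 := Set.ncard_union_le (att G T Y ∪ att G T P) (att G T Q)
  have u2 := Set.ncard_union_le (att G T Y) (att G T P)
  rw [hall, hT] at u1
  obtain ⟨y, hy⟩ := Set.ncard_eq_one.1 (by omega : (att G T Y).ncard = 1)
  obtain ⟨x, hx⟩ := Set.ncard_eq_one.1 (by omega : (att G T P).ncard = 1)
  obtain ⟨z, hz⟩ := Set.ncard_eq_one.1 (by omega : (att G T Q).ncard = 1)
  have hYne : Y.Nonempty := by
    have : y ∈ att G T Y := by rw [hy]; rfl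
    obtain ⟨-, w, hw, -⟩ := this
    exact ⟨w, hw⟩
  have hYc : Cn G Y := hYcn.resolve_left hYne.ne_empty
  rw [hx, hy, hz] at hall
  have hTe : T = {y, x, z} := by
    rw [← hall]; ext; simp only [Set.mem_union, Set.mem_singleton_iff, Set.mem_insert_iff]; tauto
  have hne : y ≠ x ∧ y ≠ z ∧ x ≠ z := by
    have h2 : ∀ s t : V, ({s, t} : Set V).ncard ≤ 2 := fun s t => by
      have := Set.ncard_insert_le s ({t} : Set V)
      rwa [Set.ncard_singleton] at this
    refine ⟨?_, ?_, ?_⟩ <;> rintro rfl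
    · have := h2 y z
      rw [hTe] at hT; simp at hT; omega
    · have := h2 x y
      rw [hTe, Set.pair_comm x y] at hT; simp at hT; rw [Set.pair_comm] at hT; omega
    · have := h2 y x
      rw [hTe] at hT; simp at hT; omega
  have m : ∀ {s : V} {Z : Set V}, att G T Z = {s} → Touch G Z {s} := fun {s Z} h => by
    have : s ∈ att G T Z := by rw [h]; rfl
    exact this.2
  rw [hTe]
  refine rootedTriangle_of_three hne.1 hne.2.1 hne.2.2 hYC (hPD.trans hDC)
    (Set.sdiff_subset.trans hDC) hYP hYQ hPQd (hYc.insert (m hy)) (hP.insert (m hx))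
    (hQ.insert (m hz)) ?_ ?_ ?_
  · exact (hYb hYne).mono Set.subset_union_right (by simp [hbP])
  · exact (hYb' hYne).mono Set.subset_union_right (Set.singleton_subset_iff.2 (Or.inr hb'Q))
  · exact hPQ.mono Set.subset_union_right Set.subset_union_right

end RootedTriangle

section TorsoMinor

variable {V : Type} {G : SimpleGraph V}

theorem rootedTriangle_comp [Finite V] {p : V} (hG : AlmostFourConn G p)
    (hI : ∀ b, (nbr G {b}).ncard = 3 → p ∈ nbr G {b} →
      ∃ x ∈ nbr G {b}, ∃ y ∈ nbr G {b}, G.Adj x y)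
    {A : Set V} (hA : ThinOutside G A) (hA4 : 4 ≤ A.ncard) {z : V} (hz : z ∉ A) :
    (nbr G (comp G Aᶜ z)).ncard = 3 ∧ p ∈ nbr G (comp G Aᶜ z) ∧
      RootedTriangle G (comp G Aᶜ z) (nbr G (comp G Aᶜ z)) := by
  set C := _root_.comp G Aᶜ z with hC
  have hcn : Cn G C := cn_comp hz
  have hsub : nbr G C ⊆ A := nbr_comp_subset'
  have hle : (nbr G C).ncard ≤ 3 :=
    (Set.ncard_le_ncard (t := {a ∈ A | Touch G C {a}})
      fun a ha => ⟨hsub ha, touch_of_mem_nbr ha⟩).trans (hA C comp_subset hcn)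
  have huniv : C ∪ nbr G C ≠ Set.univ := by
    intro e
    have : A ⊆ nbr G C := fun a ha => by
      rcases (e ▸ Set.mem_univ a : a ∈ C ∪ nbr G C) with h | h
      · exact absurd ha (comp_subset h)
      · exact h
    have := Set.ncard_le_ncard this
    omega
  have h3 : (nbr G C).ncard = 3 ∧ p ∈ nbr G C := by
    rcases hG C hcn.1 huniv with h | h
    · omega
    · exact h
  refine ⟨h3.1, h3.2, ?_⟩
  by_cases hC2 : 2 ≤ C.ncard
  · exact exists_rootedTriangle hG hcn h3.1 hC2 huniv
  have hpos := (Set.ncard_pos).2 hcn.1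
  obtain ⟨b, hb⟩ := Set.ncard_eq_one.1 (by omega : C.ncard = 1)
  have hb3 := h3
  rw [hb] at hb3
  obtain ⟨x, hx, y, hy, hxy⟩ := hI b hb3.1 hb3.2
  rw [← hb] at hx hy
  obtain ⟨c, hc, hc'⟩ : ∃ c ∈ nbr G C, c ∉ ({x, y} : Set V) := by
    by_contra! h
    have h1 := Set.ncard_le_ncard (show nbr G C ⊆ ({x, y} : Set V) from h)
    rw [Set.ncard_pair hxy.ne] at h1
    omega
  have hxc : x ≠ c := fun e => hc' (Or.inl e.symm)
  have hyc : y ≠ c := fun e => hc' (Or.inr e.symm)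
  have hTe : nbr G C = {x, y, c} := by
    refine (Set.eq_of_subset_of_ncard_le ?_ ?_).symm
    · rintro t (rfl | rfl | rfl) <;> assumption
    · rw [h3.1, Set.ncard_eq_three.2 ⟨x, y, c, hxy.ne, hxc, hyc, rfl⟩]
  rw [hTe]
  exact rootedTriangle_of_edge hcn hxy.ne hxc hyc (touch_of_mem_nbr hx) (touch_of_mem_nbr hy)
    (touch_of_mem_nbr hc) hxy

theorem isMinor_torso {A : Set V}
    (h : ∀ z ∉ A, RootedTriangle G (comp G Aᶜ z) (nbr G (comp G Aᶜ z))) :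
    IsMinor ((torso G A).induce A) G := by
  let K : Type := {C : Set V // ∃ z ∉ A, C = _root_.comp G Aᶜ z}
  have hK : ∀ C : K, RootedTriangle G C.1 (nbr G C.1) := by
    rintro ⟨C, z, hz, rfl⟩
    exact h z hz
  choose part h1 h2 h3 h4 using hK
  have hKA : ∀ C : K, C.1 ⊆ Aᶜ := by
    rintro ⟨C, z, hz, rfl⟩
    exact comp_subset
  have hKeq : ∀ C C' : K, ∀ x, x ∈ C.1 → x ∈ C'.1 → C = C' := by
    rintro ⟨C, z, hz, rfl⟩ ⟨C', z', hz', rfl⟩ x hx hx'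
    refine Subtype.ext ?_
    change _root_.comp G Aᶜ z = _root_.comp G Aᶜ z'
    rw [← comp_eq_of_mem hx, comp_eq_of_mem hx']
  refine isMinor_of_bags (fun a => {(a : V)} ∪ ⋃ C : K, ({(a : V)} ∪ part C a)) (fun a => ?_)
    (fun a b hab => ?_) (fun a b hab => ?_)
  · exact Cn.union_star (Cn.singleton _) (fun C => h3 C a) (fun C => Or.inr ⟨a, rfl, Or.inl rfl⟩)
  · have hab' : (a : V) ≠ b := fun e => hab (Subtype.ext e)
    rw [Set.disjoint_left]
    intro x hx hy
    have hx' : x = a ∨ ∃ C : K, x ∈ part C a := by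
      simp only [Set.mem_union, Set.mem_singleton_iff, Set.mem_iUnion] at hx
      rcases hx with h | ⟨C, h | h⟩
      exacts [Or.inl h, Or.inl h, Or.inr ⟨C, h⟩]
    have hy' : x = b ∨ ∃ C : K, x ∈ part C b := by
      simp only [Set.mem_union, Set.mem_singleton_iff, Set.mem_iUnion] at hy
      rcases hy with h | ⟨C, h | h⟩
      exacts [Or.inl h, Or.inl h, Or.inr ⟨C, h⟩]
    rcases hx' with rfl | ⟨C, hC⟩ <;> rcases hy' with e | ⟨C', hC'⟩
    · exact hab' e
    · exact hKA C' (h1 _ _ hC') a.2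
    · exact hKA C (h1 _ _ hC) (e ▸ b.2)
    · obtain rfl := hKeq C C' x (h1 _ _ hC) (h1 _ _ hC')
      exact (h2 C a b hab').le_bot ⟨hC, hC'⟩
  · obtain ⟨hne, -, -, hadj | ⟨D, hD, hDcn, ta, tb⟩⟩ := hab
    · exact ⟨a, Or.inl rfl, b, Or.inl rfl, hadj⟩
    · obtain ⟨z, hz⟩ := hDcn.1
      let C : K := ⟨_root_.comp G Aᶜ z, z, hD hz, rfl⟩
      have hDC : D ⊆ C.1 := hDcn.subset_comp hD hz
      have hn : ∀ c ∈ A, Touch G D {c} → c ∈ nbr G C.1 := by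
        rintro c hc ⟨d, hd, c', hc', hdc⟩
        obtain rfl : c' = c := hc'
        exact ⟨fun h => hKA C h hc, d, hDC hd, hdc⟩
      refine (h4 C a (hn a a.2 ta) b (hn b b.2 tb) hne).mono ?_ ?_ <;>
      · refine Set.Subset.trans ?_ Set.subset_union_right
        exact Set.subset_iUnion_of_subset C subset_rfl

end TorsoMinor

section Contract

variable {V : Type} {G : SimpleGraph V}

theorem almostFourConn_contract [Finite V] (hF : FourConn G) {u v : V} (huv : u ≠ v) :
    AlmostFourConn (contractEdge G u v) ⟨u, huv⟩ := by
  intro X hX huniv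
  obtain ⟨y, hy⟩ := (Set.ne_univ_iff_exists_notMem _).1 huniv
  have hyX : y ∉ X := fun h => hy (Or.inl h)
  have hyn : y ∉ nbr (contractEdge G u v) X := fun h => hy (Or.inr h)
  have hcard : (Subtype.val '' nbr (contractEdge G u v) X).ncard =
      (nbr (contractEdge G u v) X).ncard :=
    Set.ncard_image_of_injective _ Subtype.val_injective
  have hyim : ∀ Z : Set {x // x ≠ v}, y ∉ Z → (y : V) ∉ Subtype.val '' Z := by
    rintro Z hZ ⟨z, hz, e⟩
    rw [Subtype.ext e] at hz
    exact hZ hz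
  have himX : (Subtype.val '' X).Nonempty := hX.image _
  have hadj : ∀ x ∈ X, ∀ n : {x // x ≠ v}, n ∉ X → G.Adj x n →
      n ∈ nbr (contractEdge G u v) X := fun x hx n hn h =>
    ⟨hn, x, hx, contractEdge_adj.2 ⟨fun e => hn (e ▸ hx), Or.inl h⟩⟩
  by_cases hp : (⟨u, huv⟩ : {x // x ≠ v}) ∈ X
  · left
    rw [← hcard]
    have hsub : nbr G (Subtype.val '' X ∪ {v}) ⊆ Subtype.val '' nbr (contractEdge G u v) X := by
      rintro n ⟨hn, w, hw, hwn⟩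
      have hnv : n ≠ v := fun e => hn (Or.inr e)
      have hnX : (⟨n, hnv⟩ : {x // x ≠ v}) ∉ X := fun h => hn (Or.inl ⟨_, h, rfl⟩)
      refine ⟨⟨n, hnv⟩, ?_, rfl⟩
      rcases hw with ⟨w, hw, rfl⟩ | rfl
      · exact hadj w hw _ hnX hwn
      · exact ⟨hnX, _, hp, contractEdge_adj.2 ⟨fun e => hnX (e ▸ hp), Or.inr (Or.inl ⟨rfl, hwn⟩)⟩⟩
    exact (hF.four_le (himX.mono Set.subset_union_left) hsub (y := y)
      (by rintro (h | h); exacts [hyim X hyX h, y.2 h]) (hyim _ hyn)).trans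
      (Set.ncard_le_ncard hsub)
  · have hsub : nbr G (Subtype.val '' X) ⊆
        Subtype.val '' nbr (contractEdge G u v) X ∪ {v} := by
      rintro n ⟨hn, w, ⟨w, hw, rfl⟩, hwn⟩
      by_cases hnv : n = v
      · exact Or.inr hnv
      · exact Or.inl ⟨⟨n, hnv⟩, hadj w hw _ (fun h => hn ⟨_, h, rfl⟩) hwn, rfl⟩
    by_cases hpn : (⟨u, huv⟩ : {x // x ≠ v}) ∈ nbr (contractEdge G u v) X
    · have h4 := hF.four_le himX hsub (y := y) (hyim X hyX)
        (by rintro (h | h); exacts [hyim _ hyn h, y.2 h])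
      have := h4.trans ((Set.ncard_le_ncard hsub).trans (Set.ncard_union_le _ _))
      rw [hcard, Set.ncard_singleton] at this
      by_cases h : 4 ≤ (nbr (contractEdge G u v) X).ncard
      · exact Or.inl h
      · exact Or.inr ⟨by omega, hpn⟩
    · left
      rw [← hcard]
      have hsub' : nbr G (Subtype.val '' X) ⊆ Subtype.val '' nbr (contractEdge G u v) X := by
        intro n hn
        rcases hsub hn with h | h
        · exact h
        · obtain rfl : n = v := h
          obtain ⟨-, w, ⟨w, hw, rfl⟩, hwn⟩ := hn
          exact absurd ⟨hp, w, hw, contractEdge_adj.2 ⟨fun e => hp (e ▸ hw),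
            Or.inr (Or.inr ⟨rfl, hwn.symm⟩)⟩⟩ hpn
      exact (hF.four_le himX hsub' (y := y) (hyim X hyX) (hyim _ hyn)).trans
        (Set.ncard_le_ncard hsub')

theorem exists_adj_nbr_contract [Finite V] (hF : FourConn G) (h7 : 7 ≤ Nat.card V) {u v : V}
    (huv : u ≠ v) (hmin : ∀ a b, G.Adj a b → cnbr G u v ≤ cnbr G a b)
    (b : {x // x ≠ v}) (h3 : (nbr (contractEdge G u v) {b}).ncard = 3)
    (hp : ⟨u, huv⟩ ∈ nbr (contractEdge G u v) {b}) :
    ∃ x ∈ nbr (contractEdge G u v) {b}, ∃ y ∈ nbr (contractEdge G u v) {b},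
      (contractEdge G u v).Adj x y := by
  by_contra! hno
  set N := nbr (contractEdge G u v) {b} with hN
  set S : Set V := Subtype.val '' N ∪ {v} with hS
  have hcard : (Subtype.val '' N).ncard = N.ncard :=
    Set.ncard_image_of_injective _ Subtype.val_injective
  have hSc : S.ncard ≤ 4 := by
    refine (Set.ncard_union_le _ _).trans ?_
    rw [hcard, h3, Set.ncard_singleton]
  have hsub : nbr G {(b : V)} ⊆ S := by
    rintro n ⟨hn, w, hw, hwn⟩
    obtain rfl : w = b := hw
    by_cases hnv : n = v
    · exact Or.inr hnv
    · refine Or.inl ⟨⟨n, hnv⟩, ⟨fun e => hn ?_, b, rfl, contractEdge_adj.2 ⟨?_, Or.inl hwn⟩⟩, rfl⟩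
      · exact congrArg Subtype.val e
      · rintro rfl
        exact hn rfl
  obtain ⟨y, hy⟩ : ∃ y, y ∉ insert (b : V) S := by
    by_contra! h
    have h1 := Set.ncard_insert_le (b : V) S
    rw [show insert (b : V) S = Set.univ from Set.eq_univ_of_forall h, Set.ncard_univ] at h1
    omega
  have h4 := hF.four_le (Set.singleton_nonempty (b : V)) hsub (y := y)
    (fun h => hy (Or.inl h)) (fun h => hy (Or.inr h))
  have heq : nbr G {(b : V)} = S := Set.eq_of_subset_of_ncard_le hsub (by omega)
  have hbS : ∀ s ∈ S, G.Adj b s := by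
    intro s hs
    rw [← heq] at hs
    obtain ⟨-, w, rfl, h⟩ := hs
    exact h
  have hbu := hbS u (Or.inl ⟨_, hp, rfl⟩)
  have hbv := hbS v (Or.inr rfl)
  have hpos : 0 < cnbr G u v := (Set.ncard_pos).2 ⟨b, hbu.symm, hbv.symm⟩
  obtain ⟨x, hx, hxp⟩ := Set.exists_ne_of_one_lt_ncard (by omega : 1 < N.ncard) ⟨u, huv⟩
  have h0 := hmin b x (hbS x (Or.inl ⟨_, hx, rfl⟩))
  have : 0 < cnbr G b x := by omega
  obtain ⟨w, hw1, hw2⟩ := (Set.ncard_pos).1 this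
  have hwS : w ∈ S := hsub ⟨fun e => (show G.Adj b w from hw1).ne e.symm, b, rfl, hw1⟩
  rcases hwS with ⟨w, hw, rfl⟩ | rfl
  · refine hno w hw x hx (contractEdge_adj.2 ⟨?_, Or.inl (SimpleGraph.Adj.symm hw2)⟩)
    rintro rfl
    exact G.loopless.irrefl _ hw2
  · exact hno _ hp x hx (contractEdge_adj.2 ⟨hxp.symm, Or.inr (Or.inl
      ⟨rfl, SimpleGraph.Adj.symm hw2⟩)⟩)

end Contract

section FrameSection

variable {V : Type} {G : SimpleGraph V}

/-- The nine vertices carrying a frame. -/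
def core (u v w : V) (o : Fin 6 → V) : Set V := {u, v, w} ∪ Set.range o

/-- An edge `uv`, a vertex `w` and six vertices forming an octahedron up to attached components,
such that contracting `uv` gives `K2222` after absorbing the components. -/
structure Frame (G : SimpleGraph V) (u v w : V) (o : Fin 6 → V) : Prop where
  huv : G.Adj u v
  inj : Function.Injective o
  hou : ∀ i, o i ≠ u
  hov : ∀ i, o i ≠ v
  how : ∀ i, o i ≠ w
  hwu : w ≠ u
  hwv : w ≠ v
  hub : ∀ i, G.Adj w (o i)
  nuw : ¬ G.Adj u w
  nvw : ¬ G.Adj v w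
  anti : ∀ i, ¬ G.Adj (o i) (o (opp6 i))
  piece : ∀ z ∉ core u v w o, ∃ i j, j ≠ i ∧ j ≠ opp6 i ∧
    nbr G (comp G (core u v w o)ᶜ z) = {u, v, o i, o j}
  octa : ∀ i j, j ≠ i → j ≠ opp6 i → G.Adj (o i) (o j) ∨
    ∃ z ∉ core u v w o, o i ∈ nbr G (comp G (core u v w o)ᶜ z) ∧
      o j ∈ nbr G (comp G (core u v w o)ᶜ z)
  cover : ∀ i, G.Adj u (o i) ∨ G.Adj v (o i) ∨
    ∃ z ∉ core u v w o, o i ∈ nbr G (comp G (core u v w o)ᶜ z)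

theorem k2222_adj {a b : Fin 4 × Fin 2} : K2222.Adj a b ↔ a.1 ≠ b.1 := by
  simp [K2222]

theorem exists_labelling_k2222 {W : Type} {K : SimpleGraph W} (e : K ≃g K2222) (p : W) :
    ∃ (w : W) (o : Fin 6 → W), Function.Injective o ∧ (∀ i, o i ≠ p) ∧ (∀ i, o i ≠ w) ∧ w ≠ p ∧
      (∀ i, K.Adj p (o i)) ∧ (∀ i, K.Adj w (o i)) ∧ ¬ K.Adj p w ∧
      (∀ i j, K.Adj (o i) (o j) ↔ j ≠ i ∧ j ≠ opp6 i) ∧ ∀ x, x = p ∨ x = w ∨ x ∈ Set.range o := by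
  let σ : Fin 4 × Fin 2 ≃ Fin 4 × Fin 2 :=
    (Equiv.swap (e p).1 3).prodCongr (Equiv.swap (e p).2 0)
  let e' : W ≃ Fin 4 × Fin 2 := e.toEquiv.trans σ
  have hadj : ∀ x y, K.Adj x y ↔ (e' x).1 ≠ (e' y).1 := fun x y => by
    rw [← e.map_adj_iff, k2222_adj]
    simp [e', σ]
  have hp : e' p = (3, 0) :=
    Prod.ext (Equiv.swap_apply_left (e p).1 3) (Equiv.swap_apply_left (e p).2 0)
  let f : Fin 6 → Fin 4 × Fin 2 := ![(0, 0), (0, 1), (1, 0), (1, 1), (2, 0), (2, 1)]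
  have hf : Function.Injective f := by decide
  have hsymm : ∀ x, e' (e'.symm x) = x := e'.apply_symm_apply
  have hne : ∀ x y, e' x ≠ e' y → x ≠ y := fun x y h e => h (congrArg e' e)
  refine ⟨e'.symm (3, 1), fun i => e'.symm (f i), fun i j h => hf (e'.symm.injective h),
    fun i => hne _ _ ?_, fun i => hne _ _ ?_, hne _ _ ?_, fun i => ?_, fun i => ?_, ?_,
    fun i j => ?_, fun x => ?_⟩
  · rw [hp, hsymm]; revert i; decide
  · rw [hsymm, hsymm]; revert i; decide
  · rw [hp, hsymm]; decide
  · rw [hadj, hp, hsymm]; revert i; decide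
  · rw [hadj, hsymm, hsymm]; revert i; decide
  · rw [hadj, hp, hsymm]; decide
  · rw [hadj, hsymm, hsymm]; revert i j; decide
  · have : ∀ y, y = (3, 0) ∨ y = (3, 1) ∨ ∃ i, f i = y := by decide
    rcases this (e' x) with h | h | ⟨i, h⟩
    · exact Or.inl (e'.injective (h.trans hp.symm))
    · exact Or.inr (Or.inl (by rw [← h]; simp))
    · exact Or.inr (Or.inr ⟨i, by change e'.symm (f i) = x; rw [h]; simp⟩)

theorem cn_contract_iff {u v : V} {C : Set V} (hu : u ∉ C) (hv : v ∉ C) :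
    Cn (contractEdge G u v) (Subtype.val ⁻¹' C) ↔ Cn G C := by
  have hadj : ∀ x y : {x // x ≠ v}, (x : V) ∈ C → (y : V) ∈ C →
      ((contractEdge G u v).Adj x y ↔ G.Adj x y) := fun x y hx hy => by
    rw [contractEdge_adj]
    refine ⟨?_, fun h => ⟨fun e => G.loopless.irrefl _ (e ▸ h), Or.inl h⟩⟩
    rintro ⟨-, h | ⟨h, -⟩ | ⟨h, -⟩⟩
    · exact h
    · exact absurd (h ▸ hx) hu
    · exact absurd (h ▸ hy) hu
  have hvC : ∀ x ∈ C, x ≠ v := fun x hx e => hv (e ▸ hx)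
  constructor
  · rintro ⟨⟨x, hx⟩, h⟩
    refine ⟨⟨x, hx⟩, fun X hX h1 h2 => ?_⟩
    obtain ⟨a, ha⟩ := h1
    obtain ⟨b, hb⟩ := h2
    obtain ⟨a', ha', b', hb', hab⟩ := h (Subtype.val ⁻¹' X) (Set.preimage_mono hX)
      ⟨⟨a, hvC a (hX ha)⟩, ha⟩ ⟨⟨b, hvC b hb.1⟩, hb⟩
    exact ⟨a', ha', b', hb', (hadj _ _ (hX ha') hb'.1).1 hab⟩
  · rintro ⟨⟨x, hx⟩, h⟩
    refine ⟨⟨⟨x, hvC x hx⟩, hx⟩, fun X hX h1 h2 => ?_⟩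
    obtain ⟨a, ha⟩ := h1
    obtain ⟨b, hb⟩ := h2
    have hXC : Subtype.val '' X ⊆ C := by
      rintro _ ⟨z, hz, rfl⟩
      exact hX hz
    obtain ⟨_, ⟨a', ha', rfl⟩, b', hb', hab⟩ := h (Subtype.val '' X) hXC ⟨a, a, ha, rfl⟩
      ⟨b, hb.1, by rintro ⟨z, hz, e⟩; exact hb.2 (Subtype.ext e ▸ hz)⟩
    refine ⟨a', ha', ⟨b', hvC b' hb'.1⟩, ⟨hb'.1, fun h => hb'.2 ⟨_, h, rfl⟩⟩,
      (hadj _ _ (hX ha') hb'.1).2 hab⟩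

theorem exists_frame [Finite V] (hF : FourConn G) {u v : V} (huv : G.Adj u v)
    {A : Set {x // x ≠ v}} (hp : ⟨u, huv.ne⟩ ∈ A) (hthin : ThinOutside (contractEdge G u v) A)
    (e : (torso (contractEdge G u v) A).induce A ≃g K2222) :
    ∃ w o, Frame G u v w o := by
  obtain ⟨w, o, hinj, hop, how, hwp, apo, awo, npw, aoo, hall⟩ := exists_labelling_k2222 e ⟨_, hp⟩
  set H := contractEdge G u v with hH
  have hAcard : A.ncard = 8 := by
    rw [← Nat.card_coe_set_eq, Nat.card_congr e.toEquiv]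
    simp
  let o' : Fin 6 → V := fun i => (o i).1.1
  let w' : V := w.1.1
  set S := core u v w' o' with hS
  have hinj2 : ∀ {x y : A}, x.1.1 = y.1.1 → x = y := fun h => Subtype.ext (Subtype.ext h)
  have hSA : ∀ x : {x // x ≠ v}, (x : V) ∈ S ↔ x ∈ A := by
    intro x
    constructor
    · rintro ((h | h | h) | ⟨i, h⟩)
      · exact (Subtype.ext h : x = ⟨u, huv.ne⟩) ▸ hp
      · exact absurd h x.2
      · exact (Subtype.ext h : x = w.1) ▸ w.2
      · exact (Subtype.ext h : (o i).1 = x) ▸ (o i).2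
    · intro hx
      rcases hall ⟨x, hx⟩ with h | h | ⟨i, h⟩
      · exact Or.inl (Or.inl (congrArg (fun z : A => z.1.1) h))
      · exact Or.inl (Or.inr (Or.inr (congrArg (fun z : A => z.1.1) h)))
      · exact Or.inr ⟨i, congrArg (fun z : A => z.1.1) h⟩
  have huS : u ∈ S := Or.inl (Or.inl rfl)
  have hvS : v ∈ S := Or.inl (Or.inr (Or.inl rfl))
  have hGH : ∀ {x y : {x // x ≠ v}}, G.Adj x y → H.Adj x y := fun {x y} h =>
    contractEdge_adj.2 ⟨fun e => G.loopless.irrefl _ (e ▸ h), Or.inl h⟩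
  have hvH : ∀ {y : {x // x ≠ v}}, y ≠ ⟨u, huv.ne⟩ → G.Adj v y → H.Adj ⟨u, huv.ne⟩ y :=
    fun {y} hy h => contractEdge_adj.2 ⟨hy.symm, Or.inr (Or.inl ⟨rfl, h⟩)⟩
  have hHG : ∀ {x y : {x // x ≠ v}}, (x : V) ≠ u → (y : V) ≠ u → H.Adj x y → G.Adj x y :=
    fun {x y} hx hy h => by
      rcases contractEdge_adj.1 h with ⟨-, h | h | h⟩
      exacts [h, absurd h.1 hx, absurd h.1 hy]
  have hou : ∀ i, o' i ≠ u := fun i h => hop i (hinj2 h)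
  have hwu : w' ≠ u := fun h => hwp (hinj2 h)
  have hpiece : ∀ z ∉ S, ∃ i j, j ≠ i ∧ j ≠ opp6 i ∧
      nbr G (_root_.comp G Sᶜ z) = {u, v, o' i, o' j} := by
    intro z hz
    set C := _root_.comp G Sᶜ z with hC
    have hCS : ∀ c ∈ C, c ∉ S := fun c hc => comp_subset hc
    have hcn : Cn G C := cn_comp hz
    have hnS : nbr G C ⊆ S := nbr_comp_subset'
    set C' : Set {x // x ≠ v} := Subtype.val ⁻¹' C with hC'
    have hcn' : Cn H C' := (cn_contract_iff (fun h => hCS _ h huS) (fun h => hCS _ h hvS)).2 hcn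
    have hC'A : C' ⊆ Aᶜ := fun c hc h => hCS _ hc ((hSA c).2 h)
    have hcv : ∀ c ∈ C, c ≠ v := fun c hc e => hCS _ hc (e ▸ hvS)
    set N : Set {x // x ≠ v} := {a ∈ A | Touch H C' {a}} with hN
    have hN3 : N.ncard ≤ 3 := hthin C' hC'A hcn'
    have hcard : (Subtype.val '' N).ncard = N.ncard :=
      Set.ncard_image_of_injective _ Subtype.val_injective
    have hsubN : nbr G C ⊆ Subtype.val '' N ∪ {v} := by
      rintro n hn
      by_cases hnv : n = v
      · exact Or.inr hnv
      · obtain ⟨hnC, c, hc, hcn⟩ := hn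
        refine Or.inl ⟨⟨n, hnv⟩, ⟨(hSA _).1 (hnS ⟨hnC, c, hc, hcn⟩), ⟨c, hcv c hc⟩, hc, _, rfl,
          hGH hcn⟩, rfl⟩
    have h4 : 4 ≤ (nbr G C).ncard := by
      refine hF C hcn.1 fun e => ?_
      have h1 : Subtype.val '' A ⊆ nbr G C := by
        rintro _ ⟨a, ha, rfl⟩
        rcases (e ▸ Set.mem_univ _ : (a : V) ∈ C ∪ nbr G C) with h | h
        · exact absurd ((hSA a).2 ha) (hCS _ h)
        · exact h
      have h2 := Set.ncard_le_ncard (h1.trans hsubN)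
      rw [Set.ncard_image_of_injective _ Subtype.val_injective, hAcard] at h2
      have h3 := Set.ncard_union_le (Subtype.val '' N) {v}
      rw [hcard, Set.ncard_singleton] at h3
      omega
    have heq : nbr G C = Subtype.val '' N ∪ {v} := by
      refine Set.eq_of_subset_of_ncard_le hsubN ?_
      refine (Set.ncard_union_le _ _).trans ?_
      rw [hcard, Set.ncard_singleton]; omega
    have hN3' : N.ncard = 3 := by
      have h3 := Set.ncard_union_le (Subtype.val '' N) {v}
      rw [← heq, hcard, Set.ncard_singleton] at h3
      omega
    have hpN : (⟨u, huv.ne⟩ : {x // x ≠ v}) ∈ N := by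
      obtain ⟨-, c, hc, hcv'⟩ : v ∈ nbr G C := by rw [heq]; exact Or.inr rfl
      have : (⟨c, hcv c hc⟩ : {x // x ≠ v}) ≠ ⟨u, huv.ne⟩ := by
        intro e
        have hcu : c = u := congrArg Subtype.val e
        exact hCS _ hc (hcu ▸ huS)
      exact ⟨hp, ⟨c, hcv c hc⟩, hc, _, rfl, (hvH this hcv'.symm).symm⟩
    have hadj : ∀ a (ha : a ∈ N) b (hb : b ∈ N), a ≠ b → (torso H A).Adj a b := by
      intro a ha b hb hab
      exact ⟨hab, ha.1, hb.1, Or.inr ⟨C', hC'A, hcn', ha.2, hb.2⟩⟩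
    obtain ⟨a, ha⟩ : ∃ x y : {x // x ≠ v}, N = {⟨u, huv.ne⟩, x, y} ∧ x ≠ ⟨u, huv.ne⟩ ∧
        y ≠ ⟨u, huv.ne⟩ ∧ x ≠ y := by
      have hd : (N \ {⟨u, huv.ne⟩}).ncard = 2 := by
        rw [Set.ncard_sdiff_singleton_of_mem hpN]; omega
      obtain ⟨x, y, hxy, h⟩ := Set.ncard_eq_two.1 hd
      have hx : x ∈ N \ {⟨u, huv.ne⟩} := by rw [h]; exact Or.inl rfl
      have hy : y ∈ N \ {⟨u, huv.ne⟩} := by rw [h]; exact Or.inr rfl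
      refine ⟨x, y, ?_, hx.2, hy.2, hxy⟩
      rw [← h, Set.insert_sdiff_singleton, Set.insert_eq_of_mem hpN]
    obtain ⟨b, hNe, hap, hbp, hab⟩ := ha
    have haN : a ∈ N := by rw [hNe]; exact Or.inr (Or.inl rfl)
    have hbN : b ∈ N := by rw [hNe]; exact Or.inr (Or.inr rfl)
    have hlab : ∀ a ∈ N, a ≠ ⟨u, huv.ne⟩ → ∃ i, (o i).1 = a := by
      intro a ha hap
      rcases hall ⟨a, ha.1⟩ with h | h | ⟨i, h⟩
      · exact absurd (congrArg Subtype.val h) hap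
      · have h' : a = w.1 := congrArg Subtype.val h
        exact absurd (hadj _ hpN a ha hap.symm) (by rw [h']; exact npw)
      · exact ⟨i, congrArg Subtype.val h⟩
    obtain ⟨i, hi⟩ := hlab a haN hap
    obtain ⟨j, hj⟩ := hlab b hbN hbp
    have hij := (aoo i j).1 (by
      change (torso H A).Adj (o i).1 (o j).1
      rw [hi, hj]
      exact hadj a haN b hbN hab)
    refine ⟨i, j, hij.1, hij.2, ?_⟩
    rw [heq, hNe]
    have e1 : o' i = a.1 := congrArg Subtype.val hi
    have e2 : o' j = b.1 := congrArg Subtype.val hj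
    rw [e1, e2]
    ext x
    simp only [Set.mem_union, Set.mem_image, Set.mem_insert_iff, Set.mem_singleton_iff]
    constructor
    · rintro (⟨y, rfl | rfl | rfl, rfl⟩ | rfl) <;> simp
    · rintro (rfl | rfl | rfl | rfl)
      · exact Or.inl ⟨_, Or.inl rfl, rfl⟩
      · exact Or.inr rfl
      · exact Or.inl ⟨_, Or.inr (Or.inl rfl), rfl⟩
      · exact Or.inl ⟨_, Or.inr (Or.inr rfl), rfl⟩
  have hcommon : ∀ D ⊆ Aᶜ, Cn H D → ∃ z ∉ S, ∀ a : A, (a : V) ≠ u → Touch H D {a.1} →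
      (a : V) ∈ nbr G (_root_.comp G Sᶜ z) := by
    intro D hD hDcn
    obtain ⟨z, hz⟩ := hDcn.1
    have hDS : ∀ d ∈ D, (d : V) ∉ S := fun d hd h => hD hd ((hSA d).1 h)
    have hpre : Subtype.val ⁻¹' (Subtype.val '' D) = D :=
      Set.preimage_image_eq _ Subtype.val_injective
    have hcnG : Cn G (Subtype.val '' D) := by
      rw [← cn_contract_iff (u := u) (v := v), hpre]
      · exact hDcn
      · rintro ⟨d, hd, e⟩
        exact hDS d hd (e ▸ huS)
      · rintro ⟨d, hd, e⟩
        exact d.2 e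
    refine ⟨z, hDS z hz, fun a hau ha => ⟨fun h => comp_subset h ((hSA _).2 a.2), ?_⟩⟩
    obtain ⟨d, hd, a', ha', hda⟩ := ha
    obtain rfl : a' = a.1 := ha'
    refine ⟨d, hcnG.subset_comp (fun x hx => ?_) ⟨z, hz, rfl⟩ ⟨d, hd, rfl⟩,
      hHG (fun e => hDS d hd (e ▸ huS)) hau hda⟩
    obtain ⟨d', hd', rfl⟩ := hx
    exact hDS d' hd'
  refine ⟨w', o', huv, fun i j h => hinj (hinj2 h), hou, fun i => (o i).1.2,
    fun i h => how i (hinj2 h), hwu, w.1.2, fun i => ?_, fun h => npw ?_, fun h => npw ?_,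
    fun i h => ?_, hpiece, fun i j h1 h2 => ?_, fun i => ?_⟩
  · obtain ⟨-, -, -, h | ⟨D, d1, d2, d3, d4⟩⟩ := awo i
    · exact hHG hwu (hou i) h
    · obtain ⟨z, hz, hzn⟩ := hcommon D d1 d2
      have hw := hzn w hwu d3
      obtain ⟨i, j, -, -, hij⟩ := hpiece z hz
      rw [hij] at hw
      rcases hw with h | h | h | h
      · exact absurd h hwu
      · exact absurd h w.1.2
      · exact absurd (hinj2 h).symm (how i)
      · exact absurd (hinj2 h).symm (how j)
  · exact ⟨fun e => hwp (Subtype.ext e.symm), hp, w.2, Or.inl (hGH h)⟩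
  · exact ⟨fun e => hwp (Subtype.ext e.symm), hp, w.2,
      Or.inl (hvH (fun e => hwp (Subtype.ext e)) h)⟩
  · have : ¬ ((torso H A).induce A).Adj (o i) (o (opp6 i)) := fun h => ((aoo _ _).1 h).2 rfl
    exact this ⟨fun e => h.ne (congrArg Subtype.val e), (o i).2,
      (o _).2, Or.inl (hGH h)⟩
  · obtain ⟨-, -, -, h | ⟨D, d1, d2, d3, d4⟩⟩ := (aoo i j).2 ⟨h1, h2⟩
    · exact Or.inl (hHG (hou i) (hou j) h)
    · obtain ⟨z, hz, hzn⟩ := hcommon D d1 d2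
      exact Or.inr ⟨z, hz, hzn _ (hou i) d3, hzn _ (hou j) d4⟩
  · obtain ⟨-, -, -, h | ⟨D, d1, d2, d3, d4⟩⟩ := apo i
    · rcases contractEdge_adj.1 h with ⟨-, h | h | h⟩
      · exact Or.inl h
      · exact Or.inr (Or.inl h.2)
      · exact absurd h.1 (hou i)
    · obtain ⟨z, hz, hzn⟩ := hcommon D d1 d2
      exact Or.inr (Or.inr ⟨z, hz, hzn _ (hou i) d4⟩)

end FrameSection

section OctModelSection

variable {V : Type} {G : SimpleGraph V}

/-- A model of an octahedron (bags `inl i`) together with bags `inr 0` and `inr 1` touching each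
other and a bag `inr 2` touching the whole octahedron. -/
structure OctModel (G : SimpleGraph V) (B : Fin 6 ⊕ Fin 3 → Set V) : Prop where
  model : IsModel G B
  octa : ∀ i j, j ≠ i → j ≠ opp6 i → Touch G (B (.inl i)) (B (.inl j))
  pole : ∀ i, Touch G (B (.inr 2)) (B (.inl i))
  edge : Touch G (B (.inr 0)) (B (.inr 1))

/-- The labelling of the octahedron by three vertices and their antipodes. -/
def octLab (i j k : Fin 6) : Fin 6 → Fin 6 := ![i, opp6 i, j, opp6 j, k, opp6 k]

/-- Three vertices in distinct antipodal pairs. -/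
abbrev Transversal6 (i j k : Fin 6) : Prop :=
  j ≠ i ∧ j ≠ opp6 i ∧ k ≠ i ∧ k ≠ opp6 i ∧ k ≠ j ∧ k ≠ opp6 j

theorem octLab_injective {i j k : Fin 6} (h : Transversal6 i j k) :
    Function.Injective (octLab i j k) := by
  revert i j k; decide

theorem octLab_opp6 (i j k l : Fin 6) : octLab i j k (opp6 l) = opp6 (octLab i j k l) := by
  revert i j k l; decide

variable {B : Fin 6 ⊕ Fin 3 → Set V}

theorem OctModel.permute (h : OctModel G B) {i j k : Fin 6} (ht : Transversal6 i j k) :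
    OctModel G (fun x => B (Sum.map (octLab i j k) id x)) := by
  have hi := octLab_injective ht
  refine ⟨h.model.comp (hi.sumMap Function.injective_id),
    fun a b h1 h2 => h.octa _ _ (fun e => h1 (hi e)) fun e => h2 (hi ?_), fun a => h.pole _, h.edge⟩
  rw [octLab_opp6]
  exact e

theorem OctModel.swap (h : OctModel G B) :
    OctModel G (fun x => B (Sum.map id (Equiv.swap 0 1) x)) :=
  ⟨h.model.comp (Function.injective_id.sumMap (Equiv.swap 0 1).injective), h.octa, h.pole,
    h.edge.symm⟩

/-- An ordering of the nine bags. -/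
def octPos : Fin 9 → Fin 6 ⊕ Fin 3 :=
  ![.inl 0, .inl 1, .inl 2, .inl 3, .inl 4, .inl 5, .inr 0, .inr 1, .inr 2]

theorem octPos_injective : Function.Injective octPos := by decide

/-- The pairs of touching bags in every `OctModel`. -/
def octList : List (Fin 9 × Fin 9) :=
  [(0, 2), (0, 3), (0, 4), (0, 5), (1, 2), (1, 3), (1, 4), (1, 5), (2, 4),
   (2, 5), (3, 4), (3, 5), (8, 0), (8, 1), (8, 2), (8, 3), (8, 4), (8, 5),
   (6, 7)]

theorem OctModel.touch_octList (h : OctModel G B) :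
    ∀ e ∈ octList, Touch G (B (octPos e.1)) (B (octPos e.2)) := by
  have h1 : ∀ e ∈ octList,
      (∃ i j, j ≠ i ∧ j ≠ opp6 i ∧ octPos e.1 = .inl i ∧ octPos e.2 = .inl j) ∨
      (∃ i, octPos e.1 = .inr 2 ∧ octPos e.2 = .inl i) ∨
      (octPos e.1 = .inr 0 ∧ octPos e.2 = .inr 1) := by decide
  intro e he
  rcases h1 e he with ⟨i, j, h1, h2, e1, e2⟩ | ⟨i, e1, e2⟩ | ⟨e1, e2⟩ <;> rw [e1, e2]
  exacts [h.octa i j h1 h2, h.pole i, h.edge]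

theorem OctModel.k7vee_of_disjoint_pairs (h : OctModel G B)
    (h0 : Touch G (B (.inr 0)) (B (.inl 0))) (h1 : Touch G (B (.inr 0)) (B (.inl 1)))
    (h2 : Touch G (B (.inr 1)) (B (.inl 2))) (h3 : Touch G (B (.inr 1)) (B (.inl 3))) :
    IsMinor K7vee G := by
  refine k7vee_of_model (h.model.comp octPos_injective)
    ([(6, 0), (6, 1), (7, 2), (7, 3)] ++ octList) (fun e he => ?_)
    ![4, 2, 5, 3, 0, 1, 4, 5, 6] ![4, 5, 1, 3, 0, 2, 8] (by decide)
  simp only [List.mem_append, List.mem_cons, List.not_mem_nil, or_false] at he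
  rcases he with (rfl | rfl | rfl | rfl) | he
  exacts [h0, h1, h2, h3, h.touch_octList e he]

theorem OctModel.k7vee_of_pair_transversal (h : OctModel G B)
    (h0 : Touch G (B (.inr 0)) (B (.inl 0))) (h1 : Touch G (B (.inr 0)) (B (.inl 1)))
    (h2 : Touch G (B (.inr 1)) (B (.inl 0))) (h3 : Touch G (B (.inr 1)) (B (.inl 2)))
    (h4 : Touch G (B (.inr 1)) (B (.inl 4))) : IsMinor K7vee G := by
  refine k7vee_of_model (h.model.comp octPos_injective)
    ([(6, 0), (6, 1), (7, 0), (7, 2), (7, 4)] ++ octList) (fun e he => ?_)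
    ![3, 5, 4, 6, 6, 1, 5, 0, 2] ![7, 5, 8, 0, 2, 1, 3] (by decide)
  simp only [List.mem_append, List.mem_cons, List.not_mem_nil, or_false] at he
  rcases he with (rfl | rfl | rfl | rfl | rfl) | he
  exacts [h0, h1, h2, h3, h4, h.touch_octList e he]

theorem OctModel.k7vee_of_extra (h : OctModel G B) {X : Set V} (hX : Cn G X)
    (hd : ∀ i, Disjoint X (B i)) (x0 : Touch G X (B (.inl 0))) (x2 : Touch G X (B (.inl 2)))
    (xu : Touch G X (B (.inr 0))) (xv : Touch G X (B (.inr 1)))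
    (h0 : Touch G (B (.inr 0)) (B (.inl 0))) (h1 : Touch G (B (.inr 0)) (B (.inl 2)))
    (h2 : Touch G (B (.inr 0)) (B (.inl 4))) (h3 : Touch G (B (.inr 1)) (B (.inl 0)))
    (h4 : Touch G (B (.inr 1)) (B (.inl 2))) (h5 : Touch G (B (.inr 1)) (B (.inl 5))) :
    IsMinor K7vee G := by
  refine k7vee_of_model ((h.model.comp octPos_injective).cons hX fun i => hd _)
    ([(0, 1), (0, 3), (0, 7), (0, 8), (7, 1), (7, 3), (7, 5), (8, 1), (8, 3), (8, 6)] ++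
      octList.map (fun e => (e.1.succ, e.2.succ))) (fun e he => ?_)
    ![0, 3, 2, 4, 2, 5, 6, 5, 6, 1] ![0, 9, 2, 1, 3, 5, 6] (by decide)
  simp only [List.mem_append, List.mem_cons, List.not_mem_nil, or_false, List.mem_map] at he
  rcases he with (rfl | rfl | rfl | rfl | rfl | rfl | rfl | rfl | rfl | rfl) | ⟨e, he, rfl⟩
  exacts [x0, x2, xu, xv, h0, h1, h2, h3, h4, h5, h.touch_octList e he]

end OctModelSection

section OctTouch

variable {V : Type} {G : SimpleGraph V} {B : Fin 6 ⊕ Fin 3 → Set V}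

/-- A labelling to which `OctModel.k7vee_of_disjoint_pairs` or
`OctModel.k7vee_of_pair_transversal` applies. -/
def OctGood (S T : Fin 6 → Bool) : Prop :=
  ∃ i, S i ∧ S (opp6 i) ∧ ∃ j, T j ∧ ∃ k, Transversal6 i j k ∧ (T (opp6 j) ∨ T i ∧ T k)

instance (S T : Fin 6 → Bool) : Decidable (OctGood S T) := by
  unfold OctGood; infer_instance

theorem OctModel.k7vee_of_octGood (h : OctModel G B) {S T : Fin 6 → Bool}
    (hS : ∀ i, S i → Touch G (B (.inr 0)) (B (.inl i)))
    (hT : ∀ i, T i → Touch G (B (.inr 1)) (B (.inl i))) (hg : OctGood S T ∨ OctGood T S) :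
    IsMinor K7vee G := by
  rcases hg with ⟨i, h1, h2, j, h3, k, ht, h4 | ⟨h4, h5⟩⟩ |
    ⟨i, h1, h2, j, h3, k, ht, h4 | ⟨h4, h5⟩⟩
  · exact (h.permute ht).k7vee_of_disjoint_pairs (hS _ h1) (hS _ h2) (hT _ h3) (hT _ h4)
  · exact (h.permute ht).k7vee_of_pair_transversal (hS _ h1) (hS _ h2) (hT _ h4) (hT _ h3)
      (hT _ h5)
  · exact (h.permute ht).swap.k7vee_of_disjoint_pairs (hT _ h1) (hT _ h2) (hS _ h3) (hS _ h4)
  · exact (h.permute ht).swap.k7vee_of_pair_transversal (hT _ h1) (hT _ h2) (hS _ h4) (hS _ h3)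
      (hS _ h5)

theorem octGood_of_nine_aux : ∀ a₀ a₁ a₂ a₃ a₄ a₅ b₀ b₁ b₂ b₃ b₄ b₅ : Bool,
    9 ≤ a₀.toNat + a₁.toNat + a₂.toNat + a₃.toNat + a₄.toNat + a₅.toNat +
      (b₀.toNat + b₁.toNat + b₂.toNat + b₃.toNat + b₄.toNat + b₅.toNat) →
    OctGood ![a₀, a₁, a₂, a₃, a₄, a₅] ![b₀, b₁, b₂, b₃, b₄, b₅] ∨
      OctGood ![b₀, b₁, b₂, b₃, b₄, b₅] ![a₀, a₁, a₂, a₃, a₄, a₅] := by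
  decide +kernel

theorem octGood_of_nine {S T : Finset (Fin 6)} (h : 9 ≤ S.card + T.card) :
    OctGood (fun i => decide (i ∈ S)) (fun i => decide (i ∈ T)) ∨
      OctGood (fun i => decide (i ∈ T)) (fun i => decide (i ∈ S)) := by
  have hv : ∀ S : Finset (Fin 6), (fun i => decide (i ∈ S)) = ![decide (0 ∈ S), decide (1 ∈ S),
      decide (2 ∈ S), decide (3 ∈ S), decide (4 ∈ S), decide (5 ∈ S)] := fun S => by
    funext i; fin_cases i <;> rfl
  have hc : ∀ S : Finset (Fin 6), S.card = (decide (0 ∈ S)).toNat + (decide (1 ∈ S)).toNat +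
      (decide (2 ∈ S)).toNat + (decide (3 ∈ S)).toNat + (decide (4 ∈ S)).toNat +
      (decide (5 ∈ S)).toNat := fun S => by
    have : S.card = ∑ i, (decide (i ∈ S)).toNat := by
      simp [Bool.toNat, Bool.cond_decide]
    rw [this, Fin.sum_univ_six]
  rw [hv, hv T]
  rw [hc, hc T] at h
  exact octGood_of_nine_aux _ _ _ _ _ _ _ _ _ _ _ _ h

theorem OctModel.k7vee_of_nine (h : OctModel G B) {S T : Finset (Fin 6)}
    (hS : ∀ i ∈ S, Touch G (B (.inr 0)) (B (.inl i)))
    (hT : ∀ i ∈ T, Touch G (B (.inr 1)) (B (.inl i))) (h9 : 9 ≤ S.card + T.card) :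
    IsMinor K7vee G :=
  h.k7vee_of_octGood (fun i hi => hS i (of_decide_eq_true hi))
    (fun i hi => hT i (of_decide_eq_true hi)) (octGood_of_nine h9)

/-- The alternative of `exists_transversal6`. -/
abbrev ParallelGood (b c e f : Fin 6) : Prop :=
  (∃ k, Transversal6 b c k ∧ e = k ∧ f = opp6 k) ∨
      OctGood (fun i => decide (i = b ∨ i = c ∨ i = e)) (fun i => decide (i = b ∨ i = c ∨ i = f)) ∨
      OctGood (fun i => decide (i = b ∨ i = c ∨ i = f)) (fun i => decide (i = b ∨ i = c ∨ i = e))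

instance (b c e f : Fin 6) : Decidable (ParallelGood b c e f) := by
  unfold ParallelGood; infer_instance

theorem exists_transversal6 {b c e f : Fin 6} (h1 : c ≠ b) (h2 : c ≠ opp6 b) (h3 : e ≠ b)
    (h4 : e ≠ c) (h5 : f ≠ b) (h6 : f ≠ c) (h7 : e ≠ f) :
    ParallelGood b c e f := by
  revert b c e f; decide +kernel

/-- The bags of an octahedral model with a further connected set touching `b`, `c` and both
apices. -/
theorem OctModel.k7vee_of_parallel (h : OctModel G B) {X : Set V} (hX : Cn G X)
    (hd : ∀ i, Disjoint X (B i)) {b c e f : Fin 6} (h1 : c ≠ b) (h2 : c ≠ opp6 b) (h3 : e ≠ b)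
    (h4 : e ≠ c) (h5 : f ≠ b) (h6 : f ≠ c) (h7 : e ≠ f)
    (xb : Touch G X (B (.inl b))) (xc : Touch G X (B (.inl c)))
    (xu : Touch G X (B (.inr 0))) (xv : Touch G X (B (.inr 1)))
    (ub : Touch G (B (.inr 0)) (B (.inl b))) (uc : Touch G (B (.inr 0)) (B (.inl c)))
    (ue : Touch G (B (.inr 0)) (B (.inl e)))
    (vb : Touch G (B (.inr 1)) (B (.inl b))) (vc : Touch G (B (.inr 1)) (B (.inl c)))
    (vf : Touch G (B (.inr 1)) (B (.inl f))) : IsMinor K7vee G := by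
  rcases exists_transversal6 h1 h2 h3 h4 h5 h6 h7 with ⟨k, ht, rfl, rfl⟩ | hg
  · exact (h.permute ht).k7vee_of_extra hX (fun i => hd _) xb xc xu xv ub uc ue vb vc vf
  · refine h.k7vee_of_octGood (fun i hi => ?_) (fun i hi => ?_) hg
    · rcases of_decide_eq_true hi with rfl | rfl | rfl <;> assumption
    · rcases of_decide_eq_true hi with rfl | rfl | rfl <;> assumption

end OctTouch

section MembersSection

variable {V : Type} {G : SimpleGraph V} {u v w : V} {o : Fin 6 → V} {ι : Type} {X : ι → Set V}
  {a b s : ι → Fin 6}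

theorem core_swap (u v w : V) (o : Fin 6 → V) : core v u w o = core u v w o := by
  unfold core
  rw [Set.insert_comm]

theorem Frame.swap (h : Frame G u v w o) : Frame G v u w o where
  huv := h.huv.symm
  inj := h.inj
  hou := h.hov
  hov := h.hou
  how := h.how
  hwu := h.hwv
  hwv := h.hwu
  hub := h.hub
  nuw := h.nvw
  nvw := h.nuw
  anti := h.anti
  piece := by
    rw [core_swap]
    intro z hz
    obtain ⟨i, j, h1, h2, h3⟩ := h.piece z hz
    exact ⟨i, j, h1, h2, by rw [h3, Set.insert_comm]⟩
  octa := by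
    rw [core_swap]
    exact h.octa
  cover := by
    rw [core_swap]
    intro i
    rcases h.cover i with h | h | h
    exacts [Or.inr (Or.inl h), Or.inl h, Or.inr (Or.inr h)]

/-- Disjoint connected sets off the core, each touching `u`, `v` and two vertices of the
octahedron which are not antipodal. -/
structure Members (G : SimpleGraph V) (u v w : V) (o : Fin 6 → V) (X : ι → Set V)
    (a b : ι → Fin 6) : Prop where
  model : IsModel G X
  out : ∀ m, Disjoint (X m) (core u v w o)
  tu : ∀ m, Touch G (X m) {u}
  tv : ∀ m, Touch G (X m) {v}
  ta : ∀ m, Touch G (X m) {o (a m)}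
  tb : ∀ m, Touch G (X m) {o (b m)}
  ne : ∀ m, b m ≠ a m
  nopp : ∀ m, b m ≠ opp6 (a m)

/-- `s` assigns to each member one of its ends. -/
abbrev Assign (a b s : ι → Fin 6) : Prop := ∀ m, s m = a m ∨ s m = b m

/-- A vertex of the octahedron together with the members assigned to it. -/
def octBag (o : Fin 6 → V) (X : ι → Set V) (s : ι → Fin 6) (i : Fin 6) : Set V :=
  {o i} ∪ ⋃ m : {m // s m = i}, X m

/-- The nine bags given by an assignment. -/
def octBags (u v w : V) (o : Fin 6 → V) (X : ι → Set V) (s : ι → Fin 6) :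
    Fin 6 ⊕ Fin 3 → Set V :=
  Sum.elim (octBag o X s) ![{u}, {v}, {w}]

theorem mem_octBag {x : V} {i : Fin 6} : x ∈ octBag o X s i ↔ x = o i ∨ ∃ m, s m = i ∧ x ∈ X m := by
  simp [octBag, and_comm]

theorem mem_core {x : V} : x ∈ core u v w o ↔ x = u ∨ x = v ∨ x = w ∨ ∃ i, o i = x := by
  simp [core, or_assoc]

theorem Members.touch (hM : Members G u v w o X a b) (hs : Assign a b s) (m : ι) :
    Touch G (X m) {o (s m)} := by
  rcases hs m with h | h <;> rw [h]
  exacts [hM.ta m, hM.tb m]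

theorem Members.isModel (hF : Frame G u v w o) (hM : Members G u v w o X a b)
    (hs : Assign a b s) : IsModel G (octBags u v w o X s) := by
  have hout : ∀ m x, x ∈ X m → x ≠ u ∧ x ≠ v ∧ x ≠ w ∧ ∀ i, x ≠ o i := fun m x hx => by
    have := Set.disjoint_left.1 (hM.out m) hx
    rw [mem_core] at this
    push Not at this
    exact ⟨this.1, this.2.1, this.2.2.1, fun i h => this.2.2.2 i h.symm⟩
  have hoff : ∀ i x, x ∈ octBag o X s i → x ≠ u ∧ x ≠ v ∧ x ≠ w := fun i x hx => by
    rcases mem_octBag.1 hx with rfl | ⟨m, -, hx⟩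
    · exact ⟨hF.hou i, hF.hov i, hF.how i⟩
    · exact ⟨(hout m x hx).1, (hout m x hx).2.1, (hout m x hx).2.2.1⟩
  have hd : ∀ i k, Disjoint (octBag o X s i) ((![{u}, {v}, {w}] : Fin 3 → Set V) k) := by
    intro i k
    rw [Set.disjoint_left]
    intro x hx hk
    have := hoff i x hx
    fin_cases k
    exacts [this.1 hk, this.2.1 hk, this.2.2 hk]
  have h3 : ∀ k l : Fin 3, k ≠ l → Disjoint ((![{u}, {v}, {w}] : Fin 3 → Set V) k)
      ((![{u}, {v}, {w}] : Fin 3 → Set V) l) := by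
    have e1 := hF.huv.ne
    have e2 := hF.hwu
    have e3 := hF.hwv
    intro k l hkl
    fin_cases k <;> fin_cases l <;> simp_all [Ne.symm]
  refine ⟨?_, ?_⟩
  · rintro (i | k)
    · refine Cn.union_star (Cn.singleton (o i)) (fun m : {m // s m = i} => hM.model.1 m)
        fun m => Or.inl ?_
      have := hM.touch hs m
      rw [m.2] at this
      exact this.symm
    · fin_cases k <;> exact Cn.singleton _
  · rintro (i | k) (j | l) hij
    · rw [Set.disjoint_left]
      intro x hx hy
      have hij' : i ≠ j := fun e => hij (congrArg _ e)
      rcases mem_octBag.1 hx with rfl | ⟨m, h1, hx⟩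
      · rcases mem_octBag.1 hy with h | ⟨m', h2, hy⟩
        · exact hij' (hF.inj h)
        · exact (hout m' _ hy).2.2.2 i rfl
      · rcases mem_octBag.1 hy with rfl | ⟨m', h2, hy⟩
        · exact (hout m _ hx).2.2.2 j rfl
        · by_cases h : m = m'
          · subst h
            exact hij' (h1.symm.trans h2)
          · exact Set.disjoint_left.1 (hM.model.2 m m' h) hx hy
    · exact hd i l
    · exact (hd j k).symm
    · exact h3 k l fun e => hij (congrArg _ e)

theorem touch_octBag_of_adj {x : V} {i : Fin 6} (h : G.Adj x (o i)) :
    Touch G {x} (octBag o X s i) :=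
  ⟨x, rfl, o i, Or.inl rfl, h⟩

theorem subset_octBag (m : ι) : X m ⊆ octBag o X s (s m) :=
  fun _ hx => mem_octBag.2 (Or.inr ⟨m, rfl, hx⟩)

theorem Members.touch_u (hM : Members G u v w o X a b) {i : Fin 6}
    (h : G.Adj u (o i) ∨ ∃ m, s m = i) : Touch G {u} (octBag o X s i) := by
  rcases h with h | ⟨m, rfl⟩
  · exact touch_octBag_of_adj h
  · exact (hM.tu m).symm.mono le_rfl (subset_octBag m)

theorem Members.touch_v (hM : Members G u v w o X a b) {i : Fin 6}
    (h : G.Adj v (o i) ∨ ∃ m, s m = i) : Touch G {v} (octBag o X s i) := by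
  rcases h with h | ⟨m, rfl⟩
  · exact touch_octBag_of_adj h
  · exact (hM.tv m).symm.mono le_rfl (subset_octBag m)

/-- The member `m` has ends `i` and `j`. -/
abbrev HasEnds (a b : ι → Fin 6) (m : ι) (i j : Fin 6) : Prop :=
  a m = i ∧ b m = j ∨ a m = j ∧ b m = i

theorem Members.touch_octBag (hM : Members G u v w o X a b) (hs : Assign a b s) {i j : Fin 6}
    (h : G.Adj (o i) (o j) ∨ ∃ m, HasEnds a b m i j) :
    Touch G (octBag o X s i) (octBag o X s j) := by
  have ho : ∀ i, {o i} ⊆ octBag o X s i := fun i => Set.subset_union_left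
  rcases h with h | ⟨m, ⟨rfl, rfl⟩ | ⟨rfl, rfl⟩⟩
  · exact ⟨o i, ho i rfl, o j, ho j rfl, h⟩
  · rcases hs m with h | h
    · exact (hM.tb m).mono (h ▸ subset_octBag m) (ho _)
    · exact (hM.ta m).symm.mono (ho _) (h ▸ subset_octBag m)
  · rcases hs m with h | h
    · exact (hM.tb m).symm.mono (ho _) (h ▸ subset_octBag m)
    · exact (hM.ta m).mono (h ▸ subset_octBag m) (ho _)

theorem Members.octModel (hF : Frame G u v w o) (hM : Members G u v w o X a b)
    (hs : Assign a b s) (h : ∀ i j, j ≠ i → j ≠ opp6 i →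
      G.Adj (o i) (o j) ∨ ∃ m, HasEnds a b m i j) : OctModel G (octBags u v w o X s) where
  model := hM.isModel hF hs
  octa i j h1 h2 := hM.touch_octBag hs (h i j h1 h2)
  pole i := touch_octBag_of_adj (hF.hub i)
  edge := touch_singleton.2 hF.huv

end MembersSection

section RootedSection

variable {V : Type} {G : SimpleGraph V} {u v w : V} {o : Fin 6 → V}

theorem exists_fin6_ne (x y z : Fin 6) : ∃ k, k ≠ x ∧ k ≠ y ∧ k ≠ z := by
  revert x y z; decide

/-- An assignment giving `u` and `v` distinct neighbours off `b` and `c`. -/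
theorem exists_assign_distinct {ι : Type} {a b : ι → Fin 6} {P Q : Fin 6 → Prop} {i j : Fin 6}
    (hcover : ∀ k, k ≠ i → k ≠ j → P k ∨ Q k ∨ ∃ m, a m = k ∨ b m = k)
    (hP : (∀ m, (a m = i ∨ a m = j) ∧ (b m = i ∨ b m = j)) → ∃ k, k ≠ i ∧ k ≠ j ∧ P k)
    (hQ : (∀ m, (a m = i ∨ a m = j) ∧ (b m = i ∨ b m = j)) → ∃ k, k ≠ i ∧ k ≠ j ∧ Q k) :
    ∃ s, Assign a b s ∧ ∃ e f, e ≠ f ∧ e ≠ i ∧ e ≠ j ∧ f ≠ i ∧ f ≠ j ∧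
      (P e ∨ ∃ m, s m = e) ∧ (Q f ∨ ∃ m, s m = f) := by
  classical
  have hset : ∀ m x, (a m = x ∨ b m = x) → Assign a b (Function.update a m x) := by
    intro m x hx k
    by_cases h : k = m
    · subst h
      rcases hx with rfl | rfl <;> simp
    · simp [h]
  by_cases hall : ∀ m, (a m = i ∨ a m = j) ∧ (b m = i ∨ b m = j)
  · obtain ⟨e, e1, e2, e3⟩ := hP hall
    obtain ⟨f, f1, f2, f3⟩ := hQ hall
    refine ⟨a, fun m => Or.inl rfl, ?_⟩
    by_cases hef : e = f
    · subst hef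
      obtain ⟨k, k1, k2, k3⟩ := exists_fin6_ne i j e
      rcases hcover k k1 k2 with h | h | ⟨m, h⟩
      · exact ⟨k, e, k3, k1, k2, e1, e2, Or.inl h, Or.inl f3⟩
      · exact ⟨e, k, k3.symm, e1, e2, k1, k2, Or.inl e3, Or.inl h⟩
      · rcases h with h | h
        · rcases (hall m).1 with h' | h'
          exacts [absurd (h.symm.trans h') k1, absurd (h.symm.trans h') k2]
        · rcases (hall m).2 with h' | h'
          exacts [absurd (h.symm.trans h') k1, absurd (h.symm.trans h') k2]
    · exact ⟨e, f, hef, e1, e2, f1, f2, Or.inl e3, Or.inl f3⟩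
  · push Not at hall
    obtain ⟨m, hm⟩ := hall
    obtain ⟨x, hx, x1, x2⟩ : ∃ x, (a m = x ∨ b m = x) ∧ x ≠ i ∧ x ≠ j := by
      by_cases h : a m = i ∨ a m = j
      · exact ⟨b m, Or.inr rfl, hm h⟩
      · push Not at h
        exact ⟨a m, Or.inl rfl, h⟩
    obtain ⟨k, k1, k2, k3, k4, k5⟩ : ∃ k, k ≠ i ∧ k ≠ j ∧ k ≠ x ∧ k ≠ a m ∧ k ≠ b m := by
      have : ∀ i j x p q : Fin 6, p = x ∨ q = x →
          ∃ k, k ≠ i ∧ k ≠ j ∧ k ≠ x ∧ k ≠ p ∧ k ≠ q := by decide +kernel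
      exact this i j x _ _ hx
    rcases hcover k k1 k2 with h | h | ⟨m', h⟩
    · exact ⟨_, hset m x hx, k, x, k3, k1, k2, x1, x2, Or.inl h, Or.inr ⟨m, by simp⟩⟩
    · exact ⟨_, hset m x hx, x, k, k3.symm, x1, x2, k1, k2, Or.inr ⟨m, by simp⟩, Or.inl h⟩
    · have hmm : m ≠ m' := by
        rintro rfl
        rcases h with h | h
        exacts [k4 h.symm, k5 h.symm]
      refine ⟨Function.update (Function.update a m x) m' k, fun l => ?_, x, k, k3.symm, x1, x2, k1,
        k2, Or.inr ⟨m, ?_⟩, Or.inr ⟨m', ?_⟩⟩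
      · by_cases hl : l = m'
        · subst hl
          rcases h with rfl | rfl <;> simp
        · rw [Function.update_of_ne hl]
          exact hset m x hx l
      · rw [Function.update_of_ne hmm, Function.update_self]
      · rw [Function.update_self]

theorem Frame.exists_seen (hF : Frame G u v w o) (h4 : FourConn G) {i j : Fin 6}
    (h : ∀ z ∉ core u v w o, ∀ k, o k ∈ nbr G (comp G (core u v w o)ᶜ z) → k = i ∨ k = j) :
    ∃ k, k ≠ i ∧ k ≠ j ∧ G.Adj u (o k) := by
  by_contra hcon
  push Not at hcon
  have huS : u ∈ core u v w o := mem_core.2 (Or.inl rfl)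
  set T : Set V := insert u (core u v w o)ᶜ with hT
  have hn : nbr G T ⊆ {v, o i, o j} := by
    rintro y ⟨hy, x, hx, hxy⟩
    have hyS : y ∈ core u v w o := by
      by_contra h
      exact hy (Or.inr h)
    have hyu : y ≠ u := fun e => hy (Or.inl e)
    rcases mem_core.1 hyS with e | rfl | rfl | ⟨k, rfl⟩
    · exact absurd e hyu
    · exact Or.inl rfl
    · exfalso
      rcases hx with rfl | hx
      · exact hF.nuw hxy
      · have hn : y ∈ nbr G (comp G (core u v y o)ᶜ x) :=
          ⟨fun h => comp_subset h hyS, x, mem_comp_self hx, hxy⟩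
        obtain ⟨p, q, -, -, hpq⟩ := hF.piece x hx
        rw [hpq] at hn
        rcases hn with h | h | h | h
        exacts [hyu h, hF.hwv h, hF.how p h.symm, hF.how q h.symm]
    · have hk : k = i ∨ k = j := by
        rcases hx with rfl | hx
        · by_contra hk
          push Not at hk
          exact hcon k hk.1 hk.2 hxy
        · exact h x hx k ⟨fun h => comp_subset h hyS, x, mem_comp_self hx, hxy⟩
      rcases hk with rfl | rfl
      exacts [Or.inr (Or.inl rfl), Or.inr (Or.inr rfl)]
  have hw : w ∉ T ∪ nbr G T := by
    rintro ((h | h) | h)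
    · exact hF.hwu h
    · exact h (mem_core.2 (Or.inr (Or.inr (Or.inl rfl))))
    · rcases hn h with h | h | h
      exacts [hF.hwv h, hF.how i h.symm, hF.how j h.symm]
  have h3 := h4 T ⟨u, Or.inl rfl⟩ fun e => hw (e ▸ Set.mem_univ _)
  have := Set.ncard_le_ncard hn
  have h5 := Set.ncard_insert_le v {o i, o j}
  have h6 := Set.ncard_insert_le (o i) {o j}
  rw [Set.ncard_singleton] at h6
  omega

/-- The combinatorial core of `exists_rooted_model`. -/
def RootedLabels (i j e f e' f' : Fin 6) : Prop :=
  (e' = e ∨ e' ≠ opp6 e) ∧ (f' = f ∨ f' ≠ opp6 f) ∧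
  (e' ≠ i ∧ e' ≠ j ∧ f' ≠ i ∧ f' ≠ j) ∧ (e ≠ f' ∧ e' ≠ f ∧ e' ≠ f') ∧
  ((e ≠ opp6 i ∨ e' ≠ opp6 i) ∧ (e ≠ opp6 j ∨ e' ≠ opp6 j)) ∧
  ((f ≠ opp6 i ∨ f' ≠ opp6 i) ∧ (f ≠ opp6 j ∨ f' ≠ opp6 j))

instance (i j e f e' f' : Fin 6) : Decidable (RootedLabels i j e f e' f') := by
  unfold RootedLabels; infer_instance

theorem exists_rootedLabels : ∀ i j : Fin 6, j ≠ i → j ≠ opp6 i →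
    ∀ e f, e ≠ f → e ≠ i ∧ e ≠ j ∧ f ≠ i ∧ f ≠ j → ∃ e' f', RootedLabels i j e f e' f' := by
  decide +kernel

/-- A model of `K 4` rooted at both apices and two octahedral bags. -/
theorem exists_rooted_model {B : Fin 6 ⊕ Fin 3 → Set V} (hB : IsModel G B) {i j e f : Fin 6}
    (hocta : ∀ p q, q ≠ p → q ≠ opp6 p → p ≠ i → p ≠ j → Touch G (B (.inl p)) (B (.inl q)))
    (hpole : ∀ p, Touch G (B (.inr 2)) (B (.inl p))) (hedge : Touch G (B (.inr 0)) (B (.inr 1)))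
    (hj : j ≠ i) (hj' : j ≠ opp6 i) (hef : e ≠ f) (e1 : e ≠ i) (e2 : e ≠ j) (f1 : f ≠ i)
    (f2 : f ≠ j) (ue : Touch G (B (.inr 0)) (B (.inl e)))
    (vf : Touch G (B (.inr 1)) (B (.inl f))) :
    ∃ R : Fin 4 → Set V, IsModel G R ∧ (∀ k l, k ≠ l → Touch G (R k) (R l)) ∧
      B (.inr 0) ⊆ R 0 ∧ B (.inr 1) ⊆ R 1 ∧ B (.inl i) ⊆ R 2 ∧ B (.inl j) ⊆ R 3 ∧
      ∀ k, R k ⊆ ⋃ t, B t := by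
  obtain ⟨e', f', ⟨h1, h2, ⟨h3, h4, h5, h6⟩, ⟨h7, h8, h9⟩, ⟨h10, h11⟩, ⟨h12, h13⟩⟩⟩ :=
    exists_rootedLabels i j hj hj' e f hef ⟨e1, e2, f1, f2⟩
  have hcomm : ∀ p q : Fin 6, q ≠ opp6 p → p ≠ opp6 q := by decide
  have hTe : ∀ p q, p ≠ i → p ≠ j → q ≠ i → q ≠ j → (q = p ∨ q ≠ opp6 p) →
      Cn G (B (.inl p) ∪ B (.inl q)) := by
    intro p q p1 p2 q1 q2 h
    by_cases hpq : q = p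
    · subst hpq
      rw [Set.union_self]
      exact hB.1 _
    · exact (hB.1 _).union_touch (hB.1 _) (hocta p q hpq (h.resolve_left hpq) p1 p2)
  have hTi : ∀ p q k, p ≠ i → p ≠ j → q ≠ i → q ≠ j → (k = i ∨ k = j) →
      (p ≠ opp6 k ∨ q ≠ opp6 k) → Touch G (B (.inl p) ∪ B (.inl q)) (B (.inl k)) := by
    intro p q k p1 p2 q1 q2 hk h
    rw [touch_union_left]
    have hkp : k ≠ p := by rintro rfl; exact hk.elim p1 p2
    have hkq : k ≠ q := by rintro rfl; exact hk.elim q1 q2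
    rcases h with h | h
    · exact Or.inl (hocta p k hkp (hcomm _ _ h) p1 p2)
    · exact Or.inr (hocta q k hkq (hcomm _ _ h) q1 q2)
  let R : Fin 4 → Set V := ![B (.inr 0) ∪ (B (.inl e) ∪ B (.inl e')),
    B (.inr 1) ∪ (B (.inl f) ∪ B (.inl f')), B (.inr 2) ∪ B (.inl i), B (.inl j)]
  let T : Fin 4 → Set (Fin 6 ⊕ Fin 3) := ![{.inr 0, .inl e, .inl e'}, {.inr 1, .inl f, .inl f'},
    {.inr 2, .inl i}, {.inl j}]
  have hRT : ∀ k, R k = ⋃ t ∈ T k, B t := by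
    intro k
    fin_cases k <;> simp [R, T]
  have hRcn : ∀ k, Cn G (R k) := by
    intro k
    fin_cases k
    · exact (hB.1 _).union_touch (hTe _ _ e1 e2 h3 h4 h1) (touch_union_right.2 (Or.inl ue))
    · exact (hB.1 _).union_touch (hTe _ _ f1 f2 h5 h6 h2) (touch_union_right.2 (Or.inl vf))
    · exact (hB.1 _).union_touch (hB.1 _) (hpole i)
    · exact hB.1 _
  have hTd : ∀ k l, k < l → Disjoint (T k) (T l) := by
    intro k l hkl
    fin_cases k <;> fin_cases l <;> first | exact absurd hkl (by decide) | skip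
    all_goals simp [T, hj, e1.symm, e2.symm, f1.symm, f2.symm, h3.symm, h4.symm, h5.symm, h6.symm,
      hef.symm, h7.symm, h8.symm, h9.symm]
  have hRd : ∀ k l, k < l → Disjoint (R k) (R l) := by
    intro k l hkl
    rw [hRT, hRT]
    simp only [Set.disjoint_iUnion_left, Set.disjoint_iUnion_right]
    intro s hs t ht
    exact hB.2 _ _ fun e => Set.disjoint_left.1 (hTd k l hkl) (e ▸ ht) hs
  have hRt : ∀ k l, k < l → Touch G (R k) (R l) := by
    intro k l hkl
    fin_cases k <;> fin_cases l <;> first | exact absurd hkl (by decide) | skip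
    · exact hedge.mono Set.subset_union_left Set.subset_union_left
    · exact (hTi _ _ i e1 e2 h3 h4 (Or.inl rfl) h10).mono Set.subset_union_right
        Set.subset_union_right
    · exact (hTi _ _ j e1 e2 h3 h4 (Or.inr rfl) h11).mono Set.subset_union_right le_rfl
    · exact (hTi _ _ i f1 f2 h5 h6 (Or.inl rfl) h12).mono Set.subset_union_right
        Set.subset_union_right
    · exact (hTi _ _ j f1 f2 h5 h6 (Or.inr rfl) h13).mono Set.subset_union_right le_rfl
    · exact (hpole j).mono Set.subset_union_left le_rfl
  refine ⟨R, ⟨hRcn, fun k l hkl => ?_⟩, fun k l hkl => ?_, Set.subset_union_left,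
    Set.subset_union_left, Set.subset_union_right, le_rfl, fun k => ?_⟩
  · rcases lt_or_gt_of_ne hkl with h | h
    exacts [hRd k l h, (hRd l k h).symm]
  · rcases lt_or_gt_of_ne hkl with h | h
    exacts [hRt k l h, (hRt l k h).symm]
  · rw [hRT]
    exact Set.iUnion₂_subset fun t _ => Set.subset_iUnion B t

end RootedSection

section FillSection

variable {V : Type} {G : SimpleGraph V} {C Z : Set V}

/-- The subgraph on `C ∪ Z` with `Z` made complete. -/
def fill (G : SimpleGraph V) (C Z : Set V) : SimpleGraph ↥(C ∪ Z) where
  Adj x y := x ≠ y ∧ (G.Adj x y ∨ (x : V) ∈ Z ∧ (y : V) ∈ Z)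
  symm.symm _ _ h := ⟨h.1.symm, h.2.imp (fun h => h.symm) And.symm⟩
  loopless.irrefl _ h := h.1 rfl

/-- The arcs of `G` with an end in `W`. -/
def arcsAt (G : SimpleGraph V) (W : Set V) : Set (V × V) :=
  {p | G.Adj p.1 p.2 ∧ (p.1 ∈ W ∨ p.2 ∈ W)}

theorem fourConn_fill [Finite V] (h4 : FourConn G) (hn : nbr G C ⊆ Z) {y : V}
    (hyC : y ∉ C) (hyZ : y ∉ Z) : FourConn (fill G C Z) := by
  intro X hX hne
  set Q := fill G C Z
  have hadj : ∀ {x y : ↥(C ∪ Z)}, G.Adj x y → Q.Adj x y := fun {x y} h =>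
    ⟨fun e => h.ne (congrArg Subtype.val e), Or.inl h⟩
  have hcl : ∀ {x z : V}, x ∈ C → G.Adj x z → z ∈ C ∪ Z := fun {x z} hx h => by
    by_cases hz : z ∈ C
    · exact Or.inl hz
    · exact Or.inr (hn ⟨hz, x, hx, h⟩)
  rw [← Set.ncard_image_of_injective (nbr Q X) Subtype.val_injective]
  have key : ∀ Y : Set V, Y.Nonempty → Y ⊆ C → nbr G Y ⊆ Subtype.val '' nbr Q X →
      4 ≤ (Subtype.val '' nbr Q X).ncard := by
    intro Y hY hYC hs
    refine (h4.four_le (S := C ∪ Z) hY (fun z hz => ?_) (y := y) (fun h => hyC (hYC h)) ?_).trans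
      (Set.ncard_le_ncard hs)
    · obtain ⟨-, x, hx, hxz⟩ := hz
      exact hcl (hYC hx) hxz
    · rintro (h | h)
      exacts [hyC h, hyZ h]
  by_cases hXZ : ∃ x ∈ X, (x : V) ∈ Z
  · obtain ⟨x, hxX, hxZ⟩ := hXZ
    have hZ : ∀ z : ↥(C ∪ Z), (z : V) ∈ Z → z ∈ X ∪ nbr Q X := by
      intro z hz
      by_cases h : z ∈ X
      · exact Or.inl h
      · exact Or.inr ⟨h, x, hxX, fun e => h (e ▸ hxX), Or.inr ⟨hxZ, hz⟩⟩
    refine key (Subtype.val '' (X ∪ nbr Q X)ᶜ) ?_ ?_ ?_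
    · obtain ⟨z, hz⟩ := (Set.ne_univ_iff_exists_notMem _).1 hne
      exact ⟨z, z, hz, rfl⟩
    · rintro _ ⟨z, hz, rfl⟩
      rcases z.2 with h | h
      · exact h
      · exact absurd (hZ z h) hz
    · rintro z ⟨hz, _, ⟨x', hx', rfl⟩, hxz⟩
      have hxC : (x' : V) ∈ C := by
        rcases x'.2 with h | h
        · exact h
        · exact absurd (hZ x' h) hx'
      have hz' := hcl hxC hxz
      refine ⟨⟨z, hz'⟩, ?_, rfl⟩
      have h1 : (⟨z, hz'⟩ : ↥(C ∪ Z)) ∈ X ∪ nbr Q X := by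
        by_contra h
        exact hz ⟨_, h, rfl⟩
      refine h1.resolve_left fun h => hx' (Or.inr ⟨fun h' => hx' (Or.inl h'), ⟨z, hz'⟩, h, ?_⟩)
      exact hadj hxz.symm
  · push Not at hXZ
    refine key (Subtype.val '' X) (hX.image _) ?_ ?_
    · rintro _ ⟨x, hx, rfl⟩
      exact x.2.resolve_right (hXZ x hx)
    · rintro z ⟨hz, _, ⟨x', hx', rfl⟩, hxz⟩
      have hz' := hcl (x'.2.resolve_right (hXZ x' hx')) hxz
      exact ⟨⟨z, hz'⟩, ⟨fun h => hz ⟨_, h, rfl⟩, x', hx', hadj hxz⟩, rfl⟩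

theorem isMinor_fill {z : Fin 4 → V} (hz : Function.Injective z) (hZ : ∀ x ∈ Z, ∃ k, z k = x)
    {R : Fin 4 → Set V} (hR : IsModel G R) (ht : ∀ k l, k ≠ l → Touch G (R k) (R l))
    (hzR : ∀ k, z k ∈ R k) (hd : ∀ k, Disjoint C (R k)) : IsMinor (fill G C Z) G := by
  classical
  have hzC : ∀ k, z k ∉ C := fun k h => Set.disjoint_left.1 (hd k) h (hzR k)
  have hcase : ∀ x : ↥(C ∪ Z), (x : V) ∈ C ∨ ∃ k, z k = x := fun x => by
    rcases x.2 with h | h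
    · exact Or.inl h
    · exact Or.inr (hZ x h)
  let B : ↥(C ∪ Z) → Set V := fun x => if (x : V) ∈ C then {(x : V)} else
    ⋃ k : {k // z k = x}, R k
  have hB1 : ∀ x : ↥(C ∪ Z), (x : V) ∈ C → B x = {(x : V)} := fun x hx => if_pos hx
  have hB2 : ∀ (x : ↥(C ∪ Z)) (k : Fin 4), z k = x → B x = R k := fun x k hk => by
    have hx : (x : V) ∉ C := hk ▸ hzC k
    simp only [B, if_neg hx]
    ext y
    simp only [Set.mem_iUnion, Subtype.exists, exists_prop]
    constructor
    · rintro ⟨l, hl, hy⟩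
      exact (hz (hl.trans hk.symm)) ▸ hy
    · exact fun hy => ⟨k, hk, hy⟩
  have hself : ∀ x : ↥(C ∪ Z), (x : V) ∈ B x := fun x => by
    rcases hcase x with h | ⟨k, h⟩
    · rw [hB1 x h]; rfl
    · rw [hB2 x k h, ← h]
      exact hzR k
  refine isMinor_of_bags B (fun x => ?_) (fun x y hxy => ?_) fun x y hxy => ?_
  · rcases hcase x with h | ⟨k, h⟩
    · rw [hB1 x h]
      exact Cn.singleton _
    · rw [hB2 x k h]
      exact hR.1 k
  · rcases hcase x with h | ⟨k, h⟩ <;> rcases hcase y with h' | ⟨l, h'⟩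
    · rw [hB1 x h, hB1 y h', Set.disjoint_singleton]
      exact fun e => hxy (Subtype.ext e)
    · rw [hB1 x h, hB2 y l h']
      exact (hd l).mono_left (Set.singleton_subset_iff.2 h)
    · rw [hB2 x k h, hB1 y h']
      exact ((hd k).mono_left (Set.singleton_subset_iff.2 h')).symm
    · rw [hB2 x k h, hB2 y l h']
      refine hR.2 k l fun e => hxy (Subtype.ext ?_)
      rw [← h, ← h', e]
  · rcases hxy.2 with h | ⟨h, h'⟩
    · exact ⟨x, hself x, y, hself y, h⟩
    · obtain ⟨k, h⟩ := hZ x h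
      obtain ⟨l, h'⟩ := hZ y h'
      rw [hB2 x k h, hB2 y l h']
      refine ht k l fun e => hxy.1 (Subtype.ext ?_)
      rw [← h, ← h', e]

theorem ncard_arcsAt_add_le [Finite V] (hn : nbr G C ⊆ Z) (hd : Disjoint C Z) :
    (arcsAt G C).ncard + Z.ncard * (Z.ncard - 1) ≤ (arcs (fill G C Z)).ncard := by
  classical
  have := Fintype.ofFinite V
  have hcl : ∀ {x z : V}, x ∈ C → G.Adj x z → z ∈ C ∪ Z := fun {x z} hx h => by
    by_cases hz : z ∈ C
    · exact Or.inl hz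
    · exact Or.inr (hn ⟨hz, x, hx, h⟩)
  have hoff : Z.offDiag.ncard = Z.ncard * (Z.ncard - 1) := by
    have h1 := Finset.offDiag_card Z.toFinset
    rw [← Set.ncard_coe_finset, Finset.coe_offDiag, Set.coe_toFinset,
      ← Set.ncard_coe_finset Z.toFinset, Set.coe_toFinset] at h1
    rw [h1, Nat.mul_sub, mul_one]
  rw [← hoff, ← Set.ncard_union_eq,
    ← Set.ncard_image_of_injective (arcs _) (Subtype.val_injective.prodMap Subtype.val_injective)]
  · refine Set.ncard_le_ncard ?_
    rintro ⟨x, y⟩ (⟨h, hx | hy⟩ | ⟨hx, hy, hxy⟩)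
    · exact ⟨(⟨x, Or.inl hx⟩, ⟨y, hcl hx h⟩), ⟨fun e => h.ne (congrArg Subtype.val e), Or.inl h⟩,
          rfl⟩
    · exact ⟨(⟨x, hcl hy h.symm⟩, ⟨y, Or.inl hy⟩), ⟨fun e => h.ne (congrArg Subtype.val e),
          Or.inl h⟩,
        rfl⟩
    · exact ⟨(⟨x, Or.inr hx⟩, ⟨y, Or.inr hy⟩), ⟨fun e => hxy (congrArg Subtype.val e),
        Or.inr ⟨hx, hy⟩⟩, rfl⟩
  · rw [Set.disjoint_left]
    rintro ⟨x, y⟩ ⟨-, hx | hy⟩ ⟨hx', hy', -⟩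
    exacts [Set.disjoint_left.1 hd hx hx', Set.disjoint_left.1 hd hy hy']

end FillSection

section PieceSection

variable {V : Type} {G : SimpleGraph V} {u v w : V} {o : Fin 6 → V}

/-- The piece of a frame containing `z`. -/
abbrev framePiece (G : SimpleGraph V) (u v w : V) (o : Fin 6 → V) (z : V) : Set V :=
  comp G (core u v w o)ᶜ z

theorem framePiece_disjoint_core {z : V} :
    Disjoint (framePiece G u v w o z) (core u v w o) :=
  Set.disjoint_left.2 fun _ hx => comp_subset hx

theorem isModel_framePieces {P : Set V → Prop} : IsModel G
    (fun p : {C : Set V // P C ∧ ∃ z ∉ core u v w o, C = framePiece G u v w o z} => p.1) := by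
  refine ⟨fun ⟨p, _, z, hz, hp⟩ => ?_, fun ⟨p, _, z, hz, hp⟩ ⟨q, _, y, hy, hq⟩ hpq => ?_⟩
  · subst hp
    exact cn_comp (U := (core u v w o)ᶜ) hz
  · subst hp hq
    rw [Set.disjoint_left]
    intro x hx hy
    exact hpq (Subtype.ext ((comp_eq_of_mem hx).symm.trans (comp_eq_of_mem hy)))

theorem Frame.o_inj (hF : Frame G u v w o) {k i j : Fin 6}
    (h : o k ∈ ({u, v, o i, o j} : Set V)) : k = i ∨ k = j := by
  rcases h with h | h | h | h
  · exact absurd h (hF.hou k)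
  · exact absurd h (hF.hov k)
  · exact Or.inl (hF.inj h)
  · exact Or.inr (hF.inj h)

theorem injective_vec4 {x y z t : V} (h1 : x ≠ y) (h2 : x ≠ z) (h3 : x ≠ t) (h4 : y ≠ z)
    (h5 : y ≠ t) (h6 : z ≠ t) : Function.Injective ![x, y, z, t] := by
  intro k l hkl
  fin_cases k <;> fin_cases l <;> first
    | rfl
    | exact absurd hkl ‹_›
    | exact absurd hkl.symm ‹_›

theorem Frame.isMinor_fill_piece [Finite V] (hF : Frame G u v w o) (h4 : FourConn G) {z₀ : V}
    (hz₀ : z₀ ∉ core u v w o) {i j : Fin 6} (hij : j ≠ i) (hij' : j ≠ opp6 i)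
    (hn : nbr G (framePiece G u v w o z₀) = {u, v, o i, o j}) :
    IsMinor (fill G (framePiece G u v w o z₀) {u, v, o i, o j}) G := by
  set C := framePiece G u v w o z₀ with hC
  let ι := {D : Set V // D ≠ C ∧ ∃ z ∉ core u v w o, D = framePiece G u v w o z}
  have hends : ∀ m : ι, ∃ p : Fin 6 × Fin 6, p.2 ≠ p.1 ∧ p.2 ≠ opp6 p.1 ∧
      nbr G m.1 = {u, v, o p.1, o p.2} := by
    rintro ⟨D, -, z, hz, rfl⟩
    obtain ⟨p, q, h⟩ := hF.piece z hz
    exact ⟨(p, q), h⟩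
  choose ab hab using hends
  have hM : Members G u v w o (fun m : ι => m.1) (fun m => (ab m).1) (fun m => (ab m).2) := by
    refine ⟨isModel_framePieces, ?_, fun m => ?_, fun m => ?_, fun m => ?_, fun m => ?_,
      fun m => (hab m).1, fun m => (hab m).2.1⟩
    · rintro ⟨D, -, z, hz, rfl⟩
      exact framePiece_disjoint_core
    all_goals exact touch_of_mem_nbr (by rw [(hab m).2.2]; simp)
  have hother : ∀ z ∉ core u v w o, ∀ k, o k ∈ nbr G (framePiece G u v w o z) → k ≠ i → k ≠ j →
      ∃ m : ι, m.1 = framePiece G u v w o z := by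
    intro z hz k hk h1 h2
    refine ⟨⟨framePiece G u v w o z, fun e => ?_, z, hz, rfl⟩, rfl⟩
    rw [e, hn] at hk
    rcases hF.o_inj hk with h | h
    exacts [h1 h, h2 h]
  have hmem : ∀ (m : ι) k, o k ∈ nbr G m.1 → (ab m).1 = k ∨ (ab m).2 = k := by
    intro m k hk
    rw [(hab m).2.2] at hk
    exact (hF.o_inj hk).imp Eq.symm Eq.symm
  have hall : (∀ m : ι, ((ab m).1 = i ∨ (ab m).1 = j) ∧ ((ab m).2 = i ∨ (ab m).2 = j)) →
      ∀ z ∉ core u v w o, ∀ k, o k ∈ nbr G (comp G (core u v w o)ᶜ z) → k = i ∨ k = j := by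
    intro h z hz k hk
    by_contra hk'
    push Not at hk'
    obtain ⟨m, hm⟩ := hother z hz k hk hk'.1 hk'.2
    rcases hmem m k (hm ▸ hk) with e | e
    · exact (e ▸ (h m).1).elim hk'.1 hk'.2
    · exact (e ▸ (h m).2).elim hk'.1 hk'.2
  obtain ⟨s, hs, e, f, hef, e1, e2, f1, f2, he, hf⟩ :=
    exists_assign_distinct (a := fun m => (ab m).1) (b := fun m => (ab m).2) (i := i) (j := j)
      (P := fun k => G.Adj u (o k)) (Q := fun k => G.Adj v (o k))
      (by
        intro k h1 h2
        rcases hF.cover k with h | h | ⟨z, hz, h⟩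
        · exact Or.inl h
        · exact Or.inr (Or.inl h)
        · obtain ⟨m, hm⟩ := hother z hz k h h1 h2
          exact Or.inr (Or.inr ⟨m, hmem m k (hm ▸ h)⟩))
      (fun h => hF.exists_seen h4 (hall h))
      (fun h => hF.swap.exists_seen h4 (by rw [core_swap]; exact hall h))
  have hends : ∀ p q, p ≠ i → p ≠ j → q ≠ p → q ≠ opp6 p → G.Adj (o p) (o q) ∨
      ∃ m : ι, HasEnds (fun m => (ab m).1) (fun m => (ab m).2) m p q := by
    intro p q h1 h2 h3 h4
    rcases hF.octa p q h3 h4 with h | ⟨z, hz, hp, hq⟩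
    · exact Or.inl h
    · obtain ⟨m, hm⟩ := hother z hz p hp h1 h2
      refine Or.inr ⟨m, ?_⟩
      rcases hmem m p (hm ▸ hp) with e | e <;> rcases hmem m q (hm ▸ hq) with e' | e'
      · exact absurd (e'.symm.trans e) h3
      · exact Or.inl ⟨e, e'⟩
      · exact Or.inr ⟨e', e⟩
      · exact absurd (e'.symm.trans e) h3
  obtain ⟨R, hR, ht, r0, r1, r2, r3, hRB⟩ := exists_rooted_model (hM.isModel hF hs)
    (fun p q h1 h2 h3 h4 => hM.touch_octBag hs (hends p q h3 h4 h1 h2))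
    (fun p => touch_octBag_of_adj (hF.hub p)) (touch_singleton.2 hF.huv) hij hij' hef e1 e2 f1 f2
    (hM.touch_u he) (hM.touch_v hf)
  have hoo : o i ≠ o j := fun e => hij (hF.inj e).symm
  refine isMinor_fill (z := ![u, v, o i, o j]) (R := R) ?_ ?_ hR ht ?_ ?_
  · exact injective_vec4 hF.huv.ne (hF.hou i).symm (hF.hou j).symm (hF.hov i).symm
      (hF.hov j).symm hoo
  · rintro x (rfl | rfl | rfl | rfl)
    exacts [⟨0, rfl⟩, ⟨1, rfl⟩, ⟨2, rfl⟩, ⟨3, rfl⟩]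
  · intro k
    fin_cases k
    exacts [r0 rfl, r1 rfl, r2 (Or.inl rfl), r3 (Or.inl rfl)]
  · intro k
    refine Disjoint.mono_right (hRB k) ?_
    rw [Set.disjoint_iUnion_right]
    have hcore : ∀ x, x ∈ core u v w o → x ∉ C := fun x hx h => comp_subset h hx
    have hm : ∀ m : ι, Disjoint C m.1 := by
      rintro ⟨D, hD, z, hz, rfl⟩
      rw [Set.disjoint_left]
      exact fun x hx hy => hD ((comp_eq_of_mem hy).symm.trans (comp_eq_of_mem hx))
    rintro (p | t)
    · rw [Set.disjoint_right]
      intro x hx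
      rcases mem_octBag.1 hx with rfl | ⟨m, -, hx⟩
      · exact hcore _ (mem_core.2 (Or.inr (Or.inr (Or.inr ⟨p, rfl⟩))))
      · exact fun h => Set.disjoint_left.1 (hm m) h hx
    · rw [Set.disjoint_right]
      intro x hx
      refine hcore x (mem_core.2 ?_)
      fin_cases t
      exacts [Or.inl hx, Or.inr (Or.inl hx), Or.inr (Or.inr (Or.inl hx))]

end PieceSection

section PieceMembersSection

variable {V : Type} {G : SimpleGraph V} {u v w : V} {o : Fin 6 → V}

theorem ncard_arcs_k2222 {W : Type} {K : SimpleGraph W} (e : K ≃g K2222) :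
    (arcs K).ncard = 48 := by
  classical
  have h : (arcs K2222).ncard = 48 := by
    have : arcs K2222 = ((Finset.univ.filter fun p : (Fin 4 × Fin 2) × (Fin 4 × Fin 2) =>
        p.1.1 ≠ p.2.1 : Finset _) : Set _) := by
      ext p
      simp [arcs, k2222_adj]
    rw [this, Set.ncard_coe_finset]
    decide +kernel
  rw [← h]
  refine Set.ncard_congr (fun p _ => (e p.1, e p.2)) (fun p hp => e.map_adj_iff.2 hp) ?_ ?_
  · rintro ⟨x, y⟩ ⟨x', y'⟩ - - h
    simpa using h
  · rintro ⟨x, y⟩ h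
    refine ⟨(e.symm x, e.symm y), ?_, by simp⟩
    rw [← e.apply_symm_apply x, ← e.apply_symm_apply y] at h
    exact e.map_adj_iff.1 h

theorem exists_antipodes {C Z : Set V} (e : fill G C Z ≃g K2222) {z : Fin 4 → V}
    (hz : Function.Injective z) (hzZ : ∀ k, z k ∈ Z) (hZC : Disjoint C Z) :
    ∃ c : Fin 4 → V, Function.Injective c ∧ (∀ k, c k ∈ C) ∧
      ∀ k l, k ≠ l → G.Adj (c k) (c l) ∧ G.Adj (c k) (z l) := by
  let Zv : Fin 4 → ↥(C ∪ Z) := fun k => ⟨z k, Or.inr (hzZ k)⟩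
  have hadj : ∀ k l, k ≠ l → (e (Zv k)).1 ≠ (e (Zv l)).1 := fun k l hkl => by
    rw [← k2222_adj, e.map_adj_iff]
    exact ⟨fun h => hkl (hz (congrArg Subtype.val h)), Or.inr ⟨hzZ k, hzZ l⟩⟩
  let t : Fin 4 → ↥(C ∪ Z) := fun k => e.symm ((e (Zv k)).1, (e (Zv k)).2 + 1)
  have ht : ∀ k, e (t k) = ((e (Zv k)).1, (e (Zv k)).2 + 1) := fun k => e.apply_symm_apply _
  have hne : ∀ k, t k ≠ Zv k := fun k h => by
    have := congrArg Prod.snd (ht k)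
    rw [h] at this
    exact (by decide : ∀ x : Fin 2, x ≠ x + 1) _ this
  have htC : ∀ k, (t k : V) ∈ C := fun k => by
    refine (t k).2.resolve_right fun h => ?_
    have : (fill G C Z).Adj (t k) (Zv k) := ⟨hne k, Or.inr ⟨h, hzZ k⟩⟩
    rw [← e.map_adj_iff, k2222_adj, ht] at this
    exact this rfl
  have hG : ∀ k (x : ↥(C ∪ Z)), (fill G C Z).Adj (t k) x → G.Adj (t k) x := fun k x h =>
    h.2.resolve_right fun h => Set.disjoint_left.1 hZC (htC k) h.1
  refine ⟨fun k => t k, fun k l h => ?_, htC, fun k l hkl => ⟨hG k (t l) ?_, hG k (Zv l) ?_⟩⟩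
  · by_contra hkl
    have h' : t k = t l := Subtype.ext h
    have := congrArg (fun x => (e x).1) h'
    simp only [ht] at this
    exact hadj k l hkl this
  · rw [← e.map_adj_iff, k2222_adj, ht, ht]
    exact hadj k l hkl
  · rw [← e.map_adj_iff, k2222_adj, ht]
    exact hadj k l hkl

theorem Frame.exists_members_piece [Finite V] (hF : Frame G u v w o) (h4 : FourConn G)
    (hK : ¬ IsMinor K7vee G)
    (ih : ∀ (W : Type) [Finite W] (H : SimpleGraph W), Nat.card W < Nat.card V → 3 ≤ Nat.card W →
      FourConn H → ¬ IsMinor K7vee H → defect H < 0 → Nonempty (H ≃g K2222)) {z₀ : V}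
    (hz₀ : z₀ ∉ core u v w o) {i j : Fin 6} (hij : j ≠ i) (hij' : j ≠ opp6 i)
    (hn : nbr G (framePiece G u v w o z₀) = {u, v, o i, o j}) :
    ∃ (r : ℕ) (X : Fin r → Set V), 0 < r ∧
      Members G u v w o X (fun _ => i) (fun _ => j) ∧ (∀ m, X m ⊆ framePiece G u v w o z₀) ∧
      (arcsAt G (framePiece G u v w o z₀)).ncard ≤
        8 * (framePiece G u v w o z₀).ncard + 2 * r := by
  have hmin := hF.isMinor_fill_piece h4 hz₀ hij hij' hn
  have hCn : Cn G (framePiece G u v w o z₀) := cn_comp (U := (core u v w o)ᶜ) hz₀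
  have hCcore : Disjoint (framePiece G u v w o z₀) (core u v w o) := framePiece_disjoint_core
  have hz₀C : z₀ ∈ framePiece G u v w o z₀ := mem_comp_self hz₀
  generalize framePiece G u v w o z₀ = C at *
  set Z : Set V := {u, v, o i, o j} with hZ
  have hoo : o i ≠ o j := fun e => hij (hF.inj e).symm
  have hzinj : Function.Injective ![u, v, o i, o j] :=
    injective_vec4 hF.huv.ne (hF.hou i).symm (hF.hou j).symm (hF.hov i).symm (hF.hov j).symm hoo
  have hzZ : ∀ k, (![u, v, o i, o j] : Fin 4 → V) k ∈ Z := by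
    intro k
    fin_cases k <;> simp [hZ]
  have hZcore : Z ⊆ core u v w o := by
    rintro x (rfl | rfl | rfl | rfl) <;> simp [mem_core]
  have hCZ : Disjoint C Z := hCcore.mono_right hZcore
  have hZ4 : Z.ncard = 4 := by
    have : Z = Set.range ![u, v, o i, o j] := by
      ext x
      simp only [hZ, Set.mem_insert_iff, Set.mem_singleton_iff, Matrix.range_cons,
        Matrix.range_empty, Set.mem_union, Set.mem_empty_iff_false, or_false]
    rw [this, Set.ncard_range_of_injective hzinj]
    simp
  have hwC : w ∉ C := fun h => Set.disjoint_left.1 hCcore h (by simp [mem_core])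
  have hwZ : w ∉ Z := by
    rintro (h | h | h | h)
    exacts [hF.hwu h, hF.hwv h, hF.how _ h.symm, hF.how _ h.symm]
  have hcard : (C ∪ Z).ncard = C.ncard + 4 := by rw [Set.ncard_union_eq hCZ, hZ4]
  have harcs := ncard_arcsAt_add_le (G := G) hn.le hCZ
  rw [hZ4] at harcs
  have htouch : ∀ x ∈ Z, Touch G C {x} := fun x hx => touch_of_mem_nbr (hn ▸ hx)
  by_cases hd : defect (fill G C Z) < 0
  · have hlt : (C ∪ Z).ncard < Nat.card V := by
      rw [← Set.ncard_univ]
      exact Set.ncard_lt_ncard ⟨Set.subset_univ _, fun h => (h (Set.mem_univ w)).elim hwC hwZ⟩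
    obtain ⟨e⟩ := ih _ (fill G C Z) (by rwa [Nat.card_coe_set_eq])
      (by rw [Nat.card_coe_set_eq]; omega) (fourConn_fill h4 hn.le hwC hwZ)
      (fun h => hK (h.trans hmin)) hd
    have h48 := ncard_arcs_k2222 e
    have h8 : (C ∪ Z).ncard = 8 := by
      rw [← Nat.card_coe_set_eq, Nat.card_congr e.toEquiv]
      simp
    obtain ⟨c, hc, hcC, hadj⟩ := exists_antipodes e hzinj hzZ hCZ
    have hXC : ∀ m : Fin 2, (![{c 0, c 1}, {c 2, c 3}] : Fin 2 → Set V) m ⊆ C := by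
      intro m
      fin_cases m
      all_goals
        rintro x (rfl | rfl) <;> exact hcC _
    refine ⟨2, ![{c 0, c 1}, {c 2, c 3}], by omega, ⟨⟨?_, ?_⟩, fun m => hCcore.mono_left (hXC m),
      ?_, ?_, ?_, ?_, fun _ => hij, fun _ => hij'⟩, hXC, by omega⟩
    · intro m
      fin_cases m
      exacts [Cn.pair (hadj 0 1 (by decide)).1, Cn.pair (hadj 2 3 (by decide)).1]
    · have h : Disjoint ({c 0, c 1} : Set V) {c 2, c 3} := by
        rw [Set.disjoint_left]
        rintro x (rfl | rfl) (h | h) <;> exact absurd (hc h) (by decide)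
      intro m m' hm
      fin_cases m <;> fin_cases m'
      exacts [absurd rfl hm, h, h.symm, absurd rfl hm]
    · intro m
      fin_cases m
      exacts [⟨c 1, Or.inr rfl, u, rfl, (hadj 1 0 (by decide)).2⟩,
        ⟨c 2, Or.inl rfl, u, rfl, (hadj 2 0 (by decide)).2⟩]
    · intro m
      fin_cases m
      exacts [⟨c 0, Or.inl rfl, v, rfl, (hadj 0 1 (by decide)).2⟩,
        ⟨c 2, Or.inl rfl, v, rfl, (hadj 2 1 (by decide)).2⟩]
    · intro m
      fin_cases m
      exacts [⟨c 0, Or.inl rfl, _, rfl, (hadj 0 2 (by decide)).2⟩,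
        ⟨c 3, Or.inr rfl, _, rfl, (hadj 3 2 (by decide)).2⟩]
    · intro m
      fin_cases m
      exacts [⟨c 0, Or.inl rfl, _, rfl, (hadj 0 3 (by decide)).2⟩,
        ⟨c 2, Or.inl rfl, _, rfl, (hadj 2 3 (by decide)).2⟩]
  · refine ⟨1, fun _ => C, one_pos, ⟨⟨fun _ => hCn, fun a b hab => absurd
        (Subsingleton.elim a b) hab⟩,
      fun _ => hCcore, fun _ => htouch _ (hzZ 0), fun _ => htouch _ (hzZ 1),
      fun _ => htouch _ (hzZ 2), fun _ => htouch _ (hzZ 3), fun _ => hij, fun _ => hij'⟩,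
      fun _ => le_rfl, ?_⟩
    unfold defect at hd
    rw [Nat.card_coe_set_eq, hcard] at hd
    push_cast at hd
    omega

end PieceMembersSection

section GlobalMembersSection

variable {V : Type} {G : SimpleGraph V} {u v w : V} {o : Fin 6 → V}

theorem Members.sum {ι κ : Type} {X : ι → Set V} {Y : κ → Set V} {a b : ι → Fin 6}
    {c d : κ → Fin 6} (hX : Members G u v w o X a b) (hY : Members G u v w o Y c d)
    (h : ∀ m k, Disjoint (X m) (Y k)) :
    Members G u v w o (Sum.elim X Y) (Sum.elim a c) (Sum.elim b d) := by
  refine ⟨⟨Sum.rec hX.model.1 hY.model.1, ?_⟩, Sum.rec hX.out hY.out, Sum.rec hX.tu hY.tu,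
    Sum.rec hX.tv hY.tv, Sum.rec hX.ta hY.ta, Sum.rec hX.tb hY.tb, Sum.rec hX.ne hY.ne,
    Sum.rec hX.nopp hY.nopp⟩
  rintro (m | m) (k | k) hmk
  · exact hX.model.2 m k fun e => hmk (congrArg _ e)
  · exact h m k
  · exact (h k m).symm
  · exact hY.model.2 m k fun e => hmk (congrArg _ e)

theorem arcsAt_union {W C : Set V} : arcsAt G (W ∪ C) = arcsAt G W ∪ arcsAt G C := by
  ext p
  simp only [arcsAt, Set.mem_ofPred_eq, Set.mem_union]
  tauto

theorem Frame.exists_members [Finite V] (hF : Frame G u v w o) (h4 : FourConn G)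
    (hK : ¬ IsMinor K7vee G)
    (ih : ∀ (W : Type) [Finite W] (H : SimpleGraph W), Nat.card W < Nat.card V → 3 ≤ Nat.card W →
      FourConn H → ¬ IsMinor K7vee H → defect H < 0 → Nonempty (H ≃g K2222)) :
    ∃ (ι : Type) (_ : Finite ι) (X : ι → Set V) (a b : ι → Fin 6), Members G u v w o X a b ∧
      (∀ z ∉ core u v w o, ∃ m, nbr G (framePiece G u v w o z) = {u, v, o (a m), o (b m)}) ∧
      (arcsAt G (core u v w o)ᶜ).ncard ≤ 8 * ((core u v w o)ᶜ).ncard + 2 * Nat.card ι := by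
  classical
  have key : ∀ T : Finset V, (∀ z ∈ T, z ∉ core u v w o) →
      ∃ (ι : Type) (_ : Finite ι) (X : ι → Set V) (a b : ι → Fin 6), Members G u v w o X a b ∧
      (∀ z ∈ T, ∃ m, nbr G (framePiece G u v w o z) = {u, v, o (a m), o (b m)}) ∧
      (∀ m, X m ⊆ ⋃ z ∈ T, framePiece G u v w o z) ∧
      (arcsAt G (⋃ z ∈ T, framePiece G u v w o z)).ncard ≤
        8 * (⋃ z ∈ T, framePiece G u v w o z).ncard + 2 * Nat.card ι := by
    intro T
    induction T using Finset.induction with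
    | empty =>
      intro _
      refine ⟨Empty, inferInstance, Empty.elim, Empty.elim, Empty.elim,
        ⟨⟨fun m => m.elim, fun m => m.elim⟩, fun m => m.elim, fun m => m.elim, fun m => m.elim,
          fun m => m.elim, fun m => m.elim, fun m => m.elim, fun m => m.elim⟩,
        by simp, fun m => m.elim, by simp [arcsAt]⟩
    | insert z T hz hT =>
      intro hTc
      obtain ⟨ι, _, X, a, b, hM, hp, hXW, hc⟩ := hT fun y hy => hTc y (Finset.mem_insert_of_mem hy)
      have hzc := hTc z (Finset.mem_insert_self _ _)
      rw [Finset.set_biUnion_insert]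
      by_cases hzW : ∃ y ∈ T, z ∈ framePiece G u v w o y
      · obtain ⟨y, hy, hzy⟩ := hzW
        have he : framePiece G u v w o z = framePiece G u v w o y := comp_eq_of_mem hzy
        have hsub : framePiece G u v w o z ⊆ ⋃ z ∈ T, framePiece G u v w o z := by
          rw [he]
          exact Set.subset_biUnion_of_mem (u := fun z => framePiece G u v w o z) hy
        rw [Set.union_eq_self_of_subset_left hsub]
        refine ⟨ι, inferInstance, X, a, b, hM, fun x hx => ?_, hXW, hc⟩
        rcases Finset.mem_insert.1 hx with rfl | hx
        · rw [he]
          exact hp y hy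
        · exact hp x hx
      · obtain ⟨i, j, hij, hij', hn⟩ := hF.piece z hzc
        obtain ⟨r, Y, hr, hY, hYC, hYc⟩ := hF.exists_members_piece h4 hK ih hzc hij hij' hn
        have hdisj : Disjoint (framePiece G u v w o z) (⋃ z ∈ T, framePiece G u v w o z) := by
          rw [Set.disjoint_left]
          intro x hx hx'
          obtain ⟨y, hy, hxy⟩ := Set.mem_iUnion₂.1 hx'
          refine hzW ⟨y, hy, ?_⟩
          have e1 : comp G (core u v w o)ᶜ x = comp G (core u v w o)ᶜ z := comp_eq_of_mem hx
          have e2 : comp G (core u v w o)ᶜ x = comp G (core u v w o)ᶜ y := comp_eq_of_mem hxy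
          have hz' : z ∈ comp G (core u v w o)ᶜ z := mem_comp_self hzc
          rw [← e1, e2] at hz'
          exact hz'
        refine ⟨ι ⊕ Fin r, inferInstance, Sum.elim X Y, Sum.elim a fun _ => i,
          Sum.elim b fun _ => j, hM.sum hY fun m k => (hdisj.mono (hYC k) (hXW m)).symm,
          fun x hx => ?_, Sum.rec (fun m => (hXW m).trans Set.subset_union_right)
            fun k => (hYC k).trans Set.subset_union_left, ?_⟩
        · rcases Finset.mem_insert.1 hx with rfl | hx
          · exact ⟨Sum.inr ⟨0, hr⟩, hn⟩
          · obtain ⟨m, hm⟩ := hp x hx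
            exact ⟨Sum.inl m, hm⟩
        · rw [arcsAt_union, Set.ncard_union_eq hdisj, Nat.card_sum, Nat.card_fin]
          have := Set.ncard_union_le (arcsAt G (framePiece G u v w o z))
            (arcsAt G (⋃ z ∈ T, framePiece G u v w o z))
          omega
  have := Fintype.ofFinite V
  obtain ⟨ι, hι, X, a, b, hM, hp, -, hc⟩ := key (Finset.univ.filter (· ∉ core u v w o))
    fun z hz => (Finset.mem_filter.1 hz).2
  have hU : (⋃ z ∈ Finset.univ.filter (· ∉ core u v w o), framePiece G u v w o z) =
      (core u v w o)ᶜ := by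
    ext x
    simp only [Set.mem_iUnion, Finset.mem_filter, Finset.mem_univ, true_and, exists_prop]
    exact ⟨fun ⟨z, _, hx⟩ => comp_subset hx, fun hx => ⟨x, hx, mem_comp_self hx⟩⟩
  rw [hU] at hc
  exact ⟨ι, hι, X, a, b, hM, fun z hz => hp z (by simpa using hz), hc⟩

end GlobalMembersSection

section CoreCountSection

variable {V : Type} {G : SimpleGraph V} {u v w : V} {o : Fin 6 → V}

/-- The ordered pairs of distinct nonantipodal labels satisfying `P`. -/
abbrev octPairs (P : Fin 6 → Fin 6 → Prop) [∀ i j, Decidable (P i j)] : Finset (Fin 6 × Fin 6) :=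
  (Finset.univ.filter fun p : Fin 6 × Fin 6 => p.2 ≠ p.1 ∧ p.2 ≠ opp6 p.1).filter
    fun p => P p.1 p.2

theorem card_octPairs (P : Fin 6 → Fin 6 → Prop) [∀ i j, Decidable (P i j)] :
    (octPairs P).card + (octPairs fun i j => ¬ P i j).card = 24 := by
  rw [Finset.card_filter_add_card_filter_not]
  decide

theorem Frame.arcs_le [Finite V] [DecidableRel G.Adj] (hF : Frame G u v w o) :
    (arcs G).ncard ≤ (arcsAt G (core u v w o)ᶜ).ncard + (14 +
      2 * (Finset.univ.filter fun i => G.Adj u (o i)).card +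
      2 * (Finset.univ.filter fun i => G.Adj v (o i)).card +
      (octPairs fun i j => G.Adj (o i) (o j)).card) := by
  classical
  set Su := Finset.univ.filter fun i => G.Adj u (o i) with hSu
  set Sv := Finset.univ.filter fun i => G.Adj v (o i) with hSv
  set E := octPairs fun i j => G.Adj (o i) (o j) with hE
  let A : Finset (V × V) := {(u, v), (v, u)} ∪
    ((Finset.univ.image (fun i => (w, o i)) ∪ Finset.univ.image (fun i => (o i, w))) ∪
    ((Su.image (fun i => (u, o i)) ∪ Su.image (fun i => (o i, u))) ∪
    ((Sv.image (fun i => (v, o i)) ∪ Sv.image (fun i => (o i, v))) ∪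
    E.image (fun p => (o p.1, o p.2)))))
  have hA : A.card ≤ 14 + 2 * Su.card + 2 * Sv.card + E.card := by
    have h1 := Finset.card_le_two (a := (u, v)) (b := (v, u))
    have h6 : (Finset.univ : Finset (Fin 6)).card = 6 := rfl
    refine (Finset.card_union_le _ _).trans ?_
    refine (Nat.add_le_add_left ((Finset.card_union_le _ _).trans (Nat.add_le_add
      ((Finset.card_union_le _ _).trans (Nat.add_le_add Finset.card_image_le Finset.card_image_le))
      ((Finset.card_union_le _ _).trans (Nat.add_le_add ((Finset.card_union_le _ _).trans
        (Nat.add_le_add Finset.card_image_le Finset.card_image_le))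
        ((Finset.card_union_le _ _).trans (Nat.add_le_add ((Finset.card_union_le _ _).trans
        (Nat.add_le_add Finset.card_image_le Finset.card_image_le)) Finset.card_image_le))))))
        _).trans ?_
    omega
  have hsub : arcs G ⊆ arcsAt G (core u v w o)ᶜ ∪ A := by
    rintro ⟨x, y⟩ (hxy : G.Adj x y)
    by_cases hx : x ∈ core u v w o
    swap
    · exact Or.inl ⟨hxy, Or.inl hx⟩
    by_cases hy : y ∈ core u v w o
    swap
    · exact Or.inl ⟨hxy, Or.inr hy⟩
    refine Or.inr ?_
    have hanti : ∀ i j, G.Adj (o i) (o j) → (i, j) ∈ E := fun i j h => by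
      simp only [hE, Finset.mem_filter, Finset.mem_univ, true_and]
      refine ⟨⟨?_, ?_⟩, h⟩
      · rintro rfl
        exact h.ne rfl
      · rintro rfl
        exact hF.anti i h
    simp only [A, Finset.coe_union, Set.mem_union, Finset.mem_coe, Finset.mem_image,
      Finset.mem_insert, Finset.mem_singleton, Prod.mk.injEq, Finset.mem_univ, true_and, hSu, hSv,
      Finset.mem_filter]
    have h1 := hF.nuw
    have h2 := hF.nvw
    rcases mem_core.1 hx with rfl | rfl | rfl | ⟨i, rfl⟩ <;>
    rcases mem_core.1 hy with rfl | rfl | rfl | ⟨j, rfl⟩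
    · exact absurd rfl hxy.ne
    · simp
    · exact absurd hxy h1
    · exact Or.inr (Or.inr (Or.inl (Or.inl ⟨j, hxy, rfl, rfl⟩)))
    · simp
    · exact absurd rfl hxy.ne
    · exact absurd hxy h2
    · exact Or.inr (Or.inr (Or.inr (Or.inl (Or.inl ⟨j, hxy, rfl, rfl⟩))))
    · exact absurd hxy.symm h1
    · exact absurd hxy.symm h2
    · exact absurd rfl hxy.ne
    · exact Or.inr (Or.inl (Or.inl ⟨j, rfl, rfl⟩))
    · exact Or.inr (Or.inr (Or.inl (Or.inr ⟨i, hxy.symm, rfl, rfl⟩)))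
    · exact Or.inr (Or.inr (Or.inr (Or.inl (Or.inr ⟨i, hxy.symm, rfl, rfl⟩))))
    · exact Or.inr (Or.inl (Or.inr ⟨i, rfl, rfl⟩))
    · exact Or.inr (Or.inr (Or.inr (Or.inr ⟨(i, j), hanti i j hxy, rfl, rfl⟩)))
  refine (Set.ncard_le_ncard hsub).trans ((Set.ncard_union_le _ _).trans ?_)
  rw [Set.ncard_coe_finset]
  omega

theorem Frame.ncard_core [Finite V] (hF : Frame G u v w o) : (core u v w o).ncard = 9 := by
  have h : core u v w o = insert u (insert v (insert w (Set.range o))) := by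
    ext x
    simp [mem_core]
  have h1 := hF.hou
  have h2 := hF.hov
  have h3 := hF.how
  have h4 := hF.hwu
  have h5 := hF.hwv
  have h6 := hF.huv.ne
  rw [h, Set.ncard_insert_of_notMem (by simp_all [Ne.symm]),
    Set.ncard_insert_of_notMem (by simp_all [Ne.symm]),
    Set.ncard_insert_of_notMem (by simp_all), Set.ncard_range_of_injective hF.inj]
  simp

theorem Frame.card_members [Finite V] [DecidableRel G.Adj] (hF : Frame G u v w o)
    (hD : defect G < 0) {r : ℕ} (hr : (arcsAt G (core u v w o)ᶜ).ncard ≤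
      8 * ((core u v w o)ᶜ).ncard + 2 * r) :
    18 + (octPairs fun i j => ¬ G.Adj (o i) (o j)).card ≤ 2 * (r +
      (Finset.univ.filter fun i => G.Adj u (o i)).card +
      (Finset.univ.filter fun i => G.Adj v (o i)).card) := by
  have h1 := hF.arcs_le
  have h2 := card_octPairs fun i j => G.Adj (o i) (o j)
  have h3 := even_defect (G := G)
  have h4 := Set.ncard_add_ncard_compl (core u v w o)
  rw [hF.ncard_core] at h4
  have h5 : defect G ≤ -2 := by
    obtain ⟨k, hk⟩ := h3
    omega
  unfold defect at h5
  rw [← h4] at h5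
  push_cast at h5
  omega

end CoreCountSection

section AssignSection

variable {ι : Type} {a b s : ι → Fin 6} {P Q : Fin 6 → Prop}

/-- The label `k` satisfies both predicates or is used by the assignment `s`. -/
abbrev Covered (P Q : Fin 6 → Prop) (s : ι → Fin 6) (k : Fin 6) : Prop :=
  P k ∧ Q k ∨ ∃ m, s m = k

theorem assign_update [DecidableEq ι] (hs : Assign a b s) {m : ι} {x : Fin 6}
    (hx : x = a m ∨ x = b m) : Assign a b (Function.update s m x) := by
  intro k
  by_cases h : k = m
  · subst h
    rwa [Function.update_self]
  · rw [Function.update_of_ne h]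
    exact hs k

theorem exists_parallel (hs : Assign a b s)
    (hmax : ∀ s', Assign a b s' → (∀ m, Covered P Q s' (s m)) → ∀ m, Covered P Q s (s' m))
    (hcover : ∀ k, P k ∨ Q k ∨ ∃ m, a m = k ∨ b m = k)
    (hP : ∀ i j, (∀ m, (a m = i ∨ a m = j) ∧ (b m = i ∨ b m = j)) → ∃ k, k ≠ i ∧ k ≠ j ∧ P k)
    (hQ : ∀ i j, (∀ m, (a m = i ∨ a m = j) ∧ (b m = i ∨ b m = j)) → ∃ k, k ≠ i ∧ k ≠ j ∧ Q k)
    {m₀ : ι} (h₀ : P (s m₀) ∧ Q (s m₀) ∨ ∃ m, m ≠ m₀ ∧ s m = s m₀) :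
    (∀ k, k = a m₀ ∨ k = b m₀ → (P k ∧ Q k) ∨ ∃ m, m ≠ m₀ ∧ s m = k) ∧
      ∃ e f, e ≠ f ∧ (e ≠ a m₀ ∧ e ≠ b m₀) ∧ (f ≠ a m₀ ∧ f ≠ b m₀) ∧
        (P e ∨ ∃ m, m ≠ m₀ ∧ s m = e) ∧ (Q f ∨ ∃ m, m ≠ m₀ ∧ s m = f) := by
  classical
  refine ⟨fun k hk => ?_, ?_⟩
  · by_cases hks : k = s m₀
    · rw [hks]
      exact h₀
    have := hmax _ (assign_update hs hk) (fun m => ?_) m₀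
    · rw [Function.update_self] at this
      refine this.imp_right fun ⟨m, hm⟩ => ⟨m, ?_, hm⟩
      rintro rfl
      exact hks hm.symm
    · by_cases hm : m = m₀
      · subst hm
        refine h₀.imp_right fun ⟨m', h1, h2⟩ => ⟨m', ?_⟩
        rwa [Function.update_of_ne h1]
      · exact Or.inr ⟨m, Function.update_of_ne hm _ _⟩
  have hs₀ : ∀ {y}, y ≠ a m₀ → y ≠ b m₀ → s m₀ ≠ y := fun {y} h1 h2 e =>
    (hs m₀).elim (fun h => h1 (e.symm.trans h)) fun h => h2 (e.symm.trans h)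
  -- a label off the ends of `m₀` which is covered is covered by another member
  have hcov : ∀ {y}, y ≠ a m₀ → y ≠ b m₀ → Covered P Q s y →
      (P y ∨ ∃ m, m ≠ m₀ ∧ s m = y) ∧ (Q y ∨ ∃ m, m ≠ m₀ ∧ s m = y) := by
    rintro y h1 h2 (h | ⟨m, hm⟩)
    · exact ⟨Or.inl h.1, Or.inl h.2⟩
    · have : m ≠ m₀ := by
        rintro rfl
        exact hs₀ h1 h2 hm
      exact ⟨Or.inr ⟨m, this, hm⟩, Or.inr ⟨m, this, hm⟩⟩
  have hmove : ∀ m, m ≠ m₀ → (s m = a m₀ ∨ s m = b m₀) → ∀ y, y = a m ∨ y = b m → y ≠ a m₀ →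
      y ≠ b m₀ → (P y ∨ ∃ m, m ≠ m₀ ∧ s m = y) ∧ (Q y ∨ ∃ m, m ≠ m₀ ∧ s m = y) := by
    intro m hm hsm y hy h1 h2
    refine hcov h1 h2 ?_
    have := hmax _ (assign_update (assign_update hs hsm) hy) (fun k => ?_) m
    · rwa [Function.update_self] at this
    · have e₀ : Function.update (Function.update s m₀ (s m)) m y m₀ = s m := by
        rw [Function.update_of_ne hm.symm, Function.update_self]
      have hoth : ∀ l, l ≠ m₀ → Covered P Q (Function.update (Function.update s m₀ (s m)) m y)
          (s l) := by
        intro l hl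
        by_cases hlm : l = m
        · rw [hlm]
          exact Or.inr ⟨m₀, e₀⟩
        · exact Or.inr ⟨l, by rw [Function.update_of_ne hlm, Function.update_of_ne hl]⟩
      by_cases hk : k = m₀
      · subst hk
        rcases h₀ with h | ⟨l, hl, hl'⟩
        · exact Or.inl h
        · rw [← hl']
          exact hoth l hl
      · exact hoth k hk
  -- neither predicate can fail off the ends of `m₀`
  have hex : ∀ R : Fin 6 → Prop,
      (∀ i j, (∀ m, (a m = i ∨ a m = j) ∧ (b m = i ∨ b m = j)) → ∃ k, k ≠ i ∧ k ≠ j ∧ R k) →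
      (∀ y, ((P y ∨ ∃ m, m ≠ m₀ ∧ s m = y) ∧ (Q y ∨ ∃ m, m ≠ m₀ ∧ s m = y)) →
        (R y ∨ ∃ m, m ≠ m₀ ∧ s m = y)) →
      ∃ k, k ≠ a m₀ ∧ k ≠ b m₀ ∧ (R k ∨ ∃ m, m ≠ m₀ ∧ s m = k) := by
    intro R hR hPQ
    by_contra hno
    push Not at hno
    have hall : ∀ m y, (y = a m ∨ y = b m) → y = a m₀ ∨ y = b m₀ := by
      intro m y hy
      by_contra hcon
      push Not at hcon
      have hm : m ≠ m₀ := by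
        rintro rfl
        exact hy.elim hcon.1 hcon.2
      have hsm : s m = a m₀ ∨ s m = b m₀ := by
        by_contra h
        push Not at h
        exact (hno _ h.1 h.2).2 m hm rfl
      rcases hPQ y (hmove m hm hsm y hy hcon.1 hcon.2) with h | ⟨l, hl, hl'⟩
      · exact (hno y hcon.1 hcon.2).1 h
      · exact (hno y hcon.1 hcon.2).2 l hl hl'
    obtain ⟨k, h1, h2, h3⟩ := hR (a m₀) (b m₀) fun m =>
      ⟨hall m _ (Or.inl rfl), hall m _ (Or.inr rfl)⟩
    exact (hno k h1 h2).1 h3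
  obtain ⟨e, e1, e2, he⟩ := hex P hP fun _ h => h.1
  obtain ⟨f, f1, f2, hf⟩ := hex Q hQ fun _ h => h.2
  by_contra hno
  push Not at hno
  have hef : e = f := by
    by_contra h
    exact hno e f h ⟨e1, e2⟩ ⟨f1, f2⟩ he |>.elim (fun h1 h2 => hf.elim h1 fun ⟨m, h3, h4⟩ =>
      h2 m h3 h4)
  subst hef
  have hnP : ∀ y, y ≠ a m₀ → y ≠ b m₀ → y ≠ e → ¬ (P y ∨ ∃ m, m ≠ m₀ ∧ s m = y) :=
    fun y h1 h2 h3 h => (hno y e h3 ⟨h1, h2⟩ ⟨f1, f2⟩ h).elim fun h1 h2 => hf.elim h1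
      fun ⟨m, h3, h4⟩ => h2 m h3 h4
  have hnQ : ∀ y, y ≠ a m₀ → y ≠ b m₀ → y ≠ e → ¬ Q y :=
    fun y h1 h2 h3 h => (hno e y h3.symm ⟨f1, f2⟩ ⟨h1, h2⟩ he).1 h
  have hstuck : ∀ y, y ≠ a m₀ → y ≠ b m₀ → y ≠ e → ∃ m, s m = e ∧ HasEnds a b m e y := by
    intro y h1 h2 h3
    rcases hcover y with h | h | ⟨m, hm⟩
    · exact absurd (Or.inl h) (hnP y h1 h2 h3)
    · exact absurd h (hnQ y h1 h2 h3)
    · have hm₀ : m ≠ m₀ := by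
        rintro rfl
        exact hm.elim (fun h => h1 h.symm) fun h => h2 h.symm
      have hsm : s m = e := by
        by_contra hse
        by_cases hse' : s m = a m₀ ∨ s m = b m₀
        · exact hnP y h1 h2 h3 (hmove m hm₀ hse' y (hm.imp Eq.symm Eq.symm) h1 h2).1
        · push Not at hse'
          exact hnP _ hse'.1 hse'.2 hse (Or.inr ⟨m, hm₀, rfl⟩)
      refine ⟨m, hsm, ?_⟩
      rcases hm with h | h <;> rcases hs m with h' | h'
      · exact absurd (h.symm.trans (h'.symm.trans hsm)) h3
      · exact Or.inr ⟨h, h'.symm.trans hsm⟩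
      · exact Or.inl ⟨h'.symm.trans hsm, h⟩
      · exact absurd (h.symm.trans (h'.symm.trans hsm)) h3
  obtain ⟨y, y1, y2, y3⟩ := exists_fin6_ne (a m₀) (b m₀) e
  obtain ⟨y', hy', y1', y2', y3'⟩ : ∃ y', y' ≠ y ∧ y' ≠ a m₀ ∧ y' ≠ b m₀ ∧ y' ≠ e :=
    (by decide : ∀ p q r t : Fin 6, ∃ z, z ≠ p ∧ z ≠ q ∧ z ≠ r ∧ z ≠ t) y _ _ e
  obtain ⟨m, hm, hm'⟩ := hstuck y y1 y2 y3
  obtain ⟨l, hl, hl'⟩ := hstuck y' y1' y2' y3'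
  have hml : l ≠ m := by
    rintro rfl
    rcases hm' with ⟨h1, h2⟩ | ⟨h1, h2⟩ <;> rcases hl' with ⟨h3, h4⟩ | ⟨h3, h4⟩
    · exact hy' (h4.symm.trans h2)
    · exact y3 (h2.symm.trans h4)
    · exact y3 (h1.symm.trans h3)
    · exact hy' (h3.symm.trans h1)
  have hym : y = a m ∨ y = b m := hm'.elim (fun h => Or.inr h.2.symm) fun h => Or.inl h.1.symm
  have := hmax _ (assign_update hs hym) (fun k => ?_) m
  · rw [Function.update_self] at this
    exact hnP y y1 y2 y3 (hcov y1 y2 this).1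
  · by_cases hk : k = m
    · subst hk
      refine Or.inr ⟨l, ?_⟩
      rw [Function.update_of_ne hml, hl, hm]
    · exact Or.inr ⟨k, Function.update_of_ne hk _ _⟩

end AssignSection

section CountSection

variable {ι : Type} {a b : ι → Fin 6}

theorem exists_maximal_assign [Fintype ι] (a b : ι → Fin 6) (S T : Finset (Fin 6)) :
    ∃ s, Assign a b s ∧ ∀ s', Assign a b s' → (∀ m, Covered (· ∈ S) (· ∈ T) s' (s m)) →
      ∀ m, Covered (· ∈ S) (· ∈ T) s (s' m) := by
  classical
  let F : (ι → Fin 6) → ℕ := fun s =>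
    (S ∪ Finset.univ.image s).card + (T ∪ Finset.univ.image s).card
  obtain ⟨s, hs, hmax⟩ := Finset.exists_max_image
    (Finset.univ.filter fun s : ι → Fin 6 => Assign a b s) F ⟨a, by simp [Assign]⟩
  refine ⟨s, (Finset.mem_filter.1 hs).2, fun s' hs' h => ?_⟩
  have hF := hmax s' (Finset.mem_filter.2 ⟨Finset.mem_univ _, hs'⟩)
  have hsub : ∀ R : Finset (Fin 6), S ∩ T ⊆ R →
      R ∪ Finset.univ.image s ⊆ R ∪ Finset.univ.image s' := by
    intro R hR
    refine Finset.union_subset Finset.subset_union_left fun k hk => ?_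
    obtain ⟨m, -, rfl⟩ := Finset.mem_image.1 hk
    rcases h m with h | ⟨m', h⟩
    · exact Finset.mem_union_left _ (hR (Finset.mem_inter.2 h))
    · exact Finset.mem_union_right _ (Finset.mem_image.2 ⟨m', Finset.mem_univ _, h⟩)
  have h1 := hsub S Finset.inter_subset_left
  have h2 := hsub T Finset.inter_subset_right
  have c1 := Finset.card_le_card h1
  have c2 := Finset.card_le_card h2
  have e1 := Finset.eq_of_subset_of_card_le h1 (by simp only [F] at hF; omega)
  have e2 := Finset.eq_of_subset_of_card_le h2 (by simp only [F] at hF; omega)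
  intro m
  have him : s' m ∈ Finset.univ.image s' := Finset.mem_image_of_mem _ (Finset.mem_univ m)
  have m1 : s' m ∈ S ∪ Finset.univ.image s := e1 ▸ Finset.mem_union_right _ him
  have m2 : s' m ∈ T ∪ Finset.univ.image s := e2 ▸ Finset.mem_union_right _ him
  by_cases hI : s' m ∈ Finset.univ.image s
  · obtain ⟨l, -, hl⟩ := Finset.mem_image.1 hI
    exact Or.inr ⟨l, hl⟩
  · exact Or.inl ⟨(Finset.mem_union.1 m1).resolve_right hI,
        (Finset.mem_union.1 m2).resolve_right hI⟩

theorem exists_wasted [Fintype ι] {s : ι → Fin 6} {S T : Finset (Fin 6)}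
    {M : Fin 6 → Fin 6 → Prop} [∀ i j, Decidable (M i j)] (hM : ∀ i j, M i j → M j i)
    (hne : ∀ m, b m ≠ a m) (hnopp : ∀ m, b m ≠ opp6 (a m))
    (hcard : 18 + (octPairs M).card ≤ 2 * (Fintype.card ι + S.card + T.card))
    (h8 : (S ∪ Finset.univ.image s).card + (T ∪ Finset.univ.image s).card ≤ 8) :
    ∃ m₀, (s m₀ ∈ S ∧ s m₀ ∈ T ∨ ∃ m, m ≠ m₀ ∧ s m = s m₀) ∧
      (M (a m₀) (b m₀) → ∃ m, m ≠ m₀ ∧ HasEnds a b m (a m₀) (b m₀)) := by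
  classical
  have hι : Nonempty ι := by
    rw [← Fintype.card_pos_iff]
    have h1 := Finset.card_le_card (Finset.subset_union_left (s₁ := S) (s₂ := Finset.univ.image s))
    have h2 := Finset.card_le_card (Finset.subset_union_left (s₁ := T) (s₂ := Finset.univ.image s))
    omega
  set I := Finset.univ.image s with hI
  have hIm : ∀ x ∈ I, ∃ m, s m = x := fun x hx => by simpa [hI] using hx
  choose! r hr using hIm
  set K := (I \ (S ∩ T)).image r with hK
  have hKc : K.card ≤ (I \ (S ∩ T)).card := Finset.card_image_le
  have hcount : (I \ (S ∩ T)).card + S.card + T.card ≤ 8 := by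
    have h1 : (S ∪ I).card = S.card + (I \ S).card := by
      rw [← Finset.union_sdiff_self_eq_union, Finset.card_union_of_disjoint Finset.disjoint_sdiff]
    have h2 : (T ∪ I).card = T.card + (I \ T).card := by
      rw [← Finset.union_sdiff_self_eq_union, Finset.card_union_of_disjoint Finset.disjoint_sdiff]
    have h3 : I \ (S ∩ T) = I \ S ∪ I \ T := by
      ext x
      simp only [Finset.mem_sdiff, Finset.mem_inter, Finset.mem_union]
      tauto
    have h4 := Finset.card_union_le (I \ S) (I \ T)
    rw [h3]
    omega
  have hN : 2 + (octPairs M).card ≤ 2 * (Finset.univ \ K).card := by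
    have := Finset.card_sdiff_add_card_eq_card (Finset.subset_univ K)
    rw [Finset.card_univ] at this
    omega
  have hwaste : ∀ m ∈ Finset.univ \ K, s m ∈ S ∧ s m ∈ T ∨ ∃ m', m' ≠ m ∧ s m' = s m := by
    intro m hm
    have hsI : s m ∈ I := Finset.mem_image_of_mem _ (Finset.mem_univ m)
    by_cases hST : s m ∈ S ∩ T
    · exact Or.inl (Finset.mem_inter.1 hST)
    · refine Or.inr ⟨r (s m), fun e => ?_, hr _ hsI⟩
      exact (Finset.mem_sdiff.1 hm).2
        (Finset.mem_image.2 ⟨s m, Finset.mem_sdiff.2 ⟨hsI, hST⟩, e⟩)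
  by_contra hno
  push Not at hno
  have hall : ∀ m ∈ Finset.univ \ K, M (a m) (b m) ∧ ∀ m', m' ≠ m → ¬ HasEnds a b m' (a m) (b m) :=
    fun m hm => by
      obtain ⟨h1, h2⟩ := hno m (hwaste m hm)
      refine ⟨h1, fun m' hm' h => ?_⟩
      rcases h with h | h
      · exact (h2 m' hm').1 h.1 h.2
      · exact (h2 m' hm').2 h.1 h.2
  have hopp : ∀ i j : Fin 6, j ≠ opp6 i → i ≠ opp6 j := by decide
  have hsub : (Finset.univ \ K).image (fun m => (a m, b m)) ∪
      (Finset.univ \ K).image (fun m => (b m, a m)) ⊆ octPairs M := by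
    intro p hp
    simp only [Finset.mem_union, Finset.mem_image] at hp
    simp only [octPairs, Finset.mem_filter, Finset.mem_univ, true_and]
    rcases hp with ⟨m, hm, rfl⟩ | ⟨m, hm, rfl⟩
    · exact ⟨⟨hne m, hnopp m⟩, (hall m hm).1⟩
    · exact ⟨⟨(hne m).symm, hopp _ _ (hnopp m)⟩, hM _ _ (hall m hm).1⟩
  have hle := Finset.card_le_card hsub
  rw [Finset.card_union_of_disjoint, Finset.card_image_of_injOn, Finset.card_image_of_injOn] at hle
  · omega
  · intro m hm m' hm' h
    by_contra hmm
    simp only [Prod.mk.injEq] at h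
    exact (hall m hm).2 m' (Ne.symm hmm) (Or.inl ⟨h.2.symm, h.1.symm⟩)
  · intro m hm m' hm' h
    by_contra hmm
    simp only [Prod.mk.injEq] at h
    exact (hall m hm).2 m' (Ne.symm hmm) (Or.inl ⟨h.1.symm, h.2.symm⟩)
  · rw [Finset.disjoint_left]
    rintro p hp hp'
    obtain ⟨m, hm, rfl⟩ := Finset.mem_image.1 hp
    obtain ⟨m', hm', h⟩ := Finset.mem_image.1 hp'
    simp only [Prod.mk.injEq] at h
    by_cases hmm : m' = m
    · subst hmm
      exact hne _ h.1
    · exact (hall m hm).2 m' hmm (Or.inr ⟨h.2, h.1⟩)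

end CountSection

section FrameMinorSection

variable {V : Type} {G : SimpleGraph V} {u v w : V} {o : Fin 6 → V}

theorem Members.restrict {ι : Type} {X : ι → Set V} {a b : ι → Fin 6}
    (h : Members G u v w o X a b) (p : ι → Prop) :
    Members G u v w o (fun m : {m // p m} => X m) (fun m => a m) (fun m => b m) where
  model := h.model.comp Subtype.val_injective
  out m := h.out m
  tu m := h.tu m
  tv m := h.tv m
  ta m := h.ta m
  tb m := h.tb m
  ne m := h.ne m
  nopp m := h.nopp m

theorem Frame.isMinor_k7vee [Finite V] (hF : Frame G u v w o) (h4 : FourConn G)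
    (hD : defect G < 0)
    (ih : ∀ (W : Type) [Finite W] (H : SimpleGraph W), Nat.card W < Nat.card V → 3 ≤ Nat.card W →
      FourConn H → ¬ IsMinor K7vee H → defect H < 0 → Nonempty (H ≃g K2222)) :
    IsMinor K7vee G := by
  classical
  by_contra hK
  obtain ⟨ι, hι, X, a, b, hM, hp, hc⟩ := hF.exists_members h4 hK ih
  have := Fintype.ofFinite ι
  have hcard := hF.card_members hD hc
  rw [Nat.card_eq_fintype_card] at hcard
  have hmem : ∀ z ∉ core u v w o, ∃ m, ∀ k, o k ∈ nbr G (comp G (core u v w o)ᶜ z) →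
      a m = k ∨ b m = k := by
    intro z hz
    obtain ⟨m, hm⟩ := hp z hz
    refine ⟨m, fun k hk => ?_⟩
    have hk' : o k ∈ ({u, v, o (a m), o (b m)} : Set V) := hm ▸ hk
    exact (hF.o_inj hk').imp Eq.symm Eq.symm
  have hocta : ∀ i j, j ≠ i → j ≠ opp6 i → G.Adj (o i) (o j) ∨ ∃ m, HasEnds a b m i j := by
    intro i j h1 h2
    rcases hF.octa i j h1 h2 with h | ⟨z, hz, hi, hj⟩
    · exact Or.inl h
    · obtain ⟨m, hm⟩ := hmem z hz
      refine Or.inr ⟨m, ?_⟩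
      rcases hm i hi with e | e <;> rcases hm j hj with e' | e'
      · exact absurd (e'.symm.trans e) h1
      · exact Or.inl ⟨e, e'⟩
      · exact Or.inr ⟨e', e⟩
      · exact absurd (e'.symm.trans e) h1
  have hcov : ∀ k, G.Adj u (o k) ∨ G.Adj v (o k) ∨ ∃ m, a m = k ∨ b m = k := by
    intro k
    rcases hF.cover k with h | h | ⟨z, hz, h⟩
    · exact Or.inl h
    · exact Or.inr (Or.inl h)
    · obtain ⟨m, hm⟩ := hmem z hz
      exact Or.inr (Or.inr ⟨m, hm k h⟩)
  have hall : ∀ i j, (∀ m, (a m = i ∨ a m = j) ∧ (b m = i ∨ b m = j)) →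
      ∀ z ∉ core u v w o, ∀ k, o k ∈ nbr G (comp G (core u v w o)ᶜ z) → k = i ∨ k = j := by
    intro i j h z hz k hk
    obtain ⟨m, hm⟩ := hmem z hz
    rcases hm k hk with e | e
    · exact e ▸ (h m).1
    · exact e ▸ (h m).2
  set S := Finset.univ.filter fun i => G.Adj u (o i) with hS
  set T := Finset.univ.filter fun i => G.Adj v (o i) with hT
  have hSm : ∀ k, k ∈ S ↔ G.Adj u (o k) := by simp [hS]
  have hTm : ∀ k, k ∈ T ↔ G.Adj v (o k) := by simp [hT]
  obtain ⟨s, hs, hmax⟩ := exists_maximal_assign a b S T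
  by_cases h9 : 9 ≤ (S ∪ Finset.univ.image s).card + (T ∪ Finset.univ.image s).card
  · refine hK ((hM.octModel hF hs hocta).k7vee_of_nine (fun i hi => hM.touch_u ?_)
      (fun i hi => hM.touch_v ?_) h9)
    · simpa [hSm] using hi
    · simpa [hTm] using hi
  obtain ⟨m₀, h₀, hsp⟩ := exists_wasted (s := s) (M := fun i j => ¬ G.Adj (o i) (o j))
    (fun i j h h' => h h'.symm) hM.ne hM.nopp (by omega) (by omega)
  obtain ⟨hends, e, f, hef, ⟨e1, e2⟩, ⟨f1, f2⟩, he, hf⟩ := exists_parallel hs hmax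
    (by simpa only [hSm, hTm] using hcov)
    (fun i j h => by simpa only [hSm] using hF.exists_seen h4 (hall i j h))
    (fun i j h => by
      simpa only [hTm] using hF.swap.exists_seen h4 (by rw [core_swap]; exact hall i j h)) h₀
  have hM' := hM.restrict (· ≠ m₀)
  have hs' : Assign (fun m : {m // m ≠ m₀} => a m) (fun m => b m) (fun m => s m) := fun m => hs m
  have hocta' : ∀ i j, j ≠ i → j ≠ opp6 i → G.Adj (o i) (o j) ∨
      ∃ m : {m // m ≠ m₀}, HasEnds (fun m : {m // m ≠ m₀} => a m) (fun m => b m) m i j := by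
    intro i j h1 h2
    by_cases hadj : G.Adj (o i) (o j)
    · exact Or.inl hadj
    refine Or.inr ?_
    obtain ⟨m, hm⟩ := (hocta i j h1 h2).resolve_left hadj
    by_cases hmm : m = m₀
    · subst hmm
      rcases hm with ⟨rfl, rfl⟩ | ⟨rfl, rfl⟩
      · obtain ⟨l, hl, hl'⟩ := hsp hadj
        exact ⟨⟨l, hl⟩, hl'⟩
      · obtain ⟨l, hl, hl'⟩ := hsp fun h => hadj h.symm
        exact ⟨⟨l, hl⟩, hl'.symm⟩
    · exact ⟨⟨m, hmm⟩, hm⟩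
  have hU : ∀ k, (k ∈ S ∨ ∃ m, m ≠ m₀ ∧ s m = k) →
      Touch G {u} (octBag o (fun m : {m // m ≠ m₀} => X m) (fun m => s m) k) := fun k h =>
    hM'.touch_u (h.imp (hSm k).1 fun ⟨m, h1, h2⟩ => ⟨⟨m, h1⟩, h2⟩)
  have hV : ∀ k, (k ∈ T ∨ ∃ m, m ≠ m₀ ∧ s m = k) →
      Touch G {v} (octBag o (fun m : {m // m ≠ m₀} => X m) (fun m => s m) k) := fun k h =>
    hM'.touch_v (h.imp (hTm k).1 fun ⟨m, h1, h2⟩ => ⟨⟨m, h1⟩, h2⟩)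
  have ho : ∀ k, {o k} ⊆ octBag o (fun m : {m // m ≠ m₀} => X m) (fun m => s m) k :=
    fun k => Set.subset_union_left
  have hdX : ∀ t, Disjoint (X m₀)
      (octBags u v w o (fun m : {m // m ≠ m₀} => X m) (fun m => s m) t) := by
    have hout : ∀ x ∈ core u v w o, x ∉ X m₀ := fun x hx h =>
      Set.disjoint_left.1 (hM.out m₀) h hx
    rintro (p | t)
    · rw [Set.disjoint_right]
      intro x (hx : x ∈ octBag o (fun m : {m // m ≠ m₀} => X m) (fun m => s m) p)
      rcases mem_octBag.1 hx with rfl | ⟨m, -, hx⟩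
      · exact hout _ (mem_core.2 (Or.inr (Or.inr (Or.inr ⟨p, rfl⟩))))
      · exact Set.disjoint_left.1 (hM.model.2 _ _ m.2) hx
    · rw [Set.disjoint_right]
      intro x hx
      refine hout x (mem_core.2 ?_)
      fin_cases t
      exacts [Or.inl hx, Or.inr (Or.inl hx), Or.inr (Or.inr (Or.inl hx))]
  have hb := hends (a m₀) (Or.inl rfl)
  have hc := hends (b m₀) (Or.inr rfl)
  exact hK ((hM'.octModel hF hs' hocta').k7vee_of_parallel (X := X m₀) (b := a m₀) (c := b m₀)
    (e := e) (f := f) (hM.model.1 m₀) hdX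
    (hM.ne m₀) (hM.nopp m₀) e1 e2 f1 f2 hef
    ((hM.ta m₀).mono le_rfl (ho _)) ((hM.tb m₀).mono le_rfl (ho _)) (hM.tu m₀) (hM.tv m₀)
    (hU _ (hb.imp_left And.left)) (hU _ (hc.imp_left And.left)) (hU _ he)
    (hV _ (hb.imp_left And.right)) (hV _ (hc.imp_left And.right)) (hV _ hf))

end FrameMinorSection

section DenseSection

theorem defect_induce_torso {V : Type} {G : SimpleGraph V} {A : Set V} :
    defect ((torso G A).induce A) = torsoDefect G A := by
  unfold defect torsoDefect
  rw [Nat.card_coe_set_eq]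
  congr 2
  refine Set.ncard_congr (fun p _ => (p.1.1, p.2.1)) (fun p hp => hp) ?_ ?_
  · rintro ⟨⟨x, hx⟩, y, hy⟩ ⟨⟨x', hx'⟩, y', hy'⟩ - - h
    simpa using h
  · rintro ⟨x, y⟩ h
    exact ⟨(⟨x, h.2.1⟩, ⟨y, h.2.2.1⟩), h, rfl⟩

theorem exists_frame_of_loose {V : Type} [Finite V] {G : SimpleGraph V} (h4 : FourConn G)
    (h3 : 3 ≤ Nat.card V) (hK : ¬ IsMinor K7vee G) (hD : defect G < 0)
    (ht : ∃ u v, G.Adj u v ∧ defect G - 6 + 2 * cnbr G u v < 0)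
    (ih : ∀ (W : Type) [Finite W] (H : SimpleGraph W), Nat.card W < Nat.card V → 3 ≤ Nat.card W →
      FourConn H → ¬ IsMinor K7vee H → defect H < 0 → Nonempty (H ≃g K2222)) :
    ∃ u v w o, Frame G u v w o := by
  classical
  have := Fintype.ofFinite V
  obtain ⟨u₀, v₀, h₀, hneg⟩ := ht
  obtain ⟨⟨u, v⟩, huv, hmin⟩ := Finset.exists_min_image
    (Finset.univ.filter fun p : V × V => G.Adj p.1 p.2) (fun p => cnbr G p.1 p.2)
    ⟨(u₀, v₀), by simpa using h₀⟩
  replace huv : G.Adj u v := (Finset.mem_filter.1 huv).2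
  replace hmin : ∀ a b, G.Adj a b → cnbr G u v ≤ cnbr G a b := fun a b h =>
    hmin (a, b) (by simpa using h)
  have h7 := seven_le_card h3 hD
  have hc := card_contract (V := V) v
  have hd := defect_contract huv
  have hd' : defect (contractEdge G u v) < 0 := by
    have := hmin _ _ h₀
    omega
  have hac := almostFourConn_contract h4 huv.ne
  obtain ⟨A, hpA, hA3, hthin, hAd, hA4⟩ := exists_minimal_torso hac (by omega) hd'
  rw [← defect_induce_torso] at hAd
  have hA7 := seven_le_card (by rwa [Nat.card_coe_set_eq]) hAd
  have hcA : Nat.card A ≤ Nat.card {x // x ≠ v} := Nat.card_le_card_of_injective _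
    Subtype.val_injective
  have hA7' : 7 ≤ A.ncard := by rwa [Nat.card_coe_set_eq] at hA7
  have hmA : IsMinor ((torso (contractEdge G u v) A).induce A) (contractEdge G u v) :=
    isMinor_torso fun z hz => (rootedTriangle_comp hac
      (exists_adj_nbr_contract h4 h7 huv.ne hmin) hthin (by omega) hz).2.2
  obtain ⟨e⟩ := ih A _ (by omega) (by omega) hA4
    (fun h => hK (h.trans (hmA.trans (isMinor_contract huv)))) hAd
  obtain ⟨w, o, h⟩ := exists_frame h4 huv hpA hthin e
  exact ⟨u, v, w, o, h⟩

/-- A 4-connected graph with more than `4n - 9` edges and no `K7vee` minor is `K2222`. -/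
theorem k2222_of_defect_neg (n : ℕ) : ∀ (m : ℕ) (V : Type) [Finite V] (G : SimpleGraph V),
    Nat.card V = n → (arcs G).ncard = m → 3 ≤ Nat.card V → FourConn G → ¬ IsMinor K7vee G →
      defect G < 0 → Nonempty (G ≃g K2222) := by
  induction n using Nat.strong_induction_on with
  | _ n ihn =>
  intro m
  induction m using Nat.strong_induction_on with
  | _ m ihm =>
  intro V _ G hn hm h3 h4 hK hD
  have ih : ∀ (W : Type) [Finite W] (H : SimpleGraph W), Nat.card W < Nat.card V →
      3 ≤ Nat.card W → FourConn H → ¬ IsMinor K7vee H → defect H < 0 → Nonempty (H ≃g K2222) :=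
    fun W _ H hlt => ihn _ (hn ▸ hlt) _ W H rfl rfl
  by_cases ht : ∃ u v, G.Adj u v ∧ defect G - 6 + 2 * cnbr G u v < 0
  · obtain ⟨u, v, w, o, hF⟩ := exists_frame_of_loose h4 h3 hK hD ht ih
    exact absurd (hF.isMinor_k7vee h4 hD ih) hK
  · push Not at ht
    exact k2222_of_tight h3 h4 hK hD ht fun G' hlt => ihm _ (hm ▸ hlt) V G' hn rfl h3

end DenseSection

section ColouringSection

variable {V : Type} {G : SimpleGraph V}

/-- `c` is a proper colouring of `G[U]`. -/
def ProperOn (G : SimpleGraph V) (U : Set V) (c : V → Fin 6) : Prop :=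
  ∀ x ∈ U, ∀ y ∈ U, G.Adj x y → c x ≠ c y

theorem ProperOn.mono {U U' : Set V} {c : V → Fin 6} (h : ProperOn G U c) (hU : U' ⊆ U) :
    ProperOn G U' c := fun x hx y hy => h x (hU hx) y (hU hy)

theorem ProperOn.colorable {c : V → Fin 6} (h : ProperOn G Set.univ c) : G.Colorable 6 :=
  ⟨Coloring.mk c fun {x y} hxy => h x trivial y trivial hxy⟩

/-- Every minor of `G` on fewer vertices is `6`-colourable. -/
def SmallMinorsColorable (G : SimpleGraph V) : Prop :=
  ∀ (W : Type) [Finite W] (H : SimpleGraph W), IsMinor H G → Nat.card W < Nat.card V →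
    H.Colorable 6

theorem SmallMinorsColorable.exists_properOn [Finite V] (h : SmallMinorsColorable G) {U : Set V}
    (hU : U ≠ Set.univ) : ∃ c, ProperOn G U c := by
  obtain ⟨C⟩ := h U (G.induce U)
    (isMinor_of_embedding Subtype.val Subtype.val_injective fun a b hab => by simpa using hab)
    (by
      rw [Nat.card_coe_set_eq]
      exact Set.ncard_lt_card hU)
  classical
  refine ⟨fun x => if hx : x ∈ U then C ⟨x, hx⟩ else 0, fun x hx y hy hxy => ?_⟩
  simp only [hx, hy, dif_pos]
  exact C.valid (by simpa using hxy)

/-- Contracting a connected set yields a colouring in which any independent subset of it is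
monochromatic. -/
theorem SmallMinorsColorable.exists_properOn_contract [Finite V] (h : SmallMinorsColorable G)
    {U B I : Set V} (hd : Disjoint U B) (hB : Cn G B) (hU : U.ncard + 1 < Nat.card V)
    (hIB : I ⊆ B) (hI : ∀ x ∈ I, ∀ y ∈ I, ¬G.Adj x y) :
    ∃ c k, ProperOn G (U ∪ I) c ∧ (∀ x ∈ I, c x = k) ∧
      ∀ x ∈ U, Touch G {x} B → c x ≠ k := by
  classical
  let bag : Option U → Set V := fun o => o.elim B fun x => {x.1}
  let H : SimpleGraph (Option U) :=
    { Adj := fun a b => a ≠ b ∧ Touch G (bag a) (bag b)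
      symm := ⟨fun a b hab => ⟨hab.1.symm, hab.2.symm⟩⟩
      loopless := ⟨fun a ha => ha.1 rfl⟩ }
  have hH : IsMinor H G := by
    refine isMinor_of_bags bag ?_ ?_ fun a b hab => hab.2
    · rintro (_ | x)
      exacts [hB, Cn.singleton _]
    · rintro (_ | x) (_ | y) hxy
      · exact absurd rfl hxy
      · exact Set.disjoint_singleton_right.2 fun hy => Set.disjoint_left.1 hd y.2 hy
      · exact Set.disjoint_singleton_left.2 fun hx => Set.disjoint_left.1 hd x.2 hx
      · exact Set.disjoint_singleton.2 fun e => hxy (congrArg some (Subtype.ext e))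
  obtain ⟨C⟩ := h _ H hH (by rwa [Finite.card_option, Nat.card_coe_set_eq])
  have hIU : ∀ x ∈ I, x ∉ U := fun x hx hxU => Set.disjoint_left.1 hd hxU (hIB hx)
  have hout : ∀ x (hx : x ∈ U), Touch G {x} B → C (some ⟨x, hx⟩) ≠ C none :=
    fun x hx ht => C.valid ⟨by simp, ht⟩
  refine ⟨fun x => if hx : x ∈ U then C (some ⟨x, hx⟩) else C none, C none, ?_, ?_, ?_⟩
  · rintro x (hx | hx) y (hy | hy) hxy
    · simp only [hx, hy, dif_pos]
      refine C.valid ⟨fun e => hxy.ne ?_, ?_⟩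
      · simpa using e
      · simpa [bag] using hxy
    · simp only [hx, hIU y hy, dif_pos, dif_neg, not_false_eq_true]
      exact hout x hx ⟨x, rfl, y, hIB hy, hxy⟩
    · simp only [hy, hIU x hx, dif_pos, dif_neg, not_false_eq_true]
      exact (hout y hy ⟨y, rfl, x, hIB hx, hxy.symm⟩).symm
    · exact absurd hxy (hI x hx y hy)
  · intro x hx
    simp only [hIU x hx, dif_neg, not_false_eq_true]
  · intro x hx ht
    simp only [hx, dif_pos]
    exact hout x hx ht

theorem colorable_of_few_colors [Finite V] {v : V} {c : V → Fin 6} (hc : ProperOn G {v}ᶜ c)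
    {A : Set V} (hA : A.ncard ≤ 5) (hN : ∀ w, G.Adj v w → ∃ a ∈ A, c w = c a) :
    G.Colorable 6 := by
  classical
  obtain ⟨k, hk⟩ : ∃ k, k ∉ c '' A := by
    by_contra! hall
    have h1 : (c '' A).ncard ≤ 5 := (Set.ncard_image_le (Set.toFinite A)).trans hA
    rw [Set.eq_univ_of_forall hall, Set.ncard_univ, Nat.card_eq_fintype_card, Fintype.card_fin]
      at h1
    omega
  have hk' : ∀ w, G.Adj v w → c w ≠ k := by
    intro w hw e
    obtain ⟨a, ha, hca⟩ := hN w hw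
    exact hk ⟨a, ha, hca.symm.trans e⟩
  refine ProperOn.colorable (c := fun x => if x = v then k else c x) fun x _ y _ hxy => ?_
  by_cases hx : x = v
  · subst hx
    simpa only [if_pos, if_neg hxy.ne'] using (hk' y hxy).symm
  · by_cases hy : y = v
    · subst hy
      simpa only [if_pos, if_neg hxy.ne] using hk' x hxy.symm
    · simpa only [if_neg hx, if_neg hy] using hc x hx y hy hxy

theorem isMinor_k7vee_of_clique [Finite V] {T : Set V} (hT : T.ncard = 7)
    (hclq : ∀ x ∈ T, ∀ y ∈ T, x ≠ y → G.Adj x y) : IsMinor K7vee G := by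
  have e : Fin 7 ≃ T := (Finite.equivFinOfCardEq (by rw [Nat.card_coe_set_eq, hT])).symm
  exact isMinor_of_embedding (fun i => (e i : V)) (Subtype.val_injective.comp e.injective)
    fun a b hab => hclq _ (e a).2 _ (e b).2 fun h => hab.ne (e.injective (Subtype.ext h))

theorem SmallMinorsColorable.seven_le_degree [Finite V] (h : SmallMinorsColorable G)
    (h6 : ¬G.Colorable 6) (hK : ¬IsMinor K7vee G) (v : V) : 7 ≤ (G.neighborSet v).ncard := by
  by_contra! hlt
  rcases Nat.lt_or_ge (G.neighborSet v).ncard 6 with h5 | h5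
  · obtain ⟨c, hc⟩ := h.exists_properOn (U := {v}ᶜ) fun e => by
      have : v ∈ ({v}ᶜ : Set V) := e ▸ trivial
      exact this rfl
    exact h6 (colorable_of_few_colors hc (Nat.le_of_lt_succ h5) fun w hw => ⟨w, hw, rfl⟩)
  · have hd : (G.neighborSet v).ncard = 6 := by omega
    by_cases hclq : ∀ x ∈ G.neighborSet v, ∀ y ∈ G.neighborSet v, x ≠ y → G.Adj x y
    · refine hK (isMinor_k7vee_of_clique (T := insert v (G.neighborSet v)) ?_ ?_)
      · rw [Set.ncard_insert_of_notMem (by simp), hd]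
      · rintro x (rfl | hx) y (rfl | hy) hxy
        · exact absurd rfl hxy
        · exact hy
        · exact (show G.Adj y x from hx).symm
        · exact hclq x hx y hy hxy
    · push Not at hclq
      obtain ⟨x, hx, y, hy, hxy, hn⟩ := hclq
      have hvx : G.Adj v x := hx
      have hvy : G.Adj v y := hy
      have hcn : Cn G ({v, x} ∪ {y}) :=
        (Cn.pair hvx).union_touch (Cn.singleton y) ⟨v, Or.inl rfl, y, rfl, hvy⟩
      have hcard : (({v, x} ∪ {y} : Set V)ᶜ).ncard + 1 < Nat.card V := by
        have := Set.ncard_add_ncard_compl ({v, x} ∪ {y} : Set V)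
        have h1 : 1 < ({v, x} ∪ {y} : Set V).ncard :=
          (Set.one_lt_ncard (Set.toFinite _)).2 ⟨v, by simp, x, by simp, hvx.ne⟩
        omega
      obtain ⟨c, k, hc, hk, -⟩ := h.exists_properOn_contract (I := {x, y}) disjoint_compl_left hcn
        hcard (by rintro z (rfl | rfl) <;> simp) (by
          rintro a (rfl | rfl) b (rfl | rfl) hab
          exacts [hab.ne rfl, hn hab, hn hab.symm, hab.ne rfl])
      refine h6 (colorable_of_few_colors (v := v) (c := c) (hc.mono ?_)
        (A := G.neighborSet v \ {x}) ?_ ?_)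
      · intro z hz
        simp only [Set.mem_compl_iff, Set.mem_singleton_iff] at hz
        simp only [Set.mem_union, Set.mem_compl_iff, Set.mem_insert_iff, Set.mem_singleton_iff]
        tauto
      · rw [Set.ncard_sdiff_singleton_of_mem hx]
        omega
      · intro w hw
        by_cases hwx : w = x
        · exact ⟨y, ⟨hy, hxy.symm⟩, by rw [hwx, hk x (by simp), hk y (by simp)]⟩
        · exact ⟨w, ⟨hw, hwx⟩, rfl⟩

/-- Colourings of the two sides of a separation with the same colour classes on the separator
can be combined. -/
theorem colorable_of_glue {X S Y : Set V} (hcov : ∀ v, v ∈ X ∨ v ∈ S ∨ v ∈ Y)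
    (hXY : ∀ x ∈ X, ∀ y ∉ X, G.Adj x y → y ∈ S) {c d : V → Fin 6}
    (hc : ProperOn G (X ∪ S) c) (hd : ProperOn G (Y ∪ S) d)
    (hcd : ∀ s ∈ S, ∀ t ∈ S, (c s = c t ↔ d s = d t)) : G.Colorable 6 := by
  classical
  let f : Fin 6 → Fin 6 := fun a => if h : ∃ s ∈ S, d s = a then c h.choose else 0
  have hf : ∀ s ∈ S, f (d s) = c s := by
    intro s hs
    have h : ∃ t ∈ S, d t = d s := ⟨s, hs, rfl⟩
    simp only [f, dif_pos h]
    exact (hcd _ h.choose_spec.1 _ hs).2 h.choose_spec.2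
  obtain ⟨g, hg⟩ := Set.MapsTo.exists_equiv_extend_of_card_eq (α := Fin 6) (t := Finset.univ)
    (by simp) (s := d '' S) (f := f) (fun _ _ => by simp) (by
      rintro _ ⟨s, hs, rfl⟩ _ ⟨t, ht, rfl⟩ hst
      rw [hf s hs, hf t ht] at hst
      exact (hcd s hs t ht).1 hst)
  have hgS : ∀ s ∈ S, (g (d s) : Fin 6) = c s := fun s hs => (hg _ ⟨s, hs, rfl⟩).trans (hf s hs)
  have hdg : ∀ x ∈ Y ∪ S, ∀ y ∈ Y ∪ S, G.Adj x y → (g (d x) : Fin 6) ≠ g (d y) :=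
    fun x hx y hy hxy e => hd x hx y hy hxy (g.injective (Subtype.ext e))
  have hYS : ∀ x ∉ X ∪ S, x ∈ Y ∪ S := by
    intro x hx
    rcases hcov x with h | h | h
    exacts [absurd (Or.inl h) hx, Or.inr h, Or.inl h]
  have hmix : ∀ x ∈ X ∪ S, ∀ y ∉ X ∪ S, G.Adj x y → c x ≠ (g (d y) : Fin 6) := by
    rintro x (hx | hx) y hy hxy
    · exact absurd (Or.inr (hXY x hx y (fun h => hy (Or.inl h)) hxy)) hy
    · rw [← hgS x hx]
      exact hdg x (Or.inr hx) y (hYS y hy) hxy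
  refine ProperOn.colorable (c := fun x => if x ∈ X ∪ S then c x else g (d x))
    fun x _ y _ hxy => ?_
  by_cases hx : x ∈ X ∪ S <;> by_cases hy : y ∈ X ∪ S <;> simp only [hx, hy, if_true, if_false]
  · exact hc x hx y hy hxy
  · exact hmix x hx y hy hxy
  · exact (hmix y hy x hx hxy.symm).symm
  · exact hdg x (hYS x hx) y (hYS y hy) hxy

theorem SmallMinorsColorable.exists_properOn_side [Finite V] (h : SmallMinorsColorable G)
    {A S D I : Set V} (hAS : Disjoint A S) (hD : Cn G D) (hDA : Disjoint (A ∪ S) D)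
    (hDS : ∀ s ∈ S, Touch G D {s}) (hS : S.ncard ≤ 3) (hIS : I ⊆ S)
    (hI : ∀ x ∈ I, ∀ y ∈ I, ¬G.Adj x y) (hI2 : 1 < I.ncard) :
    ∃ c, ProperOn G (A ∪ S) c ∧
      ∀ s ∈ S, ∀ t ∈ S, (c s = c t ↔ s = t ∨ s ∈ I ∧ t ∈ I) := by
  have hIne : Nonempty I := (Set.nonempty_of_ncard_ne_zero (by omega)).to_subtype
  have hcn : Cn G (D ∪ I) := by
    have := Cn.union_star hD (B := fun i : I => {i.1}) (fun i => Cn.singleton _)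
      (fun i => Or.inl (hDS _ (hIS i.2)))
    convert this using 2
    ext x
    simp
  have hdisj : Disjoint (A ∪ S \ I) (D ∪ I) := by
    rw [Set.disjoint_left]
    rintro x (hx | hx) (hx' | hx')
    · exact Set.disjoint_left.1 hDA (Or.inl hx) hx'
    · exact Set.disjoint_left.1 hAS hx (hIS hx')
    · exact Set.disjoint_left.1 hDA (Or.inr hx.1) hx'
    · exact hx.2 hx'
  have hcard : (A ∪ S \ I).ncard + 1 < Nat.card V := by
    have h1 := Set.ncard_add_ncard_compl (A ∪ S \ I)
    have h2 : I ⊆ (A ∪ S \ I)ᶜ := fun x hx hx' => Set.disjoint_left.1 hdisj hx' (Or.inr hx)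
    have h3 := Set.ncard_le_ncard h2 (Set.toFinite _)
    omega
  obtain ⟨c, k, hc, hk, hk'⟩ := h.exists_properOn_contract hdisj hcn hcard
    Set.subset_union_right hI
  have hsub : A ∪ S ⊆ A ∪ S \ I ∪ I := by
    rintro x (hx | hx)
    · exact Or.inl (Or.inl hx)
    · by_cases hxI : x ∈ I
      exacts [Or.inr hxI, Or.inl (Or.inr ⟨hx, hxI⟩)]
  have hone : ∀ s ∈ S \ I, ∀ t ∈ S \ I, s = t := by
    have h1 := Set.ncard_sdiff_add_ncard_of_subset hIS (Set.toFinite _)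
    exact (Set.ncard_le_one (Set.toFinite _)).1 (by omega)
  have hne : ∀ s ∈ S, s ∉ I → c s ≠ k := fun s hs hsI =>
    hk' s (Or.inr ⟨hs, hsI⟩) ((hDS s hs).symm.mono subset_rfl Set.subset_union_left)
  refine ⟨c, hc.mono hsub, fun s hs t ht => ⟨fun e => ?_, ?_⟩⟩
  · by_cases hsI : s ∈ I <;> by_cases htI : t ∈ I
    · exact Or.inr ⟨hsI, htI⟩
    · exact absurd (e.symm.trans (hk s hsI)) (hne t ht htI)
    · exact absurd (e.trans (hk t htI)) (hne s hs hsI)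
    · exact Or.inl (hone s ⟨hs, hsI⟩ t ⟨ht, htI⟩)
  · rintro (rfl | ⟨hs, ht⟩)
    exacts [rfl, (hk s hs).trans (hk t ht).symm]

theorem SmallMinorsColorable.colorable_of_separation [Finite V] (h : SmallMinorsColorable G)
    {X S Y D E : Set V} (hcov : ∀ v, v ∈ X ∨ v ∈ S ∨ v ∈ Y)
    (hXY : ∀ x ∈ X, ∀ y ∉ X, G.Adj x y → y ∈ S) (hXS : Disjoint X S) (hYS : Disjoint Y S)
    (hD : Cn G D) (hDX : Disjoint (X ∪ S) D) (hDS : ∀ s ∈ S, Touch G D {s})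
    (hE : Cn G E) (hEY : Disjoint (Y ∪ S) E) (hES : ∀ s ∈ S, Touch G E {s})
    (hS : S.ncard ≤ 3) : G.Colorable 6 := by
  by_cases hclq : ∀ x ∈ S, ∀ y ∈ S, x ≠ y → G.Adj x y
  · have hne : ∀ {U C : Set V}, Cn G C → Disjoint U C → U ≠ Set.univ := by
      rintro U C hC hU rfl
      obtain ⟨x, hx⟩ := hC.1
      exact Set.disjoint_left.1 hU trivial hx
    obtain ⟨c, hc⟩ := h.exists_properOn (hne hD hDX)
    obtain ⟨d, hd⟩ := h.exists_properOn (hne hE hEY)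
    have hinj : ∀ {U : Set V} {c : V → Fin 6}, ProperOn G (U ∪ S) c → ∀ s ∈ S, ∀ t ∈ S,
        (c s = c t ↔ s = t) := fun hc s hs t ht =>
      ⟨fun e => by_contra fun hst => hc s (Or.inr hs) t (Or.inr ht) (hclq s hs t ht hst) e,
        fun e => e ▸ rfl⟩
    exact colorable_of_glue hcov hXY hc hd fun s hs t ht =>
      (hinj hc s hs t ht).trans (hinj hd s hs t ht).symm
  · push Not at hclq
    obtain ⟨x, hx, y, hy, hxy, hn⟩ := hclq
    have hIS : ({x, y} : Set V) ⊆ S := by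
      rintro z (rfl | rfl)
      exacts [hx, hy]
    have hI : ∀ a ∈ ({x, y} : Set V), ∀ b ∈ ({x, y} : Set V), ¬G.Adj a b := by
      rintro a (rfl | rfl) b (rfl | rfl) hab
      exacts [hab.ne rfl, hn hab, hn hab.symm, hab.ne rfl]
    have hI2 : 1 < ({x, y} : Set V).ncard := by
      rw [Set.ncard_pair hxy]
      omega
    obtain ⟨c, hc, hc'⟩ := h.exists_properOn_side hXS hD hDX hDS hS hIS hI hI2
    obtain ⟨d, hd, hd'⟩ := h.exists_properOn_side hYS hE hEY hES hS hIS hI hI2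
    exact colorable_of_glue hcov hXY hc hd fun s hs t ht =>
      (hc' s hs t ht).trans (hd' s hs t ht).symm

theorem SmallMinorsColorable.fourConn [Finite V] (h : SmallMinorsColorable G)
    (h6 : ¬G.Colorable 6) : FourConn G := by
  by_contra hF
  simp only [FourConn, not_forall, not_le] at hF
  obtain ⟨X₀, h1, h2, h3⟩ := hF
  obtain ⟨X, ⟨hX, hXu⟩, hmin⟩ := Set.exists_min_image
    {X : Set V | X.Nonempty ∧ X ∪ nbr G X ≠ Set.univ} (fun X => (nbr G X).ncard)
    (Set.toFinite _) ⟨X₀, h1, h2⟩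
  have hS : (nbr G X).ncard ≤ 3 := by
    have : (nbr G X).ncard ≤ (nbr G X₀).ncard := hmin X₀ ⟨h1, h2⟩
    omega
  obtain ⟨x, hx⟩ := hX
  obtain ⟨y, hy⟩ := (Set.ne_univ_iff_exists_notMem _).1 hXu
  have hXY : ∀ x ∈ X, ∀ y ∉ X, G.Adj x y → y ∈ nbr G X := fun x hx y hy hxy => ⟨hy, x, hx, hxy⟩
  have hXS : Disjoint X (nbr G X) := Set.disjoint_left.2 fun z hz hz' => hz'.1 hz
  have hxS : x ∈ (nbr G X)ᶜ := fun h => h.1 hx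
  have hyS : y ∈ (nbr G X)ᶜ := fun h => hy (Or.inr h)
  have hyX : y ∉ X := fun h => hy (Or.inl h)
  have hside : ∀ z ∈ (nbr G X)ᶜ, ∀ a ∈ comp G (nbr G X)ᶜ z, ∀ b ∈ comp G (nbr G X)ᶜ z,
      a ∈ X → b ∈ X := by
    intro z hz a ha b hb haX
    by_contra hbX
    obtain ⟨u, hu, w, hw, huw⟩ := (cn_comp hz).2 (X ∩ comp G (nbr G X)ᶜ z)
      Set.inter_subset_right ⟨a, haX, ha⟩ ⟨b, hb, fun h => hbX h.1⟩
    exact comp_subset hw.1 (hXY u hu.1 w (fun h => hw.2 ⟨h, hw.1⟩) huw)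
  have hfull : ∀ z ∈ (nbr G X)ᶜ, ∀ w ∈ (nbr G X)ᶜ, w ∉ comp G (nbr G X)ᶜ z →
      ∀ s ∈ nbr G X, Touch G (comp G (nbr G X)ᶜ z) {s} := by
    intro z hz w hw hwz s hs
    have hsub : nbr G (comp G (nbr G X)ᶜ z) ⊆ nbr G X := nbr_comp_subset'
    have hle := hmin (comp G (nbr G X)ᶜ z) ⟨⟨z, mem_comp_self hz⟩, fun e => by
      have : w ∈ comp G (nbr G X)ᶜ z ∪ nbr G (comp G (nbr G X)ᶜ z) := e ▸ trivial
      exact this.elim hwz fun h => hw (hsub h)⟩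
    rw [← Set.eq_of_subset_of_ncard_le hsub hle (Set.toFinite _)] at hs
    exact touch_of_mem_nbr hs
  refine h6 (h.colorable_of_separation (X := X) (S := nbr G X) (Y := (X ∪ nbr G X)ᶜ)
    (D := comp G (nbr G X)ᶜ y) (E := comp G (nbr G X)ᶜ x) (fun v => ?_) hXY hXS ?_
    (cn_comp hyS) ?_ (hfull y hyS x hxS fun hxy => ?_) (cn_comp hxS) ?_
    (hfull x hxS y hyS fun hyx => ?_) hS)
  · simp only [Set.mem_compl_iff, Set.mem_union]
    tauto
  · exact Set.disjoint_left.2 fun z hz hz' => hz (Or.inr hz')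
  · refine Set.disjoint_left.2 ?_
    rintro z (hz | hz) hz'
    · exact hyX (hside y hyS z hz' y (mem_comp_self hyS) hz)
    · exact comp_subset hz' hz
  · exact hyX (hside y hyS x hxy y (mem_comp_self hyS) hx)
  · refine Set.disjoint_left.2 ?_
    rintro z (hz | hz) hz'
    · exact hz (Or.inl (hside x hxS x (mem_comp_self hxS) z hz' hx))
    · exact comp_subset hz' hz
  · exact hyX (hside x hxS x (mem_comp_self hxS) y hyx hx)

end ColouringSection

section CriticalSection

variable {V : Type} {G : SimpleGraph V}

theorem ContractionCritical7.not_colorable [Fintype V] (h : ContractionCritical7 G) :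
    ¬G.Colorable 6 := by
  intro h6
  have := h.1 ▸ h6.chromaticNumber_le
  exact absurd this (by decide)

theorem ContractionCritical7.smallMinorsColorable [Fintype V] (h : ContractionCritical7 G) :
    SmallMinorsColorable G := by
  intro W _ H hH hcard
  have := Fintype.ofFinite W
  have hlt := h.2 W H hH ⟨fun e => hcard.ne (Nat.card_congr e.toEquiv)⟩
  rw [← chromaticNumber_le_iff_colorable]
  exact Order.le_of_lt_add_one (by exact_mod_cast hlt)

theorem K2222.colorable_six : K2222.Colorable 6 :=
  ⟨Coloring.mk (fun x => Fin.castLE (by omega) x.1) fun {x y} hxy e =>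
    k2222_adj.1 hxy (Fin.castLE_injective _ e)⟩

theorem ContractionCritical7.eighteen_le_ncard [Fintype V] [DecidableRel G.Adj]
    (h : ContractionCritical7 G) (hK : ¬IsMinor K7vee G) :
    18 ≤ {v : V | G.degree v = 7}.ncard := by
  have h6 := h.not_colorable
  have hs := h.smallMinorsColorable
  have hdeg : ∀ v, 7 ≤ G.degree v := fun v => by
    have := hs.seven_le_degree h6 hK v
    rwa [← Nat.card_coe_set_eq, Nat.card_eq_fintype_card, card_neighborSet_eq_degree] at this
  have hne : Nonempty V := by
    by_contra hV
    rw [not_nonempty_iff] at hV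
    exact h6 ⟨Coloring.mk (fun v => (hV.false v).elim) fun {v} => (hV.false v).elim⟩
  have h3 : 3 ≤ Nat.card V := by
    obtain ⟨v⟩ := hne
    have h1 := hdeg v
    have h2 := G.degree_lt_card_verts v
    rw [Nat.card_eq_fintype_card]
    omega
  have hdef : 0 ≤ defect G := by
    by_contra! hneg
    obtain ⟨e⟩ := k2222_of_defect_neg _ _ V G rfl rfl h3 (hs.fourConn h6) hK hneg
    exact h6 (K2222.colorable_six.of_hom e.toHom)
  have hle : ∑ v, (8 - (G.degree v : ℤ)) ≤ ∑ v, if G.degree v = 7 then (1 : ℤ) else 0 := by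
    refine Finset.sum_le_sum fun v _ => ?_
    have := hdeg v
    split_ifs <;> omega
  rw [sum_degree_defect, Finset.sum_boole] at hle
  have hcard : {v : V | G.degree v = 7}.ncard =
      (Finset.univ.filter fun v => G.degree v = 7).card := by
    rw [← Set.ncard_coe_finset]
    simp
  rw [hcard]
  omega

end CriticalSection

/-- a 7-contraction-critical graph with no `K7vee`-minor has at least 18
vertices of degree seven. -/
theorem statement_16 (V : Type) [Fintype V] (G : SimpleGraph V) [DecidableRel G.Adj]
    (hcrit : ContractionCritical7 G) (hminor : ¬ IsMinor K7vee G) :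
    18 ≤ {v : V | G.degree v = 7}.ncard := by
  exact hcrit.eighteen_le_ncard hminor
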